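/- Let n ≥ 3. There exists a constant m_n > 0, depending only on n, such that for every mass 0 < m < m_n, the ball of volume m is, up to translation, the unique minimizer of the functional F ↦ P(F) + ∫_{ℝⁿ}∫_{ℝⁿ} χ_F(x)χ_F(y)|x−y|^{2−n} dy dx among all sets of finite perimeter F ⊂ ℝⁿ with |F| = m. -/

import Mathlib

open MeasureTheory Metric Set

noncomputable section

/-- The divergence of a vector field on `ℝⁿ`. -/
def vdiv {n : ℕ} (φ : EuclideanSpace ℝ (Fin n) → EuclideanSpace ℝ (Fin n))
    (x : EuclideanSpace ℝ (Fin n)) : ℝ :=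
  ∑ i, fderiv ℝ φ x (EuclideanSpace.single i 1) i

/-- The set of admissible values `∫_F div φ` in the variational definition of the
perimeter: `φ` ranges over compactly supported `C¹` vector fields with `‖φ‖ ≤ 1`. -/
def perimVals {n : ℕ} (F : Set (EuclideanSpace ℝ (Fin n))) : Set ℝ :=
  { r | ∃ φ : EuclideanSpace ℝ (Fin n) → EuclideanSpace ℝ (Fin n),
      ContDiff ℝ 1 φ ∧ HasCompactSupport φ ∧ (∀ x, ‖φ x‖ ≤ 1) ∧
      r = ∫ x in F, vdiv φ x }

/-- The (distributional) perimeter `P(F)`. -/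
def perimeter {n : ℕ} (F : Set (EuclideanSpace ℝ (Fin n))) : ℝ := sSup (perimVals F)

/-- `F` is a set of finite perimeter: it is measurable and the variational
definition of the perimeter is finite. -/
def HasFinitePerimeter {n : ℕ} (F : Set (EuclideanSpace ℝ (Fin n))) : Prop :=
  MeasurableSet F ∧ BddAbove (perimVals F)

/-- The Newtonian interaction energy `NL(F) = ∫∫ χ_F(x)χ_F(y)|x-y|^{2-n}`. -/
def NL {n : ℕ} (F : Set (EuclideanSpace ℝ (Fin n))) : ℝ :=
  ∫ x in F, ∫ y in F, ‖x - y‖ ^ (2 - (n : ℝ))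

/-- The function `f_E = χ_{B_1} - χ_E`. -/
def fE {n : ℕ} (E : Set (EuclideanSpace ℝ (Fin n))) (x : EuclideanSpace ℝ (Fin n)) : ℝ :=
  (ball (0 : EuclideanSpace ℝ (Fin n)) 1).indicator 1 x - E.indicator 1 x

/-- The Newtonian potential `v(y) = ∫ (χ_{B_1} - χ_E)(x) |x-y|^{2-n} dx`. -/
def newtPot {n : ℕ} (E : Set (EuclideanSpace ℝ (Fin n))) (y : EuclideanSpace ℝ (Fin n)) : ℝ :=
  ∫ x, fE E x * ‖x - y‖ ^ (2 - (n : ℝ))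

/-- The normalization constant `σ_{n,α}` of the Riesz potential. -/
def rieszConst (n : ℕ) (α : ℝ) : ℝ :=
  (Real.pi ^ ((n : ℝ) / 2) * 2 ^ α * Real.Gamma (α / 2) / Real.Gamma (((n : ℝ) - α) / 2))⁻¹

/-- The Riesz potential `I_α f(x) = σ_{n,α} ∫ f(ξ)|x-ξ|^{α-n} dξ`. -/
def rieszPot {n : ℕ} (α : ℝ) (f : EuclideanSpace ℝ (Fin n) → ℝ)
    (x : EuclideanSpace ℝ (Fin n)) : ℝ :=
  rieszConst n α * ∫ ξ, f ξ * ‖x - ξ‖ ^ (α - (n : ℝ))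

/-- The average of `g` over the sphere `∂B_r` with respect to the
`(n-1)`-dimensional Hausdorff measure. -/
def sphAvg {n : ℕ} (g : EuclideanSpace ℝ (Fin n) → ℝ) (r : ℝ) : ℝ :=
  (μH[(n : ℝ) - 1] (sphere (0 : EuclideanSpace ℝ (Fin n)) r)).toReal⁻¹ *
    ∫ y in sphere (0 : EuclideanSpace ℝ (Fin n)) r, g y ∂μH[(n : ℝ) - 1]

/-- The average of `g` over the ball `B_r` with respect to the Lebesgue measure. -/
def ballAvg {n : ℕ} (g : EuclideanSpace ℝ (Fin n) → ℝ) (r : ℝ) : ℝ :=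
  (volume (ball (0 : EuclideanSpace ℝ (Fin n)) r)).toReal⁻¹ *
    ∫ x in ball (0 : EuclideanSpace ℝ (Fin n)) r, g x

end

open ProbabilityTheory

abbrev EE (n : ℕ) := EuclideanSpace ℝ (Fin n)

noncomputable def om (n : ℕ) : ℝ := volume.real (ball (0 : EE n) 1)

noncomputable def sg (n : ℕ) : Measure (EE n) :=
  (ENNReal.ofReal (n * om n))⁻¹ • ((volume : Measure (EE n)).toSphere).map Subtype.val

noncomputable def rad (n : ℕ) : Measure ℝ :=
  (volume.restrict (Ioi 0)).withDensity (fun r => ENNReal.ofReal (r ^ (n - 1)))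

instance rad_sfinite (n : ℕ) : SigmaFinite (rad n) := by
  unfold rad; infer_instance

lemma om_pos (n : ℕ) : 0 < om n :=
  ENNReal.toReal_pos (measure_ball_pos _ _ one_pos).ne' measure_ball_lt_top.ne

lemma nom_pos {n : ℕ} (hn : 1 ≤ n) : 0 < n * om n := by
  have := om_pos n; positivity

lemma toSphere_univ (n : ℕ) :
    (volume : Measure (EE n)).toSphere univ = ENNReal.ofReal (n * om n) := by
  rw [Measure.toSphere_apply_univ, finrank_euclideanSpace_fin, ENNReal.ofReal_mul (by positivity),
    om, ofReal_measureReal measure_ball_lt_top.ne]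
  simp

lemma sg_prob {n : ℕ} (hn : 1 ≤ n) : IsProbabilityMeasure (sg n) := by
  constructor
  rw [sg, Measure.smul_apply, Measure.map_apply measurable_subtype_coe MeasurableSet.univ,
    preimage_univ, toSphere_univ, smul_eq_mul, ENNReal.inv_mul_cancel]
  · exact (ENNReal.ofReal_pos.2 (nom_pos hn)).ne'
  · exact ENNReal.ofReal_ne_top

lemma sg_norm (n : ℕ) : ∀ᵐ θ ∂(sg n), ‖θ‖ = 1 := by
  apply Measure.ae_smul_measure
  rw [ae_map_iff measurable_subtype_coe.aemeasurable
    (measurableSet_eq_fun measurable_norm measurable_const)]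
  filter_upwards with x
  simp

lemma polar_lint {n : ℕ} (hn : 1 ≤ n) (f : EE n → ENNReal) (hf : Measurable f) :
    ∫⁻ x, f x = ENNReal.ofReal (n * om n) * ∫⁻ θ, ∫⁻ r, f (r • θ) ∂(rad n) ∂(sg n) := by
  have hne : Nontrivial (EE n) := by
    haveI : Nonempty (Fin n) := ⟨⟨0, hn⟩⟩
    infer_instance
  have h1 : ∫⁻ x, f x = ∫⁻ x : ({(0 : EE n)}ᶜ : Set (EE n)), f x ∂(volume.comap Subtype.val) := by
    rw [lintegral_subtype_comap (measurableSet_singleton _).compl, restrict_compl_singleton]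
  have h2 := (volume : Measure (EE n)).measurePreserving_homeomorphUnitSphereProd.symm
    (homeomorphUnitSphereProd (EE n)).toMeasurableEquiv
  have h3 := h2.lintegral_comp_emb (MeasurableEquiv.measurableEmbedding _)
    (fun x : ({(0 : EE n)}ᶜ : Set (EE n)) => f x)
  have hg : Measurable (fun p : EE n × ℝ => f (p.2 • p.1)) := hf.comp (by fun_prop)
  rw [h1, ← h3, lintegral_prod, sg, lintegral_smul_measure, lintegral_map,
    smul_eq_mul, ← mul_assoc, ENNReal.mul_inv_cancel, one_mul]
  · refine lintegral_congr fun θ => ?_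
    rw [Measure.volumeIoiPow, lintegral_withDensity_eq_lintegral_mul, rad,
      lintegral_withDensity_eq_lintegral_mul, finrank_euclideanSpace_fin,
      ← lintegral_subtype_comap measurableSet_Ioi]
    · rfl
    · fun_prop
    · fun_prop
    · fun_prop
    · exact (hf.comp measurable_subtype_coe).comp ((MeasurableEquiv.measurable _).comp (by fun_prop))
  · exact (ENNReal.ofReal_pos.2 (nom_pos hn)).ne'
  · exact ENNReal.ofReal_ne_top
  · exact Measurable.lintegral_prod_right' (f := fun p : EE n × ℝ => f (p.2 • p.1)) hg
  · fun_prop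
  · exact ((hf.comp measurable_subtype_coe).comp (MeasurableEquiv.measurable _)).aemeasurable

lemma polar_meas {n : ℕ} (hn : 1 ≤ n) : (volume : Measure (EE n)) =
    ENNReal.ofReal (n * om n) • ((sg n).prod (rad n)).map (fun p : EE n × ℝ => p.2 • p.1) := by
  have := sg_prob hn
  ext s hs
  have hm : Measurable (fun p : EE n × ℝ => p.2 • p.1) := by fun_prop
  rw [Measure.smul_apply, ← lintegral_indicator_one hs, polar_lint hn _ (measurable_one.indicator hs),
    ← lintegral_indicator_one hs, lintegral_map (measurable_one.indicator hs) hm, smul_eq_mul,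
    lintegral_prod (fun p : EE n × ℝ => s.indicator (1 : EE n → ENNReal) (p.2 • p.1))
      ((measurable_one.indicator hs).comp hm).aemeasurable]

lemma polar_int {n : ℕ} (hn : 1 ≤ n) {f : EE n → ℝ} (hf : Integrable f) :
    ∫ x, f x = (n * om n) * ∫ θ, (∫ r in Ioi (0 : ℝ), r ^ (n - 1) * f (r • θ)) ∂(sg n) ∧
    Integrable (fun θ => ∫ r in Ioi (0 : ℝ), r ^ (n - 1) * f (r • θ)) (sg n) ∧
    ∀ᵐ θ ∂(sg n), IntegrableOn (fun r => r ^ (n - 1) * f (r • θ)) (Ioi 0) := by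
  have := sg_prob hn
  have hm : Measurable (fun p : EE n × ℝ => p.2 • p.1) := by fun_prop
  have h0 : Integrable (fun p : EE n × ℝ => f (p.2 • p.1)) ((sg n).prod (rad n)) := by
    have h1 := hf
    rw [polar_meas hn, integrable_smul_measure (ENNReal.ofReal_pos.2 (nom_pos hn)).ne'
      ENNReal.ofReal_ne_top] at h1
    exact h1.comp_measurable hm
  have hr : ∀ g : ℝ → ℝ, ∫ r, g r ∂(rad n) = ∫ r in Ioi 0, r ^ (n - 1) * g r := by
    intro g
    rw [rad, integral_withDensity_eq_integral_toReal_smul (by fun_prop) (by simp)]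
    refine setIntegral_congr_fun measurableSet_Ioi fun r hr => ?_
    rw [ENNReal.toReal_ofReal (pow_nonneg (le_of_lt hr) _), smul_eq_mul]
  refine ⟨?_, ?_, ?_⟩
  · have h1 : AEStronglyMeasurable f (((sg n).prod (rad n)).map (fun p : EE n × ℝ => p.2 • p.1)) := by
      have h1 := hf
      rw [polar_meas hn, integrable_smul_measure (ENNReal.ofReal_pos.2 (nom_pos hn)).ne'
        ENNReal.ofReal_ne_top] at h1
      exact h1.1
    conv_lhs => rw [polar_meas hn]
    rw [integral_smul_measure, integral_map hm.aemeasurable h1, integral_prod _ h0,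
      ENNReal.toReal_ofReal (nom_pos hn).le, smul_eq_mul]
    simp_rw [hr]
  · have := h0.integral_prod_left
    simpa only [hr] using this
  · filter_upwards [h0.prod_right_ae] with θ hθ
    rw [rad, integrable_withDensity_iff (by fun_prop) (by simp)] at hθ
    refine IntegrableOn.congr_fun hθ (fun r hr => ?_) measurableSet_Ioi
    rw [ENNReal.toReal_ofReal (pow_nonneg (le_of_lt hr) _), mul_comm]

noncomputable def gam (n : ℕ) : Measure (EE n) := stdGaussian (EE n)

instance (n : ℕ) : IsGaussian (gam n) := by unfold gam; infer_instance

noncomputable def rho (n : ℕ) (r : ℝ) : ℝ := ((2 * Real.pi) ^ ((n : ℝ) / 2))⁻¹ * Real.exp (-(r ^ 2 / 2))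

noncomputable def nu (n : ℕ) : Measure ℝ :=
  (rad n).withDensity (fun r => ENNReal.ofReal (n * om n * rho n r))

lemma rho_pos (n : ℕ) (r : ℝ) : 0 < rho n r := by unfold rho; positivity

lemma rho_cont (n : ℕ) : Continuous (rho n) := by unfold rho; fun_prop

@[fun_prop] lemma rho_meas (n : ℕ) : Measurable (rho n) := (rho_cont n).measurable

lemma gam_dens (n : ℕ) :
    gam n = volume.withDensity (fun x : EE n => ENNReal.ofReal (rho n ‖x‖)) := by
  have hc : Continuous (fun x : EE n => rho n ‖x‖) := (rho_cont n).comp continuous_norm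
  have key : ∀ t : EE n, ∫ x : EE n, rho n ‖x‖ • Complex.exp (inner ℝ x t * Complex.I) =
      Complex.exp (-‖t‖ ^ 2 / 2) := by
    intro t
    have h := GaussianFourier.integral_cexp_neg_mul_sq_norm_add (V := EE n) (b := 1/2)
      (by norm_num) Complex.I t
    have e : ∀ x : EE n, rho n ‖x‖ • Complex.exp (inner ℝ x t * Complex.I) =
        ((((2 * Real.pi) ^ ((n : ℝ) / 2))⁻¹ : ℝ) : ℂ) *
          Complex.exp (-(1/2) * ‖x‖ ^ 2 + Complex.I * inner ℝ t x) := by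
      intro x
      rw [rho, Complex.real_smul, Complex.ofReal_mul, mul_assoc, Complex.ofReal_exp,
        ← Complex.exp_add, real_inner_comm]
      congr 2
      push_cast; ring
    simp_rw [e]
    rw [integral_const_mul, h, finrank_euclideanSpace_fin]
    have : ((Real.pi : ℂ) / (1/2)) ^ ((n : ℂ) / 2) = (((2 * Real.pi) ^ ((n : ℝ) / 2) : ℝ) : ℂ) := by
      rw [Complex.ofReal_cpow (by positivity)]
      push_cast; congr 1; ring
    rw [this, ← mul_assoc, ← Complex.ofReal_mul, inv_mul_cancel₀ (by positivity), Complex.ofReal_one,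
      one_mul, Complex.I_sq]
    congr 1; ring
  have hint : Integrable (fun x : EE n => rho n ‖x‖) := by
    have k0 := key 0
    by_contra hh
    rw [integral_undef] at k0
    · simp at k0
    · simpa [Complex.real_smul] using (fun h : Integrable (fun x : EE n => (rho n ‖x‖ : ℂ)) => hh (by simpa using h.re))
  haveI : IsFiniteMeasure (volume.withDensity (fun x : EE n => ENNReal.ofReal (rho n ‖x‖))) :=
    isFiniteMeasure_withDensity_ofReal hint.2
  apply Measure.ext_of_charFun
  ext t
  rw [gam, charFun_stdGaussian, charFun_apply, integral_withDensity_eq_integral_toReal_smul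
    (by fun_prop) (by simp)]
  rw [← key t]
  congr 1; ext x
  rw [ENNReal.toReal_ofReal (rho_pos _ _).le]

lemma nu_sf (n : ℕ) : SFinite (nu n) := by unfold nu; infer_instance

lemma gam_polar {n : ℕ} (hn : 1 ≤ n) :
    gam n = ((sg n).prod (nu n)).map (fun p : EE n × ℝ => p.2 • p.1) := by
  have := sg_prob hn
  have := nu_sf n
  have hm : Measurable (fun p : EE n × ℝ => p.2 • p.1) := by fun_prop
  ext s hs
  have h1 : Measurable (s.indicator (1 : EE n → ENNReal)) := measurable_one.indicator hs
  rw [← lintegral_indicator_one hs, ← lintegral_indicator_one hs, lintegral_map h1 hm,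
    lintegral_prod (fun p : EE n × ℝ => s.indicator (1 : EE n → ENNReal) (p.2 • p.1))
      (h1.comp hm).aemeasurable, gam_dens,
    lintegral_withDensity_eq_lintegral_mul _ (by fun_prop) h1, polar_lint hn _
      (Measurable.mul (by fun_prop) h1), ← lintegral_const_mul]
  · refine lintegral_congr_ae ?_
    filter_upwards [sg_norm n] with θ hθ
    have h2 : Measurable (fun r : ℝ => s.indicator (1 : EE n → ENNReal) (r • θ)) :=
      h1.comp (by fun_prop)
    have h3 : Measurable (fun r : ℝ => ((fun x : EE n => ENNReal.ofReal (rho n ‖x‖)) *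
      s.indicator (1 : EE n → ENNReal)) (r • θ)) := Measurable.mul (by fun_prop) h2
    rw [nu, lintegral_withDensity_eq_lintegral_mul _ (by fun_prop) h2, ← lintegral_const_mul _ h3]
    have : rad n = (rad n).restrict (Ioi 0) := by
      rw [rad, ← restrict_withDensity measurableSet_Ioi, Measure.restrict_restrict measurableSet_Ioi, inter_self]
    rw [this]
    refine setLIntegral_congr_fun measurableSet_Ioi fun r hr => ?_
    simp only [Pi.mul_apply]
    rw [norm_smul, hθ, mul_one, Real.norm_of_nonneg (le_of_lt hr), ← mul_assoc,
      ENNReal.ofReal_mul (nom_pos hn).le]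
  · exact Measurable.lintegral_prod_right' (f := fun p : EE n × ℝ =>
      ((fun x : EE n => ENNReal.ofReal (rho n ‖x‖)) *
        s.indicator (1 : EE n → ENNReal)) (p.2 • p.1)) (Measurable.mul (by fun_prop) (h1.comp hm))

lemma nu_prob {n : ℕ} (hn : 1 ≤ n) : IsProbabilityMeasure (nu n) := by
  have := sg_prob hn
  have := nu_sf n
  have h : gam n univ = 1 := measure_univ
  rw [gam_polar hn, Measure.map_apply (by fun_prop) MeasurableSet.univ, preimage_univ,
    ← univ_prod_univ, Measure.prod_prod, measure_univ, one_mul] at h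
  exact ⟨h⟩

lemma nu_pos (n : ℕ) : ∀ᵐ r ∂(nu n), 0 < r := by
  rw [nu, rad]
  exact (withDensity_absolutelyContinuous _ _).ae_le ((withDensity_absolutelyContinuous _ _).ae_le
    (ae_restrict_mem measurableSet_Ioi))

lemma gam_int {n : ℕ} (hn : 1 ≤ n) {f : EE n → ℝ} (hf : Measurable f) :
    (∫ x, f x ∂gam n = ∫ p, f (p.2 • p.1) ∂((sg n).prod (nu n))) ∧
    (Integrable f (gam n) ↔ Integrable (fun p : EE n × ℝ => f (p.2 • p.1)) ((sg n).prod (nu n))) := by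
  have hm : Measurable (fun p : EE n × ℝ => p.2 • p.1) := by fun_prop
  rw [gam_polar hn]
  exact ⟨integral_map hm.aemeasurable hf.aestronglyMeasurable,
    integrable_map_measure hf.aestronglyMeasurable hm.aemeasurable⟩

lemma gam_mom (n k : ℕ) : Integrable (fun x => ‖x‖ ^ k) (gam n) := by
  have h := IsGaussian.memLp_id (gam n) k (by simp)
  exact h.integrable_norm_pow'

lemma nu_mom {n : ℕ} (hn : 1 ≤ n) (k : ℕ) : Integrable (fun r => |r| ^ k) (nu n) := by
  have := sg_prob hn
  have := nu_prob hn
  have h := (gam_int hn (by fun_prop)).2.1 (gam_mom n k)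
  obtain ⟨θ, h1, h2⟩ := (h.prod_right_ae.and (sg_norm n)).exists
  simpa [norm_smul, h2] using h1

lemma gam_sq (n : ℕ) (v : EE n) : ∫ y, (inner ℝ y v) ^ 2 ∂gam n = ‖v‖ ^ 2 := by
  have h := variance_dual_stdGaussian (innerSL ℝ v)
  rw [variance_of_integral_eq_zero (by fun_prop) (integral_strongDual_stdGaussian _)] at h
  rw [innerSL_apply_norm] at h
  rw [← h]
  simp [gam, real_inner_comm]

lemma gam_sq_norm (n : ℕ) : ∫ y, ‖y‖ ^ 2 ∂gam n = n := by
  have h : ∀ y : EE n, ‖y‖ ^ 2 = ∑ i, (inner ℝ y (EuclideanSpace.single i (1 : ℝ))) ^ 2 := by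
    intro y
    rw [EuclideanSpace.norm_sq_eq]
    simp [EuclideanSpace.inner_single_right]
  simp_rw [h]
  rw [integral_finset_sum]
  · simp [gam_sq]
  · intro i _
    have := (IsGaussian.memLp_dual (gam n) (innerSL ℝ (EuclideanSpace.single i (1:ℝ))) 2 (by simp)).integrable_sq
    simpa [real_inner_comm] using this

lemma nu_sq {n : ℕ} (hn : 1 ≤ n) : ∫ r, r ^ 2 ∂nu n = n := by
  have := sg_prob hn
  have := nu_prob hn
  have hi := (gam_int hn (f := fun x => ‖x‖ ^ 2) (by fun_prop)).2.1 (gam_mom n 2)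
  rw [← gam_sq_norm n, (gam_int hn (by fun_prop)).1, integral_prod _ hi]
  have : ∀ᵐ θ ∂(sg n), ∫ r, ‖r • θ‖ ^ 2 ∂nu n = ∫ r, r ^ 2 ∂nu n := by
    filter_upwards [sg_norm n] with θ hθ
    simp [norm_smul, hθ]
  rw [integral_congr_ae this]; simp

instance fact_2pi : Fact (0 < 2 * Real.pi) := ⟨Real.two_pi_pos⟩

lemma mult_bd (k : ℤ) : ((∫ φ in (0 : ℝ)..(Real.pi / 2), Real.sin (k * φ)) - Real.sin (k * (Real.pi / 2)) / 3) ^ 2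
    ≤ (1 / 2) * (1 - Real.cos (k * (Real.pi / 2))) := by
  rcases eq_or_ne k 0 with rfl | hk
  · simp
  have hk' : (k : ℝ) ≠ 0 := by exact_mod_cast hk
  have h1 : ∫ φ in (0 : ℝ)..(Real.pi / 2), Real.sin (k * φ) = (1 - Real.cos (k * (Real.pi / 2))) / k := by
    rw [intervalIntegral.integral_comp_mul_left (fun x => Real.sin x) hk', integral_sin]
    simp; field_simp
  rw [h1]
  have h3 : ∀ m : ℤ, 0 < m → m ≤ |k| → |1 / (k : ℝ)| ≤ 1 / m := by
    intro m hm hmk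
    rw [abs_div, abs_one]
    exact one_div_le_one_div_of_le (by exact_mod_cast hm) (by exact_mod_cast hmk)
  obtain ⟨q, hq⟩ : ∃ q : ℤ, k = 4 * q ∨ k = 4 * q + 1 ∨ k = 4 * q + 2 ∨ k = 4 * q + 3 := ⟨k / 4, by omega⟩
  have red : ∀ j : ℤ, k = 4 * q + j → Real.cos (k * (Real.pi / 2)) = Real.cos (j * (Real.pi / 2)) ∧
      Real.sin (k * (Real.pi / 2)) = Real.sin (j * (Real.pi / 2)) := by
    intro j hj
    have : (k : ℝ) * (Real.pi / 2) = j * (Real.pi / 2) + q * (2 * Real.pi) := by rw [hj]; push_cast; ring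
    rw [this, Real.cos_add_int_mul_two_pi, Real.sin_add_int_mul_two_pi]; simp
  have c3 : Real.cos (3 * (Real.pi / 2)) = 0 := by
    rw [show 3 * (Real.pi / 2) = Real.pi / 2 + Real.pi by ring, Real.cos_add_pi]; simp
  have s3 : Real.sin (3 * (Real.pi / 2)) = -1 := by
    rw [show 3 * (Real.pi / 2) = Real.pi / 2 + Real.pi by ring, Real.sin_add_pi]; simp
  rcases hq with h | h | h | h
  · obtain ⟨a, b⟩ := red 0 (by omega)
    rw [a, b]; simp
  · obtain ⟨a, b⟩ := red 1 (by omega)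
    rw [a, b]; push_cast
    rw [one_mul, Real.cos_pi_div_two, Real.sin_pi_div_two, sub_zero]
    have : k = 1 ∨ 3 ≤ |k| := by rw [le_abs]; omega
    rcases this with h' | h'
    · rw [h']; norm_num
    · have := abs_le.1 (h3 3 (by norm_num) h')
      push_cast at this; nlinarith
  · obtain ⟨a, b⟩ := red 2 (by omega)
    rw [a, b]; push_cast
    rw [show 2 * (Real.pi / 2) = Real.pi by ring, Real.cos_pi, Real.sin_pi]
    have := abs_le.1 (h3 2 (by norm_num) (by rw [le_abs]; omega))
    rw [show (1 - -1) / (k : ℝ) = 2 * (1 / k) by ring]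
    push_cast at this; nlinarith
  · obtain ⟨a, b⟩ := red 3 (by omega)
    rw [a, b]; push_cast; rw [c3, s3, sub_zero]
    have : k = -1 ∨ 3 ≤ |k| := by rw [le_abs]; omega
    rcases this with h' | h'
    · rw [h']; norm_num
    · have := abs_le.1 (h3 3 (by norm_num) h')
      push_cast at this; nlinarith

open AddCircle in
lemma circle_ineq (u : AddCircle (2 * Real.pi) → ℝ) (hu : Measurable u) (M : ℝ) (hM : ∀ t, |u t| ≤ M) :
    ∫ ψ : AddCircle (2 * Real.pi), ((1 / 2) * (∫ φ in (0 : ℝ)..(Real.pi / 2), (u (ψ + φ) - u (ψ - φ))) -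
      (1 / 6) * (u (ψ + (Real.pi / 2 : ℝ)) - u (ψ - (Real.pi / 2 : ℝ)))) ^ 2 ∂haarAddCircle
    ≤ (1 / 4) * ∫ ψ, (u ψ - u (ψ + (Real.pi / 2 : ℝ))) ^ 2 ∂haarAddCircle := by
  have hM0 : 0 ≤ M := (abs_nonneg _).trans (hM 0)
  have hpi := Real.pi_pos
  set p : AddCircle (2 * Real.pi) → ℝ := fun ψ => (1 / 2) * (∫ φ in (0 : ℝ)..(Real.pi / 2), (u (ψ + φ) - u (ψ - φ))) -
      (1 / 6) * (u (ψ + (Real.pi / 2 : ℝ)) - u (ψ - (Real.pi / 2 : ℝ))) with hp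
  set d : AddCircle (2 * Real.pi) → ℝ := fun ψ => u ψ - u (ψ + (Real.pi / 2 : ℝ)) with hd
  have hmi : Measurable (fun q : AddCircle (2 * Real.pi) × ℝ => u (q.1 + q.2) - u (q.1 - q.2)) := by
    have : Measurable (fun r : ℝ => (r : AddCircle (2 * Real.pi))) := AddCircle.measurable_mk'
    exact (hu.comp (measurable_fst.add (this.comp measurable_snd))).sub
      (hu.comp (measurable_fst.sub (this.comp measurable_snd)))
  have hbi : ∀ ψ : AddCircle (2 * Real.pi), ∀ φ : ℝ, ‖u (ψ + φ) - u (ψ - φ)‖ ≤ 2 * M := by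
    intro ψ φ
    have := abs_le.1 (hM (ψ + φ)); have := abs_le.1 (hM (ψ - φ))
    rw [Real.norm_eq_abs, abs_le]; constructor <;> linarith
  have hpm : Measurable p := by
    refine (Measurable.const_mul ?_ _).sub (Measurable.const_mul ?_ _)
    · simp_rw [intervalIntegral.integral_of_le (by positivity : 0 ≤ Real.pi / 2)]
      exact (hmi.stronglyMeasurable.integral_prod_right).measurable
    · exact (hu.comp (measurable_add_const _)).sub (hu.comp (measurable_sub_const _))
  have hdm : Measurable d := hu.sub (hu.comp (measurable_add_const _))
  have hpb : ∀ ψ, |p ψ| ≤ Real.pi * M + M := by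
    intro ψ
    have h1 : ‖∫ φ in (0 : ℝ)..(Real.pi / 2), (u (ψ + φ) - u (ψ - φ))‖ ≤ 2 * M * |Real.pi / 2 - 0| :=
      intervalIntegral.norm_integral_le_of_norm_le_const fun φ _ => hbi ψ φ
    rw [sub_zero, abs_of_pos (by positivity), Real.norm_eq_abs] at h1
    have h2 := hbi ψ (Real.pi / 2)
    rw [Real.norm_eq_abs] at h2
    have := abs_le.1 h1; have := abs_le.1 h2
    simp only [hp]
    rw [abs_le]; constructor <;> nlinarith
  have hdb : ∀ ψ, |d ψ| ≤ 2 * M := by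
    intro ψ
    have := abs_le.1 (hM ψ); have := abs_le.1 (hM (ψ + (Real.pi / 2 : ℝ)))
    simp only [hd]
    rw [abs_le]; constructor <;> linarith
  have memLp : ∀ v : AddCircle (2 * Real.pi) → ℝ, Measurable v → ∀ C, (∀ t, |v t| ≤ C) →
      MemLp (fun t => (v t : ℂ)) 2 haarAddCircle := fun v hv C hC =>
    MemLp.of_bound (Complex.measurable_ofReal.comp hv).aestronglyMeasurable C
      (Filter.Eventually.of_forall fun t => by simpa using hC t)
  have pars : ∀ v : AddCircle (2 * Real.pi) → ℝ, Measurable v → ∀ C, (∀ t, |v t| ≤ C) →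
      HasSum (fun k : ℤ => ‖fourierCoeff (fun t => (v t : ℂ)) k‖ ^ 2) (∫ t, v t ^ 2 ∂haarAddCircle) := by
    intro v hv C hC
    have h := hasSum_sq_fourierCoeff ((memLp v hv C hC).toLp _)
    have e1 := (memLp v hv C hC).coeFn_toLp
    have e2 : ∀ k, fourierCoeff ((memLp v hv C hC).toLp _) k = fourierCoeff (fun t => (v t : ℂ)) k := by
      intro k
      refine integral_congr_ae ?_
      filter_upwards [e1] with t ht; rw [ht]
    simp_rw [e2] at h
    convert h using 1
    refine integral_congr_ae ?_
    filter_upwards [e1] with t ht; rw [ht]; simp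
  have bdint : ∀ v : AddCircle (2 * Real.pi) → ℂ, Measurable v → ∀ C, (∀ t, ‖v t‖ ≤ C) →
      Integrable v haarAddCircle := fun v hv C hC =>
    Integrable.of_bound hv.aestronglyMeasurable C (Filter.Eventually.of_forall hC)
  have fm : ∀ k : ℤ, Measurable (fun t : AddCircle (2 * Real.pi) => (fourier k t : ℂ)) :=
    fun k => (fourier k).continuous.measurable
  have um : Measurable (fun t => (u t : ℂ)) := Complex.measurable_ofReal.comp hu
  have fn : ∀ (k : ℤ) (t : AddCircle (2 * Real.pi)), ‖(fourier k t : ℂ)‖ = 1 := fun k t => by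
    rw [fourier_apply]; exact Circle.norm_coe _
  have shift : ∀ (k : ℤ) (a : AddCircle (2 * Real.pi)),
      ∫ t, fourier (-k) t * (u (t + a) : ℂ) ∂haarAddCircle =
        fourier k a * fourierCoeff (fun t => (u t : ℂ)) k := by
    intro k a
    have h := integral_add_right_eq_self (μ := haarAddCircle)
      (fun t : AddCircle (2 * Real.pi) => fourier (-k) (t - a) * (u t : ℂ)) a
    simp only [add_sub_cancel_right] at h
    rw [h, fourierCoeff, ← integral_const_mul]
    congr 1; ext t
    rw [smul_eq_mul, ← mul_assoc]
    congr 1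
    simp only [fourier_apply]
    rw [← Circle.coe_mul, ← toCircle_add, smul_sub]
    congr 2; simp; abel
  have ints : ∀ (k : ℤ) (a : AddCircle (2 * Real.pi)),
      Integrable (fun t => fourier (-k) t * (u (t + a) : ℂ)) haarAddCircle := by
    intro k a
    refine bdint _ ((fm _).mul (um.comp (measurable_add_const _))) M fun t => ?_
    rw [norm_mul, fn, one_mul]; simpa using hM _
  have hdc : ∀ k, fourierCoeff (fun t => (d t : ℂ)) k =
      (1 - fourier k ((Real.pi / 2 : ℝ) : AddCircle (2 * Real.pi))) * fourierCoeff (fun t => (u t : ℂ)) k := by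
    intro k
    rw [sub_mul, one_mul, ← shift]
    have : fourierCoeff (fun t => (u t : ℂ)) k = ∫ t, fourier (-k) t * (u t : ℂ) ∂haarAddCircle := rfl
    rw [this, ← integral_sub (by simpa using ints k 0) (ints k _), fourierCoeff]
    congr 1; ext t; simp only [hd, smul_eq_mul]; push_cast; ring
  have fe : ∀ (k : ℤ) (a : ℝ), (fourier k (a : AddCircle (2 * Real.pi)) : ℂ) =
      (Real.cos (k * a) : ℂ) + (Real.sin (k * a) : ℂ) * Complex.I := by
    intro k a
    rw [fourier_coe_apply, Complex.ofReal_cos, Complex.ofReal_sin, ← Complex.exp_mul_I]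
    congr 1
    have : (Real.pi : ℂ) ≠ 0 := by exact_mod_cast hpi.ne'
    push_cast; field_simp
  have fdiff : ∀ (k : ℤ) (a : ℝ), ∫ t : AddCircle (2 * Real.pi), fourier (-k) t * ((u (t + a) - u (t - a) : ℝ) : ℂ) ∂haarAddCircle =
      2 * Complex.I * (Real.sin (k * a) : ℂ) * fourierCoeff (fun t => (u t : ℂ)) k := by
    intro k a
    have e : ∀ t : AddCircle (2 * Real.pi), fourier (-k) t * ((u (t + a) - u (t - a) : ℝ) : ℂ) =
      fourier (-k) t * (u (t + a) : ℂ) - fourier (-k) t * (u (t + ((-a : ℝ) : AddCircle (2 * Real.pi))) : ℂ) := by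
      intro t; rw [sub_eq_add_neg t, AddCircle.coe_neg]; push_cast; ring
    simp_rw [e]
    rw [integral_sub (ints _ _) (ints _ _), shift, shift, fe, fe]
    simp only [mul_neg, Real.cos_neg, Real.sin_neg]
    push_cast; ring
  have hpc : ∀ k, fourierCoeff (fun t => (p t : ℂ)) k =
      Complex.I * (((∫ φ in (0 : ℝ)..(Real.pi / 2), Real.sin (k * φ)) - Real.sin (k * (Real.pi / 2)) / 3 : ℝ) : ℂ)
        * fourierCoeff (fun t => (u t : ℂ)) k := by
    intro k
    have hI : Integrable (fun q : AddCircle (2 * Real.pi) × ℝ => fourier (-k) q.1 * ((u (q.1 + q.2) - u (q.1 - q.2) : ℝ) : ℂ))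
        (haarAddCircle.prod (volume.restrict (Ioc 0 (Real.pi / 2)))) := by
      refine Integrable.of_bound (((fm _).comp measurable_fst).mul
        (Complex.measurable_ofReal.comp hmi)).aestronglyMeasurable (2 * M) (Filter.Eventually.of_forall fun q => ?_)
      rw [norm_mul, fn, one_mul, Complex.norm_real]; exact hbi _ _
    have e : ∀ t : AddCircle (2 * Real.pi), fourier (-k) t • (p t : ℂ) = (1 / 2) * (∫ φ in Ioc (0 : ℝ) (Real.pi / 2), fourier (-k) t * ((u (t + φ) - u (t - φ) : ℝ) : ℂ)) -
        (1 / 6) * (fourier (-k) t * ((u (t + (Real.pi / 2 : ℝ)) - u (t - (Real.pi / 2 : ℝ)) : ℝ) : ℂ)) := by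
      intro t
      rw [integral_const_mul, integral_complex_ofReal]
      simp only [hp, intervalIntegral.integral_of_le (by positivity : 0 ≤ Real.pi / 2), smul_eq_mul]
      push_cast; ring
    rw [fourierCoeff]
    simp_rw [e]
    rw [integral_sub, integral_const_mul, integral_const_mul, fdiff, integral_integral_swap hI]
    · simp_rw [fdiff]
      rw [integral_mul_const, integral_const_mul, integral_complex_ofReal,
        intervalIntegral.integral_of_le (by positivity : 0 ≤ Real.pi / 2)]
      push_cast; ring
    · exact hI.integral_prod_left.const_mul _
    · refine Integrable.const_mul (bdint _ ((fm _).mul (Complex.measurable_ofReal.comp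
        (hmi.comp (measurable_id.prodMk measurable_const)))) (2 * M) fun t => ?_) _
      rw [Pi.mul_apply, norm_mul, fn, one_mul]; exact (Complex.norm_real _).trans_le (hbi _ _)
  refine hasSum_le (fun k => ?_) (pars p hpm _ hpb) ((pars d hdm _ hdb).mul_left (1 / 4))
  rw [hpc, hdc, norm_mul, norm_mul, norm_mul, Complex.norm_I, one_mul, Complex.norm_real, mul_pow, mul_pow,
    Real.norm_eq_abs, sq_abs, ← mul_assoc]
  refine mul_le_mul_of_nonneg_right ((mult_bd k).trans (le_of_eq ?_)) (by positivity)
  rw [fe, ← Complex.normSq_eq_norm_sq, Complex.normSq_apply]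
  have := Real.sin_sq_add_cos_sq (k * (Real.pi / 2))
  have e1 : (1 - ((Real.cos (k * (Real.pi / 2)) : ℂ) + (Real.sin (k * (Real.pi / 2)) : ℂ) * Complex.I)).re =
    1 - Real.cos (k * (Real.pi / 2)) := by simp [-Complex.ofReal_cos, -Complex.ofReal_sin]
  have e2 : (1 - ((Real.cos (k * (Real.pi / 2)) : ℂ) + (Real.sin (k * (Real.pi / 2)) : ℂ) * Complex.I)).im =
    - Real.sin (k * (Real.pi / 2)) := by simp [-Complex.ofReal_cos, -Complex.ofReal_sin]
  rw [e1, e2]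
  nlinarith

noncomputable def fW {n : ℕ} (w : EE n → ℝ) (x : EE n) : ℝ := ‖x‖ * w (‖x‖⁻¹ • x)

noncomputable def lam : Measure ℝ := volume.restrict (Ioc 0 (Real.pi / 2))

instance : IsFiniteMeasure lam := by unfold lam; infer_instance

noncomputable def fZ {n : ℕ} (w : EE n → ℝ) (θ : EE n) : EE n :=
  (1 / (n : ℝ)) • ∫ q : ℝ × ℝ × EE n, fW w (Real.cos q.2.1 • q.1 • θ + Real.sin q.2.1 • q.2.2) • q.2.2
    ∂((nu n).prod (lam.prod (gam n)))

lemma fW_meas {n : ℕ} {w : EE n → ℝ} (hw : Measurable w) : Measurable (fW w) :=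
  measurable_norm.mul (hw.comp (by fun_prop))

lemma fW_bd {n : ℕ} {w : EE n → ℝ} {M : ℝ} (hM : ∀ x, |w x| ≤ M) (x : EE n) : |fW w x| ≤ M * ‖x‖ := by
  rw [fW, abs_mul, abs_norm, mul_comm]
  exact mul_le_mul_of_nonneg_right (hM _) (norm_nonneg _)

lemma fW_polar {n : ℕ} (w : EE n → ℝ) {r : ℝ} (hr : 0 < r) {θ : EE n} (hθ : ‖θ‖ = 1) :
    fW w (r • θ) = r * w θ := by
  rw [fW, norm_smul, hθ, mul_one, Real.norm_of_nonneg hr.le, smul_smul, inv_mul_cancel₀ hr.ne', one_smul]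

lemma nrm_rot {V : Type*} [NormedAddCommGroup V] [InnerProductSpace ℝ V] (φ : ℝ) (x y : V) :
    ‖Real.cos φ • x + Real.sin φ • y‖ ≤ ‖x‖ + ‖y‖ := by
  refine (norm_add_le _ _).trans (add_le_add ?_ ?_)
  · rw [norm_smul]; exact mul_le_of_le_one_left (norm_nonneg _) (Real.abs_cos_le_one φ)
  · rw [norm_smul]; exact mul_le_of_le_one_left (norm_nonneg _) (Real.abs_sin_le_one φ)

lemma rot_mp (n : ℕ) (φ : ℝ) : MeasurePreserving (fun p : EE n × EE n =>
    (Real.cos φ • p.1 + Real.sin φ • p.2, -Real.sin φ • p.1 + Real.cos φ • p.2))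
    ((gam n).prod (gam n)) ((gam n).prod (gam n)) := by
  have h := IsGaussian.map_rotation_eq_self (μ := gam n) (by simp [gam, integral_id_stdGaussian]) φ
  refine ⟨by fun_prop, ?_⟩
  conv_rhs => rw [← h]
  congr 1

lemma rot_int (n : ℕ) (φ : ℝ) {f : EE n × EE n → ℝ} (hf : Measurable f) :
    ∫ p : EE n × EE n, f (Real.cos φ • p.1 + Real.sin φ • p.2, -Real.sin φ • p.1 + Real.cos φ • p.2)
      ∂((gam n).prod (gam n)) = ∫ p, f p ∂((gam n).prod (gam n)) := by
  have h := rot_mp n φ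
  conv_rhs => rw [← h.map_eq]
  rw [integral_map h.measurable.aemeasurable hf.aestronglyMeasurable]

lemma gg_mom (n : ℕ) : Integrable (fun p : EE n × EE n => (‖p.1‖ + ‖p.2‖) ^ 2) ((gam n).prod (gam n)) := by
  have h1 : Integrable (fun p : EE n × EE n => ‖p.1‖ ^ 2) ((gam n).prod (gam n)) :=
    (gam_mom n 2).comp_fst _
  have h2 : Integrable (fun p : EE n × EE n => ‖p.2‖ ^ 2) ((gam n).prod (gam n)) :=
    (gam_mom n 2).comp_snd _
  refine Integrable.mono' ((h1.add h2).const_mul 2) (by fun_prop) (Filter.Eventually.of_forall fun p => ?_)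
  rw [Real.norm_of_nonneg (by positivity)]
  simp only [Pi.add_apply]
  nlinarith [sq_nonneg (‖p.1‖ - ‖p.2‖)]

lemma gg_int {n : ℕ} {f : EE n × EE n → ℝ} (hf : Measurable f) {C : ℝ}
    (h : ∀ p, |f p| ≤ C * (‖p.1‖ + ‖p.2‖) ^ 2) : Integrable f ((gam n).prod (gam n)) :=
  Integrable.mono' ((gg_mom n).const_mul C) hf.aestronglyMeasurable (Filter.Eventually.of_forall h)

lemma ggl_int {n : ℕ} {f : (EE n × EE n) × ℝ → ℝ} (hf : Measurable f) {C : ℝ}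
    (h : ∀ p, |f p| ≤ C * (‖p.1.1‖ + ‖p.1.2‖) ^ 2) : Integrable f (((gam n).prod (gam n)).prod lam) :=
  Integrable.mono' (((gg_mom n).const_mul C).comp_fst lam) hf.aestronglyMeasurable
    (Filter.Eventually.of_forall h)

lemma gg_dep {n : ℕ} (hn : 2 ≤ n) : ∀ᵐ p ∂((gam n).prod (gam n)),
    (inner ℝ p.1 p.2 : ℝ) ^ 2 ≠ ‖p.1‖ ^ 2 * ‖p.2‖ ^ 2 := by
  have hac : gam n ≪ volume := by rw [gam_dens]; exact withDensity_absolutelyContinuous _ _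
  have hne : Nontrivial (EE n) := by
    haveI : Nonempty (Fin n) := ⟨⟨0, by omega⟩⟩
    infer_instance
  have hm : MeasurableSet {p : EE n × EE n | (inner ℝ p.1 p.2 : ℝ) ^ 2 ≠ ‖p.1‖ ^ 2 * ‖p.2‖ ^ 2} :=
    (measurableSet_eq_fun (by fun_prop) (by fun_prop)).compl
  rw [Measure.ae_prod_iff_ae_ae hm]
  have h0 : ∀ᵐ x ∂gam n, x ≠ 0 := hac.ae_le (Measure.ae_ne volume 0)
  filter_upwards [h0] with x hx
  apply hac.ae_le
  have hs : volume ((Submodule.span ℝ {x} : Submodule ℝ (EE n)) : Set (EE n)) = 0 := by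
    refine Measure.addHaar_submodule _ _ fun h => ?_
    have := finrank_span_singleton (K := ℝ) hx
    rw [h, finrank_top, finrank_euclideanSpace_fin] at this
    omega
  filter_upwards [measure_eq_zero_iff_ae_notMem.1 hs] with y hy heq
  apply hy
  have : |(inner ℝ x y : ℝ)| = ‖x‖ * ‖y‖ := by
    rw [← abs_of_nonneg (by positivity : 0 ≤ ‖x‖ * ‖y‖)]
    exact sq_eq_sq_iff_abs_eq_abs _ _ |>.1 (by rw [heq]; ring)
  by_cases hy0 : y = 0
  · rw [hy0]; exact Submodule.zero_mem _
  have h2 := (abs_real_inner_div_norm_mul_norm_eq_one_iff x y).1 (by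
    rw [abs_div, this, abs_of_nonneg (by positivity)]
    exact div_self (by positivity))
  obtain ⟨_, r, _, rfl⟩ := h2
  exact Submodule.smul_mem _ _ (Submodule.mem_span_singleton_self x)

lemma mp_sw (n : ℕ) : MeasurePreserving (fun q : (EE n × EE n) × ℝ => (q.1.1, q.2, q.1.2))
    (((gam n).prod (gam n)).prod lam) ((gam n).prod (lam.prod (gam n))) :=
  ((MeasurePreserving.id (gam n)).prod (Measure.measurePreserving_swap (μ := gam n) (ν := lam))).comp
    (measurePreserving_prodAssoc (gam n) (gam n) lam)

lemma mp_pol {n : ℕ} (hn : 1 ≤ n) : MeasurePreserving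
    (fun q : EE n × (ℝ × ℝ × EE n) => (q.2.1 • q.1, q.2.2))
    ((sg n).prod ((nu n).prod (lam.prod (gam n)))) ((gam n).prod (lam.prod (gam n))) := by
  have := sg_prob hn
  have := nu_prob hn
  have a : MeasurePreserving (fun p : EE n × ℝ => p.2 • p.1) ((sg n).prod (nu n)) (gam n) :=
    ⟨by fun_prop, (gam_polar hn).symm⟩
  exact (a.prod (MeasurePreserving.id (lam.prod (gam n)))).comp
    ((measurePreserving_prodAssoc (sg n) (nu n) (lam.prod (gam n))).symm MeasurableEquiv.prodAssoc)

lemma ngl_mom {n : ℕ} (hn : 1 ≤ n) (k : ℕ) : Integrable (fun q : ℝ × ℝ × EE n => (|q.1| + ‖q.2.2‖) ^ k)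
    ((nu n).prod (lam.prod (gam n))) := by
  have := nu_prob hn
  have h1 : Integrable (fun q : ℝ × ℝ × EE n => |q.1| ^ k) ((nu n).prod (lam.prod (gam n))) :=
    (nu_mom hn k).comp_fst _
  have h2 : Integrable (fun q : ℝ × ℝ × EE n => ‖q.2.2‖ ^ k) ((nu n).prod (lam.prod (gam n))) :=
    Integrable.comp_snd (f := fun q : ℝ × EE n => ‖q.2‖ ^ k) ((gam_mom n k).comp_snd _) _
  refine Integrable.mono' ((h1.add h2).const_mul (2 ^ k)) (by fun_prop) (Filter.Eventually.of_forall fun p => ?_)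
  rw [Real.norm_of_nonneg (by positivity)]
  simp only [Pi.add_apply]
  refine (add_pow_le (abs_nonneg _) (norm_nonneg _) k).trans ?_
  gcongr <;> simp

lemma fZ_int {n : ℕ} (hn : 1 ≤ n) {w : EE n → ℝ} (hw : Measurable w) {M : ℝ} (hM : ∀ x, |w x| ≤ M)
    {θ : EE n} (hθ : ‖θ‖ ≤ 1) : Integrable (fun q : ℝ × ℝ × EE n =>
      fW w (Real.cos q.2.1 • q.1 • θ + Real.sin q.2.1 • q.2.2) • q.2.2) ((nu n).prod (lam.prod (gam n))) := by
  have hM0 : 0 ≤ M := (abs_nonneg _).trans (hM 0)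
  refine Integrable.mono' ((ngl_mom hn 2).const_mul M) ?_ (Filter.Eventually.of_forall fun q => ?_)
  · exact Measurable.aestronglyMeasurable (((fW_meas hw).comp (by fun_prop)).smul (by fun_prop))
  · rw [norm_smul]
    calc _ ≤ (M * (|q.1| + ‖q.2.2‖)) * ‖q.2.2‖ := by
          gcongr
          refine (fW_bd hM _).trans ?_
          gcongr
          refine (nrm_rot _ _ _).trans ?_
          rw [norm_smul, Real.norm_eq_abs]
          gcongr; exact mul_le_of_le_one_right (abs_nonneg _) hθ
      _ ≤ (M * (|q.1| + ‖q.2.2‖)) * (|q.1| + ‖q.2.2‖) := by gcongr; simp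
      _ = _ := by ring

lemma fZ_meas {n : ℕ} (hn : 1 ≤ n) {w : EE n → ℝ} (hw : Measurable w) : Measurable (fZ w) := by
  have := nu_prob hn
  have h : StronglyMeasurable (fun p : EE n × (ℝ × ℝ × EE n) =>
      fW w (Real.cos p.2.2.1 • p.2.1 • p.1 + Real.sin p.2.2.1 • p.2.2.2) • p.2.2.2) :=
    Measurable.stronglyMeasurable (((fW_meas hw).comp (by fun_prop)).smul (by fun_prop))
  have h2 := (h.integral_prod_right' (ν := (nu n).prod (lam.prod (gam n)))).measurable
  exact h2.const_smul (1 / (n : ℝ))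

/-- duality: pairing of `fZ` with a bounded zero-homogeneous field -/
lemma fZ_pair {n : ℕ} (hn : 1 ≤ n) {w : EE n → ℝ} (hw : Measurable w) {M : ℝ} (hM : ∀ x, |w x| ≤ M)
    {D : EE n → EE n} {C : ℝ} (hD : Measurable D) (hDb : ∀ x, ‖D x‖ ≤ C)
    (hDh : ∀ r : ℝ, 0 < r → ∀ x, D (r • x) = D x) :
    Integrable (fun q : (EE n × EE n) × ℝ => fW w (Real.cos q.2 • q.1.1 + Real.sin q.2 • q.1.2) *
      inner ℝ (D q.1.1) q.1.2) (((gam n).prod (gam n)).prod lam) ∧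
    n * ∫ θ, inner ℝ (D θ) (fZ w θ) ∂sg n =
      ∫ q, fW w (Real.cos q.2 • q.1.1 + Real.sin q.2 • q.1.2) * inner ℝ (D q.1.1) q.1.2
        ∂(((gam n).prod (gam n)).prod lam) := by
  have := sg_prob hn
  have := nu_prob hn
  have hC : 0 ≤ C := (norm_nonneg _).trans (hDb 0)
  have hM0 : 0 ≤ M := (abs_nonneg _).trans (hM 0)
  have hWm := fW_meas hw
  have hWb := fW_bd hM
  set H : EE n × ℝ × EE n → ℝ := fun q =>
    fW w (Real.cos q.2.1 • q.1 + Real.sin q.2.1 • q.2.2) * inner ℝ (D q.1) q.2.2 with hH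
  have hHm : Measurable H := (hWm.comp (by fun_prop)).mul ((hD.comp (by fun_prop)).inner (by fun_prop))
  have hHb : ∀ q, |H q| ≤ M * C * (‖q.1‖ + ‖q.2.2‖) ^ 2 := by
    intro q
    rw [hH, abs_mul]
    calc _ ≤ (M * (‖q.1‖ + ‖q.2.2‖)) * (C * ‖q.2.2‖) := by
          refine mul_le_mul ((hWb _).trans ?_) ((abs_real_inner_le_norm _ _).trans ?_) (abs_nonneg _) (by positivity)
          · gcongr; exact nrm_rot _ _ _
          · gcongr; exact hDb _
      _ ≤ (M * (‖q.1‖ + ‖q.2.2‖)) * (C * (‖q.1‖ + ‖q.2.2‖)) := by gcongr; simp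
      _ = _ := by ring
  have hi : Integrable (fun q : (EE n × EE n) × ℝ => H (q.1.1, q.2, q.1.2)) (((gam n).prod (gam n)).prod lam) :=
    ggl_int (hHm.comp (by fun_prop)) fun q => hHb _
  refine ⟨hi, ?_⟩
  have mp1 := mp_sw n
  have mp2 := mp_pol hn
  have hHi : Integrable H ((gam n).prod (lam.prod (gam n))) := by
    rw [← mp1.map_eq, integrable_map_measure hHm.aestronglyMeasurable mp1.measurable.aemeasurable]
    exact hi
  have hHi2 := (mp2.integrable_comp hHm.aestronglyMeasurable).2 hHi
  have e1 : ∫ q : (EE n × EE n) × ℝ, H (q.1.1, q.2, q.1.2) ∂(((gam n).prod (gam n)).prod lam) =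
      ∫ q, H q ∂((gam n).prod (lam.prod (gam n))) := by
    rw [← mp1.map_eq, integral_map mp1.measurable.aemeasurable hHm.aestronglyMeasurable]
  refine Eq.trans ?_ e1.symm
  rw [← mp2.map_eq, integral_map mp2.measurable.aemeasurable hHm.aestronglyMeasurable, integral_prod
    (fun q : EE n × (ℝ × ℝ × EE n) => H (q.2.1 • q.1, q.2.2)) hHi2,
    ← integral_const_mul]
  refine integral_congr_ae ?_
  filter_upwards [sg_norm n] with θ hθ
  have hnn : (n : ℝ) ≠ 0 := by positivity
  rw [fZ, inner_smul_right, ← mul_assoc, mul_one_div_cancel hnn, one_mul, ← integral_inner (fZ_int hn hw hM hθ.le)]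
  refine integral_congr_ae ?_
  filter_upwards [Measure.quasiMeasurePreserving_fst.ae (nu_pos n)] with q hq
  simp only [hH]
  rw [inner_smul_right, hDh _ hq]

lemma field_id {n : ℕ} (hn : 2 ≤ n) {w : EE n → ℝ} (hw : Measurable w) {M : ℝ} (hM : ∀ x, |w x| ≤ M)
    (h0 : ∫ θ, w θ ∂sg n = 0) {F : EE n → ℝ} {D : EE n → EE n} {C : ℝ} (hF : Measurable F)
    (hFb : ∀ x, |F x| ≤ C * ‖x‖) (hFh : ∀ r : ℝ, 0 < r → ∀ x, F (r • x) = r * F x)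
    (hD : Measurable D) (hDb : ∀ x, ‖D x‖ ≤ C) (hDh : ∀ r : ℝ, 0 < r → ∀ x, D (r • x) = D x)
    (hG : ∀ x, x ≠ 0 → HasGradientAt F (D x) x) :
    ∫ θ, inner ℝ (D θ) (fZ w θ) ∂sg n = ∫ θ, w θ * F θ ∂sg n := by
  have := sg_prob (by omega : 1 ≤ n)
  have := nu_prob (by omega : 1 ≤ n)
  have hn1 : 1 ≤ n := by omega
  have hC : 0 ≤ C := (norm_nonneg _).trans (hDb 0)
  have hM0 : 0 ≤ M := (abs_nonneg _).trans (hM 0)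
  have hWm := fW_meas hw
  have hWb := fW_bd hM
  -- the pointwise identity
  have ftc : ∀ᵐ p ∂((gam n).prod (gam n)), fW w p.1 * F (-p.2) - fW w p.1 * F p.1 =
      ∫ φ, fW w p.1 * inner ℝ (D (Real.cos φ • p.1 - Real.sin φ • p.2))
        (-(Real.sin φ • p.1 + Real.cos φ • p.2)) ∂lam := by
    filter_upwards [gg_dep hn] with p hp
    have hne : ∀ φ : ℝ, Real.cos φ • p.1 - Real.sin φ • p.2 ≠ 0 := by
      intro φ h
      apply hp
      have hh := sub_eq_zero.1 h
      by_cases hs : Real.sin φ = 0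
      · have hc : Real.cos φ ≠ 0 := by
          intro hc; have := Real.sin_sq_add_cos_sq φ; rw [hs, hc] at this; norm_num at this
        rw [hs, zero_smul, smul_eq_zero] at hh
        rw [hh.resolve_left hc]; simp
      · have : p.2 = (Real.sin φ)⁻¹ • Real.cos φ • p.1 := by
          rw [hh, smul_smul, inv_mul_cancel₀ hs, one_smul]
        rw [this, smul_smul, inner_smul_right, norm_smul, real_inner_self_eq_norm_sq, Real.norm_eq_abs,
          mul_pow (|_|), sq_abs]
        ring
    have hder : ∀ φ : ℝ, HasDerivAt (fun φ : ℝ => F (Real.cos φ • p.1 - Real.sin φ • p.2))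
        (inner ℝ (D (Real.cos φ • p.1 - Real.sin φ • p.2)) (-(Real.sin φ • p.1 + Real.cos φ • p.2))) φ := by
      intro φ
      have h1 := (hG _ (hne φ)).hasFDerivAt
      have h2 : HasDerivAt (fun φ : ℝ => Real.cos φ • p.1 - Real.sin φ • p.2)
          (-(Real.sin φ • p.1 + Real.cos φ • p.2)) φ := by
        have h4 := ((Real.hasDerivAt_cos φ).smul_const p.1).sub ((Real.hasDerivAt_sin φ).smul_const p.2)
        have h5 : -Real.sin φ • p.1 - Real.cos φ • p.2 = -(Real.sin φ • p.1 + Real.cos φ • p.2) := by module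
        rw [h5] at h4; exact h4
      have h3 := h1.comp_hasDerivAt φ h2
      exact h3
    have hint := intervalIntegral.integral_eq_sub_of_hasDerivAt (a := 0) (b := Real.pi / 2) (fun φ _ => hder φ) ?_
    · rw [intervalIntegral.integral_of_le (by positivity)] at hint
      rw [integral_const_mul, lam, hint]
      simp; ring
    · rw [intervalIntegrable_iff_integrableOn_Ioc_of_le (by positivity)]
      refine Measure.integrableOn_of_bounded (M := C * (‖p.1‖ + ‖p.2‖)) (by simp) ?_ ?_
      · refine Measurable.aestronglyMeasurable ?_
        exact (hD.comp (by fun_prop)).inner (by fun_prop)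
      · refine Filter.Eventually.of_forall fun φ => (norm_inner_le_norm _ _).trans ?_
        refine mul_le_mul (hDb _) ?_ (norm_nonneg _) hC
        rw [norm_neg, add_comm, add_comm ‖p.1‖]; exact nrm_rot φ p.2 p.1
  -- integrate
  set G : (EE n × EE n) × ℝ → ℝ := fun q => fW w q.1.1 *
    inner ℝ (D (Real.cos q.2 • q.1.1 - Real.sin q.2 • q.1.2)) (-(Real.sin q.2 • q.1.1 + Real.cos q.2 • q.1.2)) with hGd
  have hGm : Measurable G := (hWm.comp (by fun_prop)).mul ((hD.comp (by fun_prop)).inner (by fun_prop))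
  have hGi : Integrable G (((gam n).prod (gam n)).prod lam) := by
    refine ggl_int hGm (C := M * C) fun q => ?_
    rw [hGd, abs_mul]
    calc _ ≤ (M * ‖q.1.1‖) * (C * (‖q.1.1‖ + ‖q.1.2‖)) := by
          refine mul_le_mul (hWb _) ((abs_real_inner_le_norm _ _).trans ?_) (abs_nonneg _) (by positivity)
          refine mul_le_mul (hDb _) ?_ (norm_nonneg _) hC
          rw [norm_neg, add_comm, add_comm ‖q.1.1‖]; exact nrm_rot _ _ _
      _ ≤ (M * (‖q.1.1‖ + ‖q.1.2‖)) * (C * (‖q.1.1‖ + ‖q.1.2‖)) := by gcongr; simp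
      _ = _ := by ring
  have i1 : Integrable (fun p : EE n × EE n => fW w p.1 * F (-p.2)) ((gam n).prod (gam n)) := by
    refine gg_int (C := M * C) ((hWm.comp measurable_fst).mul (hF.comp (by fun_prop))) fun p => ?_
    rw [abs_mul]
    calc _ ≤ (M * ‖p.1‖) * (C * ‖-p.2‖) := mul_le_mul (hWb _) (hFb _) (abs_nonneg _) (by positivity)
      _ ≤ (M * (‖p.1‖ + ‖p.2‖)) * (C * (‖p.1‖ + ‖p.2‖)) := by gcongr <;> simp
      _ = _ := by ring
  have i2 : Integrable (fun p : EE n × EE n => fW w p.1 * F p.1) ((gam n).prod (gam n)) := by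
    refine gg_int (C := M * C) ((hWm.comp measurable_fst).mul (hF.comp (by fun_prop))) fun p => ?_
    rw [abs_mul]
    calc _ ≤ (M * ‖p.1‖) * (C * ‖p.1‖) := mul_le_mul (hWb _) (hFb _) (abs_nonneg _) (by positivity)
      _ ≤ (M * (‖p.1‖ + ‖p.2‖)) * (C * (‖p.1‖ + ‖p.2‖)) := by gcongr <;> simp
      _ = _ := by ring
  have hEW : ∫ x, fW w x ∂gam n = 0 := by
    rw [(gam_int hn1 hWm).1]
    have : ∀ᵐ p ∂((sg n).prod (nu n)), fW w (p.2 • p.1) = w p.1 * p.2 := by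
      filter_upwards [Measure.quasiMeasurePreserving_fst.ae (sg_norm n),
        Measure.quasiMeasurePreserving_snd.ae (nu_pos n)] with p h1 h2
      rw [fW_polar w h2 h1, mul_comm]
    rw [integral_congr_ae this, integral_prod_mul (fun θ => w θ) (fun r : ℝ => r), h0, zero_mul]
  have e1 : ∫ p : EE n × EE n, fW w p.1 * F (-p.2) ∂((gam n).prod (gam n)) = 0 := by
    rw [integral_prod_mul (fun x => fW w x) (fun y => F (-y)), hEW, zero_mul]
  have e2 : ∫ p : EE n × EE n, fW w p.1 * F p.1 ∂((gam n).prod (gam n)) = n * ∫ θ, w θ * F θ ∂sg n := by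
    rw [integral_fun_fst (fun x => fW w x * F x), probReal_univ, one_smul, (gam_int hn1 (f := fun x => fW w x * F x) (hWm.mul hF)).1]
    have : ∀ᵐ p ∂((sg n).prod (nu n)), fW w (p.2 • p.1) * F (p.2 • p.1) = (w p.1 * F p.1) * p.2 ^ 2 := by
      filter_upwards [Measure.quasiMeasurePreserving_fst.ae (sg_norm n),
        Measure.quasiMeasurePreserving_snd.ae (nu_pos n)] with p h1 h2
      rw [fW_polar w h2 h1, hFh _ h2]; ring
    rw [integral_congr_ae this, integral_prod_mul (fun θ => w θ * F θ) (fun r : ℝ => r ^ 2), nu_sq hn1, mul_comm]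
  have e3 := integral_congr_ae ftc
  rw [integral_sub i1 i2, e1, e2, zero_sub, integral_integral_swap hGi] at e3
  obtain ⟨hHi, hZ⟩ := fZ_pair hn1 hw hM hD hDb hDh
  have e4 : ∀ φ : ℝ, ∫ p : EE n × EE n, G (p, φ) ∂((gam n).prod (gam n)) =
      - ∫ p : EE n × EE n, fW w (Real.cos φ • p.1 + Real.sin φ • p.2) * inner ℝ (D p.1) p.2 ∂((gam n).prod (gam n)) := by
    intro φ
    have hm : Measurable (fun p : EE n × EE n => G (p, φ)) := hGm.comp (by fun_prop)
    rw [← rot_int n φ hm, ← integral_neg]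
    congr 1; ext p
    have a1 : Real.cos φ • (Real.cos φ • p.1 + Real.sin φ • p.2) -
        Real.sin φ • (-Real.sin φ • p.1 + Real.cos φ • p.2) = (Real.sin φ ^ 2 + Real.cos φ ^ 2) • p.1 := by module
    have a2 : Real.sin φ • (Real.cos φ • p.1 + Real.sin φ • p.2) +
        Real.cos φ • (-Real.sin φ • p.1 + Real.cos φ • p.2) = (Real.sin φ ^ 2 + Real.cos φ ^ 2) • p.2 := by module
    rw [Real.sin_sq_add_cos_sq, one_smul] at a1 a2
    simp only [hGd]
    rw [a1, a2, inner_neg_right]; ring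
  change _ = ∫ φ, ∫ p, G (p, φ) ∂((gam n).prod (gam n)) ∂lam at e3
  simp_rw [e4] at e3
  rw [integral_neg, neg_inj, ← integral_integral_swap hHi, integral_integral hHi, ← hZ] at e3
  exact (mul_left_cancel₀ (by positivity) e3).symm

noncomputable def fpp {n : ℕ} (W : EE n → ℝ) (p : EE n × EE n) : ℝ :=
  (1 / 2) * (∫ φ, (W (Real.cos φ • p.1 + Real.sin φ • p.2) - W (Real.cos φ • p.1 - Real.sin φ • p.2)) ∂lam) -
    (1 / 6) * (W p.2 - W (-p.2))

lemma fpp_meas {n : ℕ} {W : EE n → ℝ} (hW : Measurable W) : Measurable (fpp W) := by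
  have h : StronglyMeasurable (fun q : (EE n × EE n) × ℝ => W (Real.cos q.2 • q.1.1 + Real.sin q.2 • q.1.2) -
      W (Real.cos q.2 • q.1.1 - Real.sin q.2 • q.1.2)) :=
    Measurable.stronglyMeasurable ((hW.comp (by fun_prop)).sub (hW.comp (by fun_prop)))
  have h2 := (h.integral_prod_right' (ν := lam)).measurable
  exact (h2.const_mul _).sub (((hW.comp measurable_snd).sub (hW.comp (by fun_prop))).const_mul _)

lemma lam_univ : lam.real univ = Real.pi / 2 := by
  simp [lam, (by positivity : (0 : ℝ) ≤ Real.pi / 2)]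

lemma W_rot {n : ℕ} {W : EE n → ℝ} {M : ℝ} (hb : ∀ x, |W x| ≤ M * ‖x‖) (φ : ℝ) (x y : EE n) :
    |W (Real.cos φ • x + Real.sin φ • y)| ≤ M * (‖x‖ + ‖y‖) ∧ |W (Real.cos φ • x - Real.sin φ • y)| ≤ M * (‖x‖ + ‖y‖) := by
  by_cases hM : 0 ≤ M
  · constructor
    · exact (hb _).trans (by gcongr; exact nrm_rot _ _ _)
    · refine (hb _).trans ?_
      have := nrm_rot φ x (-y)
      rw [smul_neg, ← sub_eq_add_neg, norm_neg] at this
      gcongr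
  · have hz : ∀ z : EE n, z = 0 := fun z => by
      by_contra h
      have := (abs_nonneg _).trans (hb z)
      have h2 : 0 < ‖z‖ := norm_pos_iff.2 h
      nlinarith
    have := hb 0
    rw [hz x, hz y]; simp_all

lemma fpp_bd {n : ℕ} {W : EE n → ℝ} {M : ℝ} (hb : ∀ x, |W x| ≤ M * ‖x‖) (p : EE n × EE n) :
    |fpp W p| ≤ 3 * (M * (‖p.1‖ + ‖p.2‖)) := by
  have h1 : ‖∫ φ, (W (Real.cos φ • p.1 + Real.sin φ • p.2) - W (Real.cos φ • p.1 - Real.sin φ • p.2)) ∂lam‖ ≤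
      (2 * (M * (‖p.1‖ + ‖p.2‖))) * lam.real univ :=
    norm_integral_le_of_norm_le_const (Filter.Eventually.of_forall fun φ => by
      have := W_rot hb φ p.1 p.2
      rw [Real.norm_eq_abs]
      refine (abs_sub _ _).trans ?_
      linarith)
  rw [lam_univ, Real.norm_eq_abs] at h1
  have h2 := (W_rot hb (Real.pi / 2) p.1 p.2)
  simp only [Real.cos_pi_div_two, Real.sin_pi_div_two, zero_smul, one_smul, zero_add, zero_sub] at h2
  have h0 : 0 ≤ M * (‖p.1‖ + ‖p.2‖) := (abs_nonneg _).trans h2.1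
  rw [fpp]
  refine (abs_sub _ _).trans ?_
  rw [abs_mul, abs_mul, abs_of_pos (by norm_num : (0 : ℝ) < 1 / 2), abs_of_pos (by norm_num : (0 : ℝ) < 1 / 6)]
  have h3 := abs_sub (W p.2) (W (-p.2))
  have := Real.pi_lt_four
  nlinarith

lemma fpp_sq {n : ℕ} {W : EE n → ℝ} (hW : Measurable W) {M : ℝ} (hb : ∀ x, |W x| ≤ M * ‖x‖) :
    ∫ p, fpp W p ^ 2 ∂((gam n).prod (gam n)) ≤ (1 / 4) * ∫ p : EE n × EE n, (W p.1 - W p.2) ^ 2 ∂((gam n).prod (gam n)) := by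
  set μ := (gam n).prod (gam n)
  set η : Measure (AddCircle (2 * Real.pi)) := AddCircle.haarAddCircle
  set c : AddCircle (2 * Real.pi) → ℝ := Real.Angle.cos
  set s : AddCircle (2 * Real.pi) → ℝ := Real.Angle.sin
  have hc0 : Continuous c := Real.Angle.continuous_cos
  have hs0 : Continuous s := Real.Angle.continuous_sin
  have hc := hc0.measurable
  have hs := hs0.measurable
  have hcc : ∀ t : ℝ, c (t : AddCircle (2 * Real.pi)) = Real.cos t := fun t => rfl
  have hsc : ∀ t : ℝ, s (t : AddCircle (2 * Real.pi)) = Real.sin t := fun t => rfl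
  have gen : ∀ (f : EE n × EE n → ℝ) (C : ℝ), Measurable f → (∀ p, |f p| ≤ C * (‖p.1‖ + ‖p.2‖)) →
      Integrable (fun q : (EE n × EE n) × AddCircle (2 * Real.pi) =>
        f (c q.2 • q.1.1 + s q.2 • q.1.2, -s q.2 • q.1.1 + c q.2 • q.1.2) ^ 2) (μ.prod η) ∧
      ∫ p, f p ^ 2 ∂μ = ∫ p : EE n × EE n, ∫ ψ, f (c ψ • p.1 + s ψ • p.2, -s ψ • p.1 + c ψ • p.2) ^ 2 ∂η ∂μ := by
    intro f C hf hfb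
    have hi : Integrable (fun q : (EE n × EE n) × AddCircle (2 * Real.pi) =>
        f (c q.2 • q.1.1 + s q.2 • q.1.2, -s q.2 • q.1.1 + c q.2 • q.1.2) ^ 2) (μ.prod η) := by
      refine Integrable.mono' (((gg_mom n).const_mul (4 * C ^ 2)).comp_fst η) ?_ (Filter.Eventually.of_forall fun q => ?_)
      · exact Measurable.aestronglyMeasurable ((hf.comp (by fun_prop)).pow_const 2)
      · obtain ⟨⟨x, y⟩, ψ⟩ := q
        induction ψ using QuotientAddGroup.induction_on with | _ t
        simp only [hcc, hsc]
        rw [Real.norm_of_nonneg (by positivity)]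
        have h1 := hfb (Real.cos t • x + Real.sin t • y, -Real.sin t • x + Real.cos t • y)
        have h2 := nrm_rot t x y
        have h3 := nrm_rot t y (-x)
        rw [norm_neg, smul_neg, ← neg_smul, add_comm (Real.cos t • y)] at h3
        have h5 : 0 ≤ ‖Real.cos t • x + Real.sin t • y‖ + ‖-Real.sin t • x + Real.cos t • y‖ := by positivity
        have h4 : ‖Real.cos t • x + Real.sin t • y‖ + ‖-Real.sin t • x + Real.cos t • y‖ ≤ 2 * (‖x‖ + ‖y‖) := by linarith
        calc _ = |f (Real.cos t • x + Real.sin t • y, -Real.sin t • x + Real.cos t • y)| ^ 2 := (sq_abs _).symm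
          _ ≤ (C * (‖Real.cos t • x + Real.sin t • y‖ + ‖-Real.sin t • x + Real.cos t • y‖)) ^ 2 := by
              gcongr
          _ = C ^ 2 * (‖Real.cos t • x + Real.sin t • y‖ + ‖-Real.sin t • x + Real.cos t • y‖) ^ 2 := by ring
          _ ≤ C ^ 2 * (2 * (‖x‖ + ‖y‖)) ^ 2 := by gcongr
          _ = _ := by ring
    refine ⟨hi, ?_⟩
    rw [integral_integral_swap hi]
    have : ∀ ψ, ∫ p : EE n × EE n, f (c ψ • p.1 + s ψ • p.2, -s ψ • p.1 + c ψ • p.2) ^ 2 ∂μ = ∫ p, f p ^ 2 ∂μ := by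
      intro ψ
      induction ψ using QuotientAddGroup.induction_on with | _ t
      simp only [hcc, hsc]
      exact rot_int n t (f := fun p => f p ^ 2) (hf.pow_const 2)
    simp_rw [this]
    simp
  obtain ⟨i1, e1⟩ := gen (fpp W) (3 * M) (fpp_meas hW) fun p => (fpp_bd hb p).trans (by linarith)
  obtain ⟨i2, e2⟩ := gen (fun p => W p.1 - W p.2) (2 * M) ((hW.comp measurable_fst).sub (hW.comp measurable_snd)) fun p => by
    have h2 := (W_rot hb (Real.pi / 2) p.1 p.2)
    have h3 := (W_rot hb 0 p.1 p.2)
    simp only [Real.cos_pi_div_two, Real.sin_pi_div_two, zero_smul, one_smul, zero_add, Real.cos_zero, Real.sin_zero, add_zero] at h2 h3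
    exact (abs_sub _ _).trans (by linarith)
  rw [e1, e2, ← integral_const_mul]
  refine integral_mono i1.integral_prod_left (i2.integral_prod_left.const_mul _) fun p => ?_
  have key := circle_ineq (fun t => W (c t • p.1 + s t • p.2)) (hW.comp (by fun_prop)) (M * (‖p.1‖ + ‖p.2‖)) (fun ψ => by
    induction ψ using QuotientAddGroup.induction_on with | _ t
    exact (W_rot hb t p.1 p.2).1)
  refine le_trans (le_of_eq ?_) (key.trans (le_of_eq ?_))
  · congr 1; ext ψ
    induction ψ using QuotientAddGroup.induction_on with | _ t
    have ea : ∀ a b : ℝ, ((a : AddCircle (2 * Real.pi)) + (b : AddCircle (2 * Real.pi))) = ((a + b : ℝ) : AddCircle (2 * Real.pi)) := fun _ _ => rfl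
    have eb : ∀ a b : ℝ, ((a : AddCircle (2 * Real.pi)) - (b : AddCircle (2 * Real.pi))) = ((a - b : ℝ) : AddCircle (2 * Real.pi)) := fun _ _ => rfl
    rw [fpp, intervalIntegral.integral_of_le (by positivity)]
    simp only [ea, eb, hcc, hsc, Real.cos_add, Real.cos_sub, Real.sin_add, Real.sin_sub, Real.cos_pi_div_two, Real.sin_pi_div_two]
    congr 2
    · congr 2
      ext φ
      congr 2 <;> module
    · congr 3 <;> module
  · congr 2; ext ψ
    induction ψ using QuotientAddGroup.induction_on with | _ t
    have ea : ∀ a b : ℝ, ((a : AddCircle (2 * Real.pi)) + (b : AddCircle (2 * Real.pi))) = ((a + b : ℝ) : AddCircle (2 * Real.pi)) := fun _ _ => rfl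
    simp only [ea, hcc, hsc, Real.cos_add, Real.sin_add, Real.cos_pi_div_two, Real.sin_pi_div_two]
    congr 3; module
lemma isub {α : Type*} [MeasurableSpace α] {μ : Measure α} {f g : α → ℝ} (hf : Integrable f μ) (hg : Integrable g μ) :
    Integrable (fun x => f x - g x) μ := hf.sub hg

lemma fZ_bd {n : ℕ} (hn : 1 ≤ n) {w : EE n → ℝ} (hw : Measurable w) {M : ℝ} (hM : ∀ x, |w x| ≤ M) :
    ∃ C, ∀ θ : EE n, ‖θ‖ ≤ 1 → ‖fZ w θ‖ ≤ C := by
  refine ⟨(1 / (n : ℝ)) * (M * ∫ q : ℝ × ℝ × EE n, (|q.1| + ‖q.2.2‖) ^ 2 ∂((nu n).prod (lam.prod (gam n)))), fun θ hθ => ?_⟩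
  have hM0 : 0 ≤ M := (abs_nonneg _).trans (hM 0)
  rw [fZ, norm_smul, Real.norm_of_nonneg (by positivity)]
  gcongr
  rw [← integral_const_mul]
  refine norm_integral_le_of_norm_le ((ngl_mom hn 2).const_mul M) (Filter.Eventually.of_forall fun q => ?_)
  rw [norm_smul]
  calc _ ≤ (M * (|q.1| + ‖q.2.2‖)) * ‖q.2.2‖ := by
        gcongr
        refine (fW_bd hM _).trans ?_
        gcongr
        refine (nrm_rot _ _ _).trans ?_
        rw [norm_smul, Real.norm_eq_abs]
        gcongr; exact mul_le_of_le_one_right (abs_nonneg _) hθ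
    _ ≤ (M * (|q.1| + ‖q.2.2‖)) * (|q.1| + ‖q.2.2‖) := by gcongr; simp
    _ = _ := by ring

lemma fZ_l2 {n : ℕ} (hn : 1 ≤ n) {w : EE n → ℝ} (hw : Measurable w) {M : ℝ} (hM : ∀ x, |w x| ≤ M)
    (h0 : ∫ θ, w θ ∂sg n = 0) (h1 : ∫ θ, w θ • θ ∂sg n = 0) :
    ∫ θ, ‖fZ w θ‖ ^ 2 ∂sg n ≤ (1 / (2 * n)) * ∫ θ, w θ ^ 2 ∂sg n := by
  have := sg_prob hn
  have := nu_prob hn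
  have hM0 : 0 ≤ M := (abs_nonneg _).trans (hM 0)
  have hn0 : (0 : ℝ) < n := by positivity
  obtain ⟨C, hC⟩ := fZ_bd hn hw hM
  have hWm := fW_meas hw
  have hWb := fW_bd hM
  set W := fW w with hWdef
  set μ := (gam n).prod (gam n) with hμ
  set Q : EE n → EE n := fun x => fZ w (‖x‖⁻¹ • x) with hQ
  have hQm : Measurable Q := (fZ_meas hn hw).comp (by fun_prop)
  have hQb : ∀ x, ‖Q x‖ ≤ C := fun x => hC _ (by
    rw [norm_smul, norm_inv, norm_norm]; exact inv_mul_le_one)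
  have hC0 : 0 ≤ C := (norm_nonneg _).trans (hQb 0)
  have hQh : ∀ r : ℝ, 0 < r → ∀ x, Q (r • x) = Q x := fun r hr x => by
    simp only [hQ]
    rw [norm_smul, Real.norm_of_nonneg hr.le, smul_smul, mul_inv, mul_comm r⁻¹, mul_assoc, inv_mul_cancel₀ hr.ne', mul_one]
  have hQ1 : ∀ θ : EE n, ‖θ‖ = 1 → Q θ = fZ w θ := fun θ h => by simp [hQ, h]
  obtain ⟨hi, hZ⟩ := fZ_pair hn hw hM hQm hQb hQh
  have eZ : ∫ θ, inner ℝ (Q θ) (fZ w θ) ∂sg n = ∫ θ, ‖fZ w θ‖ ^ 2 ∂sg n := by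
    refine integral_congr_ae ?_
    filter_upwards [sg_norm n] with θ hθ
    rw [hQ1 θ hθ, real_inner_self_eq_norm_sq]
  rw [eZ, integral_prod _ hi] at hZ
  set I := ∫ θ, ‖fZ w θ‖ ^ 2 ∂sg n
  set A : EE n × EE n → ℝ := fun p => ∫ φ, W (Real.cos φ • p.1 + Real.sin φ • p.2) ∂lam with hA
  have hWi : ∀ p : EE n × EE n, Integrable (fun φ => W (Real.cos φ • p.1 + Real.sin φ • p.2)) lam := fun p =>
    Integrable.of_bound (Measurable.aestronglyMeasurable (hWm.comp (by fun_prop))) (M * (‖p.1‖ + ‖p.2‖))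
      (Filter.Eventually.of_forall fun φ => (W_rot hWb φ p.1 p.2).1)
  have hAm : Measurable A := by
    have h : StronglyMeasurable (fun q : (EE n × EE n) × ℝ => W (Real.cos q.2 • q.1.1 + Real.sin q.2 • q.1.2)) :=
      Measurable.stronglyMeasurable (hWm.comp (by fun_prop))
    exact (h.integral_prod_right' (ν := lam)).measurable
  simp only [integral_mul_const] at hZ
  have hqb : ∀ (f : EE n × EE n → ℝ) (K : ℝ), Measurable f → (∀ p, |f p| ≤ K * (‖p.1‖ + ‖p.2‖)) →
      Integrable (fun p : EE n × EE n => f p * inner ℝ (Q p.1) p.2) μ := by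
    intro f K hf hfb
    refine gg_int (C := K * C) (hf.mul ((hQm.comp measurable_fst).inner measurable_snd)) fun p => ?_
    rw [abs_mul]
    calc _ ≤ (K * (‖p.1‖ + ‖p.2‖)) * (C * ‖p.2‖) := by
          refine mul_le_mul (hfb _) ((abs_real_inner_le_norm _ _).trans ?_) (abs_nonneg _) ((abs_nonneg _).trans (hfb _))
          gcongr; exact hQb _
      _ ≤ (K * (‖p.1‖ + ‖p.2‖)) * (C * (‖p.1‖ + ‖p.2‖)) := by
          refine mul_le_mul_of_nonneg_left ?_ ((abs_nonneg _).trans (hfb _))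
          gcongr; simp
      _ = _ := by ring
  have hAb : ∀ p, |A p| ≤ (M * (Real.pi / 2)) * (‖p.1‖ + ‖p.2‖) := fun p => by
    refine (norm_integral_le_of_norm_le_const (μ := lam) (f := fun φ => W (Real.cos φ • p.1 + Real.sin φ • p.2)) (C := M * (‖p.1‖ + ‖p.2‖)) (Filter.Eventually.of_forall fun φ => (W_rot hWb φ p.1 p.2).1)).trans ?_
    rw [lam_univ]; linarith
  have neg_mp : MeasurePreserving (fun y : EE n => -y) (gam n) (gam n) := by
    refine ⟨by fun_prop, ?_⟩
    rw [gam_dens]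
    ext s hs
    rw [Measure.map_apply measurable_neg hs, withDensity_apply _ hs, withDensity_apply _ (measurable_neg hs),
      ← (Measure.measurePreserving_neg (volume : Measure (EE n))).setLIntegral_comp_preimage hs (by fun_prop)]
    simp
  have sw_mp : MeasurePreserving (fun p : EE n × EE n => (p.1, -p.2)) μ μ := (MeasurePreserving.id (gam n)).prod neg_mp
  have sw_int : ∀ f : EE n × EE n → ℝ, Measurable f → ∫ p : EE n × EE n, f (p.1, -p.2) ∂μ = ∫ p, f p ∂μ := by
    intro f hf
    conv_rhs => rw [← sw_mp.map_eq]
    rw [integral_map sw_mp.measurable.aemeasurable hf.aestronglyMeasurable]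
  have iA := hqb A _ hAm hAb
  have iA' := hqb (fun p => A (p.1, -p.2)) _ (hAm.comp (by fun_prop)) (fun p => (hAb _).trans_eq (by rw [norm_neg]))
  have iW := hqb (fun p => W p.2) M (hWm.comp measurable_snd) fun p => (hWb _).trans (by gcongr; simp)
  have iW' := hqb (fun p => W (-p.2)) M (hWm.comp (by fun_prop)) fun p => (hWb _).trans (by rw [norm_neg]; gcongr; simp)
  have sA : ∫ p : EE n × EE n, A (p.1, -p.2) * inner ℝ (Q p.1) p.2 ∂μ = - ∫ p : EE n × EE n, A p * inner ℝ (Q p.1) p.2 ∂μ := by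
    rw [← sw_int (fun p => A p * inner ℝ (Q p.1) p.2) (hAm.mul ((hQm.comp measurable_fst).inner measurable_snd)), ← integral_neg]
    congr 1; ext p; rw [inner_neg_right]; ring
  have eW : ∫ y, W y • y ∂gam n = 0 := by
    have hm : Measurable (fun p : EE n × ℝ => p.2 • p.1) := by fun_prop
    rw [gam_polar hn, integral_map (f := fun y => W y • y) hm.aemeasurable (Measurable.aestronglyMeasurable (hWm.smul measurable_id))]
    have : ∀ᵐ p ∂((sg n).prod (nu n)), W (p.2 • p.1) • p.2 • p.1 = (p.2 ^ 2) • (w p.1 • p.1) := by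
      filter_upwards [Measure.quasiMeasurePreserving_fst.ae (sg_norm n),
        Measure.quasiMeasurePreserving_snd.ae (nu_pos n)] with p h1 h2
      rw [hWdef, fW_polar w h2 h1, smul_smul, smul_smul]; congr 1; ring
    rw [integral_congr_ae this]
    have e := integral_prod_smul (μ := nu n) (ν := sg n) (fun r : ℝ => r ^ 2) (fun θ => w θ • θ)
    rw [h1, smul_zero] at e
    rw [← e, ← integral_prod_swap]; rfl
  have iWy : Integrable (fun y => W y • y) (gam n) := by
    refine Integrable.mono' ((gam_mom n 2).const_mul M) (Measurable.aestronglyMeasurable (hWm.smul measurable_id)) (Filter.Eventually.of_forall fun y => ?_)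
    rw [norm_smul]
    calc _ ≤ (M * ‖y‖) * ‖y‖ := by gcongr; exact hWb y
      _ = _ := by ring
  have sW : ∫ p : EE n × EE n, W p.2 * inner ℝ (Q p.1) p.2 ∂μ = 0 := by
    rw [integral_prod _ iW]
    have : ∀ x, ∫ y, W y * inner ℝ (Q x) y ∂gam n = 0 := fun x => by
      have e := integral_inner (𝕜 := ℝ) iWy (Q x)
      rw [eW, inner_zero_right] at e
      rw [← e]; congr 1; ext y; rw [inner_smul_right]
    simp_rw [this]; simp
  have sW' : ∫ p : EE n × EE n, W (-p.2) * inner ℝ (Q p.1) p.2 ∂μ = 0 := by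
    rw [← neg_eq_zero, ← integral_neg, ← sW, ← sw_int (fun p => W p.2 * inner ℝ (Q p.1) p.2) ((hWm.comp measurable_snd).mul ((hQm.comp measurable_fst).inner measurable_snd))]
    congr 1; ext p; rw [inner_neg_right]; ring
  have ip : ∫ p, fpp W p * inner ℝ (Q p.1) p.2 ∂μ = n * I := by
    have e : ∀ p : EE n × EE n, fpp W p * inner ℝ (Q p.1) p.2 =
        (1 / 2) * (A p * inner ℝ (Q p.1) p.2 - A (p.1, -p.2) * inner ℝ (Q p.1) p.2) -
        (1 / 6) * (W p.2 * inner ℝ (Q p.1) p.2 - W (-p.2) * inner ℝ (Q p.1) p.2) := by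
      intro p
      have h2 := hWi (p.1, -p.2)
      rw [fpp]
      simp only [hA, smul_neg, ← sub_eq_add_neg] at h2 ⊢
      rw [integral_sub (hWi p) h2]; ring
    simp_rw [e]
    rw [integral_sub ((isub iA iA').const_mul _) ((isub iW iW').const_mul _), integral_const_mul, integral_const_mul,
      integral_sub iA iA', integral_sub iW iW', sA, sW, sW', hZ]
    ring
  have iQ : Integrable (fun p : EE n × EE n => (inner ℝ (Q p.1) p.2) ^ 2) μ := by
    refine gg_int (C := C ^ 2) (((hQm.comp measurable_fst).inner measurable_snd).pow_const 2) fun p => ?_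
    rw [abs_pow, ← mul_pow]
    refine pow_le_pow_left₀ (abs_nonneg _) ((abs_real_inner_le_norm _ _).trans ?_) 2
    gcongr
    · exact hQb _
    · simp
  have eQ : ∫ p : EE n × EE n, (inner ℝ (Q p.1) p.2) ^ 2 ∂μ = I := by
    rw [integral_prod _ iQ]
    have : ∀ x, ∫ y, (inner ℝ (Q x) y) ^ 2 ∂gam n = ‖Q x‖ ^ 2 := fun x => by
      rw [← gam_sq]; simp_rw [real_inner_comm]
    simp_rw [this]
    have hq2 : Measurable fun x => ‖Q x‖ ^ 2 := hQm.norm.pow_const 2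
    rw [(gam_int hn hq2).1]
    have : ∀ᵐ p ∂((sg n).prod (nu n)), ‖Q (p.2 • p.1)‖ ^ 2 = ‖fZ w p.1‖ ^ 2 := by
      filter_upwards [Measure.quasiMeasurePreserving_fst.ae (sg_norm n),
        Measure.quasiMeasurePreserving_snd.ae (nu_pos n)] with p h1 h2
      rw [hQh _ h2, hQ1 _ h1]
    rw [integral_congr_ae this, integral_fun_fst (fun x => ‖fZ w x‖ ^ 2), probReal_univ, one_smul]
  have ip2 : Integrable (fun p => fpp W p ^ 2) μ := by
    refine gg_int (C := 9 * M ^ 2) ((fpp_meas hWm).pow_const 2) fun p => ?_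
    rw [abs_pow]
    refine (pow_le_pow_left₀ (abs_nonneg _) (fpp_bd hWb p) 2).trans (le_of_eq (by ring))
  have am : n * I ≤ (1 / (2 * n)) * ∫ p, fpp W p ^ 2 ∂μ + (n / 2) * I := by
    rw [← ip]
    conv_rhs => rw [← eQ]
    rw [← integral_const_mul, ← integral_const_mul, ← integral_add (ip2.const_mul _) (iQ.const_mul _)]
    refine integral_mono (hqb _ (3 * M) (fpp_meas hWm) fun p => (fpp_bd hWb p).trans_eq (by ring)) ((ip2.const_mul _).add (iQ.const_mul _)) fun p => ?_
    have := sq_nonneg (fpp W p - n * inner ℝ (Q p.1) p.2)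
    simp only [Pi.add_apply]
    rw [← sub_nonneg]
    have e : 1 / (2 * (n : ℝ)) * fpp W p ^ 2 + n / 2 * inner ℝ (Q p.1) p.2 ^ 2 - fpp W p * inner ℝ (Q p.1) p.2
      = (fpp W p - n * inner ℝ (Q p.1) p.2) ^ 2 / (2 * n) := by field_simp; ring
    rw [e]; positivity
  -- E W, E W²
  have hEW : ∫ x, W x ∂gam n = 0 := by
    rw [(gam_int hn hWm).1]
    have : ∀ᵐ p ∂((sg n).prod (nu n)), W (p.2 • p.1) = w p.1 * p.2 := by
      filter_upwards [Measure.quasiMeasurePreserving_fst.ae (sg_norm n),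
        Measure.quasiMeasurePreserving_snd.ae (nu_pos n)] with p h1 h2
      rw [hWdef, fW_polar w h2 h1, mul_comm]
    rw [integral_congr_ae this, integral_prod_mul (fun θ => w θ) (fun r : ℝ => r), h0, zero_mul]
  have hEW2 : ∫ x, W x ^ 2 ∂gam n = n * ∫ θ, w θ ^ 2 ∂sg n := by
    rw [(gam_int hn (hWm.pow_const 2)).1]
    have : ∀ᵐ p ∂((sg n).prod (nu n)), W (p.2 • p.1) ^ 2 = w p.1 ^ 2 * p.2 ^ 2 := by
      filter_upwards [Measure.quasiMeasurePreserving_fst.ae (sg_norm n),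
        Measure.quasiMeasurePreserving_snd.ae (nu_pos n)] with p h1 h2
      rw [hWdef, fW_polar w h2 h1]; ring
    rw [integral_congr_ae this, integral_prod_mul (fun θ => w θ ^ 2) (fun r : ℝ => r ^ 2), nu_sq hn, mul_comm]
  have iW2 : Integrable (fun x => W x ^ 2) (gam n) := by
    refine Integrable.mono' ((gam_mom n 2).const_mul (M ^ 2)) (hWm.pow_const 2).aestronglyMeasurable (Filter.Eventually.of_forall fun y => ?_)
    rw [norm_pow, ← mul_pow]
    exact pow_le_pow_left₀ (norm_nonneg _) (hWb y) 2
  have iW1 : Integrable W (gam n) :=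
    Integrable.mono' ((gam_mom n 1).const_mul M) hWm.aestronglyMeasurable (Filter.Eventually.of_forall fun y => by simpa using hWb y)
  have hfp := fpp_sq hWm hWb
  have ed : ∫ p : EE n × EE n, (W p.1 - W p.2) ^ 2 ∂μ = 2 * (n * ∫ θ, w θ ^ 2 ∂sg n) := by
    have e : ∀ p : EE n × EE n, (W p.1 - W p.2) ^ 2 = (W p.1 ^ 2 + W p.2 ^ 2) - 2 * (W p.1 * W p.2) := fun p => by ring
    simp_rw [e]
    have j1 : Integrable (fun p : EE n × EE n => W p.1 ^ 2) μ := iW2.comp_fst _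
    have j2 : Integrable (fun p : EE n × EE n => W p.2 ^ 2) μ := iW2.comp_snd _
    rw [integral_sub (j1.fun_add j2) ((iW1.mul_prod iW1).const_mul 2), integral_add j1 j2, integral_const_mul,
      integral_prod_mul, hEW, integral_fun_fst (fun x => W x ^ 2), integral_fun_snd (fun x => W x ^ 2), probReal_univ, hEW2, one_smul]
    ring
  rw [ed] at hfp
  set X := ∫ θ, w θ ^ 2 ∂sg n
  have h5 : (1 / (2 * n)) * ∫ p, fpp W p ^ 2 ∂μ ≤ (1 / (2 * n)) * (1 / 4 * (2 * (n * X))) := by gcongr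
  have h6 : (1 / (2 * (n : ℝ))) * (1 / 4 * (2 * (n * X))) = X / 4 := by field_simp; try ring
  rw [h6] at h5
  have h7 : n * I ≤ X / 2 := by linarith
  calc I = (n * I) / n := by field_simp
    _ ≤ (X / 2) / n := by gcongr
    _ = _ := by field_simp

lemma gam_le {n : ℕ} {f : EE n → ℝ} (h0 : ∀ x, 0 ≤ f x) (hi : Integrable f) :
    ∫ x, f x ∂gam n ≤ rho n 0 * ∫ x, f x := by
  rw [gam_dens, integral_withDensity_eq_integral_toReal_smul (by fun_prop) (by simp), ← integral_const_mul]
  refine integral_mono_of_nonneg (Filter.Eventually.of_forall fun x => ?_) (hi.const_mul _) (Filter.Eventually.of_forall fun x => ?_)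
  · exact mul_nonneg ENNReal.toReal_nonneg (h0 x)
  · simp only [smul_eq_mul]
    rw [ENNReal.toReal_ofReal (rho_pos n _).le]
    refine mul_le_mul_of_nonneg_right ?_ (h0 x)
    unfold rho
    gcongr
    positivity

lemma cut_int {n : ℕ} (hn : 1 ≤ n) {w : EE n → ℝ} (hw : Measurable w) {M : ℝ} (hM : ∀ x, |w x| ≤ M) {K : ℝ} (hK : 0 < K) :
    Integrable ((closedBall (0 : EE n) K).indicator fun z => |w (‖z‖⁻¹ • z)|) ∧
    ∫ z, (closedBall (0 : EE n) K).indicator (fun z => |w (‖z‖⁻¹ • z)|) z = om n * K ^ n * ∫ θ, |w θ| ∂sg n := by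
  have hm : Measurable ((closedBall (0 : EE n) K).indicator fun z => |w (‖z‖⁻¹ • z)|) :=
    Measurable.indicator ((hw.comp (by fun_prop)).abs) measurableSet_closedBall
  have hi : Integrable ((closedBall (0 : EE n) K).indicator fun z => |w (‖z‖⁻¹ • z)|) := by
    rw [integrable_indicator_iff measurableSet_closedBall]
    exact Measure.integrableOn_of_bounded (M := M) measure_closedBall_lt_top.ne
      ((hw.comp (by fun_prop)).abs).aestronglyMeasurable (Filter.Eventually.of_forall fun x => by simpa using hM _)
  refine ⟨hi, ?_⟩
  rw [(polar_int hn hi).1, mul_comm (n : ℝ), mul_assoc, mul_assoc]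
  congr 1
  rw [← integral_const_mul, ← integral_const_mul]
  refine integral_congr_ae ?_
  filter_upwards [sg_norm n] with θ hθ
  have e : ∀ r ∈ Ioi (0 : ℝ), r ^ (n - 1) * (closedBall (0 : EE n) K).indicator (fun z => |w (‖z‖⁻¹ • z)|) (r • θ) =
      (Ioc 0 K).indicator (fun r => r ^ (n - 1) * |w θ|) r := by
    intro r hr
    have hr : 0 < r := hr
    have hnr : ‖r • θ‖ = r := by rw [norm_smul, hθ, mul_one, Real.norm_of_nonneg hr.le]
    by_cases h : r ≤ K
    · rw [indicator_of_mem (by simpa [hnr] using h), indicator_of_mem (show r ∈ Ioc 0 K from ⟨hr, h⟩), hnr, smul_smul, inv_mul_cancel₀ hr.ne', one_smul]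
    · rw [indicator_of_notMem (by simpa [hnr] using h), indicator_of_notMem (fun h' => h h'.2), mul_zero]
  rw [setIntegral_congr_fun measurableSet_Ioi e, setIntegral_indicator measurableSet_Ioc,
    inter_eq_right.2 (fun x hx => hx.1), integral_mul_const, ← intervalIntegral.integral_of_le hK.le, integral_pow,
    Nat.sub_add_cancel hn]
  have : (n : ℝ) ≠ 0 := by positivity
  have e2 : ((n - 1 : ℕ) : ℝ) + 1 = n := by rw [Nat.cast_sub hn]; simp
  rw [e2, zero_pow (by omega)]
  field_simp; ring

set_option maxHeartbeats 1000000 in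
lemma fZ_sup {n : ℕ} (hn : 1 ≤ n) {M ε : ℝ} (hMp : 0 < M) (hε : 0 < ε) : ∃ η > 0, ∀ w : EE n → ℝ, Measurable w →
    (∀ x, |w x| ≤ M) → ∫ θ, |w θ| ∂sg n ≤ η → ∀ θ : EE n, ‖θ‖ = 1 → ‖fZ w θ‖ ≤ ε := by
  classical
  have := sg_prob hn
  have := nu_prob hn
  set μ := (nu n).prod (lam.prod (gam n)) with hμ
  set m2 := ∫ q : ℝ × EE n, (|q.1| + ‖q.2‖) ^ 2 ∂((nu n).prod (gam n)) with hm2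
  set m3 := ∫ q : ℝ × ℝ × EE n, (|q.1| + ‖q.2.2‖) ^ 3 ∂μ with hm3
  have m2n : 0 ≤ m2 := integral_nonneg fun q => by positivity
  have m3n : 0 ≤ m3 := integral_nonneg fun q => by positivity
  obtain ⟨φ0, hφ0, hφ1, hφ2⟩ : ∃ φ0 : ℝ, 0 < φ0 ∧ φ0 < Real.pi / 2 ∧ M * (φ0 * m2) ≤ ε / 3 := by
    refine ⟨min (Real.pi / 4) (ε / (3 * M * (m2 + 1))), by positivity, (min_le_left _ _).trans_lt (by linarith [Real.pi_pos]), ?_⟩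
    calc _ ≤ M * (ε / (3 * M * (m2 + 1)) * (m2 + 1)) := by gcongr; · exact min_le_right _ _
                                                           · linarith
      _ = _ := by field_simp
  obtain ⟨K, hK, hK2⟩ : ∃ K : ℝ, 0 < K ∧ M / K * m3 ≤ ε / 3 := by
    refine ⟨3 * M * (m3 + 1) / ε, by positivity, ?_⟩
    calc _ ≤ M / (3 * M * (m3 + 1) / ε) * (m3 + 1) := by gcongr; linarith
      _ = _ := by field_simp
  have hs0 : 0 < Real.sin φ0 := Real.sin_pos_of_pos_of_lt_pi hφ0 (by linarith [Real.pi_pos])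
  set L := rho n 0 * ((Real.sin φ0 ^ n)⁻¹ * (om n * (2 * K) ^ n)) with hL
  have hL0 : 0 < L := by have := rho_pos n 0; have := om_pos n; positivity
  set B := 2 * K ^ 2 * (Real.pi / 2 * L)
  have hB : 0 < B := by have := Real.pi_pos; positivity
  refine ⟨ε / (3 * B), by positivity, fun w hw hM hη θ hθ => ?_⟩
  set h : EE n → ℝ := (closedBall (0 : EE n) (2 * K)).indicator fun z => |w (‖z‖⁻¹ • z)| with hh
  obtain ⟨hhi, hhe⟩ := cut_int hn hw hM (by positivity : 0 < 2 * K)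
  have hhm : Measurable h := Measurable.indicator ((hw.comp (by fun_prop)).abs) measurableSet_closedBall
  have hh0 : ∀ z, 0 ≤ h z := fun z => indicator_nonneg (fun _ _ => abs_nonneg _) z
  have hhb : ∀ z, h z ≤ M := fun z => by
    rw [hh, indicator_apply]; split_ifs
    · exact hM _
    · exact hMp.le
  set f1 : ℝ × ℝ × EE n → ℝ := fun q => M * ((Iic φ0).indicator 1 q.2.1 * (|q.1| + ‖q.2.2‖) ^ 2)
  set f2 : ℝ × ℝ × EE n → ℝ := fun q => M / K * (|q.1| + ‖q.2.2‖) ^ 3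
  set f3 : ℝ × ℝ × EE n → ℝ := fun q => 2 * K ^ 2 * ((Ioi φ0).indicator 1 q.2.1 * h (Real.cos q.2.1 • q.1 • θ + Real.sin q.2.1 • q.2.2))
  have i1 : Integrable f1 μ := by
    refine Integrable.mono' ((ngl_mom hn 2).const_mul M) ?_ (Filter.Eventually.of_forall fun q => ?_)
    · exact Measurable.aestronglyMeasurable ((((measurable_one.indicator measurableSet_Iic).comp (by fun_prop)).mul (by fun_prop)).const_mul _)
    · simp only [f1, norm_mul, Real.norm_of_nonneg hMp.le]
      gcongr
      rw [indicator_apply]; split_ifs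
      · simp [abs_of_nonneg (by positivity : 0 ≤ |q.1| + ‖q.2.2‖)]
      · simp; positivity
  have i2 : Integrable f2 μ := (ngl_mom hn 3).const_mul _
  have i3 : Integrable f3 μ := by
    refine Integrable.of_bound (Measurable.aestronglyMeasurable ((((measurable_one.indicator measurableSet_Ioi).comp (by fun_prop)).mul (hhm.comp (by fun_prop))).const_mul _)) (2 * K ^ 2 * M) (Filter.Eventually.of_forall fun q => ?_)
    simp only [f3, norm_mul, Real.norm_of_nonneg (by positivity : 0 ≤ K ^ 2), norm_pow, Real.norm_of_nonneg hK.le, Real.norm_ofNat, Real.norm_of_nonneg (hh0 _)]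
    gcongr
    rw [indicator_apply]; split_ifs
    · simpa using hhb _
    · simpa using hMp.le
  have pt : ∀ q : ℝ × ℝ × EE n, ‖fW w (Real.cos q.2.1 • q.1 • θ + Real.sin q.2.1 • q.2.2) • q.2.2‖ ≤ f1 q + f2 q + f3 q := by
    intro q
    set z := Real.cos q.2.1 • q.1 • θ + Real.sin q.2.1 • q.2.2 with hz
    have hzn : ‖z‖ ≤ |q.1| + ‖q.2.2‖ := by
      refine (nrm_rot _ _ _).trans ?_
      rw [norm_smul, hθ, mul_one, Real.norm_eq_abs]
    have f1n : 0 ≤ f1 q := by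
      have : 0 ≤ (Iic φ0).indicator (1 : ℝ → ℝ) q.2.1 := indicator_nonneg (fun _ _ => zero_le_one) _
      positivity
    have f2n : 0 ≤ f2 q := by positivity
    have f3n : 0 ≤ f3 q := by
      have : 0 ≤ (Ioi φ0).indicator (1 : ℝ → ℝ) q.2.1 := indicator_nonneg (fun _ _ => zero_le_one) _
      have := hh0 z
      positivity
    have gen : ‖fW w z • q.2.2‖ ≤ M * (|q.1| + ‖q.2.2‖) ^ 2 := by
      rw [norm_smul]
      calc _ ≤ (M * (|q.1| + ‖q.2.2‖)) * (|q.1| + ‖q.2.2‖) := by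
            gcongr
            · exact (fW_bd hM _).trans (by gcongr)
            · simp
        _ = _ := by ring
    by_cases hc : q.2.1 ≤ φ0
    · have : f1 q = M * (|q.1| + ‖q.2.2‖) ^ 2 := by simp [f1, indicator_of_mem (show q.2.1 ∈ Iic φ0 from hc)]
      linarith
    by_cases hk : K ≤ |q.1| + ‖q.2.2‖
    · have : M * (|q.1| + ‖q.2.2‖) ^ 2 ≤ f2 q := by
        simp only [f2]
        rw [div_mul_eq_mul_div, le_div_iff₀ hK, mul_assoc]
        gcongr
        calc _ ≤ (|q.1| + ‖q.2.2‖) ^ 2 * (|q.1| + ‖q.2.2‖) := by gcongr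
          _ = _ := by ring
      linarith
    · have : ‖fW w z • q.2.2‖ ≤ f3 q := by
        simp only [f3]
        rw [indicator_of_mem (show q.2.1 ∈ Ioi φ0 from not_le.1 hc), ← hz, hh,
          indicator_of_mem (by simp only [mem_closedBall, dist_zero_right]; linarith), norm_smul, fW, norm_mul, norm_norm, Real.norm_eq_abs]
        simp only [Pi.one_apply, one_mul]
        have : ‖z‖ ≤ 2 * K := by linarith
        have h3 : ‖q.2.2‖ ≤ K := by linarith [abs_nonneg q.1]
        calc _ ≤ (2 * K) * |w (‖z‖⁻¹ • z)| * K := by gcongr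
          _ = _ := by ring
      linarith
  have e1 : ∫ q, f1 q ∂μ ≤ ε / 3 := by
    refine le_trans ?_ hφ2
    simp only [f1]
    rw [integral_const_mul]
    gcongr
    have mp : MeasurePreserving (fun q : ℝ × ℝ × EE n => (q.2.1, q.1, q.2.2)) μ (lam.prod ((nu n).prod (gam n))) := by
      have a1 := (measurePreserving_prodAssoc lam (nu n) (gam n)).comp ((Measure.measurePreserving_swap (μ := nu n) (ν := lam)).prod (MeasurePreserving.id (gam n)))
      exact a1.comp ((measurePreserving_prodAssoc (nu n) lam (gam n)).symm MeasurableEquiv.prodAssoc)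
    have e := integral_map (μ := μ) mp.measurable.aemeasurable (f := fun q : ℝ × ℝ × EE n => (Iic φ0).indicator (1 : ℝ → ℝ) q.1 * (|q.2.1| + ‖q.2.2‖) ^ 2)
      (Measurable.aestronglyMeasurable (((measurable_one.indicator measurableSet_Iic).comp measurable_fst).mul (by fun_prop)))
    rw [mp.map_eq, integral_prod_mul (fun φ : ℝ => (Iic φ0).indicator (1 : ℝ → ℝ) φ) (fun q : ℝ × EE n => (|q.1| + ‖q.2‖) ^ 2),
      integral_indicator_one measurableSet_Iic] at e
    refine e.symm.le.trans (mul_le_mul_of_nonneg_right ?_ m2n)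
    rw [lam, measureReal_restrict_apply measurableSet_Iic]
    calc _ ≤ volume.real (Ioc 0 φ0) := measureReal_mono (fun x hx => ⟨hx.2.1, hx.1⟩) (by simp)
      _ = φ0 := by simp [hφ0.le]
  have e2 : ∫ q, f2 q ∂μ ≤ ε / 3 := by
    simp only [f2]; rw [integral_const_mul]; exact hK2
  have e3 : ∫ q, f3 q ∂μ ≤ ε / 3 := by
    have inner : ∀ r φ : ℝ, φ ≤ Real.pi / 2 → ∫ y, f3 (r, φ, y) ∂gam n ≤ 2 * K ^ 2 * (L * ∫ θ, |w θ| ∂sg n) := by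
      intro r φ hφ
      simp only [f3]
      rw [integral_const_mul, integral_const_mul]
      refine mul_le_mul_of_nonneg_left ?_ (by positivity)
      have hw0 : 0 ≤ ∫ θ, |w θ| ∂sg n := integral_nonneg fun _ => abs_nonneg _
      rw [indicator_apply]; split_ifs with hc
      · have hc : φ0 < φ := hc
        have hsin : Real.sin φ0 ≤ Real.sin φ := Real.sin_le_sin_of_le_of_le_pi_div_two (by linarith) hφ hc.le
        have hsp : 0 < Real.sin φ := hs0.trans_le hsin
        simp only [Pi.one_apply, one_mul]
        refine (gam_le (fun y => hh0 _) ?_).trans ?_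
        · exact Integrable.comp_smul (hhi.comp_add_left _) hsp.ne'
        · rw [Measure.integral_comp_smul_of_nonneg volume (fun y => h (Real.cos φ • r • θ + y)) _ (hR := hsp.le),
            integral_add_left_eq_self h, finrank_euclideanSpace_fin, smul_eq_mul, hhe, hL]
          have := rho_pos n 0
          have := om_pos n
          rw [mul_assoc (rho n 0), mul_assoc _ (om n * (2 * K) ^ n)]
          gcongr
      · simp only [zero_mul]; positivity
    rw [integral_prod _ i3]
    have hlb : ∀ᵐ φ ∂lam, φ ≤ Real.pi / 2 := by
      unfold lam; filter_upwards [ae_restrict_mem measurableSet_Ioc] with φ hφ using hφ.2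
    have st : ∀ᵐ r ∂nu n, ∫ q : ℝ × EE n, f3 (r, q) ∂(lam.prod (gam n)) ≤ ε / 3 := by
      filter_upwards [i3.prod_right_ae] with r hr
      rw [integral_prod _ hr]
      calc _ ≤ ∫ φ, 2 * K ^ 2 * (L * ∫ θ, |w θ| ∂sg n) ∂lam :=
            integral_mono_ae hr.integral_prod_left (integrable_const _) (by filter_upwards [hlb] with φ hφ using inner r φ hφ)
        _ = B * ∫ θ, |w θ| ∂sg n := by rw [integral_const, lam_univ, smul_eq_mul]; ring
        _ ≤ B * (ε / (3 * B)) := by gcongr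
        _ = _ := by field_simp
    calc _ ≤ ∫ r, ε / 3 ∂nu n := integral_mono_ae i3.integral_prod_left (integrable_const _) st
      _ = _ := by simp
  have hnn : (1 : ℝ) ≤ n := by exact_mod_cast hn
  rw [fZ, norm_smul, Real.norm_of_nonneg (by positivity)]
  calc _ ≤ 1 * ∫ q, f1 q + f2 q + f3 q ∂μ := by
        gcongr
        · rw [div_le_one (by positivity)]; exact hnn
        · exact norm_integral_le_of_norm_le ((i1.fun_add i2).fun_add i3) (Filter.Eventually.of_forall pt)
    _ ≤ ε := by
        rw [one_mul, integral_add (i1.fun_add i2) i3, integral_add i1 i2]; linarith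

noncomputable def fy {n : ℕ} (w : EE n → ℝ) (θ : EE n) : ℝ := inner ℝ θ (fZ w θ)
noncomputable def ft {n : ℕ} (w : EE n → ℝ) (θ : EE n) : EE n := fZ w θ - fy w θ • θ

lemma rad_grad {n : ℕ} {f : EE n → ℝ} (hf : ContDiff ℝ 1 f) (t : ℝ) {x : EE n} (hx : x ≠ 0) :
    HasGradientAt (fun x : EE n => ‖x‖ * f (t • ‖x‖⁻¹ • x)) (f (t • ‖x‖⁻¹ • x) • ‖x‖⁻¹ • x +
      t • (gradient f (t • ‖x‖⁻¹ • x) - inner ℝ (‖x‖⁻¹ • x) (gradient f (t • ‖x‖⁻¹ • x)) • ‖x‖⁻¹ • x)) x := by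
  have hgi : ∀ x v, inner ℝ (gradient f x) v = fderiv ℝ f x v := fun x v => by
    rw [gradient, InnerProductSpace.toDual_symm_apply]
  have hxn : 0 < ‖x‖ := norm_pos_iff.2 hx
  have e1 : HasFDerivAt (fun x : EE n => ‖x‖) (‖x‖⁻¹ • innerSL ℝ x) x := by
    have h1 := ((hasStrictFDerivAt_norm_sq x).hasFDerivAt).sqrt (by positivity)
    simp only [Real.sqrt_sq (norm_nonneg _)] at h1
    refine h1.congr_fderiv ?_
    rw [← Nat.cast_smul_eq_nsmul ℝ, smul_smul]
    congr 1; push_cast; field_simp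
  have e2 : HasFDerivAt (fun x : EE n => ‖x‖⁻¹) (-(‖x‖ ^ 2)⁻¹ • ‖x‖⁻¹ • innerSL ℝ x) x :=
    (hasDerivAt_inv hxn.ne').comp_hasFDerivAt x e1
  have e3 : HasFDerivAt (fun x : EE n => t • ‖x‖⁻¹ • x) _ x := (e2.smul (hasFDerivAt_id x)).const_smul t
  have e4 : HasFDerivAt (fun x : EE n => f (t • ‖x‖⁻¹ • x)) _ x :=
    HasFDerivAt.comp x (hf.differentiable one_ne_zero (t • ‖x‖⁻¹ • x)).hasFDerivAt e3
  have e5 := e1.mul e4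
  rw [hasGradientAt_iff_hasFDerivAt]
  refine e5.congr_fderiv ?_
  ext v
  rw [InnerProductSpace.toDual_apply_apply, inner_add_left, inner_smul_left, inner_smul_left, inner_smul_left,
    inner_sub_left, inner_smul_left, hgi, real_inner_comm _ (‖x‖⁻¹ • x), hgi]
  simp [inner_smul_left]
  field_simp
  ring

set_option maxHeartbeats 400000 in
lemma field_t {n : ℕ} (hn : 2 ≤ n) {w : EE n → ℝ} (hw : Measurable w) {M : ℝ} (hM : ∀ x, |w x| ≤ M)
    (h0 : ∫ θ, w θ ∂sg n = 0) {f : EE n → ℝ} (hf : ContDiff ℝ 1 f) {A : ℝ} (hA : ∀ x, |f x| ≤ A)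
    (hA' : ∀ x, ‖fderiv ℝ f x‖ ≤ A) (t : ℝ) (ht : 0 ≤ t) :
    ∫ θ, (f (t • θ) * fy w θ + t * fderiv ℝ f (t • θ) (ft w θ)) ∂sg n = ∫ θ, w θ * f (t • θ) ∂sg n := by
  have hA0 : 0 ≤ A := (abs_nonneg _).trans (hA 0)
  set N : EE n → EE n := fun x => ‖x‖⁻¹ • x with hN
  have hNm : Measurable N := by fun_prop
  have hNn : ∀ x, ‖N x‖ ≤ 1 := fun x => by rw [hN, norm_smul, norm_inv, norm_norm]; exact inv_mul_le_one
  have hNh : ∀ r : ℝ, 0 < r → ∀ x, N (r • x) = N x := fun r hr x => by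
    simp only [hN]
    rw [norm_smul, Real.norm_of_nonneg hr.le, smul_smul, mul_inv, mul_comm r⁻¹, mul_assoc, inv_mul_cancel₀ hr.ne', mul_one]
  set g : EE n → EE n := gradient f with hg
  have hgn : ∀ x, ‖g x‖ ≤ A := fun x => by rw [hg, gradient, LinearIsometryEquiv.norm_map]; exact hA' x
  have hgi : ∀ x v, inner ℝ (g x) v = fderiv ℝ f x v := fun x v => by
    rw [hg, gradient, InnerProductSpace.toDual_symm_apply]
  have hgc : Continuous g := by
    exact (LinearIsometryEquiv.continuous _).comp (hf.continuous_fderiv one_ne_zero)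
  set D : EE n → EE n := fun x => f (t • N x) • N x + t • (g (t • N x) - inner ℝ (N x) (g (t • N x)) • N x) with hD
  have hfm := hf.continuous.measurable
  have hgm := hgc.measurable
  have mf : Measurable fun x => f (t • N x) := hfm.comp (hNm.const_smul t)
  have mg : Measurable fun x => g (t • N x) := hgm.comp (hNm.const_smul t)
  have m3 : Measurable fun x => (inner ℝ (N x) (g (t • N x)) : ℝ) := hNm.inner mg
  have hDm : Measurable D := by
    have a1 : Measurable fun x => f (t • N x) • N x := mf.smul hNm
    have a2 : Measurable fun x => (inner ℝ (N x) (g (t • N x)) : ℝ) • N x := m3.smul hNm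
    have a3 : Measurable fun x => t • (g (t • N x) - (inner ℝ (N x) (g (t • N x)) : ℝ) • N x) := (mg.sub a2).const_smul t
    exact a1.add a3
  have key := field_id hn hw hM h0 (F := fun x => ‖x‖ * f (t • N x)) (D := D) (C := A + t * (A + A))
    (measurable_norm.mul mf)
    (fun x => by
      rw [abs_mul, abs_norm, mul_comm]
      gcongr
      exact (hA _).trans (by nlinarith))
    (fun r hr x => by
      rw [hNh r hr, norm_smul, Real.norm_of_nonneg hr.le, mul_assoc])
    hDm
    (fun x => by
      refine (norm_add_le _ _).trans (add_le_add ?_ ?_)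
      · rw [norm_smul]; exact (mul_le_of_le_one_right (norm_nonneg _) (hNn x)).trans (hA _)
      · rw [norm_smul, Real.norm_of_nonneg ht]
        gcongr
        refine (norm_sub_le _ _).trans (add_le_add (hgn _) ?_)
        rw [norm_smul]
        refine (mul_le_of_le_one_right (norm_nonneg _) (hNn x)).trans ((norm_inner_le_norm _ _).trans ?_)
        exact (mul_le_of_le_one_left (norm_nonneg _) (hNn x)).trans (hgn _))
    (fun r hr x => by simp only [hD, hNh r hr])
    (fun x hx => rad_grad hf t hx)
  have e : ∀ θ : EE n, ‖θ‖ = 1 → N θ = θ := fun θ hθ => by simp [hN, hθ]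
  have k2 : ∫ θ, w θ * (‖θ‖ * f (t • N θ)) ∂sg n = ∫ θ, w θ * f (t • θ) ∂sg n := by
    refine integral_congr_ae ?_
    filter_upwards [sg_norm n] with θ hθ
    rw [e θ hθ, hθ, one_mul]
  rw [← k2, ← key]
  refine integral_congr_ae ?_
  filter_upwards [sg_norm n] with θ hθ
  simp only [hD]
  rw [e θ hθ, ft, map_sub, map_smul, ← hgi, ← hgi, inner_add_left, inner_smul_left, inner_smul_left, inner_sub_left,
    inner_smul_left, fy, real_inner_comm θ (g _), smul_eq_mul]
  simp only [conj_trivial]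
  ring

noncomputable def pn (n : ℕ) : ℝ := n / (n - 1)

lemma ray_aux {n : ℕ} (hn : 2 ≤ n) {R : ℝ} (hR : 0 < R) {g g' : ℝ → ℝ} (hg : ∀ r, HasDerivAt g (g' r) r)
    (hc : Continuous g') (h0 : ∀ r, 0 ≤ g r) (hRz : g R = 0) :
    n * ∫ r in (0 : ℝ)..R, g r ^ pn n * r ^ (n - 1) ≤ (∫ r in (0 : ℝ)..R, max (-g' r) 0 * r ^ (n - 1)) ^ pn n := by
  have hn1 : (0 : ℝ) < n - 1 := by have : (2 : ℝ) ≤ n := by exact_mod_cast hn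
                                   linarith
  have hp : 1 ≤ pn n := by rw [pn, le_div_iff₀ hn1]; linarith
  have hgc : Continuous g := continuous_iff_continuousAt.2 fun r => (hg r).continuousAt
  set q : ℝ → ℝ := fun r => max (-g' r) 0
  have hq : Continuous q := by fun_prop
  have hq0 : ∀ r, 0 ≤ q r := fun r => le_max_right _ _
  set G : ℝ → ℝ := fun r => ∫ ρ in r..R, q ρ
  have hG : ∀ r, HasDerivAt G (-q r) r := fun r =>
    intervalIntegral.integral_hasDerivAt_left (hq.intervalIntegrable _ _) hq.stronglyMeasurable.stronglyMeasurableAtFilter hq.continuousAt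
  set H : ℝ → ℝ := fun r => ∫ ρ in (0 : ℝ)..r, q ρ * ρ ^ (n - 1)
  have hqr : Continuous fun ρ : ℝ => q ρ * ρ ^ (n - 1) := by fun_prop
  have hH : ∀ r, HasDerivAt H (q r * r ^ (n - 1)) r := fun r =>
    intervalIntegral.integral_hasDerivAt_right (hqr.intervalIntegrable _ _) hqr.stronglyMeasurable.stronglyMeasurableAtFilter hqr.continuousAt
  have hGc : Continuous G := continuous_iff_continuousAt.2 fun r => (hG r).continuousAt
  have hHc : Continuous H := continuous_iff_continuousAt.2 fun r => (hH r).continuousAt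
  set K : ℝ → ℝ := fun r => H r + r ^ (n - 1) * G r
  have hK : ∀ r, HasDerivAt K ((n - 1 : ℕ) * r ^ (n - 1 - 1) * G r) r := fun r => by
    have := (hH r).add ((hasDerivAt_pow (n - 1) r).mul (hG r))
    refine this.congr_deriv ?_
    ring
  have hKc : Continuous K := by fun_prop
  have hKp : ∀ r, HasDerivAt (fun r => K r ^ pn n) ((n - 1 : ℕ) * r ^ (n - 1 - 1) * G r * pn n * K r ^ (pn n - 1)) r :=
    fun r => (hK r).rpow_const (Or.inr hp)
  have hcont : Continuous fun r => ((n - 1 : ℕ) * r ^ (n - 1 - 1) * G r * pn n * K r ^ (pn n - 1) : ℝ) := by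
    refine Continuous.mul (by fun_prop) (hKc.rpow_const fun r => Or.inr (by linarith))
  have ftc := intervalIntegral.integral_eq_sub_of_hasDerivAt (a := 0) (b := R) (fun r _ => hKp r) (hcont.intervalIntegrable _ _)
  have hK0 : K 0 = 0 := by
    simp [K, H, zero_pow (by omega : n - 1 ≠ 0)]
  have hKR : K R = ∫ r in (0 : ℝ)..R, q r * r ^ (n - 1) := by simp [K, H, G]
  rw [hK0, Real.zero_rpow (by linarith), sub_zero, hKR] at ftc
  rw [← ftc, ← intervalIntegral.integral_const_mul]
  have hgp : Continuous fun r => (n * (g r ^ pn n * r ^ (n - 1)) : ℝ) := by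
    have : Continuous fun r => g r ^ pn n := hgc.rpow_const fun r => Or.inr (by linarith)
    fun_prop
  refine intervalIntegral.integral_mono_on hR.le (hgp.intervalIntegrable _ _) (hcont.intervalIntegrable _ _) fun r hr => ?_
  have hgG : g r ≤ G r := by
    have := intervalIntegral.integral_eq_sub_of_hasDerivAt (a := r) (b := R) (fun r _ => hg r) (hc.intervalIntegrable _ _)
    rw [hRz, zero_sub] at this
    have h2 : g r = ∫ ρ in r..R, -g' ρ := by rw [intervalIntegral.integral_neg, this, neg_neg]
    rw [h2]
    exact intervalIntegral.integral_mono_on hr.2 (hc.neg.intervalIntegrable _ _) (hq.intervalIntegrable _ _) fun x _ => le_max_left _ _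
  have hGn : 0 ≤ G r := (h0 r).trans hgG
  have hHn : 0 ≤ H r := intervalIntegral.integral_nonneg hr.1 fun ρ hρ => mul_nonneg (hq0 _) (pow_nonneg hρ.1 _)
  have hKG : r ^ (n - 1) * G r ≤ K r := by simp only [K]; linarith
  have hr0 := hr.1
  have e1 : ((n - 1 : ℕ) : ℝ) = n - 1 := by rw [Nat.cast_sub (by omega)]; simp
  have e2 : (n : ℝ) = (n - 1) * pn n := by rw [pn]; field_simp
  have e3 : (r ^ (n - 1) * G r) ^ (pn n - 1) = r * G r ^ (pn n - 1) := by
    rw [Real.mul_rpow (by positivity) hGn, ← Real.rpow_natCast, ← Real.rpow_mul hr0, e1]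
    have : (n - 1 : ℝ) * (pn n - 1) = 1 := by rw [pn]; field_simp; ring
    rw [this, Real.rpow_one]
  have e4 : G r ^ pn n = G r * G r ^ (pn n - 1) := by
    rw [← Real.rpow_one_add' hGn (by linarith)]; congr 1; ring
  have e5 : r ^ (n - 1) = r ^ (n - 1 - 1) * r := by rw [← pow_succ]; congr 1; omega
  calc _ ≤ n * (G r ^ pn n * r ^ (n - 1)) := by
        have := h0 r
        gcongr
    _ = (n - 1 : ℕ) * r ^ (n - 1 - 1) * G r * pn n * (r ^ (n - 1) * G r) ^ (pn n - 1) := by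
        rw [e3, e4, e5, e1]
        conv_lhs => rw [e2]
        ring
    _ ≤ _ := by
        have : 0 ≤ pn n := by linarith
        have : 0 ≤ r ^ (n - 1) * G r := by positivity
        gcongr

lemma ray_ineq {n : ℕ} (hn : 2 ≤ n) {R : ℝ} (hR : 0 < R) {g g' : ℝ → ℝ} (hg : ∀ r, HasDerivAt g (g' r) r)
    (hc : Continuous g') (h0 : ∀ r, 0 ≤ g r) (hRz : g R = 0) {u s : ℝ} (hs : |s| ≤ u) :
    (u + s) * (n * ∫ r in (0 : ℝ)..R, g r ^ pn n * r ^ (n - 1)) ^ (pn n)⁻¹ ≤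
      u * (∫ r in (0 : ℝ)..R, |g' r| * r ^ (n - 1)) + s * ((n - 1) * ∫ r in (0 : ℝ)..R, g r * r ^ (n - 2)) := by
  have hn1 : (0 : ℝ) < n - 1 := by have : (2 : ℝ) ≤ n := by exact_mod_cast hn
                                   linarith
  have hp : 0 < pn n := by rw [pn]; positivity
  have hgc : Continuous g := continuous_iff_continuousAt.2 fun r => (hg r).continuousAt
  have aux := ray_aux hn hR hg hc h0 hRz
  set N := ∫ r in (0 : ℝ)..R, max (-g' r) 0 * r ^ (n - 1) with hN
  set P := ∫ r in (0 : ℝ)..R, max (g' r) 0 * r ^ (n - 1) with hP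
  have hN0 : 0 ≤ N := intervalIntegral.integral_nonneg hR.le fun ρ hρ => mul_nonneg (le_max_right _ _) (pow_nonneg hρ.1 _)
  have hP0 : 0 ≤ P := intervalIntegral.integral_nonneg hR.le fun ρ hρ => mul_nonneg (le_max_right _ _) (pow_nonneg hρ.1 _)
  have hgp : 0 ≤ ∫ r in (0 : ℝ)..R, g r ^ pn n * r ^ (n - 1) :=
    intervalIntegral.integral_nonneg hR.le fun ρ hρ => mul_nonneg (Real.rpow_nonneg (h0 _) _) (pow_nonneg hρ.1 _)
  have hb : (n * ∫ r in (0 : ℝ)..R, g r ^ pn n * r ^ (n - 1)) ^ (pn n)⁻¹ ≤ N := by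
    calc _ ≤ (N ^ pn n) ^ (pn n)⁻¹ := by gcongr
      _ = N := Real.rpow_rpow_inv hN0 hp.ne'
  have c1 : Continuous fun r => max (-g' r) 0 * r ^ (n - 1) := by fun_prop
  have c2 : Continuous fun r => max (g' r) 0 * r ^ (n - 1) := by fun_prop
  have eX : ∫ r in (0 : ℝ)..R, |g' r| * r ^ (n - 1) = P + N := by
    rw [hP, hN, ← intervalIntegral.integral_add (c2.intervalIntegrable _ _) (c1.intervalIntegrable _ _)]
    congr 1; ext r
    rw [← add_mul]; congr 1
    rcases le_total 0 (g' r) with h | h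
    · rw [abs_of_nonneg h, max_eq_left h, max_eq_right (by linarith), add_zero]
    · rw [abs_of_nonpos h, max_eq_right h, max_eq_left (by linarith), zero_add]
  have eY : (n - 1) * ∫ r in (0 : ℝ)..R, g r * r ^ (n - 2) = N - P := by
    have e1 : ((n - 1 : ℕ) : ℝ) = n - 1 := by rw [Nat.cast_sub (by omega)]; simp
    have hd : ∀ r, HasDerivAt (fun r => g r * r ^ (n - 1)) (g' r * r ^ (n - 1) + g r * ((n - 1 : ℕ) * r ^ (n - 1 - 1))) r :=
      fun r => (hg r).mul (hasDerivAt_pow (n - 1) r)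
    have d1 : Continuous fun r => g' r * r ^ (n - 1) := by fun_prop
    have d2 : Continuous fun r => g r * ((n - 1 : ℕ) * r ^ (n - 1 - 1) : ℝ) := by fun_prop
    have ftc := intervalIntegral.integral_eq_sub_of_hasDerivAt (a := 0) (b := R) (fun r _ => hd r) ((d1.add d2).intervalIntegrable _ _)
    rw [intervalIntegral.integral_add (d1.intervalIntegrable _ _) (d2.intervalIntegrable _ _), hRz, zero_mul, zero_pow (by omega), mul_zero, sub_zero] at ftc
    have e3 : ∫ r in (0 : ℝ)..R, g' r * r ^ (n - 1) = P - N := by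
      rw [hP, hN, ← intervalIntegral.integral_sub (c2.intervalIntegrable _ _) (c1.intervalIntegrable _ _)]
      congr 1; ext r
      rw [← sub_mul]; congr 1
      rcases le_total 0 (g' r) with h | h
      · rw [max_eq_left h, max_eq_right (by linarith), sub_zero]
      · rw [max_eq_right h, max_eq_left (by linarith)]; ring
    have e4 : ∫ r in (0 : ℝ)..R, g r * ((n - 1 : ℕ) * r ^ (n - 1 - 1) : ℝ) = (n - 1) * ∫ r in (0 : ℝ)..R, g r * r ^ (n - 2) := by
      rw [← intervalIntegral.integral_const_mul]
      congr 1; ext r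
      rw [e1, Nat.sub_sub]; ring
    rw [e3, e4] at ftc
    linarith
  rw [eX, eY]
  have := abs_le.1 hs
  have h3 : (u + s) * (n * ∫ r in (0 : ℝ)..R, g r ^ pn n * r ^ (n - 1)) ^ (pn n)⁻¹ ≤ (u + s) * N :=
    mul_le_mul_of_nonneg_left hb (by linarith)
  have h4 : 0 ≤ (u - s) * P := mul_nonneg (by linarith) hP0
  linarith

lemma bint {α : Type*} [MeasurableSpace α] {μ : Measure α} [IsFiniteMeasure μ] {f : α → ℝ} (hf : Measurable f) {C : ℝ}
    (h : ∀ᵐ x ∂μ, |f x| ≤ C) : Integrable f μ := Integrable.of_bound hf.aestronglyMeasurable C h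

lemma sg_mean {n : ℕ} (hn : 1 ≤ n) (v : EE n) : ∫ θ, inner ℝ θ v ∂sg n = 0 := by
  have := sg_prob hn
  have := nu_prob hn
  have h1 : ∫ x, inner ℝ x v ∂gam n = 0 := by
    have := integral_strongDual_stdGaussian (innerSL ℝ v)
    simpa [gam, real_inner_comm] using this
  rw [(gam_int hn (by fun_prop)).1] at h1
  have e : ∀ p : EE n × ℝ, inner ℝ (p.2 • p.1) v = inner ℝ p.1 v * p.2 := fun p => by
    rw [real_inner_smul_left, mul_comm]
  simp_rw [e] at h1
  rw [integral_prod_mul (fun θ : EE n => inner ℝ θ v) (fun r : ℝ => r)] at h1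
  rcases mul_eq_zero.1 h1 with h | h
  · exact h
  · exfalso
    rw [integral_eq_zero_iff_of_nonneg_ae] at h
    · obtain ⟨r, h1, h2⟩ := (h.and (nu_pos n)).exists
      simp at h1; linarith
    · filter_upwards [nu_pos n] with r hr using hr.le
    · have := (nu_mom hn 1)
      refine this.congr ?_
      filter_upwards [nu_pos n] with r hr
      rw [pow_one, abs_of_pos hr]

lemma sg_var {n : ℕ} (hn : 1 ≤ n) (v z : EE n) : ∫ θ, inner ℝ θ v * inner ℝ θ z ∂sg n = inner ℝ v z / n := by
  have := sg_prob hn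
  have := nu_prob hn
  have hn0 : (n : ℝ) ≠ 0 := by positivity
  have key : ∀ v : EE n, ∫ θ, (inner ℝ θ v) ^ 2 ∂sg n = ‖v‖ ^ 2 / n := by
    intro v
    have h1 := gam_sq n v
    rw [(gam_int hn (by fun_prop)).1] at h1
    have e : ∀ p : EE n × ℝ, inner ℝ (p.2 • p.1) v ^ 2 = inner ℝ p.1 v ^ 2 * p.2 ^ 2 := fun p => by
      rw [real_inner_smul_left]; ring
    simp_rw [e] at h1
    rw [integral_prod_mul (fun θ : EE n => (inner ℝ θ v) ^ 2) (fun r : ℝ => r ^ 2), nu_sq hn] at h1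
    rw [← h1]; field_simp
  have hi : ∀ v : EE n, Integrable (fun θ => (inner ℝ θ v) ^ 2) (sg n) := fun v => by
    refine bint (C := ‖v‖ ^ 2) (by fun_prop) ?_
    filter_upwards [sg_norm n] with θ hθ
    have := abs_real_inner_le_norm θ v
    rw [hθ, one_mul] at this
    rw [abs_pow]
    gcongr
  have e : ∀ θ : EE n, inner ℝ θ v * inner ℝ θ z = (1/4) * ((inner ℝ θ (v + z)) ^ 2 - (inner ℝ θ (v - z)) ^ 2) := by
    intro θ; rw [inner_add_right, inner_sub_right]; ring
  simp_rw [e]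
  rw [integral_const_mul, integral_sub (hi _) (hi _), key, key, @norm_add_sq_real, @norm_sub_sq_real]
  ring

lemma hbd {N a : ℝ} (hN : 3 ≤ N) (h1 : -1 ≤ a) : 0 ≤ (N - 1) / N * ((1 + a) ^ (N / (N - 1)) - 1) - a ∧
    (N - 1) / N * ((1 + a) ^ (N / (N - 1)) - 1) - a ≤ a ^ 2 / N := by
  have hN1 : 0 < N - 1 := by linarith
  have hN0 : 0 < N := by linarith
  have e : (N - 1) / N * (N / (N - 1)) = 1 := by field_simp
  constructor
  · have := one_add_mul_self_le_rpow_one_add h1 (p := N / (N - 1)) (by rw [le_div_iff₀ hN1]; linarith)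
    have h2 : (N - 1) / N * (N / (N - 1) * a) ≤ (N - 1) / N * ((1 + a) ^ (N / (N - 1)) - 1) :=
      mul_le_mul_of_nonneg_left (by linarith) (by positivity)
    rw [← mul_assoc, e] at h2
    linarith
  · have h3 := rpow_one_add_le_one_add_mul_self h1 (p := 1 / (N - 1)) (by positivity)
      (by rw [div_le_one hN1]; linarith)
    have h4 : (1 + a) ^ (N / (N - 1)) ≤ (1 + a) * (1 + 1 / (N - 1) * a) := by
      have : N / (N - 1) = 1 + 1 / (N - 1) := by field_simp; ring
      rw [this, Real.rpow_one_add' (by linarith) (by positivity)]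
      exact mul_le_mul_of_nonneg_left h3 (by linarith)
    have h5 : (N - 1) / N * ((1 + a) ^ (N / (N - 1)) - 1) ≤ (N - 1) / N * ((1 + a) * (1 + 1 / (N - 1) * a) - 1) :=
      mul_le_mul_of_nonneg_left (by linarith) (by positivity)
    have : (N - 1) / N * ((1 + a) * (1 + 1 / (N - 1) * a) - 1) = a + a ^ 2 / N := by
      field_simp; ring
    linarith

lemma sph_pt {N c ε a w y t u : ℝ} (hN : 3 ≤ N) (hε0 : 0 ≤ ε) (hε : ε ≤ 1 / 4) (ha : |a| ≤ 1) (ht : 0 ≤ t) (hte : t ≤ ε)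
    (hu : u = √(1 - t ^ 2)) :
    (1 + c) * (1 + a) - (1 / 2 + 2 * ε) * (t ^ 2 + y ^ 2) - (ε + 1 / (2 * (N - 1) ^ 2)) * a ^ 2 +
      (1 / (N - 1)) * (w + w * a - y) ≤ (u + (w - y) / (N - 1) + c) * (1 + a) := by
  have hN1 : 0 < N - 1 := by linarith
  have h1 : 1 - t ^ 2 / 2 - ε * t ^ 2 / 2 ≤ u := by
    rw [hu]
    apply Real.le_sqrt_of_sq_le
    have h2 : t ^ 2 ≤ ε := by nlinarith
    have h3 : t ^ 2 * t ^ 2 ≤ ε * t ^ 2 := by nlinarith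
    have h4 : (1 + ε) ^ 2 * (t ^ 2 * t ^ 2) ≤ 4 * (t ^ 2 * t ^ 2) :=
      mul_le_mul_of_nonneg_right (by nlinarith) (by positivity)
    nlinarith
  have h2 : (1 - u) * (1 + a) ≤ (1 / 2 + 2 * ε) * t ^ 2 + ε * a ^ 2 := by
    have h3 : t ^ 2 * |a| ≤ ε * (t ^ 2 + a ^ 2) / 2 := by
      have h4 : t ^ 2 * |a| ≤ ε * (t * |a|) := by nlinarith [mul_nonneg ht (abs_nonneg a)]
      nlinarith [sq_nonneg (t - |a|), sq_abs a]
    have h5 : (1 - u) * (1 + a) ≤ (t ^ 2 / 2 + ε * t ^ 2 / 2) * (1 + a) := by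
      apply mul_le_mul_of_nonneg_right (by linarith)
      linarith [neg_abs_le a]
    have h6 : t ^ 2 * a ≤ t ^ 2 * |a| := mul_le_mul_of_nonneg_left (le_abs_self a) (by positivity)
    have h7 : (1 + ε) * (t ^ 2 * a) ≤ (1 + ε) * (ε * (t ^ 2 + a ^ 2) / 2) :=
      mul_le_mul_of_nonneg_left (h6.trans h3) (by linarith)
    nlinarith [mul_nonneg hε0 (sq_nonneg t), mul_nonneg hε0 (sq_nonneg a), mul_nonneg hε0 (mul_nonneg hε0 (sq_nonneg a)),
      mul_nonneg hε0 (mul_nonneg hε0 (sq_nonneg t))]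
  have h3 : (1 / (N - 1)) * (y * a) ≤ y ^ 2 / 2 + 1 / (2 * (N - 1) ^ 2) * a ^ 2 := by
    have := sq_nonneg (y - 1 / (N - 1) * a)
    have e : 1 / (2 * (N - 1) ^ 2) * a ^ 2 = (1 / (N - 1) * a) ^ 2 / 2 := by field_simp
    rw [e]; nlinarith
  have e : (u + (w - y) / (N - 1) + c) * (1 + a) = (1 + c) * (1 + a) - (1 - u) * (1 + a) +
      (1 / (N - 1)) * (w + w * a - y) - (1 / (N - 1)) * (y * a) := by ring
  rw [e]
  nlinarith [mul_nonneg hε0 (sq_nonneg y)]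

/-- margin -/
noncomputable def mgn (N : ℝ) : ℝ := N ^ 2 * (N - 2) / (N - 1) ^ 4 - 1 / N - 1 / (2 * (N - 1) ^ 2)

lemma mgn_pos {N : ℝ} (hN : 3 ≤ N) : 0 < mgn N := by
  obtain ⟨k, rfl⟩ : ∃ k, N = k + 1 := ⟨N - 1, by ring⟩
  have hk : 2 ≤ k := by linarith
  have e : mgn (k + 1) = (3 * k ^ 3 - k ^ 2 - 4 * k - 2) / (2 * k ^ 4 * (k + 1)) := by
    unfold mgn
    have : k + 1 - 1 = k := by ring
    rw [this]
    field_simp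
    ring
  rw [e]
  apply div_pos _ (by positivity)
  nlinarith [mul_nonneg (sub_nonneg.2 hk) (sq_nonneg k), mul_nonneg (sub_nonneg.2 hk) (sub_nonneg.2 hk)]

lemma sph_fin {N c ε η m S Q Z E B : ℝ} (hN : 3 ≤ N) (hB : B = 2 * N * (N - 2) / (N - 1) ^ 2) (hε : 0 < ε) (hc0 : 0 < c) (hc : c ≤ ε) (hε1 : ε ≤ mgn N / 10)
    (hε2 : ε ≤ 1 / 4) (hη0 : 0 < η) (hη : (2 + 2 * N) * η ≤ mgn N / 10) (hη1 : η ≤ 1) (hm : 0 ≤ m) (hS : 0 ≤ S) (hE : -m - S / N ≤ E) (hQ : Q ≤ B * S)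
    (hQ2 : B * S - 2 * η * (m + S) - 2 * N * η * S ≤ Q) (hZ : Z ≤ 1 / (2 * N) * (B * Q)) :
    (1 + c) - 4 * m ≤ (1 + c) * (1 + E) - (1 / 2 + 2 * ε) * Z - (ε + 1 / (2 * (N - 1) ^ 2)) * S + (1 / (N - 1)) * Q := by
  have hN1 : 0 < N - 1 := by linarith
  have hN0 : 0 < N := by linarith
  have hB2 : B ≤ 2 := by rw [hB, div_le_iff₀ (by positivity)]; nlinarith
  have hB0 : 0 ≤ B := by rw [hB]; apply div_nonneg _ (by positivity); nlinarith
  set K := N / (2 * (N - 1) ^ 2) with hK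
  have hK0 : 0 ≤ K := by positivity
  have hK1 : K ≤ 1 := by rw [hK, div_le_one (by positivity)]; nlinarith
  have eK : 1 / (N - 1) - B / (4 * N) = K := by rw [hB, hK]; field_simp; ring
  have eKB : K * B = mgn N + 1 / N + 1 / (2 * (N - 1) ^ 2) := by rw [hB, hK, mgn]; field_simp; ring
  have hN3 : 1 / N ≤ 1 / 3 := by apply one_div_le_one_div_of_le <;> linarith
  have h1 : (1 / 2 + 2 * ε) * Z ≤ B / (4 * N) * Q + 2 * ε * S := by
    have : (1 / 2 + 2 * ε) * Z ≤ (1 / 2 + 2 * ε) * (1 / (2 * N) * (B * Q)) :=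
      mul_le_mul_of_nonneg_left hZ (by linarith)
    have e : (1 / 2 + 2 * ε) * (1 / (2 * N) * (B * Q)) = B / (4 * N) * Q + ε * (1 / N) * (B * Q) := by
      field_simp; ring
    have h2 : B * Q ≤ 4 * S := by
      have : B * Q ≤ B * (B * S) := mul_le_mul_of_nonneg_left hQ hB0
      have h4 : B * (B * S) ≤ 2 * (2 * S) := by gcongr
      linarith
    have h3 : ε * (1 / N) * (B * Q) ≤ ε * (1 / N) * (4 * S) := mul_le_mul_of_nonneg_left h2 (by positivity)
    have h4 : ε * (1 / N) * (4 * S) ≤ ε * (1 / 3) * (4 * S) := by gcongr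
    have : 0 ≤ ε * S := by positivity
    linarith
  have h2 : K * (B * S - 2 * η * (m + S) - 2 * N * η * S) ≤ K * Q := mul_le_mul_of_nonneg_left hQ2 hK0
  have h3 : K * (2 * η * (m + S) + 2 * N * η * S) ≤ 1 * (2 * η * (m + S) + 2 * N * η * S) := by gcongr
  have h4 : (1 + c) * (-m - S / N) ≤ (1 + c) * E := mul_le_mul_of_nonneg_left hE (by linarith)
  have h5 : (2 + 2 * N) * η * S ≤ mgn N / 10 * S := mul_le_mul_of_nonneg_right hη hS
  have h6 : c * (S * (1 / N)) ≤ ε * (S * (1/3)) := by gcongr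
  have h7 : ε * S ≤ mgn N / 10 * S := mul_le_mul_of_nonneg_right hε1 hS
  have h8 : η * m ≤ 1 * m := mul_le_mul_of_nonneg_right hη1 hm
  have h9 : c * m ≤ 1 / 4 * m := mul_le_mul_of_nonneg_right (hc.trans hε2) hm
  have h10 : 0 ≤ mgn N * S := mul_nonneg (mgn_pos hN).le hS
  have e2 : (1 / (N - 1)) * Q = K * Q + B / (4 * N) * Q := by rw [← eK]; ring
  have e3 : K * (B * S) = mgn N * S + S * (1 / N) + 1 / (2 * (N - 1) ^ 2) * S := by
    rw [← mul_assoc, eKB]; ring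
  have e4 : S / N = S * (1 / N) := by ring
  rw [e4] at h4
  rw [e2]
  nlinarith

lemma ft_norm {n : ℕ} (w : EE n → ℝ) {θ : EE n} (h : ‖θ‖ = 1) : ‖ft w θ‖ ^ 2 + fy w θ ^ 2 = ‖fZ w θ‖ ^ 2 := by
  have : ‖ft w θ‖ ^ 2 = ‖fZ w θ‖ ^ 2 - 2 * inner ℝ (fZ w θ) (fy w θ • θ) + ‖fy w θ • θ‖ ^ 2 := by
    rw [ft, @norm_sub_sq_real]
  rw [this, norm_smul, h, inner_smul_right, real_inner_comm, ← fy]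
  simp
  ring

lemma ft_le {n : ℕ} (w : EE n → ℝ) {θ : EE n} (h : ‖θ‖ = 1) : ‖ft w θ‖ ≤ ‖fZ w θ‖ ∧ |fy w θ| ≤ ‖fZ w θ‖ := by
  have e := ft_norm w h
  constructor
  · exact le_of_sq_le_sq (by linarith [sq_nonneg (fy w θ)]) (norm_nonneg _)
  · exact abs_le_of_sq_le_sq (by linarith [sq_nonneg ‖ft w θ‖]) (norm_nonneg _)

lemma fy_meas {n : ℕ} (hn : 1 ≤ n) {w : EE n → ℝ} (hw : Measurable w) : Measurable (fy w) :=
  Measurable.inner measurable_id (fZ_meas hn hw)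

lemma ft_meas {n : ℕ} (hn : 1 ≤ n) {w : EE n → ℝ} (hw : Measurable w) : Measurable (ft w) :=
  (fZ_meas hn hw).sub ((fy_meas hn hw).smul measurable_id)

lemma fy_mean {n : ℕ} (hn : 2 ≤ n) {w : EE n → ℝ} (hw : Measurable w) {M : ℝ} (hM : ∀ x, |w x| ≤ M)
    (h0 : ∫ θ, w θ ∂sg n = 0) : ∫ θ, fy w θ ∂sg n = 0 := by
  have := field_t hn hw hM h0 (f := fun _ => 1) contDiff_const (A := 1) (by simp) (by simp) 0 le_rfl
  simpa [h0] using this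

set_option maxHeartbeats 1000000 in
lemma sph_main {n : ℕ} (hn : 3 ≤ n) : ∃ c : ℝ, 0 < c ∧ ∃ η : ℝ, 0 < η ∧ ∀ a : EE n → ℝ, Measurable a → (∀ θ, |a θ| ≤ 1) →
    ∫ θ, |a θ| ∂sg n ≤ η → ∀ m : ℝ, |∫ θ, ((1 + a θ) ^ pn n - 1) ∂sg n| ≤ m →
    ∫ θ, ((1 + a θ) ^ pn n - 1) • θ ∂sg n = 0 → ∃ w : EE n → ℝ, Measurable w ∧ (∀ θ, |w θ| ≤ 3) ∧ ∫ θ, w θ ∂sg n = 0 ∧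
      (∀ θ, ‖θ‖ = 1 → ‖ft w θ‖ ≤ 1 ∧ |(w θ - fy w θ) / (n - 1) + c| ≤ √(1 - ‖ft w θ‖ ^ 2)) ∧
      (1 + c) - 4 * m ≤ ∫ θ, (√(1 - ‖ft w θ‖ ^ 2) + (w θ - fy w θ) / (n - 1) + c) * (1 + a θ) ∂sg n := by
  have hn1 : 1 ≤ n := by omega
  have := sg_prob hn1
  set N : ℝ := (n : ℝ) with hNdef
  have hN : 3 ≤ N := by rw [hNdef]; exact_mod_cast hn
  have hN1 : 0 < N - 1 := by linarith
  have hmg := mgn_pos hN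
  obtain ⟨ε, hε0, hε1, hε2⟩ : ∃ ε : ℝ, 0 < ε ∧ ε ≤ mgn N / 10 ∧ ε ≤ 1 / 100 :=
    ⟨min (mgn N / 10) (1 / 100), by positivity, min_le_left _ _, min_le_right _ _⟩
  obtain ⟨η₀, hη₀, hsup⟩ := fZ_sup hn1 (M := 3) (by norm_num) hε0
  obtain ⟨η, hη, h1, h2, h3⟩ : ∃ η : ℝ, 0 < η ∧ (2 + 2 * N) * η ≤ mgn N / 10 ∧ (2 + 2 * N) * η ≤ 1 / 100 ∧ (4 + 2 * N) * η ≤ η₀ := by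
    refine ⟨min (mgn N / 10) (min (1 / 100) η₀) / (4 + 2 * N), by positivity, ?_, ?_, ?_⟩
    all_goals rw [mul_div_assoc', div_le_iff₀ (by positivity)]
    · exact mul_le_mul (by linarith) (min_le_left _ _) (by positivity) (by linarith) |>.trans_eq (mul_comm _ _)
    · exact mul_le_mul (by linarith) ((min_le_right _ _).trans (min_le_left _ _)) (by positivity) (by linarith) |>.trans_eq (mul_comm _ _)
    · exact mul_le_mul (by linarith) ((min_le_right _ _).trans (min_le_right _ _)) (by positivity) (by linarith) |>.trans_eq (mul_comm _ _)
  have hη1 : η ≤ 1 := by nlinarith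
  refine ⟨ε, hε0, η, hη, fun a ha hab hae m hm hv => ?_⟩
  have hm0 : 0 ≤ m := (abs_nonneg _).trans hm
  set B := 2 * N * (N - 2) / (N - 1) ^ 2 with hB
  have hB2 : B ≤ 2 := by rw [hB, div_le_iff₀ (by positivity)]; nlinarith
  have hB0 : 0 ≤ B := by rw [hB]; apply div_nonneg _ (by positivity); nlinarith
  have hB3 : B / (N - 1) ≤ 3 / 4 := by
    rw [hB, div_div, div_le_iff₀ (by positivity)]
    obtain ⟨k, hk⟩ : ∃ k, N = k + 1 := ⟨N - 1, by ring⟩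
    have hk2 : 0 ≤ k - 2 := by linarith
    rw [hk]; ring_nf
    nlinarith [mul_nonneg hk2 (sq_nonneg k), mul_nonneg hk2 hk2]
  have ai : Integrable a (sg n) := bint ha (.of_forall hab)
  have avi : Integrable (fun θ => a θ • θ) (sg n) := by
    refine Integrable.of_bound (ha.smul measurable_id).aestronglyMeasurable 1 ?_
    filter_upwards [sg_norm n] with θ hθ
    rw [norm_smul, hθ, mul_one]; exact hab θ
  set α := ∫ θ, a θ ∂sg n with hα
  set q := ∫ θ, a θ • θ ∂sg n with hq
  set S := ∫ θ, a θ ^ 2 ∂sg n with hS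
  have hαη : |α| ≤ η := (abs_integral_le_integral_abs).trans hae
  have hqη : ‖q‖ ≤ η := by
    refine (norm_integral_le_integral_norm _).trans ((integral_congr_ae ?_).trans_le hae)
    filter_upwards [sg_norm n] with θ hθ
    rw [norm_smul, hθ, mul_one]; rfl
  have a2i : Integrable (fun θ => a θ ^ 2) (sg n) := bint (C := 1) (ha.pow_const 2) (.of_forall fun θ => by
    rw [abs_pow]; exact pow_le_one₀ (abs_nonneg _) (hab θ))
  have hS0 : 0 ≤ S := integral_nonneg fun _ => by positivity
  set v : EE n → ℝ := fun θ => (1 + a θ) ^ pn n - 1 with hvdef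
  set h : EE n → ℝ := fun θ => (N - 1) / N * v θ - a θ with hhdef
  have hh : ∀ θ, 0 ≤ h θ ∧ h θ ≤ a θ ^ 2 / N := fun θ => hbd hN (by linarith [neg_abs_le (a θ), hab θ])
  have hpm : Measurable v := by
    have h0 : Measurable (fun θ => 1 + a θ) := measurable_const.add ha
    exact (h0.pow_const (pn n)).sub_const 1
  have hhm : Measurable h := (hpm.const_mul _).sub ha
  have a2n : Integrable (fun θ => a θ ^ 2 / N) (sg n) := a2i.div_const N
  have hi : Integrable h (sg n) := a2n.mono' hhm.aestronglyMeasurable (.of_forall fun θ => by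
    rw [Real.norm_of_nonneg (hh θ).1]; exact (hh θ).2)
  have hint : ∫ θ, h θ ∂sg n ≤ S / N := by
    rw [hS, ← integral_div]
    exact integral_mono hi a2n fun θ => (hh θ).2
  have hint0 : 0 ≤ ∫ θ, h θ ∂sg n := integral_nonneg fun θ => (hh θ).1
  have hvh : ∀ θ, v θ = N / (N - 1) * (h θ + a θ) := fun θ => by simp only [hhdef]; field_simp; ring
  have e1 : ∫ θ, v θ ∂sg n = N / (N - 1) * ((∫ θ, h θ ∂sg n) + α) := by
    simp_rw [hvh]; rw [integral_const_mul, integral_add hi ai]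
  have hhv : Integrable (fun θ => h θ • θ) (sg n) := by
    refine hi.mono (hhm.smul measurable_id).aestronglyMeasurable ?_
    filter_upwards [sg_norm n] with θ hθ
    rw [norm_smul, hθ, mul_one]
  have e2 : ∫ θ, h θ • θ ∂sg n + q = 0 := by
    have : ∀ θ, v θ • θ = (N / (N - 1)) • (h θ • θ + a θ • θ) := fun θ => by
      rw [hvh, ← add_smul, smul_smul]
    rw [integral_congr_ae (.of_forall this), integral_smul, integral_add hhv avi] at hv
    exact (smul_eq_zero.1 hv).resolve_left (by positivity)
  have hqS : ‖q‖ ≤ S / N := by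
    have : q = - ∫ θ, h θ • θ ∂sg n := by rw [eq_neg_iff_add_eq_zero, add_comm]; exact e2
    rw [this, norm_neg]
    refine (norm_integral_le_integral_norm _).trans ((integral_congr_ae ?_).trans_le hint)
    filter_upwards [sg_norm n] with θ hθ
    rw [norm_smul, hθ, mul_one, Real.norm_of_nonneg (hh θ).1]
  have hαv : |(∫ θ, h θ ∂sg n) + α| ≤ m := by
    rw [e1, abs_mul, abs_of_pos (by positivity)] at hm
    have : 1 ≤ N / (N - 1) := by rw [le_div_iff₀ hN1]; linarith
    exact (le_mul_of_one_le_left (abs_nonneg _) this).trans hm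
  have hSN : S / N ≤ S := div_le_self hS0 (by linarith)
  rw [abs_le] at hαv
  have hαm : |α| ≤ m + S := by rw [abs_le]; constructor <;> linarith
  -- the field datum
  set l : EE n → ℝ := fun θ => inner ℝ θ q with hl
  have hlm : Measurable l := by fun_prop
  have hlb : ∀ θ : EE n, ‖θ‖ ≤ 1 → |l θ| ≤ η := fun θ hθ => (abs_real_inner_le_norm θ q).trans
    (by have := mul_le_mul hθ hqη (norm_nonneg _) zero_le_one; linarith)
  have hlb' : ∀ᵐ θ ∂sg n, |l θ| ≤ η := (sg_norm n).mono fun θ hθ => hlb θ hθ.le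
  have li : Integrable l (sg n) := bint hlm hlb'
  have alm : Measurable (fun θ => a θ * l θ) := ha.mul hlm
  have ali : Integrable (fun θ => a θ * l θ) (sg n) := bint (C := 1 * η) alm (hlb'.mono fun θ hθ => by
    rw [abs_mul]; exact mul_le_mul (hab θ) hθ (abs_nonneg _) zero_le_one)
  have l2i : Integrable (fun θ => l θ ^ 2) (sg n) := bint (C := η ^ 2) (hlm.pow_const 2) (hlb'.mono fun θ hθ => by
    rw [abs_pow]; exact pow_le_pow_left₀ (abs_nonneg _) hθ 2)
  have il : ∫ θ, l θ ∂sg n = 0 := sg_mean hn1 q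
  have ial : ∀ z : EE n, ∫ θ, a θ * inner ℝ θ z ∂sg n = inner ℝ q z := fun z => by
    rw [hq, real_inner_comm, ← integral_inner avi]
    refine integral_congr_ae (.of_forall fun θ => ?_)
    simp only [inner_smul_right]; rw [real_inner_comm]
  have ill : ∀ z : EE n, ∫ θ, l θ * inner ℝ θ z ∂sg n = inner ℝ q z / N := fun z => sg_var hn1 q z
  set w : EE n → ℝ := fun θ => B * (a θ - α - N * l (‖θ‖⁻¹ • θ)) with hw
  have hlm' : Measurable (fun θ : EE n => l (‖θ‖⁻¹ • θ)) := hlm.comp (by fun_prop)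
  have hwm : Measurable w := ((ha.sub_const α).sub (hlm'.const_mul N)).const_mul B
  have hwae : ∀ θ : EE n, ‖θ‖ = 1 → w θ = B * (a θ - α - N * l θ) := fun θ hθ => by simp only [hw]; rw [hθ]; simp
  have hwae' : ∀ᵐ θ ∂sg n, w θ = B * (a θ - α - N * l θ) := (sg_norm n).mono fun θ hθ => hwae θ hθ
  have hNl : ∀ θ : EE n, N * |l (‖θ‖⁻¹ • θ)| ≤ N * η := fun θ => by
    refine mul_le_mul_of_nonneg_left (hlb _ ?_) (by linarith)
    rw [norm_smul, norm_inv, norm_norm]; exact inv_mul_le_one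
  have hwf : ∀ θ, |w θ| ≤ B * (|a θ| + η + N * η) := fun θ => by
    rw [hw]; simp only
    rw [abs_mul, abs_of_nonneg hB0]
    refine mul_le_mul_of_nonneg_left ?_ hB0
    have t1 := abs_sub (a θ - α) (N * l (‖θ‖⁻¹ • θ))
    have t2 := abs_sub (a θ) α
    have t3 := hNl θ
    rw [abs_mul, abs_of_pos (by linarith : 0 < N)] at t1
    linarith
  have hw3 : ∀ θ, |w θ| ≤ 3 := fun θ => by
    refine (hwf θ).trans ?_
    have : B * (|a θ| + η + N * η) ≤ 2 * (1 + η + N * η) := mul_le_mul hB2 (by linarith [hab θ]) (by positivity) (by norm_num)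
    linarith
  clear_value w
  have wi : Integrable w (sg n) := bint hwm (.of_forall hw3)
  have hw0 : ∫ θ, w θ ∂sg n = 0 := by
    rw [integral_congr_ae hwae', integral_const_mul, integral_sub (isub ai (integrable_const _)) (li.const_mul N),
      integral_sub ai (integrable_const _), integral_const_mul, il, integral_const]
    simp [hα]
  have hwv : Integrable (fun θ => w θ • θ) (sg n) := by
    refine wi.mono (hwm.smul measurable_id).aestronglyMeasurable ?_
    filter_upwards [sg_norm n] with θ hθ
    rw [norm_smul, hθ, mul_one]
  have hinz : ∀ z : EE n, Integrable (fun θ => inner ℝ θ z) (sg n) := fun z => bint (C := ‖z‖) (by fun_prop) (by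
    filter_upwards [sg_norm n] with θ hθ
    have := abs_real_inner_le_norm θ z
    rwa [hθ, one_mul] at this)
  have hbz : ∀ (b : EE n → ℝ) (C : ℝ), Measurable b → (∀ᵐ θ ∂sg n, |b θ| ≤ C) → ∀ z : EE n, Integrable (fun θ => b θ * inner ℝ θ z) (sg n) :=
    fun b C hb hC z => (hinz z).bdd_mul hb.aestronglyMeasurable hC
  have hw1 : ∫ θ, w θ • θ ∂sg n = 0 := by
    refine ext_inner_left ℝ fun z => ?_
    rw [inner_zero_right, ← integral_inner hwv]
    have : ∀ᵐ θ ∂sg n, inner ℝ z (w θ • θ) = B * (a θ * inner ℝ θ z - α * inner ℝ θ z - N * (l θ * inner ℝ θ z)) := by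
      filter_upwards [hwae'] with θ hθ
      rw [inner_smul_right, real_inner_comm, hθ]; ring
    rw [integral_congr_ae this, integral_const_mul, integral_sub (isub (hbz a 1 ha (.of_forall hab) z) ((hinz z).const_mul α))
      ((hbz l η hlm hlb' z).const_mul N), integral_sub (hbz a 1 ha (.of_forall hab) z) ((hinz z).const_mul α),
      integral_const_mul, integral_const_mul, ial, ill, sg_mean hn1]
    field_simp; simp
  set D := S - α ^ 2 - N * ‖q‖ ^ 2 with hD
  have hwa : ∫ θ, w θ * a θ ∂sg n = B * D := by
    have : ∀ᵐ θ ∂sg n, w θ * a θ = B * (a θ ^ 2 - α * a θ - N * (a θ * l θ)) := by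
      filter_upwards [hwae'] with θ hθ
      rw [hθ]; ring
    rw [integral_congr_ae this, integral_const_mul, integral_sub (isub a2i (ai.const_mul α)) (ali.const_mul N),
      integral_sub a2i (ai.const_mul α), integral_const_mul, integral_const_mul, ial, real_inner_self_eq_norm_sq]
    ring
  have hww : ∫ θ, w θ ^ 2 ∂sg n = B * (B * D) := by
    have : ∀ᵐ θ ∂sg n, w θ ^ 2 = B * (w θ * a θ - α * w θ - N * (inner ℝ q (w θ • θ))) := by
      filter_upwards [hwae'] with θ hθ
      rw [inner_smul_right, real_inner_comm, sq]
      nth_rewrite 1 [hθ]; ring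
    have wai : Integrable (fun θ => w θ * a θ) (sg n) := ai.bdd_mul hwm.aestronglyMeasurable (.of_forall hw3)
    have hq2 : Integrable (fun θ => inner ℝ q (w θ • θ)) (sg n) := hwv.const_inner q
    rw [integral_congr_ae this, integral_const_mul, integral_sub (isub wai (wi.const_mul α)) (hq2.const_mul N),
      integral_sub wai (wi.const_mul α), integral_const_mul, integral_const_mul, integral_inner hwv, hw1, hw0, hwa]
    simp
  have hZ := fZ_l2 hn1 hwm hw3 hw0 hw1
  rw [hww] at hZ
  have hwl1 : ∫ θ, |w θ| ∂sg n ≤ η₀ := by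
    have hb : ∀ θ, |w θ| ≤ 2 * |a θ| + 2 * (η + N * η) := fun θ => (hwf θ).trans (by
      have := mul_le_mul_of_nonneg_right hB2 (show 0 ≤ |a θ| + η + N * η by positivity)
      linarith)
    have := integral_mono wi.abs ((ai.abs.const_mul 2).fun_add (integrable_const (2 * (η + N * η)))) hb
    rw [integral_add (ai.abs.const_mul 2) (integrable_const _), integral_const_mul, integral_const] at this
    simp at this
    linarith
  have hze := hsup w hwm hw3 hwl1
  refine ⟨w, hwm, hw3, hw0, fun θ hθ => ?_, ?_⟩
  · have hz := hze θ hθ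
    have e := ft_norm w hθ
    have hf := (ft_le w hθ).1.trans hz
    have hy := (ft_le w hθ).2.trans hz
    refine ⟨by linarith, ?_⟩
    have hu : 99 / 100 ≤ √(1 - ‖ft w θ‖ ^ 2) := Real.le_sqrt_of_sq_le (by
      have := pow_le_pow_left₀ (norm_nonneg _) (hf.trans hε2) 2
      linarith)
    refine le_trans ?_ hu
    have t1 := abs_add_le ((w θ - fy w θ) / (N - 1)) ε
    rw [abs_div, abs_of_pos hN1, abs_of_pos hε0] at t1
    have t2 := abs_sub (w θ) (fy w θ)
    have t3 : |w θ - fy w θ| / (N - 1) ≤ B / (N - 1) * (|a θ| + η + N * η) + ε / (N - 1) := by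
      rw [div_mul_eq_mul_div, ← add_div]
      have := hwf θ
      exact div_le_div_of_nonneg_right (by linarith) hN1.le
    have t4 : B / (N - 1) * (|a θ| + η + N * η) ≤ 3 / 4 * (1 + η + N * η) :=
      mul_le_mul hB3 (by linarith [hab θ]) (by positivity) (by norm_num)
    have t5 : ε / (N - 1) ≤ ε := div_le_self hε0.le (by linarith)
    linarith
  · set Z := ∫ θ, ‖fZ w θ‖ ^ 2 ∂sg n
    have hD1 : B * D ≤ B * S := mul_le_mul_of_nonneg_left (by rw [hD]; linarith [sq_nonneg α, mul_nonneg (by linarith : 0 ≤ N) (sq_nonneg ‖q‖)]) hB0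
    have hD2 : B * S - 2 * η * (m + S) - 2 * N * η * S ≤ B * D := by
      have t1 : α ^ 2 ≤ η * (m + S) := by
        rw [← sq_abs, sq]; exact mul_le_mul hαη hαm (abs_nonneg _) hη.le
      have t2 : ‖q‖ ^ 2 ≤ η * S := by
        rw [sq]; exact mul_le_mul hqη (hqS.trans hSN) (norm_nonneg _) hη.le
      have t3 : α ^ 2 + N * ‖q‖ ^ 2 ≤ η * (m + S) + N * (η * S) := by gcongr
      have t4 : B * (α ^ 2 + N * ‖q‖ ^ 2) ≤ 2 * (η * (m + S) + N * (η * S)) :=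
        mul_le_mul hB2 t3 (by positivity) (by norm_num)
      rw [hD]; linarith
    have fin := sph_fin hN hB hε0 hε0 le_rfl hε1 (by linarith) hη h1 hη1 hm0 hS0 (E := α) (by linarith) hD1 hD2 hZ
    refine fin.trans ?_
    have hZi : Integrable (fun θ => ‖fZ w θ‖ ^ 2) (sg n) := by
      refine bint (C := ε ^ 2) ((fZ_meas hn1 hwm).norm.pow_const 2) ?_
      filter_upwards [sg_norm n] with θ hθ
      rw [abs_of_nonneg (by positivity)]
      exact pow_le_pow_left₀ (norm_nonneg _) (hze θ hθ) 2
    have hyb : ∀ θ : EE n, ‖θ‖ = 1 → |fy w θ| ≤ ε := fun θ hθ => (ft_le w hθ).2.trans (hze θ hθ)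
    have hyi : Integrable (fy w) (sg n) := bint (fy_meas hn1 hwm) ((sg_norm n).mono hyb)
    have wai : Integrable (fun θ => w θ * a θ) (sg n) := ai.bdd_mul hwm.aestronglyMeasurable (.of_forall hw3)
    have i1 : Integrable (fun θ => (1 + ε) * (1 + a θ)) (sg n) := ((integrable_const 1).fun_add ai).const_mul _
    have i2 := hZi.const_mul (1 / 2 + 2 * ε)
    have i3 := a2i.const_mul (ε + 1 / (2 * (N - 1) ^ 2))
    have i4 : Integrable (fun θ => 1 / (N - 1) * (w θ + w θ * a θ - fy w θ)) (sg n) :=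
      (isub (wi.fun_add wai) hyi).const_mul _
    have eL : ∫ θ, ((1 + ε) * (1 + a θ) - (1 / 2 + 2 * ε) * ‖fZ w θ‖ ^ 2 - (ε + 1 / (2 * (N - 1) ^ 2)) * a θ ^ 2 +
        1 / (N - 1) * (w θ + w θ * a θ - fy w θ)) ∂sg n = (1 + ε) * (1 + α) - (1 / 2 + 2 * ε) * Z -
        (ε + 1 / (2 * (N - 1) ^ 2)) * S + (1 / (N - 1)) * (B * D) := by
      rw [integral_add (isub (isub i1 i2) i3) i4, integral_sub (isub i1 i2) i3, integral_sub i1 i2, integral_const_mul,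
        integral_const_mul, integral_const_mul, integral_const_mul, integral_sub (wi.fun_add wai) hyi, integral_add wi wai,
        integral_add (integrable_const 1) ai, fy_mean (by omega) hwm hw3 hw0, hw0, hwa, integral_const]
      simp [Z, hα, hS]
    rw [← eL]
    refine integral_mono_ae ((isub (isub i1 i2) i3).fun_add i4) ?_ ?_
    · have um : Measurable (fun θ => √(1 - ‖ft w θ‖ ^ 2)) :=
        Real.continuous_sqrt.measurable.comp (((ft_meas hn1 hwm).norm.pow_const 2).const_sub 1)
      have ub : ∀ θ, |√(1 - ‖ft w θ‖ ^ 2)| ≤ 1 := fun θ => by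
        rw [abs_of_nonneg (Real.sqrt_nonneg _)]
        exact Real.sqrt_le_one.2 (by linarith [sq_nonneg ‖ft w θ‖])
      have i5 : Integrable (fun θ => √(1 - ‖ft w θ‖ ^ 2) + (w θ - fy w θ) / (N - 1) + ε) (sg n) :=
        ((bint um (.of_forall ub)).fun_add ((isub wi hyi).div_const _)).fun_add (integrable_const ε)
      have i6 : Measurable (fun θ => 1 + a θ) := ha.const_add 1
      refine i5.mul_bdd (c := 2) i6.aestronglyMeasurable (.of_forall fun θ => ?_)
      have := hab θ; rw [abs_le] at this
      rw [Real.norm_eq_abs, abs_le]; constructor <;> linarith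
    · filter_upwards [sg_norm n] with θ hθ
      have e := ft_norm w hθ
      have hf := (ft_le w hθ).1.trans (hze θ hθ)
      have := sph_pt (c := ε) (w := w θ) (y := fy w θ) hN hε0.le (by linarith) (hab θ) (norm_nonneg _) hf rfl
      rw [e] at this
      exact this

lemma pol_able {n : ℕ} (hn : 1 ≤ n) {f : EE n → ℝ} (hf : Measurable f) {R C : ℝ} (hR : ∀ x, R < ‖x‖ → f x = 0)
    (hC : ∀ x, ‖x‖ ^ (n - 1) * |f x| ≤ C) : Integrable f := by
  have := sg_prob hn
  refine ⟨hf.aestronglyMeasurable, ?_⟩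
  rw [hasFiniteIntegral_iff_enorm, polar_lint hn _ hf.enorm]
  refine ENNReal.mul_lt_top ENNReal.ofReal_lt_top ?_
  have h1 : ∀ᵐ θ ∂sg n, ∫⁻ r, ‖f (r • θ)‖ₑ ∂rad n ≤ ENNReal.ofReal C * ENNReal.ofReal R := by
    filter_upwards [sg_norm n] with θ hθ
    rw [rad, lintegral_withDensity_eq_lintegral_mul _ (by fun_prop) (by fun_prop)]
    calc ∫⁻ r in Ioi 0, ENNReal.ofReal (r ^ (n - 1)) * ‖f (r • θ)‖ₑ
        ≤ ∫⁻ r in Ioi 0, (Ioc 0 R).indicator (fun _ => ENNReal.ofReal C) r := by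
          refine setLIntegral_mono' measurableSet_Ioi fun r hr => ?_
          have hr0 : 0 < r := hr
          have hnr : ‖r • θ‖ = r := by rw [norm_smul, hθ, mul_one, Real.norm_of_nonneg hr0.le]
          by_cases hrR : r ≤ R
          · rw [indicator_of_mem (show r ∈ Ioc 0 R from ⟨hr, hrR⟩), Real.enorm_eq_ofReal_abs, ← ENNReal.ofReal_mul (by positivity)]
            have := hC (r • θ)
            rw [hnr] at this
            exact ENNReal.ofReal_le_ofReal this
          · rw [hR _ (by rw [hnr]; linarith)]; simp
      _ ≤ ∫⁻ r, (Ioc 0 R).indicator (fun _ => ENNReal.ofReal C) r := setLIntegral_le_lintegral _ _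
      _ = _ := by rw [lintegral_indicator measurableSet_Ioc]; simp
  refine (lintegral_mono_ae h1).trans_lt ?_
  rw [lintegral_const, measure_univ, mul_one]
  exact ENNReal.mul_lt_top ENNReal.ofReal_lt_top ENNReal.ofReal_lt_top

lemma pol_eq {n : ℕ} (hn : 1 ≤ n) {f : EE n → ℝ} (hf : Integrable f) {R : ℝ} (hR : ∀ x, R < ‖x‖ → f x = 0) :
    ∫ x, f x = (n * om n) * ∫ θ, (∫ r in Ioc 0 R, r ^ (n - 1) * f (r • θ)) ∂(sg n) := by
  rw [(polar_int hn hf).1]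
  congr 1
  refine integral_congr_ae ?_
  filter_upwards [sg_norm n] with θ hθ
  refine setIntegral_eq_of_subset_of_forall_diff_eq_zero measurableSet_Ioi (fun r hr => hr.1) fun r hr => ?_
  have hr0 : 0 < r := hr.1
  rw [hR _, mul_zero]
  rw [norm_smul, hθ, mul_one, Real.norm_of_nonneg hr0.le]
  by_contra hh
  exact hr.2 ⟨hr.1, not_lt.1 hh⟩

lemma pn_bd {n : ℕ} (hn : 3 ≤ n) : 1 < pn n ∧ pn n ≤ 2 := by
  have hN : (3 : ℝ) ≤ n := by exact_mod_cast hn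
  unfold pn
  constructor
  · rw [lt_div_iff₀ (by linarith)]; linarith
  · rw [div_le_iff₀ (by linarith)]; linarith

lemma pow_cmp {p t : ℝ} (hp : 1 ≤ p) (hp2 : p ≤ 2) (h0 : 0 ≤ t) (h1 : t ≤ 1) : t ^ p ≤ t ∧ 1 - t ^ p ≤ 2 * (1 - t) := by
  constructor
  · exact (Real.rpow_le_rpow_of_exponent_ge' h0 h1 zero_le_one hp).trans_eq (Real.rpow_one t)
  · have := one_add_mul_self_le_rpow_one_add (s := t - 1) (by linarith) hp
    rw [add_sub_cancel] at this
    nlinarith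

lemma pow_cmp2 {p t : ℝ} (hp : 1 ≤ p) (h0 : 0 ≤ t) : |t - 1| ≤ |t ^ p - 1| := by
  rcases le_total t 1 with h | h
  · have := (Real.rpow_le_rpow_of_exponent_ge' h0 h zero_le_one hp).trans_eq (Real.rpow_one t)
    rw [abs_of_nonpos (by linarith), abs_of_nonpos (by linarith)]; linarith
  · have := Real.rpow_le_rpow_of_exponent_le h hp
    rw [Real.rpow_one] at this
    rw [abs_of_nonneg (by linarith), abs_of_nonneg (by linarith)]; linarith

noncomputable def chB (n : ℕ) (x : EE n) : ℝ := (ball (0 : EE n) 1).indicator (fun _ => 1) x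

lemma chB_meas (n : ℕ) : Measurable (chB n) := measurable_const.indicator measurableSet_ball

lemma chB_bd {n : ℕ} (x : EE n) : 0 ≤ chB n x ∧ chB n x ≤ 1 := by
  unfold chB; by_cases h : x ∈ ball (0 : EE n) 1 <;> simp [h]

lemma pow_chB {n : ℕ} (hn : 3 ≤ n) (x : EE n) {t : ℝ} (h0 : 0 ≤ t) (h1 : t ≤ 1) : |t ^ pn n - chB n x| ≤ 2 * |t - chB n x| := by
  have ⟨a, b⟩ := pow_cmp (pn_bd hn).1.le (pn_bd hn).2 h0 h1
  have h2 := Real.rpow_nonneg h0 (pn n)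
  unfold chB
  by_cases h : x ∈ ball (0 : EE n) 1
  · simp only [h, indicator_of_mem]
    rw [abs_of_nonpos (by linarith), abs_of_nonpos (by linarith)]; linarith
  · simp only [h, not_false_eq_true, indicator_of_notMem, sub_zero]
    rw [abs_of_nonneg (by linarith), abs_of_nonneg (by linarith)]; linarith

lemma int_pow {n : ℕ} (hn : 1 ≤ n) {R : ℝ} (hR : 0 ≤ R) : n * ∫ r in Ioc 0 R, r ^ (n - 1) = R ^ n := by
  rw [← intervalIntegral.integral_of_le hR, integral_pow, Nat.sub_add_cancel hn]
  have : ((n - 1 : ℕ) : ℝ) + 1 = n := by exact_mod_cast Nat.sub_add_cancel hn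
  rw [this, zero_pow (by omega)]
  have : (n : ℝ) ≠ 0 := by positivity
  field_simp; ring

noncomputable def bq {n : ℕ} (g : EE n → ℝ) (R : ℝ) (θ : EE n) : ℝ := n * ∫ r in Ioc 0 R, r ^ (n - 1) * g (r • θ) ^ pn n

set_option maxHeartbeats 800000 in
lemma jlem_a {n : ℕ} (hn : 3 ≤ n) {R : ℝ} (hR : 1 ≤ R) (hR2 : R ^ (n - 1) ≤ 2) {g : EE n → ℝ} (hg : Measurable g)
    (h0 : ∀ x, 0 ≤ g x) (h1 : ∀ x, g x ≤ 1) (hs : ∀ x, R ≤ ‖x‖ → g x = 0)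
    (hc : ∫ x, g x ^ pn n • (‖x‖⁻¹ • x) = 0) : Measurable (bq g R) ∧ (∀ θ, 0 ≤ bq g R θ) ∧
    (∀ θ, bq g R θ ^ (pn n)⁻¹ ≤ 2) ∧ om n * ∫ θ, |bq g R θ ^ (pn n)⁻¹ - 1| ∂sg n ≤ 2 * ∫ x, |g x - chB n x| ∧
    om n * ∫ θ, (bq g R θ - 1) ∂sg n = (∫ x, g x ^ pn n) - om n ∧ ∫ θ, (bq g R θ - 1) • θ ∂sg n = 0 := by
  have hn1 : 1 ≤ n := by omega
  have := sg_prob hn1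
  have hn0 : (0 : ℝ) < n := by positivity
  have hω := om_pos n
  obtain ⟨hp1, hp2⟩ := pn_bd hn
  have gpm : Measurable (fun x => g x ^ pn n) := hg.pow_const _
  have gp0 : ∀ x, 0 ≤ g x ^ pn n := fun x => Real.rpow_nonneg (h0 x) _
  have gp1 : ∀ x, g x ^ pn n ≤ 1 := fun x => Real.rpow_le_one (h0 x) (h1 x) (by linarith)
  have gps : ∀ x, R < ‖x‖ → g x ^ pn n = 0 := fun x hx => by rw [hs x hx.le, Real.zero_rpow (by linarith)]
  have chs : ∀ x, R < ‖x‖ → chB n x = 0 := fun x hx => by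
    unfold chB; rw [indicator_of_notMem]; simp; linarith
  have able : ∀ f : EE n → ℝ, Measurable f → (∀ x, |f x| ≤ 1) → (∀ x, R < ‖x‖ → f x = 0) → Integrable f := fun f hf hb hz => by
    refine pol_able hn1 hf hz (C := R ^ (n - 1)) fun x => ?_
    by_cases hx : R < ‖x‖
    · rw [hz x hx]; simp; positivity
    · have := mul_le_mul (pow_le_pow_left₀ (norm_nonneg x) (not_lt.1 hx) (n - 1)) (hb x) (abs_nonneg _) (by positivity)
      linarith
  have ri : ∀ f : ℝ → ℝ, Measurable f → (∀ r, |f r| ≤ 1) → IntegrableOn (fun r => r ^ (n - 1) * f r) (Ioc 0 R) := fun f hf hb => by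
    have hm : Measurable (fun r : ℝ => r ^ (n - 1) * f r) := (measurable_id.pow_const _).mul hf
    refine bint (C := R ^ (n - 1)) hm ((ae_restrict_mem measurableSet_Ioc).mono fun r hr => ?_)
    rw [abs_mul, abs_of_nonneg (pow_nonneg hr.1.le _)]
    have := mul_le_mul (pow_le_pow_left₀ hr.1.le hr.2 (n - 1)) (hb r) (abs_nonneg _) (by positivity)
    linarith
  have sm : ∀ θ : EE n, Measurable (fun r : ℝ => r • θ) := fun θ => by fun_prop
  have rgi : ∀ θ : EE n, IntegrableOn (fun r => r ^ (n - 1) * g (r • θ) ^ pn n) (Ioc 0 R) := fun θ =>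
    ri (fun r => g (r • θ) ^ pn n) (gpm.comp (sm θ)) fun r => by rw [abs_of_nonneg (gp0 _)]; exact gp1 _
  have rone : IntegrableOn (fun r : ℝ => r ^ (n - 1)) (Ioc 0 R) := by
    simpa using ri (fun _ => 1) measurable_const (by simp)
  have bm : Measurable (bq g R) := by
    have hm2 : Measurable (fun p : EE n × ℝ => g (p.2 • p.1) ^ pn n) := gpm.comp (by fun_prop)
    have hm : Measurable (fun p : EE n × ℝ => p.2 ^ (n - 1) * g (p.2 • p.1) ^ pn n) := (measurable_snd.pow_const _).mul hm2
    exact (hm.stronglyMeasurable.integral_prod_right' (ν := volume.restrict (Ioc 0 R))).measurable.const_mul (n : ℝ)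
  have b0 : ∀ θ, 0 ≤ bq g R θ := fun θ => mul_nonneg hn0.le (setIntegral_nonneg measurableSet_Ioc fun r hr =>
    mul_nonneg (pow_nonneg hr.1.le _) (gp0 _))
  have bR : ∀ θ, bq g R θ ≤ R ^ n := fun θ => by
    rw [← int_pow hn1 (by linarith), bq]
    refine mul_le_mul_of_nonneg_left (setIntegral_mono_on (rgi θ) rone measurableSet_Ioc fun r hr => ?_) hn0.le
    exact mul_le_of_le_one_right (pow_nonneg hr.1.le _) (gp1 _)
  have bi : Integrable (bq g R) (sg n) := bint bm (C := R ^ n) (.of_forall fun θ => by rw [abs_of_nonneg (b0 θ)]; exact bR θ)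
  have key : ∫ θ, |bq g R θ - 1| ∂sg n ≤ n * ∫ θ, (∫ r in Ioc 0 R, r ^ (n - 1) * |g (r • θ) ^ pn n - chB n (r • θ)|) ∂sg n := by
    rw [← integral_const_mul]
    have fm : Measurable (fun p : EE n × ℝ => p.2 ^ (n - 1) * |g (p.2 • p.1) ^ pn n - chB n (p.2 • p.1)|) := by
      have hsm : Measurable (fun p : EE n × ℝ => p.2 • p.1) := by fun_prop
      have hm : Measurable (fun p : EE n × ℝ => g (p.2 • p.1) ^ pn n - chB n (p.2 • p.1)) := (gpm.comp hsm).sub ((chB_meas n).comp hsm)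
      exact (measurable_snd.pow_const _).mul hm.abs
    have rri : ∀ θ : EE n, IntegrableOn (fun r => r ^ (n - 1) * |g (r • θ) ^ pn n - chB n (r • θ)|) (Ioc 0 R) := fun θ => by
      have hm : Measurable (fun r : ℝ => g (r • θ) ^ pn n - chB n (r • θ)) := (gpm.comp (sm θ)).sub ((chB_meas n).comp (sm θ))
      refine ri (fun r => |g (r • θ) ^ pn n - chB n (r • θ)|) hm.abs fun r => ?_
      rw [abs_abs, abs_le]; constructor <;> linarith [gp0 (r • θ), gp1 (r • θ), (chB_bd (r • θ)).1, (chB_bd (r • θ)).2]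
    refine integral_mono_ae (isub bi (integrable_const _)).abs ?_ ?_
    · refine Integrable.const_mul ?_ _
      refine bint (C := ∫ r in Ioc 0 R, r ^ (n - 1)) (fm.stronglyMeasurable.integral_prod_right' (ν := volume.restrict (Ioc 0 R))).measurable (.of_forall fun θ => ?_)
      rw [abs_of_nonneg (setIntegral_nonneg measurableSet_Ioc fun r hr => mul_nonneg (pow_nonneg hr.1.le _) (abs_nonneg _))]
      refine setIntegral_mono_on (rri θ) rone measurableSet_Ioc fun r hr => mul_le_of_le_one_right (pow_nonneg hr.1.le _) ?_
      rw [abs_le]; constructor <;> linarith [gp0 (r • θ), gp1 (r • θ), (chB_bd (r • θ)).1, (chB_bd (r • θ)).2]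
    · filter_upwards [sg_norm n] with θ hθ
      have e1 : (1 : ℝ) = n * ∫ r in Ioc 0 R, r ^ (n - 1) * chB n (r • θ) := by
        have : ∫ r in Ioc 0 R, r ^ (n - 1) * chB n (r • θ) = ∫ r in Ioo 0 1, r ^ (n - 1) := by
          have e : ∀ r ∈ Ioc 0 R, r ^ (n - 1) * chB n (r • θ) = (Ioo (0 : ℝ) 1).indicator (fun r => r ^ (n - 1)) r := fun r hr => by
            have : ‖r • θ‖ = r := by rw [norm_smul, hθ, mul_one, Real.norm_of_nonneg hr.1.le]
            unfold chB indicator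
            simp only [mem_ball_zero_iff, this, mem_Ioo, hr.1, true_and]
            split_ifs <;> simp
          rw [setIntegral_congr_fun measurableSet_Ioc e, setIntegral_indicator measurableSet_Ioo]
          congr 2
          ext r; simp only [mem_inter_iff, mem_Ioc, mem_Ioo]
          constructor
          · tauto
          · intro h; exact ⟨⟨h.1, by linarith⟩, h⟩
        rw [this, ← integral_Ioc_eq_integral_Ioo, int_pow hn1 zero_le_one, one_pow]
      have rci : IntegrableOn (fun r => r ^ (n - 1) * chB n (r • θ)) (Ioc 0 R) :=
        ri (fun r => chB n (r • θ)) ((chB_meas n).comp (sm θ)) fun r => by rw [abs_of_nonneg (chB_bd _).1]; exact (chB_bd _).2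
      rw [bq, e1, ← mul_sub, ← integral_sub (rgi θ) rci, abs_mul, abs_of_pos hn0]
      refine mul_le_mul_of_nonneg_left (abs_integral_le_integral_abs.trans_eq ?_) hn0.le
      refine setIntegral_congr_fun measurableSet_Ioc fun r hr => ?_
      rw [← mul_sub, abs_mul, abs_of_nonneg (pow_nonneg hr.1.le _)]
  have fi : Integrable (fun x => |g x ^ pn n - chB n x|) := by
    have hm : Measurable (fun x => g x ^ pn n - chB n x) := gpm.sub (chB_meas n)
    refine able _ hm.abs (fun x => ?_) fun x hx => by rw [gps x hx, chs x hx]; simp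
    rw [abs_abs, abs_le]; constructor <;> linarith [gp0 x, gp1 x, (chB_bd x).1, (chB_bd x).2]
  have fi2 : Integrable (fun x => |g x - chB n x|) := by
    have hm : Measurable (fun x => g x - chB n x) := hg.sub (chB_meas n)
    refine able _ hm.abs (fun x => ?_) fun x hx => by rw [hs x hx.le, chs x hx]; simp
    rw [abs_abs, abs_le]; constructor <;> linarith [h0 x, h1 x, (chB_bd x).1, (chB_bd x).2]
  have gpi : Integrable (fun x => g x ^ pn n) := able _ gpm (fun x => by rw [abs_of_nonneg (gp0 x)]; exact gp1 x) gps
  refine ⟨bm, b0, fun θ => ?_, ?_, ?_, ?_⟩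
  · refine (Real.rpow_le_rpow (b0 θ) (bR θ) (by positivity)).trans ?_
    rw [← Real.rpow_natCast R n, ← Real.rpow_mul (by linarith)]
    have : (n : ℝ) * (pn n)⁻¹ = ((n - 1 : ℕ) : ℝ) := by
      unfold pn; rw [inv_div, Nat.cast_sub hn1]; field_simp; simp
    rw [this, Real.rpow_natCast]
    exact hR2
  · have t1 : ∫ θ, |bq g R θ ^ (pn n)⁻¹ - 1| ∂sg n ≤ ∫ θ, |bq g R θ - 1| ∂sg n := by
      refine integral_mono_of_nonneg (.of_forall fun _ => abs_nonneg _) (isub bi (integrable_const _)).abs (.of_forall fun θ => ?_)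
      have := pow_cmp2 hp1.le (Real.rpow_nonneg (b0 θ) (pn n)⁻¹)
      rwa [Real.rpow_inv_rpow (b0 θ) (by linarith)] at this
    have t2 := pol_eq hn1 fi (R := R) fun x hx => by rw [gps x hx, chs x hx]; simp
    have t3 : ∫ x, |g x ^ pn n - chB n x| ≤ 2 * ∫ x, |g x - chB n x| := by
      rw [← integral_const_mul]
      exact integral_mono fi (fi2.const_mul 2) fun x => pow_chB hn x (h0 x) (h1 x)
    have t4 := mul_le_mul_of_nonneg_left (t1.trans key) hω.le
    refine t4.trans (le_trans (le_of_eq ?_) t3)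
    rw [t2]; ring
  · rw [integral_sub bi (integrable_const _), pol_eq hn1 gpi gps]
    unfold bq
    rw [integral_const_mul]; simp; ring
  · have bvi : Integrable (fun θ => bq g R θ • θ) (sg n) := by
      refine bi.mono (bm.smul measurable_id).aestronglyMeasurable ?_
      filter_upwards [sg_norm n] with θ hθ
      rw [norm_smul, hθ, mul_one]
    have vi : Integrable (fun θ : EE n => (bq g R θ - 1) • θ) (sg n) := by
      refine (isub bi (integrable_const 1)).mono ((bm.sub_const 1).smul measurable_id).aestronglyMeasurable ?_
      filter_upwards [sg_norm n] with θ hθ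
      rw [norm_smul, hθ, mul_one]
    have gvi : Integrable (fun x => g x ^ pn n • (‖x‖⁻¹ • x)) := by
      have hm : Measurable (fun x : EE n => ‖x‖⁻¹ • x) := by fun_prop
      refine gpi.mono (gpm.smul hm).aestronglyMeasurable (.of_forall fun x => ?_)
      rw [norm_smul, norm_smul, norm_inv, norm_norm]
      exact mul_le_of_le_one_right (norm_nonneg _) inv_mul_le_one
    refine ext_inner_left ℝ fun z => ?_
    have hc' : ∫ x, inner ℝ z (g x ^ pn n • (‖x‖⁻¹ • x)) = 0 := by rw [integral_inner gvi, hc, inner_zero_right]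
    rw [pol_eq hn1 (gvi.const_inner z) (R := R) (fun x hx => by rw [gps x hx]; simp)] at hc'
    have hc2 := (mul_eq_zero.1 hc').resolve_left (by positivity)
    have e : ∀ᵐ θ ∂sg n, inner ℝ z ((bq g R θ - 1) • θ) = n * (∫ r in Ioc 0 R, r ^ (n - 1) * inner ℝ z (g (r • θ) ^ pn n • (‖r • θ‖⁻¹ • r • θ))) - inner ℝ θ z := by
      filter_upwards [sg_norm n] with θ hθ
      have : ∀ r ∈ Ioc 0 R, r ^ (n - 1) * inner ℝ z (g (r • θ) ^ pn n • (‖r • θ‖⁻¹ • r • θ)) = (r ^ (n - 1) * g (r • θ) ^ pn n) * inner ℝ θ z := fun r hr => by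
        have hr0 := hr.1
        rw [norm_smul, hθ, mul_one, Real.norm_of_nonneg hr.1.le, smul_smul r⁻¹, inv_mul_cancel₀ hr.1.ne', one_smul, inner_smul_right, real_inner_comm]
        ring
      rw [setIntegral_congr_fun measurableSet_Ioc this, integral_mul_const, ← mul_assoc, ← bq, inner_smul_right, real_inner_comm]
      ring
    have i1 : Integrable (fun θ : EE n => inner ℝ θ z) (sg n) := by
      refine bint (C := ‖z‖) (by fun_prop) ?_
      filter_upwards [sg_norm n] with θ hθ
      have := abs_real_inner_le_norm θ z
      rwa [hθ, one_mul] at this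
    have i2 : Integrable (fun θ => n * (∫ r in Ioc 0 R, r ^ (n - 1) * inner ℝ z (g (r • θ) ^ pn n • (‖r • θ‖⁻¹ • r • θ)))) (sg n) := by
      have := ((vi.const_inner z).fun_add i1)
      refine this.congr (e.mono fun θ hθ => ?_)
      simp only [hθ]; ring
    rw [inner_zero_right, ← integral_inner vi, integral_congr_ae e, integral_sub i2 i1, sg_mean hn1, integral_const_mul, hc2]
    simp

lemma dir_le {n : ℕ} (L : EE n →L[ℝ] ℝ) {θ τ : EE n} (hθ : ‖θ‖ = 1) (ho : inner ℝ θ τ = 0) (hτ : ‖τ‖ ≤ 1) :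
    √(1 - ‖τ‖ ^ 2) * |L θ| + L τ ≤ ‖L‖ := by
  set u := √(1 - ‖τ‖ ^ 2) with hu
  have hu0 : 0 ≤ u := Real.sqrt_nonneg _
  have hu2 : u ^ 2 = 1 - ‖τ‖ ^ 2 := Real.sq_sqrt (by nlinarith [norm_nonneg τ])
  have key : ∀ s : ℝ, s ^ 2 = 1 → L ((s * u) • θ + τ) ≤ ‖L‖ := fun s hs => by
    refine (le_abs_self _).trans ((L.le_opNorm _).trans ?_)
    have : ‖(s * u) • θ + τ‖ ^ 2 = 1 := by
      rw [@norm_add_sq_real, norm_smul, hθ, real_inner_smul_left, ho, mul_one, Real.norm_eq_abs, sq_abs, mul_pow, hs, hu2]; ring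
    have h1 : ‖(s * u) • θ + τ‖ = 1 := by
      exact (pow_eq_one_iff_of_nonneg (norm_nonneg _) two_ne_zero).1 this
    rw [h1, mul_one]
  rcases abs_cases (L θ) with ⟨h, -⟩ | ⟨h, -⟩
  · have := key 1 (by norm_num)
    rw [map_add, map_smul] at this
    rw [h]; simpa using this
  · have := key (-1) (by norm_num)
    rw [map_add, map_smul] at this
    rw [h]; simpa using this

lemma ft_orth {n : ℕ} (w : EE n → ℝ) {θ : EE n} (h : ‖θ‖ = 1) : inner ℝ θ (ft w θ) = 0 := by
  rw [ft, inner_sub_right, inner_smul_right, real_inner_self_eq_norm_sq, h, ← fy]; ring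

set_option maxHeartbeats 1000000 in
lemma jlem {n : ℕ} (hn : 3 ≤ n) : ∃ c : ℝ, 0 < c ∧ ∃ η : ℝ, 0 < η ∧ ∀ (R : ℝ), 1 ≤ R → R ^ (n - 1) ≤ 2 → ∀ g : EE n → ℝ, ContDiff ℝ 1 g →
    (∀ x, 0 ≤ g x) → (∀ x, g x ≤ 1) → (∀ x, R ≤ ‖x‖ → g x = 0) → ∫ x, g x ^ pn n • (‖x‖⁻¹ • x) = 0 →
    ∫ x, |g x - chB n x| ≤ η → ∀ m, |(∫ x, g x ^ pn n) - om n| ≤ m →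
    (1 + c) * (n * om n) - 4 * n * m ≤ (∫ x, ‖fderiv ℝ g x‖) + c * ((n - 1) * ∫ x, g x * ‖x‖⁻¹) := by
  have hn1 : 1 ≤ n := by omega
  have hn2 : 2 ≤ n := by omega
  have := sg_prob hn1
  have hω := om_pos n
  have hn0 : (0 : ℝ) < n := by positivity
  have hN1 : (0 : ℝ) < n - 1 := by have : (3 : ℝ) ≤ n := by exact_mod_cast hn
                                   linarith
  obtain ⟨hp1, hp2⟩ := pn_bd hn
  obtain ⟨c, hc0, η, hη0, hmain⟩ := sph_main hn
  refine ⟨c, hc0, η * om n / 2, by positivity, fun R hR hR2 g hg h0 h1 hs hc hcl m hm => ?_⟩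
  have hR0 : 0 < R := by linarith
  obtain ⟨bm, b0, b2, bl1, bm0, bm1⟩ := jlem_a hn hR hR2 hg.continuous.measurable h0 h1 hs hc
  set β : EE n → ℝ := fun θ => bq g R θ ^ (pn n)⁻¹ with hβ
  have hβ0 : ∀ θ, 0 ≤ β θ := fun θ => Real.rpow_nonneg (b0 θ) _
  have hβm : Measurable β := bm.pow_const _
  have hβp : ∀ θ, (1 + (β θ - 1)) ^ pn n = bq g R θ := fun θ => by
    rw [add_sub_cancel, hβ]; simp only; rw [Real.rpow_inv_rpow (b0 θ) (by linarith)]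
  obtain ⟨w, hwm, hw3, hw0, hws, hfin⟩ := hmain (fun θ => β θ - 1) (hβm.sub_const 1)
    (fun θ => by rw [abs_le]; constructor <;> linarith [hβ0 θ, b2 θ])
    (by have := bl1.trans (mul_le_mul_of_nonneg_left hcl zero_le_two)
        have e : 2 * (η * om n / 2) = om n * η := by ring
        rw [e] at this
        exact le_of_mul_le_mul_left this hω) (m / om n)
    (by simp_rw [hβp]
        rw [le_div_iff₀ hω, mul_comm]; rw [← bm0, abs_mul, abs_of_pos hω] at hm; exact hm)
    (by simp_rw [hβp]; exact bm1)
  simp only [add_sub_cancel] at hfin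
  -- bounds
  have hcs : HasCompactSupport g := HasCompactSupport.intro (isCompact_closedBall (0 : EE n) R) fun x hx => hs x (by
    simp at hx; exact hx.le)
  have hdc : Continuous (fderiv ℝ g) := hg.continuous_fderiv one_ne_zero
  obtain ⟨A, hA⟩ := (hcs.fderiv ℝ).exists_bound_of_continuous hdc
  have hA0 : 0 ≤ A := (norm_nonneg _).trans (hA 0)
  have hds : ∀ x, R < ‖x‖ → fderiv ℝ g x = 0 := fun x hx => by
    have : g =ᶠ[nhds x] fun _ => 0 := by
      filter_upwards [(isOpen_lt continuous_const continuous_norm).mem_nhds hx] with y hy using hs y (le_of_lt hy)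
    rw [this.fderiv_eq]; simp
  set P := (sg n).prod (volume.restrict (Ioc (0 : ℝ) R)) with hP
  set d : EE n → ℝ → ℝ := fun θ r => fderiv ℝ g (r • θ) θ with hd
  set u : EE n → ℝ := fun θ => √(1 - ‖ft w θ‖ ^ 2) with hu
  set s : EE n → ℝ := fun θ => (w θ - fy w θ) / (n - 1) + c with hsdef
  have hray : ∀ θ : EE n, ‖θ‖ = 1 → (u θ + (w θ - fy w θ) / (n - 1) + c) * β θ ≤
      ∫ r in Ioc 0 R, (u θ * |d θ r| * r ^ (n - 1) + (w θ - fy w θ) * (g (r • θ) * r ^ (n - 2)) + c * (n - 1) * (g (r • θ) * r ^ (n - 2))) := fun θ hθ => by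
    have hgd : ∀ r, HasDerivAt (fun r : ℝ => g (r • θ)) (d θ r) r := fun r => by
      have h1 := (hg.differentiable one_ne_zero (r • θ)).hasFDerivAt
      have h2 : HasDerivAt (fun r : ℝ => r • θ) θ r := by simpa using (hasDerivAt_id r).smul_const θ
      exact h1.comp_hasDerivAt r h2
    have hdcont : Continuous (d θ) := by fun_prop
    have hgc : Continuous (fun r : ℝ => g (r • θ)) := hg.continuous.comp (by fun_prop)
    have := ray_ineq hn2 hR0 (g := fun r => g (r • θ)) hgd hdcont (fun r => h0 _)
      (hs _ (by rw [norm_smul, hθ, mul_one]; exact le_abs_self R)) (hws θ hθ).2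
    rw [intervalIntegral.integral_of_le hR0.le, intervalIntegral.integral_of_le hR0.le, intervalIntegral.integral_of_le hR0.le] at this
    have e : (n * ∫ r in Ioc 0 R, g (r • θ) ^ pn n * r ^ (n - 1)) ^ (pn n)⁻¹ = β θ := by
      simp only [hβ, bq]; congr 2
      refine setIntegral_congr_fun measurableSet_Ioc fun r _ => mul_comm _ _
    rw [e] at this
    have ci : ∀ f : ℝ → ℝ, Continuous f → IntegrableOn f (Ioc 0 R) := fun f hf =>
      (hf.integrableOn_Icc).mono_set Ioc_subset_Icc_self
    have i1 : IntegrableOn (fun r => u θ * |d θ r| * r ^ (n - 1)) (Ioc 0 R) := ci _ (by fun_prop)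
    have i2 : IntegrableOn (fun r => (w θ - fy w θ) * (g (r • θ) * r ^ (n - 2))) (Ioc 0 R) := ci _ (by fun_prop)
    have i3 : IntegrableOn (fun r => c * (n - 1) * (g (r • θ) * r ^ (n - 2))) (Ioc 0 R) := ci _ (by fun_prop)
    rw [integral_add (i1.fun_add i2) i3, integral_add i1 i2, integral_const_mul, integral_const_mul]
    simp_rw [mul_assoc (u θ)]
    rw [integral_const_mul]
    refine (le_of_eq ?_).trans (this.trans (le_of_eq ?_))
    · ring
    · simp only [hu]; field_simp; ring
  have hsm : Measurable (fun p : EE n × ℝ => p.2 • p.1) := by fun_prop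
  have hae : ∀ᵐ p ∂P, ‖p.1‖ = 1 ∧ p.2 ∈ Ioc 0 R :=
    (Measure.quasiMeasurePreserving_fst.ae (sg_norm n)).and (Measure.quasiMeasurePreserving_snd.ae (ae_restrict_mem measurableSet_Ioc))
  obtain ⟨K, hK⟩ := fZ_bd hn1 hwm hw3
  have hfy : ∀ θ : EE n, ‖θ‖ = 1 → |fy w θ| ≤ K := fun θ hθ => (ft_le w hθ).2.trans (hK θ hθ.le)
  have hwy : ∀ θ : EE n, ‖θ‖ = 1 → |w θ - fy w θ| ≤ 3 + K := fun θ hθ =>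
    (abs_sub _ _).trans (add_le_add (hw3 θ) (hfy θ hθ))
  have um : Measurable u := Real.continuous_sqrt.measurable.comp (((ft_meas hn1 hwm).norm.pow_const 2).const_sub 1)
  have u0 : ∀ θ, 0 ≤ u θ := fun θ => Real.sqrt_nonneg _
  have u1 : ∀ θ, u θ ≤ 1 := fun θ => Real.sqrt_le_one.2 (by linarith [sq_nonneg ‖ft w θ‖])
  have ym : Measurable (fun θ => w θ - fy w θ) := hwm.sub (fy_meas hn1 hwm)
  have rb : ∀ (k : ℕ) (r : ℝ), r ∈ Ioc 0 R → 0 ≤ r ^ k ∧ r ^ k ≤ R ^ k := fun k r hr =>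
    ⟨pow_nonneg hr.1.le k, pow_le_pow_left₀ hr.1.le hr.2 k⟩
  have gr : Measurable (fun p : EE n × ℝ => g (p.2 • p.1) * p.2 ^ (n - 2)) :=
    (hg.continuous.measurable.comp hsm).mul (measurable_snd.pow_const _)
  have grb : ∀ p : EE n × ℝ, p.2 ∈ Ioc 0 R → |g (p.2 • p.1) * p.2 ^ (n - 2)| ≤ R ^ (n - 2) := fun p hp => by
    rw [abs_of_nonneg (mul_nonneg (h0 _) (rb _ _ hp).1)]
    exact (mul_le_of_le_one_left (rb _ _ hp).1 (h1 _)).trans (rb _ _ hp).2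
  have gri : Integrable (fun p : EE n × ℝ => g (p.2 • p.1) * p.2 ^ (n - 2)) P := bint gr (hae.mono fun p hp => grb p hp.2)
  have dm : Measurable (fun p : EE n × ℝ => fderiv ℝ g (p.2 • p.1)) := hdc.measurable.comp hsm
  have appm : Measurable (fun q : (EE n →L[ℝ] ℝ) × EE n => q.1 q.2) := isBoundedBilinearMap_apply.continuous.measurable
  have F1m : Measurable (fun p : EE n × ℝ => u p.1 * |d p.1 p.2| * p.2 ^ (n - 1)) := by
    have h2 : Measurable (fun p : EE n × ℝ => d p.1 p.2) := appm.comp (dm.prodMk measurable_fst)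
    exact ((um.comp measurable_fst).mul h2.abs).mul (measurable_snd.pow_const _)
  have F1i : Integrable (fun p : EE n × ℝ => u p.1 * |d p.1 p.2| * p.2 ^ (n - 1)) P := bint (C := 1 * A * R ^ (n - 1)) F1m (hae.mono fun p hp => by
    have h3 : |d p.1 p.2| ≤ A := ((fderiv ℝ g (p.2 • p.1)).le_opNorm _).trans (by rw [hp.1, mul_one]; exact hA _)
    rw [abs_of_nonneg (mul_nonneg (mul_nonneg (u0 _) (abs_nonneg _)) (rb _ _ hp.2).1)]
    exact mul_le_mul (mul_le_mul (u1 _) h3 (abs_nonneg _) zero_le_one) (rb _ _ hp.2).2 (rb _ _ hp.2).1 (by positivity))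
  have F2i : Integrable (fun p : EE n × ℝ => (w p.1 - fy w p.1) * (g (p.2 • p.1) * p.2 ^ (n - 2))) P :=
    gri.bdd_mul (c := 3 + K) (ym.comp measurable_fst).aestronglyMeasurable (hae.mono fun p hp => hwy _ hp.1)
  have ftb : ∀ θ : EE n, ‖θ‖ = 1 → ∀ r : ℝ, |fderiv ℝ g (r • θ) (ft w θ)| ≤ A := fun θ hθ r =>
    ((fderiv ℝ g (r • θ)).le_opNorm _).trans ((mul_le_mul (hA _) (hws θ hθ).1 (norm_nonneg _) hA0).trans_eq (mul_one A))
  have F4m : Measurable (fun p : EE n × ℝ => fderiv ℝ g (p.2 • p.1) (ft w p.1)) :=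
    appm.comp (dm.prodMk ((ft_meas hn1 hwm).comp measurable_fst))
  have F4i : Integrable (fun p : EE n × ℝ => fderiv ℝ g (p.2 • p.1) (ft w p.1) * p.2 ^ (n - 1)) P :=
    bint (C := A * R ^ (n - 1)) (F4m.mul (measurable_snd.pow_const _)) (hae.mono fun p hp => by
      rw [abs_mul, abs_of_nonneg (rb _ _ hp.2).1]
      exact mul_le_mul (ftb _ hp.1 _) (rb _ _ hp.2).2 (rb _ _ hp.2).1 hA0)
  have e24 : ∫ p : EE n × ℝ, (w p.1 - fy w p.1) * (g (p.2 • p.1) * p.2 ^ (n - 2)) ∂P = ∫ p : EE n × ℝ, fderiv ℝ g (p.2 • p.1) (ft w p.1) * p.2 ^ (n - 1) ∂P := by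
    rw [hP, integral_prod_symm _ F2i, integral_prod_symm _ F4i]
    refine setIntegral_congr_fun measurableSet_Ioc fun r hr => ?_
    simp only
    have gm : Measurable (fun θ : EE n => g (r • θ)) := hg.continuous.measurable.comp (by fun_prop)
    have gb : ∀ θ : EE n, |g (r • θ)| ≤ 1 := fun θ => by rw [abs_of_nonneg (h0 _)]; exact h1 _
    have i1 : Integrable (fun θ => w θ * g (r • θ)) (sg n) := (bint gm (.of_forall gb)).bdd_mul (c := 3) hwm.aestronglyMeasurable (.of_forall hw3)
    have i2 : Integrable (fun θ => g (r • θ) * fy w θ) (sg n) := (bint (fy_meas hn1 hwm) ((sg_norm n).mono hfy)).bdd_mul (c := 1) gm.aestronglyMeasurable (.of_forall gb)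
    have i3 : Integrable (fun θ => r * fderiv ℝ g (r • θ) (ft w θ)) (sg n) :=
      (bint (f := fun θ => fderiv ℝ g (r • θ) (ft w θ)) (C := A) (F4m.comp (measurable_id.prodMk measurable_const)) ((sg_norm n).mono fun θ hθ => ftb θ hθ r)).const_mul r
    have ht := field_t hn2 hwm hw3 hw0 hg (A := A + 1) (fun x => by rw [abs_of_nonneg (h0 _)]; linarith [h1 x]) (fun x => by linarith [hA x]) r hr.1.le
    rw [integral_add i2 i3] at ht
    have e1 : ∫ θ, (w θ - fy w θ) * (g (r • θ) * r ^ (n - 2)) ∂sg n = ((∫ θ, w θ * g (r • θ) ∂sg n) - ∫ θ, g (r • θ) * fy w θ ∂sg n) * r ^ (n - 2) := by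
      rw [← integral_sub i1 i2, ← integral_mul_const]; congr 1; ext θ; ring
    have e2 : r ^ (n - 1) = r * r ^ (n - 2) := by rw [← pow_succ']; congr 1; omega
    rw [e1, ← ht, add_sub_cancel_left, ← integral_mul_const, e2]
    congr 1; ext θ; ring
  have dni : Integrable (fun p : EE n × ℝ => p.2 ^ (n - 1) * ‖fderiv ℝ g (p.2 • p.1)‖) P :=
    bint (C := R ^ (n - 1) * A) ((measurable_snd.pow_const _).mul dm.norm) (hae.mono fun p hp => by
      rw [abs_mul, abs_of_nonneg (rb _ _ hp.2).1, abs_norm]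
      exact mul_le_mul (rb _ _ hp.2).2 (hA _) (norm_nonneg _) (by positivity))
  have e14 : ∫ p : EE n × ℝ, u p.1 * |d p.1 p.2| * p.2 ^ (n - 1) ∂P + ∫ p : EE n × ℝ, fderiv ℝ g (p.2 • p.1) (ft w p.1) * p.2 ^ (n - 1) ∂P ≤
      ∫ p : EE n × ℝ, p.2 ^ (n - 1) * ‖fderiv ℝ g (p.2 • p.1)‖ ∂P := by
    rw [← integral_add F1i F4i]
    refine integral_mono_ae (F1i.fun_add F4i) dni (hae.mono fun p hp => ?_)
    have := dir_le (fderiv ℝ g (p.2 • p.1)) hp.1 (ft_orth w hp.1) (hws _ hp.1).1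
    have := mul_le_mul_of_nonneg_left this (rb (n - 1) _ hp.2).1
    simp only [hu, hd]
    linarith
  have eD : ∫ x, ‖fderiv ℝ g x‖ = n * om n * ∫ p : EE n × ℝ, p.2 ^ (n - 1) * ‖fderiv ℝ g (p.2 • p.1)‖ ∂P := by
    rw [hP, integral_prod _ dni, pol_eq hn1 (hdc.norm.integrable_of_hasCompactSupport (hcs.fderiv ℝ).norm) fun x hx => by rw [hds x hx, norm_zero]]
  have gim : Measurable (fun x : EE n => g x * ‖x‖⁻¹) := hg.continuous.measurable.mul measurable_norm.inv
  have gis : ∀ x, R < ‖x‖ → g x * ‖x‖⁻¹ = 0 := fun x hx => by rw [hs x hx.le, zero_mul]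
  have hr12 : ∀ r : ℝ, 0 < r → r ^ (n - 1) * r⁻¹ = r ^ (n - 2) := fun r hr => by
    have e2 : r ^ (n - 1) = r ^ (n - 2) * r := by rw [← pow_succ]; congr 1; omega
    rw [e2, mul_assoc, mul_inv_cancel₀ hr.ne', mul_one]
  have gii : Integrable (fun x : EE n => g x * ‖x‖⁻¹) := pol_able hn1 gim gis (C := R ^ (n - 2)) fun x => by
    rcases (norm_nonneg x).eq_or_lt with hx | hx
    · rw [← hx]; simp; positivity
    · rcases le_or_gt ‖x‖ R with h | h
      · rw [abs_of_nonneg (mul_nonneg (h0 _) (by positivity)), mul_comm (g x), ← mul_assoc, hr12 _ hx]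
        exact (mul_le_of_le_one_right (by positivity) (h1 _)).trans (pow_le_pow_left₀ hx.le h _)
      · rw [gis x h]; simp; positivity
  have eG : ∫ x, g x * ‖x‖⁻¹ = n * om n * ∫ p : EE n × ℝ, g (p.2 • p.1) * p.2 ^ (n - 2) ∂P := by
    rw [hP, integral_prod _ gri, pol_eq hn1 gii gis]
    congr 1
    refine integral_congr_ae ((sg_norm n).mono fun θ hθ => setIntegral_congr_fun measurableSet_Ioc fun r hr => ?_)
    simp only
    rw [norm_smul, hθ, mul_one, Real.norm_of_nonneg hr.1.le, ← hr12 r hr.1]; ring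
  have F3i := gri.const_mul (c * (n - 1))
  have step : (1 + c) - 4 * (m / om n) ≤ ∫ p : EE n × ℝ, (u p.1 * |d p.1 p.2| * p.2 ^ (n - 1) + (w p.1 - fy w p.1) * (g (p.2 • p.1) * p.2 ^ (n - 2)) + c * (n - 1) * (g (p.2 • p.1) * p.2 ^ (n - 2))) ∂P := by
    refine hfin.trans ?_
    have ii := (F1i.fun_add F2i).fun_add F3i
    rw [hP, integral_prod _ ii]
    refine integral_mono_ae ?_ ii.integral_prod_left ((sg_norm n).mono hray)
    have i5 : Integrable (fun θ => u θ + (w θ - fy w θ) / (n - 1) + c) (sg n) :=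
      ((bint um (C := 1) (.of_forall fun θ => by rw [abs_of_nonneg (u0 θ)]; exact u1 θ)).fun_add ((bint ym ((sg_norm n).mono hwy)).div_const _)).fun_add (integrable_const c)
    exact i5.mul_bdd (c := 2) hβm.aestronglyMeasurable (.of_forall fun θ => by rw [Real.norm_of_nonneg (hβ0 θ)]; exact b2 θ)
  rw [integral_add (F1i.fun_add F2i) F3i, integral_add F1i F2i, e24, integral_const_mul] at step
  rw [eD, eG]
  have hnω : 0 < n * om n := by positivity
  have := mul_le_mul_of_nonneg_left (step.trans (add_le_add e14 le_rfl)) hnω.le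
  have e : n * om n * ((1 + c) - 4 * (m / om n)) = (1 + c) * (n * om n) - 4 * n * m := by field_simp
  rw [e] at this
  refine this.trans (le_of_eq ?_)
  ring

noncomputable def ins {d : ℕ} (i : Fin (d + 1)) (s : ℝ) (x : EE d) : EE (d + 1) :=
  WithLp.toLp 2 (i.insertNth (α := fun _ => ℝ) s x.ofLp)

lemma cs_of {X E F : Type*} [TopologicalSpace X] [Zero E] [Zero F] {f : X → E} {g : X → F} (hs : HasCompactSupport f)
    (h : ∀ x, f x = 0 → g x = 0) : HasCompactSupport g :=
  hs.mono fun x hx hf => hx (h x hf)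

lemma ins_same {d : ℕ} (i : Fin (d + 1)) (s : ℝ) (x : EE d) : ins i s x i = s := by simp [ins]

lemma ins_sq {d : ℕ} (i : Fin (d + 1)) (s : ℝ) (x : EE d) : ‖ins i s x‖ ^ 2 = s ^ 2 + ‖x‖ ^ 2 := by
  rw [EuclideanSpace.norm_sq_eq, EuclideanSpace.norm_sq_eq, Fin.sum_univ_succAbove _ i]
  simp [ins]

lemma ins_mp {d : ℕ} (i : Fin (d + 1)) :
    MeasurePreserving (fun p : ℝ × EE d => ins i p.1 p.2) (volume.prod volume) volume := by
  have h1 : MeasurePreserving (fun p : ℝ × EE d => (p.1, p.2.ofLp)) (volume.prod volume) (volume.prod volume) :=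
    (MeasurePreserving.id volume).prod (PiLp.volume_preserving_ofLp (Fin d))
  have h2 := (volume_preserving_piFinSuccAbove (fun _ : Fin (d + 1) => ℝ) i).symm
  have h3 := PiLp.volume_preserving_toLp (Fin (d + 1))
  exact h3.comp (h2.comp h1)

noncomputable def insL {d : ℕ} (i : Fin (d + 1)) : EE d →L[ℝ] EE (d + 1) :=
  LinearMap.mkContinuous
    { toFun := fun x => ins i 0 x
      map_add' := fun x y => by
        ext j; refine Fin.succAboveCases i ?_ (fun k => ?_) j <;> simp [ins]
      map_smul' := fun c x => by
        ext j; refine Fin.succAboveCases i ?_ (fun k => ?_) j <;> simp [ins] } 1 (fun x => by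
        have := ins_sq i 0 x
        rw [zero_pow two_ne_zero, zero_add] at this
        rw [one_mul]; exact ((sq_eq_sq₀ (norm_nonneg _) (norm_nonneg _)).1 this).le)

lemma ins_eq {d : ℕ} (i : Fin (d + 1)) (s : ℝ) (x : EE d) :
    ins i s x = s • EuclideanSpace.single i (1 : ℝ) + insL i x := by
  ext j; refine Fin.succAboveCases i ?_ (fun k => ?_) j <;> simp [ins, insL]

lemma ins_cont {d : ℕ} (i : Fin (d + 1)) : Continuous (fun p : ℝ × EE d => ins i p.1 p.2) := by
  simp_rw [ins_eq]; fun_prop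

lemma ins_int {d : ℕ} (i : Fin (d + 1)) {f : EE (d + 1) → ℝ} (hf : Integrable f) :
    ∫ x, f x = ∫ s, ∫ x, f (ins i s x) := by
  have h := ins_mp i
  have h1 : Integrable (fun p : ℝ × EE d => f (ins i p.1 p.2)) (volume.prod volume) := h.integrable_comp_of_integrable hf
  have h2 := integral_map (μ := volume.prod volume) h.measurable.aemeasurable (f := f) (by rw [h.map_eq]; exact hf.1)
  rw [h.map_eq] at h2
  rw [h2, integral_prod _ h1]

lemma ins_able {d : ℕ} (i : Fin (d + 1)) {f : EE (d + 1) → ℝ} (hf : Integrable f) :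
    Integrable (fun s => ∫ x, f (ins i s x)) :=
  ((ins_mp i).integrable_comp_of_integrable hf).integral_prod_left

lemma sl_sup {d : ℕ} (i : Fin (d + 1)) {f : EE (d + 1) → ℝ} (hs : HasCompactSupport f) :
    ∃ R : ℝ, ∀ s x, f (ins i s x) ≠ 0 → |s| ≤ R ∧ ‖x‖ ≤ R := by
  obtain ⟨R, hR⟩ := hs.isCompact.isBounded.subset_closedBall 0
  refine ⟨R, fun s x h => ?_⟩
  have h1 := hR (subset_tsupport _ h)
  rw [mem_closedBall_zero_iff] at h1
  have h2 := ins_sq i s x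
  have h3 := norm_nonneg (ins i s x)
  exact ⟨abs_le_of_sq_le_sq (by nlinarith [sq_nonneg ‖x‖]) (by linarith), by
    exact (abs_norm x).symm.le.trans (abs_le_of_sq_le_sq (by nlinarith [sq_nonneg s]) (by linarith))⟩

lemma sl_cs {d : ℕ} (i : Fin (d + 1)) {f : EE (d + 1) → ℝ} (hs : HasCompactSupport f) (s : ℝ) :
    HasCompactSupport (fun x => f (ins i s x)) := by
  obtain ⟨R, hR⟩ := sl_sup i hs
  refine HasCompactSupport.intro (isCompact_closedBall 0 R) fun x hx => ?_
  by_contra h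
  exact hx (by simpa using (hR s x h).2)

lemma sl_cont {d : ℕ} (i : Fin (d + 1)) {f : EE (d + 1) → ℝ} (hc : Continuous f) (hs : HasCompactSupport f) :
    Continuous (fun s => ∫ x, f (ins i s x)) ∧ HasCompactSupport (fun s => ∫ x, f (ins i s x)) := by
  obtain ⟨R, hR⟩ := sl_sup i hs
  constructor
  · refine continuous_parametric_integral_of_continuous (μ := volume) (f := fun s x => f (ins i s x)) (s := closedBall (0 : EE d) R) ?_ (isCompact_closedBall 0 R) |>.congr fun s => ?_
    · exact hc.comp (ins_cont i)
    · exact setIntegral_eq_integral_of_forall_compl_eq_zero fun x hx => by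
        by_contra h; exact hx (by simpa using (hR s x h).2)
  · refine HasCompactSupport.intro (isCompact_closedBall 0 R) fun s hx => ?_
    rw [integral_eq_zero_of_ae]
    refine .of_forall fun x => ?_
    by_contra h
    exact hx (by simpa using (hR s x h).1)

lemma sl_fd {d : ℕ} (i : Fin (d + 1)) {g : EE (d + 1) → ℝ} (hg : ContDiff ℝ 1 g) (s : ℝ) :
    ContDiff ℝ 1 (fun x => g (ins i s x)) ∧ ∀ x, fderiv ℝ (fun x => g (ins i s x)) x = (fderiv ℝ g (ins i s x)).comp (insL i) := by
  simp_rw [ins_eq]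
  refine ⟨hg.comp (by fun_prop), fun x => ?_⟩
  exact (((hg.differentiable one_ne_zero _).hasFDerivAt).comp x (((insL i).hasFDerivAt).const_add _)).fderiv

lemma sl_pt {d : ℕ} (i : Fin (d + 1)) (l : EE (d + 1) →L[ℝ] ℝ) {t : ℝ} (ht : |t| ≤ 1) :
    - t * l (EuclideanSpace.single i 1) + √(1 - t ^ 2) * ‖l.comp (insL i)‖ ≤ ‖l‖ := by
  have ht2 : t ^ 2 ≤ 1 := by rw [← sq_abs]; exact pow_le_one₀ (abs_nonneg t) ht
  set u := √(1 - t ^ 2)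
  have hu : u ^ 2 = 1 - t ^ 2 := Real.sq_sqrt (by linarith)
  have hu0 : 0 ≤ u := Real.sqrt_nonneg _
  have key : ∀ y : EE d, ‖y‖ ≤ 1 → - t * l (EuclideanSpace.single i 1) + u * l (insL i y) ≤ ‖l‖ := by
    intro y hy
    have h1 : ‖ins i (-t) (u • y)‖ ≤ 1 := by
      have h2 := ins_sq i (-t) (u • y)
      rw [norm_smul, mul_pow, Real.norm_eq_abs, sq_abs, hu] at h2
      have h3 : ‖y‖ ^ 2 ≤ 1 := pow_le_one₀ (norm_nonneg _) hy
      have : ‖ins i (-t) (u • y)‖ ^ 2 ≤ 1 := by nlinarith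
      exact (abs_norm _).symm.le.trans ((sq_le_one_iff_abs_le_one _).1 this)
    have h4 := (le_abs_self _).trans (l.le_of_opNorm_le le_rfl (ins i (-t) (u • y)))
    have h5 := h4.trans (mul_le_of_le_one_right (norm_nonneg l) h1)
    rw [ins_eq, map_add, map_smul, map_smul, map_smul, smul_eq_mul, smul_eq_mul] at h5
    exact h5
  have h0 := key 0 (by simp)
  simp only [map_zero, mul_zero, add_zero] at h0
  have : ‖u • l.comp (insL i)‖ ≤ ‖l‖ - - t * l (EuclideanSpace.single i 1) := by
    refine ContinuousLinearMap.opNorm_le_of_unit_norm (by linarith) fun y hy => ?_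
    rw [Real.norm_eq_abs, abs_le]
    have a := key y hy.le
    have b := key (-y) (by rw [norm_neg]; exact hy.le)
    simp only [map_neg] at b
    simp only [ContinuousLinearMap.smul_apply, ContinuousLinearMap.comp_apply, smul_eq_mul]
    constructor <;> linarith
  rw [norm_smul, Real.norm_of_nonneg hu0] at this
  linarith

lemma sl_ineq {d : ℕ} (i : Fin (d + 1)) {g : EE (d + 1) → ℝ} (hg : ContDiff ℝ 1 g) (hs : HasCompactSupport g)
    {T T' : ℝ → ℝ} (hT : ∀ s, HasDerivAt T (T' s) s) (hT' : Continuous T') (h1 : ∀ s, |T s| ≤ 1) :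
    Integrable (fun s => √(1 - T s ^ 2) * ∫ x, ‖fderiv ℝ (fun x => g (ins i s x)) x‖) ∧
    ∫ s, (T' s * (∫ x, g (ins i s x)) + √(1 - T s ^ 2) * ∫ x, ‖fderiv ℝ (fun x => g (ins i s x)) x‖) ≤ ∫ x, ‖fderiv ℝ g x‖ := by
  have hTc : Continuous T := continuous_iff_continuousAt.2 fun s => (hT s).continuousAt
  have hD : Continuous (fderiv ℝ g) := hg.continuous_fderiv one_ne_zero
  have hDs : HasCompactSupport (fderiv ℝ g) := hs.fderiv ℝ
  set e : EE (d + 1) := EuclideanSpace.single i 1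
  have hpr : ∀ x : EE (d + 1), HasFDerivAt (fun x : EE (d + 1) => T (x i)) ((T' (x i)) • (EuclideanSpace.proj i : EE (d + 1) →L[ℝ] ℝ)) x := fun x =>
    (hT (x i)).comp_hasFDerivAt x (EuclideanSpace.proj (𝕜 := ℝ) i).hasFDerivAt
  have i1 : Integrable (fun x => T' (x i) * g x) :=
    ((hT'.comp (by fun_prop)).mul hg.continuous).integrable_of_hasCompactSupport hs.mul_left
  have i2 : Integrable (fun x => T (x i) * fderiv ℝ g x e) := by
    refine ((hTc.comp (by fun_prop)).mul (by fun_prop)).integrable_of_hasCompactSupport ?_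
    exact cs_of hDs fun x hx => by simp [hx]
  have i3 : Integrable (fun x => √(1 - T (x i) ^ 2) * ‖(fderiv ℝ g x).comp (insL i)‖) := by
    refine Continuous.integrable_of_hasCompactSupport ?_ ?_
    · have : Continuous (fun x : EE (d + 1) => T (x i)) := hTc.comp (by fun_prop)
      have h2 : Continuous (fun x => (fderiv ℝ g x).comp (insL i)) := hD.clm_comp continuous_const
      fun_prop
    · exact cs_of hDs fun x hx => by simp [hx]
  have ibp : ∫ x, T (x i) * fderiv ℝ g x e = - ∫ x, T' (x i) * g x := by
    have := integral_mul_fderiv_eq_neg_fderiv_mul_of_integrable (μ := (volume : Measure (EE (d + 1)))) (f := fun x => T (x i)) (g := g) (v := e)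
    simp only [(hpr _).fderiv, ContinuousLinearMap.smul_apply, smul_eq_mul] at this
    have he : (EuclideanSpace.proj i : EE (d + 1) →L[ℝ] ℝ) e = 1 := by simp [e]
    rw [he] at this
    simp only [mul_one] at this
    exact this i1 i2 (((hTc.comp (by fun_prop)).mul hg.continuous).integrable_of_hasCompactSupport hs.mul_left)
      (fun x _ => (hpr x).differentiableAt) (fun x _ => hg.differentiable one_ne_zero x)
  have e3 : ∀ s, ∫ x, √(1 - T (ins i s x i) ^ 2) * ‖(fderiv ℝ g (ins i s x)).comp (insL i)‖
      = √(1 - T s ^ 2) * ∫ x, ‖fderiv ℝ (fun x => g (ins i s x)) x‖ := fun s => by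
    simp only [ins_same, (sl_fd i hg s).2]; rw [integral_const_mul]
  have a3 := ins_able i i3
  simp only [e3] at a3
  have e1 : ∀ s, ∫ x, T' (ins i s x i) * g (ins i s x) = T' s * ∫ x, g (ins i s x) := fun s => by
    simp only [ins_same]; rw [integral_const_mul]
  have a1 := ins_able i i1
  simp only [e1] at a1
  refine ⟨a3, ?_⟩
  rw [integral_add a1 a3]
  have f1 := ins_int i i1
  have f3 := ins_int i i3
  simp only [e1] at f1
  simp only [e3] at f3
  rw [← f1, ← f3, ← neg_neg (∫ x, T' (x i) * g x), ← ibp, ← integral_neg, ← integral_add i2.fun_neg i3]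
  refine integral_mono (i2.fun_neg.fun_add i3) (hD.norm.integrable_of_hasCompactSupport hDs.norm) fun x => ?_
  have := sl_pt i (fderiv ℝ g x) (h1 (x i))
  simpa using this

noncomputable def aB (d : ℕ) (t : ℝ) : ℝ := om d * √(1 - t ^ 2) ^ d

lemma aB_cont (d : ℕ) : Continuous (aB d) := by unfold aB; fun_prop

lemma aB_nn (d : ℕ) (t : ℝ) : 0 ≤ aB d t := by have := om_pos d; unfold aB; positivity

lemma aB_pos (d : ℕ) {t : ℝ} (h : |t| < 1) : 0 < aB d t := by
  have h1 := om_pos d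
  have : 0 < √(1 - t ^ 2) := Real.sqrt_pos.2 (by have := (sq_lt_one_iff_abs_lt_one t).2 h; linarith)
  unfold aB; positivity

lemma aB_le (d : ℕ) (t : ℝ) : aB d t ≤ om d :=
  mul_le_of_le_one_right (om_pos d).le (pow_le_one₀ (Real.sqrt_nonneg _) (Real.sqrt_le_one.2 (by nlinarith [sq_nonneg t])))

lemma sl_ball {d : ℕ} (i : Fin (d + 1)) {h : ℝ → ℝ} (hh : Continuous h) :
    ∫ x in ball (0 : EE (d + 1)) 1, h (x i) = ∫ t in Ioo (-1) 1, h t * aB d t := by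
  have hc : Continuous (fun x : EE (d + 1) => h (x i)) := hh.comp (by fun_prop)
  have h1 : IntegrableOn (fun x : EE (d + 1) => h (x i)) (ball 0 1) :=
    (hc.continuousOn.integrableOn_compact (isCompact_closedBall 0 1)).mono_set ball_subset_closedBall
  rw [← integral_indicator measurableSet_ball, ins_int i (h1.integrable_indicator measurableSet_ball), ← integral_indicator measurableSet_Ioo]
  congr 1; ext s
  have e1 : ∀ x : EE d, (ball (0 : EE (d + 1)) 1).indicator (fun x => h (x i)) (ins i s x)
      = (ball (0 : EE d) (√(1 - s ^ 2))).indicator (fun _ => h s) x := by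
    intro x
    have : ins i s x ∈ ball (0 : EE (d + 1)) 1 ↔ x ∈ ball (0 : EE d) (√(1 - s ^ 2)) := by
      rw [mem_ball_zero_iff, mem_ball_zero_iff, Real.lt_sqrt (norm_nonneg _), ← sq_lt_one_iff₀ (norm_nonneg _), ins_sq]
      constructor <;> intro <;> linarith
    by_cases hx : x ∈ ball (0 : EE d) (√(1 - s ^ 2))
    · rw [indicator_of_mem hx, indicator_of_mem (this.2 hx), ins_same]
    · rw [indicator_of_notMem hx, indicator_of_notMem (fun h => hx (this.1 h))]
  simp only [e1]
  rw [integral_indicator measurableSet_ball, setIntegral_const, smul_eq_mul, mul_comm]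
  by_cases hs : s ∈ Ioo (-1 : ℝ) 1
  · rw [indicator_of_mem hs]
    have : 0 < √(1 - s ^ 2) := Real.sqrt_pos.2 (by nlinarith [hs.1, hs.2])
    rw [measureReal_def, Measure.addHaar_ball_of_pos _ _ this, finrank_euclideanSpace_fin, ENNReal.toReal_mul, ENNReal.toReal_ofReal (by positivity), aB, om, measureReal_def]; ring
  · rw [indicator_of_notMem hs, Real.sqrt_eq_zero_of_nonpos, ball_zero, measureReal_empty, mul_zero]
    by_contra hh
    exact hs (abs_lt.1 ((sq_lt_one_iff_abs_lt_one s).1 (by linarith)))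

lemma om_succ (d : ℕ) : om (d + 1) = ∫ t in (-1)..1, aB d t := by
  have := sl_ball (0 : Fin (d + 1)) (h := fun _ => 1) continuous_const
  rw [setIntegral_const, smul_eq_mul, mul_one] at this
  rw [om, this, intervalIntegral.integral_of_le (by norm_num), integral_Ioc_eq_integral_Ioo]
  simp

lemma bF_ex (d : ℕ) : ∃ F Q : ℝ → ℝ, (∀ t, HasDerivAt F (aB d t + max 0 (t ^ 2 - 1)) t) ∧ StrictMono F ∧ Continuous Q ∧ (∀ y, F (Q y) = y) ∧
    (∀ t, |t| ≤ 1 → F t = ∫ u in (-1)..t, aB d u) := by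
  set w : ℝ → ℝ := fun t => aB d t + max 0 (t ^ 2 - 1) with hw
  have hwc : Continuous w := (aB_cont d).add (by fun_prop)
  have hw0 : ∀ t, 0 ≤ w t := fun t => add_nonneg (aB_nn d t) (le_max_left _ _)
  have hii : ∀ a b, IntervalIntegrable w volume a b := fun a b => hwc.intervalIntegrable a b
  have hi2 : ∀ a b : ℝ, IntervalIntegrable (fun u : ℝ => u ^ 2 - 1) volume a b := fun a b => Continuous.intervalIntegrable (by fun_prop) a b
  have hw1 : ∀ t, t ^ 2 - 1 ≤ w t := fun t => (le_max_right _ _).trans (le_add_of_nonneg_left (aB_nn d t))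
  have hwp : ∀ t, t ^ 2 ≠ 1 → 0 < w t := fun t ht => by
    rcases lt_or_gt_of_ne ht with h | h
    · exact add_pos_of_pos_of_nonneg (aB_pos d ((sq_lt_one_iff_abs_lt_one t).1 h)) (le_max_left _ _)
    · exact (sub_pos.2 h).trans_le (hw1 t)
  set F : ℝ → ℝ := fun t => ∫ u in (-1)..t, w u with hF
  have hd : ∀ t, HasDerivAt F (w t) t := fun t => intervalIntegral.integral_hasDerivAt_right (hii _ _) (hwc.stronglyMeasurableAtFilter _ _) hwc.continuousAt
  have hFc : Continuous F := continuous_iff_continuousAt.2 fun t => (hd t).continuousAt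
  have hsm : StrictMono F := fun x y hxy => by
    have h1 : F y - F x = ∫ u in x..y, w u := intervalIntegral.integral_interval_sub_left (hii _ _) (hii _ _)
    have : 0 < ∫ u in x..y, w u := by
      refine intervalIntegral.integral_pos hxy hwc.continuousOn (fun u _ => hw0 u) ?_
      by_cases a : x ^ 2 = 1
      · by_cases b : y ^ 2 = 1
        · exact ⟨(x + y) / 2, ⟨by linarith, by linarith⟩, hwp _ fun h => by nlinarith [sq_pos_of_pos (sub_pos.2 hxy)]⟩
        · exact ⟨y, ⟨hxy.le, le_rfl⟩, hwp _ b⟩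
      · exact ⟨x, ⟨le_rfl, hxy.le⟩, hwp _ a⟩
    linarith
  have hp : ∀ a b : ℝ, ∫ u in a..b, (u ^ 2 - 1) = (b ^ 3 - a ^ 3) / 3 - (b - a) := fun a b => by
    rw [intervalIntegral.integral_sub (Continuous.intervalIntegrable (by fun_prop) _ _) (Continuous.intervalIntegrable (by fun_prop) _ _), integral_pow, intervalIntegral.integral_const]; norm_num
  have hsur : Function.Surjective F := fun y => by
    refine mem_range_of_exists_le_of_exists_ge hFc ⟨-(|y| + 3), ?_⟩ ⟨|y| + 3, ?_⟩
    · have : ∫ u in (-(|y| + 3))..(-1), (u ^ 2 - 1) ≤ ∫ u in (-(|y| + 3))..(-1), w u :=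
        intervalIntegral.integral_mono (by linarith [abs_nonneg y]) (hi2 _ _) (hii _ _) hw1
      rw [hp] at this
      simp only [hF]
      rw [intervalIntegral.integral_symm]
      nlinarith [neg_abs_le y, abs_nonneg y, sq_nonneg |y|, mul_nonneg (sq_nonneg |y|) (abs_nonneg y)]
    · have : ∫ u in (-1)..(|y| + 3), (u ^ 2 - 1) ≤ F (|y| + 3) :=
        intervalIntegral.integral_mono (by linarith [abs_nonneg y]) (hi2 _ _) (hii _ _) hw1
      rw [hp] at this
      nlinarith [le_abs_self y, abs_nonneg y, sq_nonneg |y|, mul_nonneg (sq_nonneg |y|) (abs_nonneg y)]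
  refine ⟨F, (hsm.orderIsoOfSurjective F hsur).symm, hd, hsm, OrderIso.continuous _, fun y => ?_, fun t ht => ?_⟩
  · exact (hsm.orderIsoOfSurjective F hsur).apply_symm_apply y
  · refine intervalIntegral.integral_congr fun u hu => ?_
    rw [abs_le] at ht
    rw [uIcc_of_le ht.1] at hu
    simp only [hw]
    rw [max_eq_left, add_zero]
    nlinarith [hu.1, hu.2]

lemma tr_ex (d : ℕ) {a : ℝ → ℝ} (ha : Continuous a) (ha0 : ∀ s, 0 ≤ a s) (hai : Integrable a) {c ε : ℝ} (hc : 0 < c) (hε : 0 < ε)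
    (hk : ε + c * (∫ s, a s) < om (d + 1)) : ∃ T : ℝ → ℝ, (∀ s, |T s| < 1) ∧ Continuous T ∧ (∀ s, HasDerivAt T (c * a s / aB d (T s)) s) ∧
      (∀ s, ∫ u in (-1)..(T s), aB d u = ε + c * ∫ u in Iic s, a u) := by
  obtain ⟨F, Q, hd, hsm, hQ, hFQ, hF⟩ := bF_ex d
  set P : ℝ → ℝ := fun s => ε + c * ∫ u in Iic s, a u with hP
  have hPd : ∀ s, HasDerivAt P (c * a s) s := fun s => by
    have h1 : ∀ s, (∫ u in Iic s, a u) = (∫ u in Iic 0, a u) + ∫ u in (0)..s, a u := fun s => by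
      have := intervalIntegral.integral_Iic_sub_Iic (μ := volume) (f := a) (a := 0) (b := s) hai.integrableOn hai.integrableOn
      linarith
    have : P = fun s => ε + c * ((∫ u in Iic 0, a u) + ∫ u in (0)..s, a u) := funext fun s => by simp only [hP]; rw [h1]
    rw [this]
    exact (((intervalIntegral.integral_hasDerivAt_right (ha.intervalIntegrable _ _) (ha.stronglyMeasurableAtFilter _ _) ha.continuousAt).const_add _).const_mul c).const_add ε
  have hPc : Continuous P := continuous_iff_continuousAt.2 fun t => (hPd t).continuousAt
  have h0 : ∀ s, 0 < P s := fun s => add_pos_of_pos_of_nonneg hε (mul_nonneg hc.le (integral_nonneg ha0))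
  have h1 : ∀ s, P s < om (d + 1) := fun s => by
    refine lt_of_le_of_lt ?_ hk
    have := setIntegral_le_integral (s := Iic s) hai (.of_forall ha0)
    simp only [hP]; gcongr
  have hF0 : F (-1) = 0 := by rw [hF _ (by norm_num), intervalIntegral.integral_same]
  have hF1 : F 1 = om (d + 1) := by rw [hF _ (by norm_num), om_succ]
  have hT1 : ∀ s, |Q (P s)| < 1 := fun s => by
    rw [abs_lt, ← hsm.lt_iff_lt (a := -1), ← hsm.lt_iff_lt (b := 1), hFQ, hF0, hF1]; exact ⟨h0 s, h1 s⟩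
  refine ⟨fun s => Q (P s), hT1, hQ.comp hPc, fun s => ?_, fun s => by rw [← hF _ (hT1 s).le, hFQ]⟩
  have h2 := hd (Q (P s))
  have h3 : max 0 (Q (P s) ^ 2 - 1) = 0 := max_eq_left (by have := (sq_lt_one_iff_abs_lt_one _).2 (hT1 s); linarith)
  rw [h3, add_zero] at h2
  have h4 := HasDerivAt.of_local_left_inverse (f := F) (g := Q) hQ.continuousAt h2 (aB_pos d (hT1 s)).ne' (.of_forall hFQ)
  have := h4.comp s (hPd s)
  rwa [inv_mul_eq_div] at this

def Sb (d : ℕ) : Prop := ∀ g : EE d → ℝ, ContDiff ℝ 1 g → HasCompactSupport g → (∀ x, 0 ≤ g x) →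
  d * om d ^ (1 / (d : ℝ)) * (∫ x, g x ^ (1 + 1 / (d : ℝ))) ≤ (∫ x, ‖fderiv ℝ g x‖) * (∫ x, g x) ^ (1 / (d : ℝ))

lemma sl_alg {d : ℕ} (hd : 1 ≤ d) {A a D t c : ℝ} (hA : 0 ≤ A) (ha : 0 ≤ a) (hD : 0 ≤ D) (ht : |t| < 1) (hc : 0 < c) (hc1 : c ≤ 1)
    (hS : d * om d ^ (1 / (d : ℝ)) * a ≤ D * A ^ (1 / (d : ℝ))) :
    c * (a * ((d + 1) + (√(A / aB d t) - 1) ^ 2)) ≤ c * a / aB d t * A + √(1 - t ^ 2) * D := by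
  have hd0 : (0 : ℝ) < d := by exact_mod_cast hd
  have ho := om_pos d
  have hB := aB_pos d ht
  set r := √(1 - t ^ 2) with hr
  have hr0 : 0 ≤ r := Real.sqrt_nonneg _
  rcases hA.eq_or_lt with h | h
  · rw [← h, Real.zero_rpow (by positivity), mul_zero] at hS
    have : 0 < d * om d ^ (1 / (d : ℝ)) := by positivity
    have a0 : a = 0 := le_antisymm (by by_contra hh; push Not at hh; nlinarith [mul_pos this hh]) ha
    rw [← h, a0]; simp; positivity
  · set l := A / aB d t with hl
    have hl0 : 0 < l := by positivity
    have e1 : aB d t ^ (1 / (d : ℝ)) = om d ^ (1 / (d : ℝ)) * r := by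
      rw [aB, Real.mul_rpow ho.le (by positivity), one_div, Real.pow_rpow_inv_natCast hr0 (by omega)]
    have e2 : (l⁻¹) ^ (1 / (d : ℝ)) * A ^ (1 / (d : ℝ)) = aB d t ^ (1 / (d : ℝ)) := by
      rw [← Real.mul_rpow (by positivity) h.le, hl]; congr 1; field_simp
    have hAp : 0 < A ^ (1 / (d : ℝ)) := by positivity
    have e3 : d * a * (l⁻¹) ^ (1 / (d : ℝ)) ≤ r * D := by
      rw [← mul_le_mul_iff_left₀ hAp, mul_assoc, e2, e1]
      nlinarith
    have e4 : 1 - Real.log l / d ≤ (l⁻¹) ^ (1 / (d : ℝ)) := by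
      rw [Real.rpow_def_of_pos (by positivity), Real.log_inv]
      have := Real.add_one_le_exp (-Real.log l * (1 / d))
      calc _ = -Real.log l * (1 / d) + 1 := by ring
        _ ≤ _ := this
    have e5 : Real.log l ≤ 2 * (√l - 1) := by
      have := Real.log_le_sub_one_of_pos (Real.sqrt_pos.2 hl0)
      rw [Real.log_sqrt hl0.le] at this; linarith
    have e6 : (d : ℝ) - Real.log l ≤ d * (l⁻¹) ^ (1 / (d : ℝ)) := by
      have := mul_le_mul_of_nonneg_left e4 hd0.le
      rwa [mul_sub, mul_one, mul_div_cancel₀ _ hd0.ne'] at this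
    have e7 : (d + 1) + (√l - 1) ^ 2 ≤ l + d * (l⁻¹) ^ (1 / (d : ℝ)) := by
      have := Real.sq_sqrt hl0.le; nlinarith
    have e8 : c * a / aB d t * A = c * (a * l) := by rw [hl]; ring
    rw [e8]
    have e9 := mul_le_mul_of_nonneg_left e7 ha
    have e10 : 0 ≤ d * a * (l⁻¹) ^ (1 / (d : ℝ)) := by positivity
    have := mul_le_mul_of_nonneg_left e9 hc.le
    nlinarith

lemma pw_able {n : ℕ} {g : EE n → ℝ} (hg : Continuous g) (hs : HasCompactSupport g) {p : ℝ} (hp : 0 < p) :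
    Continuous (fun x => g x ^ p) ∧ HasCompactSupport (fun x => g x ^ p) ∧ Integrable (fun x => g x ^ p) := by
  have h1 : Continuous (fun x => g x ^ p) := hg.rpow_const fun _ => Or.inr hp.le
  have h2 : HasCompactSupport (fun x => g x ^ p) := cs_of hs fun x hx => by rw [hx, Real.zero_rpow hp.ne']
  exact ⟨h1, h2, h1.integrable_of_hasCompactSupport h2⟩

lemma sl_main {d : ℕ} (hd : 1 ≤ d) (hS : Sb d) (i : Fin (d + 1)) {g : EE (d + 1) → ℝ} (hg : ContDiff ℝ 1 g) (hs : HasCompactSupport g)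
    (h0 : ∀ x, 0 ≤ g x) {c : ℝ} (hc : 0 < c) (hc1 : c ≤ 1) {a : ℝ → ℝ} (ha : a = fun s => ∫ x, g (ins i s x) ^ (1 + 1 / (d : ℝ)))
    (hcM : c * (∫ x, g x ^ (1 + 1 / (d : ℝ))) < om (d + 1)) :
    ∃ T : ℝ → ℝ, (∀ s, |T s| < 1) ∧ Continuous T ∧ (∀ s, HasDerivAt T (c * a s / aB d (T s)) s) ∧
      (∀ s, ∫ u in (-1)..(T s), aB d u = (om (d + 1) - c * (∫ x, g x ^ (1 + 1 / (d : ℝ)))) / 2 + c * ∫ u in Iic s, a u) ∧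
      Integrable (fun s => a s * (√((∫ x, g (ins i s x)) / aB d (T s)) - 1) ^ 2) ∧
      c * ((d + 1) * (∫ x, g x ^ (1 + 1 / (d : ℝ))) + ∫ s, a s * (√((∫ x, g (ins i s x)) / aB d (T s)) - 1) ^ 2) ≤ ∫ x, ‖fderiv ℝ g x‖ := by
  obtain ⟨pc, ps, pi⟩ := pw_able hg.continuous hs (p := 1 + 1 / (d : ℝ)) (by positivity)
  set M := ∫ x, g x ^ (1 + 1 / (d : ℝ)) with hM
  have hMa : M = ∫ s, a s := by rw [hM, ha, ins_int i pi]
  obtain ⟨ac, as⟩ := sl_cont i pc ps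
  obtain ⟨Ac, As⟩ := sl_cont i hg.continuous hs
  rw [← ha] at ac as
  have ai : Integrable a := ac.integrable_of_hasCompactSupport as
  have ha0 : ∀ s, 0 ≤ a s := fun s => by rw [ha]; exact integral_nonneg fun x => Real.rpow_nonneg (h0 _) _
  obtain ⟨T, T1, Tc, Td, TF⟩ := tr_ex d ac ha0 ai (c := c) (ε := (om (d + 1) - c * M) / 2) hc (by linarith) (by rw [← hMa]; linarith)
  have Bc : Continuous (fun s => aB d (T s)) := (aB_cont d).comp Tc
  have Tc' : Continuous (fun s => c * a s / aB d (T s)) := (by fun_prop : Continuous fun s => c * a s).div Bc fun s => (aB_pos d (T1 s)).ne'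
  have lc : Continuous (fun s => (∫ x, g (ins i s x)) / aB d (T s)) := Ac.div Bc fun s => (aB_pos d (T1 s)).ne'
  have qi : Integrable (fun s => a s * (√((∫ x, g (ins i s x)) / aB d (T s)) - 1) ^ 2) := by
    refine Continuous.integrable_of_hasCompactSupport (by fun_prop) (cs_of as fun s hs => by rw [hs, zero_mul])
  refine ⟨T, T1, Tc, Td, TF, qi, ?_⟩
  obtain ⟨k1, k2⟩ := sl_ineq i hg hs Td Tc' fun s => (T1 s).le
  refine le_trans (le_of_eq ?_) (le_trans (integral_mono (f := fun s => c * (a s * ((d + 1) + (√((∫ x, g (ins i s x)) / aB d (T s)) - 1) ^ 2))) ?_ ?_ fun s => ?_) k2)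
  · rw [integral_const_mul]; congr 1
    rw [integral_congr_ae (.of_forall fun s => mul_add (a s) _ _), integral_add (ai.mul_const _) qi, integral_mul_const, ← hMa]; ring
  · exact (((ai.mul_const ((d : ℝ) + 1)).fun_add qi).congr (.of_forall fun s => (mul_add (a s) _ _).symm)).const_mul c
  · exact ((Tc'.mul Ac).integrable_of_hasCompactSupport As.mul_left).fun_add k1
  · have := hS _ (sl_fd i hg s).1 (sl_cs i hs s) (fun x => h0 _)
    refine sl_alg hd (integral_nonneg fun x => h0 _) (ha0 s) (integral_nonneg fun x => norm_nonneg _) (T1 s) hc hc1 ?_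
    rw [ha]; exact this

lemma sob_of {d : ℕ} (hd : 1 ≤ d) (hS : Sb d) {g : EE (d + 1) → ℝ} (hg : ContDiff ℝ 1 g) (hs : HasCompactSupport g)
    (h0 : ∀ x, 0 ≤ g x) : (d + 1) * om (d + 1) ^ (1 / ((d : ℝ) + 1)) * (∫ x, g x ^ (1 + 1 / (d : ℝ))) ^ ((d : ℝ) / (d + 1)) ≤ ∫ x, ‖fderiv ℝ g x‖ := by
  have hd0 : (0 : ℝ) < d := by exact_mod_cast hd
  set M := ∫ x, g x ^ (1 + 1 / (d : ℝ)) with hM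
  have ho := om_pos (d + 1)
  set κ := om (d + 1)
  have hM0 : 0 ≤ M := integral_nonneg fun x => Real.rpow_nonneg (h0 _) _
  rcases hM0.eq_or_lt with h | h
  · rw [← h, Real.zero_rpow (by positivity), mul_zero]; exact integral_nonneg fun x => norm_nonneg _
  set t := (κ / M) ^ ((d : ℝ) / (d + 1)) with ht
  have ht0 : 0 < t := by positivity
  have htp : t ^ (1 + 1 / (d : ℝ)) = κ / M := by
    rw [ht, ← Real.rpow_mul (by positivity)]
    convert Real.rpow_one _ using 2; field_simp
  have e1 : ∫ x, (t * g x) ^ (1 + 1 / (d : ℝ)) = κ := by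
    simp_rw [Real.mul_rpow ht0.le (h0 _)]
    rw [integral_const_mul, htp, ← hM]; field_simp
  have e2 : ∀ x, fderiv ℝ (fun x => t * g x) x = t • fderiv ℝ g x := fun x => fderiv_const_mul (hg.differentiable one_ne_zero x) t
  have key : ∀ c : ℝ, 0 < c → c < 1 → c * ((d + 1) * κ) ≤ t * ∫ x, ‖fderiv ℝ g x‖ := by
    intro c hc hc1
    obtain ⟨T, -, -, -, -, -, h⟩ := sl_main hd hS 0 (g := fun x => t * g x) (contDiff_const.mul hg) hs.mul_left (fun x => mul_nonneg ht0.le (h0 x)) hc hc1.le rfl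
      (by rw [e1]; nlinarith)
    rw [e1] at h
    simp only [e2, norm_smul, Real.norm_of_nonneg ht0.le] at h
    rw [integral_const_mul] at h
    refine le_trans ?_ h
    refine mul_le_mul_of_nonneg_left (le_add_of_nonneg_right (integral_nonneg fun s => mul_nonneg (integral_nonneg fun x => ?_) (sq_nonneg _))) hc.le
    exact Real.rpow_nonneg (mul_nonneg ht0.le (h0 _)) _
  have k2 : (d + 1) * κ ≤ t * ∫ x, ‖fderiv ℝ g x‖ := by
    set Y := t * ∫ x, ‖fderiv ℝ g x‖ with hY
    have hY0 : 0 ≤ Y := mul_nonneg ht0.le (integral_nonneg fun x => norm_nonneg _)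
    have hX : 0 < (d + 1) * κ := by positivity
    set X := (d + 1) * κ
    by_contra hh; push Not at hh
    have h1 := key ((Y / X + 1) / 2) (by positivity) (by have := (div_lt_one hX).2 hh; linarith)
    have h2 : (Y / X + 1) / 2 * X = (Y + X) / 2 := by field_simp
    linarith
  have e3 : κ ^ (1 / ((d : ℝ) + 1)) * M ^ ((d : ℝ) / (d + 1)) * t = κ := by
    rw [mul_assoc, ht, ← Real.mul_rpow h.le (by positivity), mul_div_cancel₀ _ h.ne', ← Real.rpow_add ho]
    convert Real.rpow_one _ using 2; field_simp; ring
  rw [← mul_le_mul_iff_right₀ ht0]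
  nlinarith

lemma sb_succ {d : ℕ} (hd : 1 ≤ d) (hS : Sb d) : Sb (d + 1) := by
  intro g hg hs h0
  have hd0 : (0 : ℝ) < d := by exact_mod_cast hd
  have h1 := sob_of hd hS hg hs h0
  have ho := om_pos (d + 1)
  set p : ℝ := 1 + 1 / (d : ℝ) with hp
  have hpq : p.HolderConjugate ((d : ℝ) + 1) := by
    rw [Real.holderConjugate_iff]; constructor
    · rw [hp]; have : 0 < 1 / (d : ℝ) := by positivity
      linarith
    · rw [hp]; field_simp
  obtain ⟨-, -, pi⟩ := pw_able hg.continuous hs (p := p) (by rw [hp]; positivity)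
  have gi : Integrable g := hg.continuous.integrable_of_hasCompactSupport hs
  have hc2 : Continuous (fun x => g x ^ (1 / ((d : ℝ) + 1))) := hg.continuous.rpow_const fun _ => Or.inr (by positivity)
  have hh := integral_mul_le_Lp_mul_Lq_of_nonneg hpq (μ := (volume : Measure (EE (d + 1)))) (f := g) (g := fun x => g x ^ (1 / ((d : ℝ) + 1)))
    (.of_forall h0) (.of_forall fun x => Real.rpow_nonneg (h0 x) _) ?_ ?_
  · have e1 : ∀ x, (g x ^ (1 / ((d : ℝ) + 1))) ^ ((d : ℝ) + 1) = g x := fun x => by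
      rw [← Real.rpow_mul (h0 x), one_div_mul_cancel (by positivity), Real.rpow_one]
    have e2 : ∀ x, g x * g x ^ (1 / ((d : ℝ) + 1)) = g x ^ (1 + 1 / ((d : ℝ) + 1)) := fun x => by
      rw [Real.rpow_add_of_nonneg (h0 x) zero_le_one (by positivity), Real.rpow_one]
    simp only [e1, e2] at hh
    have e3 : 1 / p = (d : ℝ) / (d + 1) := by rw [hp]; field_simp
    rw [e3] at hh
    push_cast
    refine (mul_le_mul_of_nonneg_left hh (by positivity)).trans ?_
    rw [← mul_assoc]
    exact mul_le_mul_of_nonneg_right h1 (Real.rpow_nonneg (integral_nonneg h0) _)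
  · exact hg.continuous.memLp_of_hasCompactSupport hs
  · exact hc2.memLp_of_hasCompactSupport (cs_of hs fun x hx => by simp only [hx]; exact Real.zero_rpow (by positivity))

lemma sb_one : Sb 1 := by
  intro g hg hs h0
  have ho := om_pos 1
  have o0 : volume.real (univ : Set (EE 0)) = 1 := by
    rw [measureReal_def, ← (PiLp.volume_preserving_toLp (Fin 0)).measure_preimage MeasurableSet.univ.nullMeasurableSet, preimage_univ, volume_pi, Measure.pi_of_empty, Measure.dirac_apply_of_mem (mem_univ _), ENNReal.toReal_one]
  have i0 : ∀ f : EE 0 → ℝ, ∫ x, f x = f 0 := fun f => by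
    have : f = fun _ => f 0 := funext fun x => by rw [Subsingleton.elim x 0]
    rw [this, integral_const, o0, one_smul]
  have a0 : ∀ t, aB 0 t = 1 := fun t => by
    have : ball (0 : EE 0) 1 = univ := by ext x; rw [Subsingleton.elim x 0]; simp
    rw [aB, om, this, o0]; simp
  have gi : Integrable g := hg.continuous.integrable_of_hasCompactSupport hs
  obtain ⟨-, -, pi⟩ := pw_able hg.continuous hs (p := 2) (by norm_num)
  obtain ⟨Ac, As⟩ := sl_cont 0 hg.continuous hs
  have e1 := ins_int 0 gi
  have e2 := ins_int 0 pi
  simp only [i0] at e1 e2 Ac As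
  have hX0 : 0 ≤ ∫ x, g x ^ (2 : ℝ) := integral_nonneg fun x => Real.rpow_nonneg (h0 x) _
  have hM0 : 0 ≤ ∫ x, g x := integral_nonneg h0
  have hD0 : 0 ≤ ∫ x, ‖fderiv ℝ g x‖ := integral_nonneg fun x => norm_nonneg _
  have key : ∀ c : ℝ, 0 < c → c * (∫ x, g x) < om 1 → c * (∫ x, g x ^ (2 : ℝ)) ≤ ∫ x, ‖fderiv ℝ g x‖ := by
    intro c hc hcM
    obtain ⟨T, T1, Tc, Td, -⟩ := tr_ex 0 Ac (fun s => h0 _) (Ac.integrable_of_hasCompactSupport As) (c := c) (ε := (om 1 - c * ∫ x, g x) / 2) hc (by linarith)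
      (by rw [← e1]; show _ / 2 + c * ∫ x : EE 1, g x < om 1; linarith)
    simp only [a0, div_one] at Td
    obtain ⟨k1, k2⟩ := sl_ineq 0 hg hs Td (Ac.const_mul c) fun s => (T1 s).le
    refine le_trans ?_ k2
    have k3 : Integrable (fun s => c * g (ins 0 s 0) * g (ins 0 s 0)) :=
      ((Ac.const_mul c).mul Ac).integrable_of_hasCompactSupport As.mul_left
    simp only [i0] at k1 ⊢
    rw [e2, ← integral_const_mul]
    have e4 : ∀ s, c * g (ins 0 s 0) ^ (2 : ℝ) = c * g (ins 0 s 0) * g (ins 0 s 0) := fun s => by rw [Real.rpow_two]; ring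
    simp only [e4]
    refine integral_mono k3 (k3.fun_add k1) fun s => ?_
    exact le_add_of_nonneg_right (by positivity)
  have e9 : (1 : ℝ) + 1 = 2 := by norm_num
  simp only [e9, Nat.cast_one, div_one, Real.rpow_one, one_mul]
  set X := ∫ x, g x ^ (2 : ℝ)
  set M := ∫ x, g x
  set D := ∫ x, ‖fderiv ℝ g x‖
  by_contra hh; push Not at hh
  have hX : 0 < X := by
    rcases hX0.eq_or_lt with h | h
    · rw [← h, mul_zero] at hh; nlinarith
    · exact h
  rcases hM0.eq_or_lt with h | h
  · have := key ((D + 1) / X) (by positivity) (by rw [← h, mul_zero]; exact ho)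
    rw [div_mul_cancel₀ _ hX.ne'] at this; linarith
  · have h1 : D / X < om 1 / M := by rw [div_lt_div_iff₀ hX h]; exact hh
    have h2 := key ((D / X + om 1 / M) / 2) (by positivity) (by
      calc _ < om 1 / M * M := mul_lt_mul_of_pos_right (by linarith) h
        _ = _ := div_mul_cancel₀ _ h.ne')
    have h3 : D / X * X < (D / X + om 1 / M) / 2 * X := mul_lt_mul_of_pos_right (by linarith) hX
    rw [div_mul_cancel₀ _ hX.ne'] at h3; linarith

lemma sb_all {d : ℕ} (hd : 1 ≤ d) : Sb d := by
  induction d, hd using Nat.le_induction with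
  | base => exact sb_one
  | succ d hd ih => exact sb_succ hd ih

def AD {n : ℕ} (g : EE n → ℝ) : Prop := ContDiff ℝ 1 g ∧ HasCompactSupport g ∧ (∀ x, 0 ≤ g x) ∧ ∀ x, g x ≤ 1

noncomputable def Kd (d : ℕ) : ℝ := (d + 1) * om (d + 1) ^ (1 / ((d : ℝ) + 1))

lemma Kd_pos (d : ℕ) : 0 < Kd d := by have := om_pos (d + 1); unfold Kd; positivity

lemma st_bd : ∃ C : ℝ, 0 < C ∧ ∀ t, |deriv Real.smoothTransition t| ≤ C * (Icc 0 1).indicator 1 t := by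
  have hc : Continuous (deriv Real.smoothTransition) := (Real.smoothTransition.contDiff (n := 1)).continuous_deriv le_rfl
  obtain ⟨C, hC⟩ := (isCompact_Icc (a := (0 : ℝ)) (b := 1)).exists_bound_of_continuousOn hc.continuousOn
  refine ⟨max C 1, by positivity, fun t => ?_⟩
  by_cases h : t ∈ Icc (0 : ℝ) 1
  · rw [indicator_of_mem h, Pi.one_apply, mul_one]; exact (hC t h).trans (le_max_left _ _)
  · rw [indicator_of_notMem h, mul_zero, abs_nonpos_iff]
    rcases lt_or_ge t 0 with h0 | h0
    · have : Real.smoothTransition =ᶠ[nhds t] fun _ => 0 := by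
        filter_upwards [Iio_mem_nhds h0] with u hu using Real.smoothTransition.zero_of_nonpos (le_of_lt hu)
      rw [this.deriv_eq, deriv_const]
    · have : Real.smoothTransition =ᶠ[nhds t] fun _ => 1 := by
        filter_upwards [Ioi_mem_nhds (lt_of_not_ge fun h1 => h ⟨h0, h1⟩)] with u hu using Real.smoothTransition.one_of_one_le (le_of_lt hu)
      rw [this.deriv_eq, deriv_const]

lemma ramp : ∃ C : ℝ, 0 < C ∧ ∀ (n : ℕ) (l : EE n → ℝ), ContDiff ℝ 1 l → (∀ x, ‖fderiv ℝ l x‖ ≤ 1) → ∀ s h : ℝ, 0 < h →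
    ∃ q : EE n → ℝ, ContDiff ℝ 1 q ∧ (∀ x, 0 ≤ q x) ∧ (∀ x, q x ≤ 1) ∧ (∀ x, l x ≤ s → q x = 1) ∧ (∀ x, s + h ≤ l x → q x = 0) ∧
      ∀ x, ‖fderiv ℝ q x‖ ≤ C / h * (Icc s (s + h)).indicator 1 (l x) := by
  obtain ⟨C, hC, hb⟩ := st_bd
  refine ⟨C, hC, fun n l hl hl1 s h hh => ⟨fun x => 1 - Real.smoothTransition ((l x - s) / h), ?_, fun x => ?_, fun x => ?_, fun x hx => ?_, fun x hx => ?_, fun x => ?_⟩⟩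
  · exact contDiff_const.sub ((Real.smoothTransition.contDiff (n := 1)).comp ((hl.sub contDiff_const).div_const h))
  · linarith [Real.smoothTransition.le_one ((l x - s) / h)]
  · linarith [Real.smoothTransition.nonneg ((l x - s) / h)]
  · beta_reduce; rw [Real.smoothTransition.zero_of_nonpos (div_nonpos_of_nonpos_of_nonneg (by linarith) hh.le), sub_zero]
  · beta_reduce; rw [Real.smoothTransition.one_of_one_le ((one_le_div hh).2 (by linarith)), sub_self]
  · have d1 : HasFDerivAt (fun x => (l x - s) / h) (h⁻¹ • fderiv ℝ l x) x := by
      simpa only [div_eq_mul_inv] using (((hl.differentiable one_ne_zero x).hasFDerivAt.sub_const s).mul_const h⁻¹)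
    have d2 := ((Real.smoothTransition.contDiff (n := 1)).differentiable one_ne_zero ((l x - s) / h)).hasDerivAt
    have d3 := (d2.comp_hasFDerivAt x d1).const_sub 1
    have d4 : fderiv ℝ (fun x => 1 - Real.smoothTransition ((l x - s) / h)) x = _ := d3.fderiv
    rw [d4, norm_neg, norm_smul, norm_smul, Real.norm_eq_abs, norm_inv, Real.norm_of_nonneg hh.le]
    have e : (Icc (0 : ℝ) 1).indicator (1 : ℝ → ℝ) ((l x - s) / h) = (Icc s (s + h)).indicator 1 (l x) := by
      have : (l x - s) / h ∈ Icc (0 : ℝ) 1 ↔ l x ∈ Icc s (s + h) := by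
        rw [mem_Icc, mem_Icc, le_div_iff₀ hh, div_le_one hh, zero_mul, sub_nonneg, sub_le_iff_le_add']
      by_cases h1 : l x ∈ Icc s (s + h)
      · rw [indicator_of_mem h1, indicator_of_mem (this.2 h1)]; rfl
      · rw [indicator_of_notMem h1, indicator_of_notMem fun h2 => h1 (this.1 h2)]
    have := hb ((l x - s) / h)
    rw [e] at this
    refine (mul_le_mul this (mul_le_of_le_one_right (by positivity) (hl1 x)) (by positivity) ((abs_nonneg _).trans this)).trans (le_of_eq ?_)
    ring

lemma cut : ∃ C : ℝ, 0 < C ∧ ∀ (d : ℕ), 1 ≤ d → ∀ g : EE (d + 1) → ℝ, AD g → ∀ l : EE (d + 1) → ℝ, ContDiff ℝ 1 l → (∀ x, ‖fderiv ℝ l x‖ ≤ 1) →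
    ∀ s h : ℝ, 0 < h → ∃ q : EE (d + 1) → ℝ, AD (fun x => g x * q x) ∧ Continuous q ∧ (∀ x, 0 ≤ q x) ∧ (∀ x, q x ≤ 1) ∧ (∀ x, l x ≤ s → q x = 1) ∧ (∀ x, s + h ≤ l x → q x = 0) ∧
      (∫ x, ‖fderiv ℝ (fun x => g x * q x) x‖) + Kd d * (∫ x, (g x * (1 - q x)) ^ (1 + 1 / (d : ℝ))) ^ ((d : ℝ) / (d + 1)) ≤
        (∫ x, ‖fderiv ℝ g x‖) + C / h * ∫ x, g x * (Icc s (s + h)).indicator 1 (l x) := by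
  obtain ⟨C, hC, hr⟩ := ramp
  refine ⟨2 * C, by positivity, fun d hd g ⟨hg, hs, h0, h1⟩ l hl hl1 s h hh => ?_⟩
  obtain ⟨q, q1, q2, q3, q4, q5, q6⟩ := hr _ l hl hl1 s h hh
  have hgq : ContDiff ℝ 1 (fun x => g x * q x) := hg.mul q1
  have hgr : ContDiff ℝ 1 (fun x => g x * (1 - q x)) := hg.mul (contDiff_const.sub q1)
  have sgq : HasCompactSupport (fun x => g x * q x) := hs.mul_right
  have sgr : HasCompactSupport (fun x => g x * (1 - q x)) := hs.mul_right
  refine ⟨q, ⟨hgq, sgq, fun x => mul_nonneg (h0 x) (q2 x), fun x => mul_le_one₀ (h1 x) (q2 x) (q3 x)⟩, q1.continuous, q2, q3, q4, q5, ?_⟩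
  have hS := sob_of hd (sb_all hd) hgr sgr fun x => mul_nonneg (h0 x) (by linarith [q3 x])
  have ai : ∀ f : EE (d + 1) → ℝ, ContDiff ℝ 1 f → HasCompactSupport f → Integrable (fun x => ‖fderiv ℝ f x‖) := fun f hf hfs =>
    ((hf.continuous_fderiv one_ne_zero).integrable_of_hasCompactSupport (hfs.fderiv (𝕜 := ℝ))).norm
  have gi : Integrable g := hg.continuous.integrable_of_hasCompactSupport hs
  have ii : Integrable (fun x => g x * (Icc s (s + h)).indicator 1 (l x)) := by
    refine gi.mul_bdd (c := 1) ?_ (.of_forall fun x => ?_)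
    · exact ((measurable_const.indicator measurableSet_Icc).comp hl.continuous.measurable).aestronglyMeasurable
    · rw [indicator_apply]; split_ifs <;> simp
  refine (add_le_add_right hS _).trans ?_
  rw [← integral_add (ai _ hgq sgq) (ai _ hgr sgr), ← integral_const_mul, ← integral_add (ai _ hg hs) (ii.const_mul _)]
  refine integral_mono ((ai _ hgq sgq).add (ai _ hgr sgr)) ((ai _ hg hs).add (ii.const_mul _)) fun x => ?_
  have dg := (hg.differentiable one_ne_zero x).hasFDerivAt
  have dq := (q1.differentiable one_ne_zero x).hasFDerivAt
  have e1 : fderiv ℝ (fun x => g x * q x) x = _ := (dg.mul dq).fderiv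
  have e2 : fderiv ℝ (fun x => g x * (1 - q x)) x = _ := (dg.mul (dq.const_sub 1)).fderiv
  simp only [e1, e2]
  have n1 := norm_add_le (g x • fderiv ℝ q x) (q x • fderiv ℝ g x)
  have n2 := norm_add_le (g x • -fderiv ℝ q x) ((1 - q x) • fderiv ℝ g x)
  rw [norm_smul, norm_smul, Real.norm_of_nonneg (h0 x), Real.norm_of_nonneg (q2 x)] at n1
  rw [norm_smul, norm_smul, Real.norm_of_nonneg (h0 x), Real.norm_of_nonneg (by linarith [q3 x] : 0 ≤ 1 - q x), norm_neg] at n2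
  have n3 := mul_le_mul_of_nonneg_left (q6 x) (h0 x)
  calc _ ≤ ‖fderiv ℝ g x‖ + 2 * (g x * ‖fderiv ℝ q x‖) := by linarith
    _ ≤ ‖fderiv ℝ g x‖ + 2 * (g x * (C / h * (Icc s (s + h)).indicator 1 (l x))) := by linarith
    _ = _ := by ring

lemma sl_ind {d : ℕ} (i : Fin (d + 1)) {f : EE (d + 1) → ℝ} (hf : Integrable f) {S : Set ℝ} (hS : MeasurableSet S) :
    Integrable (fun x => f x * S.indicator 1 (x i)) ∧ ∫ x, f x * S.indicator 1 (x i) = ∫ s in S, ∫ x, f (ins i s x) := by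
  have ii : Integrable (fun x => f x * S.indicator 1 (x i)) := by
    refine hf.mul_bdd (c := 1) ?_ (.of_forall fun x => ?_)
    · exact ((measurable_const.indicator hS).comp (by fun_prop : Continuous fun x : EE (d + 1) => x i).measurable).aestronglyMeasurable
    · classical rw [indicator_apply]; split_ifs <;> simp
  refine ⟨ii, ?_⟩
  rw [ins_int i ii, ← integral_indicator hS]
  refine integral_congr_ae (.of_forall fun s => ?_)
  classical simp only [ins_same, indicator_apply]
  split_ifs <;> simp

set_option maxHeartbeats 1000000 in
lemma cut_lb {d : ℕ} (hd : 1 ≤ d) {v : ℝ} (hv : 0 < v) (hvk : v < om (d + 1)) : ∃ α > 0, ∃ δ > 0, ∀ g : EE (d + 1) → ℝ, AD g →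
    |(∫ x, g x ^ (1 + 1 / (d : ℝ))) - om (d + 1)| ≤ δ → ∫ x, ‖fderiv ℝ g x‖ ≤ (d + 1) * om (d + 1) + δ → ∀ i s,
      v ≤ (∫ u in Iic s, ∫ x, g (ins i u x) ^ (1 + 1 / (d : ℝ))) → v ≤ (∫ x, g x ^ (1 + 1 / (d : ℝ))) - (∫ u in Iic s, ∫ x, g (ins i u x) ^ (1 + 1 / (d : ℝ))) →
      α ≤ ∫ x, g (ins i s x) := by
  obtain ⟨C, hC, hcut⟩ := cut
  have hd0 : (0 : ℝ) < d := by exact_mod_cast hd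
  set κ := om (d + 1) with hκ
  have hκ0 : 0 < κ := om_pos _
  set q : ℝ := (d : ℝ) / (d + 1) with hq
  have hq0 : 0 < q := by positivity
  have hq1 : q - 1 < 0 := by rw [hq]; field_simp; linarith
  have hk0 := Kd_pos d
  set Γ := Kd d * (κ - v / 2) ^ (q - 1) with hΓ
  have hk' : 0 < κ - v / 2 := by linarith
  have hΓ0 : 0 < Γ := by positivity
  have hγ : 0 < Γ * κ - (d + 1) * κ := by
    have h1 : κ ^ (q - 1) < (κ - v / 2) ^ (q - 1) := Real.rpow_lt_rpow_of_neg hk' (by linarith) hq1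
    have h2 : Kd d * κ ^ (q - 1) = d + 1 := by
      rw [Kd, mul_assoc, ← Real.rpow_add hκ0, (by rw [hq]; field_simp; ring : 1 / ((d : ℝ) + 1) + (q - 1) = 0), Real.rpow_zero, mul_one]
    have h3 := mul_lt_mul_of_pos_left h1 hk0
    rw [h2] at h3
    have := mul_lt_mul_of_pos_right h3 hκ0
    linarith
  set γ := Γ * κ - (d + 1) * κ
  refine ⟨γ / (4 * (C + Γ)), by positivity, min (v / 4) (γ / (4 * (1 + Γ))), by positivity, fun g hAD hM hD i s hV1 hV2 => ?_⟩
  obtain ⟨hg, hs, h0, h1⟩ := hAD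
  by_contra hA; push Not at hA
  set α := γ / (4 * (C + Γ)) with hα
  have hα0 : 0 < α := by positivity
  set p : ℝ := 1 + 1 / (d : ℝ)
  have hp1 : 1 ≤ p := le_add_of_nonneg_right (by positivity)
  obtain ⟨pc, ps, pi⟩ := pw_able hg.continuous hs (p := p) (by linarith)
  obtain ⟨Ac, As⟩ := sl_cont i hg.continuous hs
  obtain ⟨ac, as⟩ := sl_cont i pc ps
  have gi : Integrable g := hg.continuous.integrable_of_hasCompactSupport hs
  obtain ⟨h, hh, hh1, hh2, hhA⟩ : ∃ h > 0, h ≤ 1 ∧ h * α ≤ v / 4 ∧ ∀ u ∈ Icc s (s + h), ∫ x, g (ins i u x) ≤ α := by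
    obtain ⟨e, he, he'⟩ := Metric.eventually_nhds_iff.1 (Ac.continuousAt.eventually_lt (continuousAt_const (x := s)) hA)
    refine ⟨min (min 1 (v / 4 / α)) (e / 2), by positivity, (min_le_left _ _).trans (min_le_left _ _), ?_, fun u hu => (he' ?_).le⟩
    · exact (le_div_iff₀ hα0).1 ((min_le_left _ _).trans (min_le_right _ _))
    · rw [Real.dist_eq, abs_lt]; have := min_le_right (min 1 (v / 4 / α)) (e / 2); constructor <;> linarith [hu.1, hu.2]
  have hle : ∀ u, ∫ x, g (ins i u x) ^ p ≤ ∫ x, g (ins i u x) := fun u =>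
    integral_mono ((pc.comp (by have := ins_cont i; fun_prop)).integrable_of_hasCompactSupport (sl_cs i ps u))
      ((hg.continuous.comp (by have := ins_cont i; fun_prop)).integrable_of_hasCompactSupport (sl_cs i hs u))
      fun x => Real.rpow_le_self_of_le_one (h0 _) (h1 _) hp1
  have hl : ContDiff ℝ 1 (fun x : EE (d + 1) => x i) := by fun_prop
  have hl1 : ∀ x, ‖fderiv ℝ (fun x : EE (d + 1) => x i) x‖ ≤ 1 := fun x => by
    have : fderiv ℝ (fun x : EE (d + 1) => x i) x = EuclideanSpace.proj i := (EuclideanSpace.proj (𝕜 := ℝ) i).hasFDerivAt.fderiv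
    rw [this]
    exact ContinuousLinearMap.opNorm_le_bound _ zero_le_one fun y => by rw [one_mul]; exact PiLp.norm_apply_le y i
  obtain ⟨f, ⟨f1, f2, f3, f4⟩, fc, f0, fl, fs, fh, hF⟩ := hcut d hd g ⟨hg, hs, h0, h1⟩ _ hl hl1 s h hh
  have hS := sob_of hd (sb_all hd) f1 f2 f3
  have bd : ∫ x, g x * (Icc s (s + h)).indicator 1 (x i) ≤ α * h := by
    rw [(sl_ind i gi measurableSet_Icc).2]
    have := setIntegral_mono_on (ins_able i gi).integrableOn (integrableOn_const (C := α) (by simp)) measurableSet_Icc hhA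
    simpa [hh.le, mul_comm] using this
  set V := ∫ u in Iic s, ∫ x, g (ins i u x) ^ p with hVd
  set M := ∫ x, g x ^ p with hMd
  have b1 : V ≤ ∫ x, (g x * f x) ^ p := by
    rw [hVd, ← (sl_ind i pi measurableSet_Iic).2]
    refine integral_mono (sl_ind i pi measurableSet_Iic).1 (pw_able f1.continuous f2 (by linarith)).2.2 fun x => ?_
    classical simp only [indicator_apply, Pi.one_apply]
    split_ifs with hx
    · rw [fs x hx, mul_one, mul_one]
    · rw [mul_zero]; exact Real.rpow_nonneg (f3 x) _
  have b2 : M - V - h * α ≤ ∫ x, (g x * (1 - f x)) ^ p := by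
    have ai := ins_able i pi
    have e1 : M = (∫ u in Iic (s + h), ∫ x, g (ins i u x) ^ p) + ∫ u in Ioi (s + h), ∫ x, g (ins i u x) ^ p := by
      rw [hMd, ins_int i pi, ← compl_Iic, integral_add_compl measurableSet_Iic ai]
    have e2 : (∫ u in Iic (s + h), ∫ x, g (ins i u x) ^ p) = V + ∫ u in Ioc s (s + h), ∫ x, g (ins i u x) ^ p := by
      rw [← Iic_union_Ioc_eq_Iic (by linarith : s ≤ s + h), setIntegral_union (Iic_disjoint_Ioc le_rfl) measurableSet_Ioc ai.integrableOn ai.integrableOn]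
    have e3 : (∫ u in Ioc s (s + h), ∫ x, g (ins i u x) ^ p) ≤ h * α := by
      have := setIntegral_mono_on ai.integrableOn (integrableOn_const (C := α) (by simp)) measurableSet_Ioc fun u hu => (hle u).trans (hhA u (Ioc_subset_Icc_self hu))
      simpa [hh.le, mul_comm] using this
    refine le_trans (b := ∫ u in Ioi (s + h), ∫ x, g (ins i u x) ^ p) (by linarith) ?_
    rw [← (sl_ind i pi measurableSet_Ioi).2]
    refine integral_mono (sl_ind i pi measurableSet_Ioi).1 (pw_able (hg.continuous.mul (continuous_const.sub fc)) hs.mul_right (by linarith)).2.2 fun x => ?_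
    classical simp only [indicator_apply, Pi.one_apply]
    split_ifs with hx
    · rw [fh x (le_of_lt hx), sub_zero, mul_one, mul_one]
    · rw [mul_zero]; exact Real.rpow_nonneg (mul_nonneg (h0 x) (by linarith [fl x])) _
  have hM' := abs_le.1 hM
  have m1 := min_le_left (v / 4) (γ / (4 * (1 + Γ)))
  have m2 := min_le_right (v / 4) (γ / (4 * (1 + Γ)))
  have lo : ∀ u, 0 < u → u ≤ κ - v / 2 → u * (κ - v / 2) ^ (q - 1) ≤ u ^ q := fun u hu hu1 => by
    have := mul_le_mul_of_nonneg_left (Real.rpow_le_rpow_of_nonpos hu hu1 hq1.le) hu.le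
    rwa [mul_comm u (u ^ _), ← Real.rpow_add_one hu.ne', sub_add_cancel] at this
  have l1 := (lo V (by linarith) (by linarith)).trans (Real.rpow_le_rpow (by linarith) b1 hq0.le)
  have l2 := (lo (M - V - h * α) (by linarith) (by have : 0 ≤ h * α := by positivity
                                                   linarith)).trans (Real.rpow_le_rpow (by linarith) b2 hq0.le)
  have l3 := mul_le_mul_of_nonneg_left (add_le_add l1 l2) hk0.le
  have l4 : C / h * (∫ x, g x * (Icc s (s + h)).indicator 1 (x i)) ≤ C * α := by
    refine (mul_le_mul_of_nonneg_left bd (by positivity)).trans (le_of_eq (by field_simp))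
  have l5 : Kd d * (∫ x, (g x * f x) ^ p) ^ q ≤ ∫ x, ‖fderiv ℝ (fun x => g x * f x) x‖ := hS
  have l6 : Γ * (M - h * α) ≤ (d + 1) * κ + min (v / 4) (γ / (4 * (1 + Γ))) + C * α := by
    have : Γ * (M - h * α) = Kd d * (V * (κ - v / 2) ^ (q - 1) + (M - V - h * α) * (κ - v / 2) ^ (q - 1)) := by rw [hΓ]; ring
    rw [this]; linarith
  set δ := min (v / 4) (γ / (4 * (1 + Γ)))
  have l7 : (1 + Γ) * δ ≤ γ / 4 := by
    have := mul_le_mul_of_nonneg_left m2 (by positivity : 0 ≤ 1 + Γ)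
    refine this.trans (le_of_eq (by field_simp))
  have l8 : (C + Γ) * α = γ / 4 := by rw [hα]; field_simp
  have l9 : Γ * (h * α) ≤ Γ * α := mul_le_mul_of_nonneg_left (mul_le_of_le_one_left hα0.le hh1) hΓ0.le
  have l10 : Γ * (κ - δ) ≤ Γ * M := mul_le_mul_of_nonneg_left (by linarith) hΓ0.le
  have l11 : γ = Γ * κ - (d + 1) * κ := rfl
  rw [mul_sub] at l6 l10; rw [add_mul] at l7 l8
  linarith

lemma jac_bd {a A B c α β ω θ : ℝ} (hβ : 0 < β) (hBβ : β ≤ B) (hBω : B ≤ ω) (ha : 0 ≤ a) (haA : a ≤ A) (hα : 0 < α) (hA : α ≤ A)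
    (hc1 : c ≤ 1) (hθ : 0 < θ) :
    |1 - c * a / B| ≤ 1 / β * ((1 - c) * a + (3 + 2 * ω / α) * (A - a) + ω * θ / α * A + ω * (1 / θ + 1) * (2 / α) * (a * (√(A / B) - 1) ^ 2)) := by
  have hB : 0 < B := hβ.trans_le hBβ
  have hω : 0 < ω := hB.trans_le hBω
  have hA0 : 0 < A := hα.trans_le hA
  have hAB : |A - B| ≤ (2 + 2 * ω / α) * (A - a) + ω * θ / α * A + ω * (1 / θ + 1) * (2 / α) * (a * (√(A / B) - 1) ^ 2) := by
    set r := √(A / B) with hr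
    have hAr : A = r ^ 2 * B := by rw [hr, Real.sq_sqrt (by positivity)]; field_simp
    have p1 : 0 ≤ ω * θ / α * A := by positivity
    have p2 : 0 ≤ ω * (1 / θ + 1) * (2 / α) * (a * (r - 1) ^ 2) := by positivity
    rcases le_or_gt (α / 2) a with h | h
    · have e1 : |A - B| = B * |r ^ 2 - 1| := by rw [hAr, (by ring : r ^ 2 * B - B = B * (r ^ 2 - 1)), abs_mul, abs_of_pos hB]
      have e2 : |r ^ 2 - 1| ≤ θ + (1 / θ + 1) * (r - 1) ^ 2 := by
        have k1 : 2 * (r - 1) ≤ θ + 1 / θ * (r - 1) ^ 2 := by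
          have := sq_nonneg (θ - (r - 1)); field_simp; nlinarith
        have k2 : -(2 * (r - 1)) ≤ θ + 1 / θ * (r - 1) ^ 2 := by
          have := sq_nonneg (θ + (r - 1)); field_simp; nlinarith
        have := sq_nonneg (r - 1)
        rw [abs_le]; constructor <;> nlinarith
      have e3 : B * |r ^ 2 - 1| ≤ ω * (θ + (1 / θ + 1) * (r - 1) ^ 2) := mul_le_mul hBω e2 (abs_nonneg _) hω.le
      have e4 : ω * θ ≤ ω * θ / α * A := by
        rw [div_mul_eq_mul_div, le_div_iff₀ hα]; exact mul_le_mul_of_nonneg_left hA (by positivity)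
      have e5 : ω * (1 / θ + 1) * (r - 1) ^ 2 ≤ ω * (1 / θ + 1) * (2 / α) * (a * (r - 1) ^ 2) := by
        have : 1 ≤ 2 / α * a := by rw [div_mul_eq_mul_div, le_div_iff₀ hα]; linarith
        have h2 : 0 ≤ ω * (1 / θ + 1) * (r - 1) ^ 2 := by positivity
        calc _ ≤ ω * (1 / θ + 1) * (r - 1) ^ 2 * (2 / α * a) := le_mul_of_one_le_right h2 this
          _ = _ := by ring
      have e6 : 0 ≤ (2 + 2 * ω / α) * (A - a) := mul_nonneg (by positivity) (by linarith)
      rw [e1]; linarith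
    · have e1 : |A - B| ≤ A + ω := by rw [abs_le]; constructor <;> linarith
      have e2 : ω ≤ 2 * ω / α * (A - a) := by
        rw [div_mul_eq_mul_div, le_div_iff₀ hα]; nlinarith
      linarith
  have e : 1 - c * a / B = (B - c * a) / B := by field_simp
  rw [e, abs_div, abs_of_pos hB, div_eq_inv_mul, ← one_div]
  refine mul_le_mul (one_div_le_one_div_of_le hβ hBβ) ?_ (abs_nonneg _) (by positivity)
  have : |B - c * a| ≤ |A - B| + ((A - a) + (1 - c) * a) := by
    have h1 : 0 ≤ (1 - c) * a := mul_nonneg (by linarith) ha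
    have h2 := abs_le.1 (le_refl |A - B|)
    rw [abs_le]; constructor <;> linarith [h2.1, h2.2]
  linarith

lemma tr_chg {d : ℕ} {a T : ℝ → ℝ} {c : ℝ} (ac : Continuous a) (as : HasCompactSupport a) (hT1 : ∀ s, |T s| < 1) (Tc : Continuous T)
    (Td : ∀ s, HasDerivAt T (c * a s / aB d (T s)) s) {h : ℝ → ℝ} (hc : Continuous h) (h0 : ∀ t, 0 ≤ h t) :
    c * ∫ s, a s * h (T s) ≤ ∫ t in (-1)..1, h t * aB d t := by
  obtain ⟨R, hR⟩ := as.isCompact.isBounded.subset_closedBall 0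
  have hb : Continuous (fun t => h t * aB d t) := hc.mul (aB_cont d)
  set H : ℝ → ℝ := fun t => ∫ u in (0 : ℝ)..t, h u * aB d u
  have hH : ∀ t, HasDerivAt H (h t * aB d t) t := fun t => intervalIntegral.integral_hasDerivAt_right (hb.intervalIntegrable _ _)
    (hb.stronglyMeasurableAtFilter _ _) hb.continuousAt
  have e1 : ∀ s, HasDerivAt (fun s => H (T s)) (c * (a s * h (T s))) s := fun s => by
    have := (hH (T s)).comp s (Td s)
    rwa [mul_assoc, mul_div_cancel₀ _ (aB_pos d (hT1 s)).ne', (by ring : h (T s) * (c * a s) = c * (a s * h (T s)))] at this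
  have cc : Continuous (fun s => a s * h (T s)) := by fun_prop
  have e2 : ∫ s, a s * h (T s) = ∫ s in (-|R| - 1)..|R|, a s * h (T s) := by
    rw [intervalIntegral.integral_of_le (by linarith [abs_nonneg R]), setIntegral_eq_integral_of_forall_compl_eq_zero]
    intro s hs
    have : a s = 0 := by
      by_contra hh
      have h1 := hR (subset_tsupport _ hh)
      rw [mem_closedBall_zero_iff, Real.norm_eq_abs] at h1
      have := abs_le.1 (h1.trans (le_abs_self R))
      exact hs ⟨by linarith, this.2⟩
    rw [this, zero_mul]
  rw [e2, ← intervalIntegral.integral_const_mul, intervalIntegral.integral_eq_sub_of_hasDerivAt (fun s _ => e1 s) ((cc.const_mul c).intervalIntegrable _ _),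
    intervalIntegral.integral_interval_sub_left (hb.intervalIntegrable _ _) (hb.intervalIntegrable _ _)]
  rcases le_total (T (-|R| - 1)) (T |R|) with hh | hh
  · exact intervalIntegral.integral_mono_interval (abs_le.1 (hT1 _).le).1 hh (abs_le.1 (hT1 _).le).2
      (.of_forall fun t => mul_nonneg (h0 t) (aB_nn d t)) (hb.intervalIntegrable _ _)
  · rw [intervalIntegral.integral_symm]
    have h1 := intervalIntegral.integral_nonneg hh (μ := volume) fun t _ => mul_nonneg (h0 t) (aB_nn d t)
    have h2 := intervalIntegral.integral_nonneg (by norm_num : (-1 : ℝ) ≤ 1) (μ := volume) fun t _ => mul_nonneg (h0 t) (aB_nn d t)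
    linarith

lemma pt_aux {t x e : ℝ} (ht : |t| ≤ 1) (hx : |x| ≤ e) (he : e ≤ 1) : (t + x) ^ 2 ≤ t ^ 2 + 3 * e := by
  have h1 : |t * x| ≤ e := by rw [abs_mul]; exact (mul_le_of_le_one_left (abs_nonneg _) ht).trans hx
  have h2 : x ^ 2 ≤ e := by
    rw [← sq_abs, sq]; exact (mul_le_of_le_one_left (abs_nonneg _) (hx.trans he)).trans hx
  linarith [le_of_abs_le h1, (by ring : (t + x) ^ 2 = t ^ 2 + 2 * (t * x) + x ^ 2)]

set_option maxHeartbeats 2000000 in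
lemma one_dir {d : ℕ} (hd : 1 ≤ d) {η : ℝ} (hη : 0 < η) : ∃ δ > 0, ∀ g : EE (d + 1) → ℝ, AD g → |(∫ x, g x) - om (d + 1)| ≤ δ →
    |(∫ x, g x ^ (1 + 1 / (d : ℝ))) - om (d + 1)| ≤ δ → ∫ x, ‖fderiv ℝ g x‖ ≤ (d + 1) * om (d + 1) + δ → ∀ i, ∃ b : ℝ,
      ∫ x, g x ^ (1 + 1 / (d : ℝ)) * min ((x i - b) ^ 2) 4 ≤ (∫ x in ball (0 : EE (d + 1)) 1, x i ^ 2) + η := by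
  set κ := om (d + 1) with hκ
  have hκ0 : 0 < κ := om_pos _
  set ω := om d with hω
  have hω0 : 0 < ω := om_pos _
  have bc := aB_cont d
  have bi : ∀ u v, IntervalIntegrable (aB d) volume u v := fun u v => bc.intervalIntegrable _ _
  obtain ⟨k, hk⟩ := exists_nat_gt (max 1 (32 * ω / (η / 4)))
  have hk1 : (1 : ℝ) < k := (le_max_left _ _).trans_lt hk
  have hk2 : 32 * ω / (2 * k + 1) ≤ η / 4 := by
    have := ((le_max_right _ _).trans_lt hk).le
    rw [div_le_iff₀ (by positivity)] at this ⊢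
    have h9 : 0 ≤ k * (η / 4) := by positivity
    linarith
  set ε : ℝ := 1 / (4 * k) with hε
  have hε0 : 0 < ε := by positivity
  have hε1 : ε < 1 / 4 := by rw [hε]; exact one_div_lt_one_div_of_lt (by norm_num) (by linarith)
  have hpow : ∀ t : ℝ, 1 - ε ≤ |t| → 1 / 2 ≤ t ^ (2 * k) := fun t ht => by
    have h1 := one_add_mul_le_pow (by linarith : -2 ≤ -ε) (2 * k)
    have h2 : (1 + -ε) ^ (2 * k) ≤ |t| ^ (2 * k) := pow_le_pow_left₀ (by linarith) (by linarith) _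
    rw [(even_two_mul k).pow_abs] at h2
    refine le_trans (le_of_eq ?_) (h1.trans h2)
    push_cast; rw [hε]; field_simp; ring
  set β := aB d (1 - ε) with hβ
  have hβ0 : 0 < β := aB_pos d (by rw [abs_of_pos] <;> linarith)
  have hβle : ∀ t, |t| ≤ 1 - ε → β ≤ aB d t := fun t ht => by
    have : t ^ 2 ≤ (1 - ε) ^ 2 := by rw [← sq_abs t]; exact pow_le_pow_left₀ (abs_nonneg _) ht 2
    exact mul_le_mul_of_nonneg_left (pow_le_pow_left₀ (Real.sqrt_nonneg _) (Real.sqrt_le_sqrt (by linarith)) d) hω0.le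
  have pos1 : ∀ u v : ℝ, -1 ≤ u → u < v → v ≤ 1 → 0 < ∫ t in u..v, aB d t := fun u v hu huv hv =>
    intervalIntegral.intervalIntegral_pos_of_pos_on (bi _ _) (fun t ht => aB_pos d (abs_lt.2 ⟨by linarith [ht.1], by linarith [ht.2]⟩)) huv
  have q1 := pos1 (-1) (-1 + ε) le_rfl (by linarith) (by linarith)
  have q2 := pos1 (1 - ε) 1 (by linarith) (by linarith) le_rfl
  set v := min (min (∫ t in (-1)..(-1 + ε), aB d t) (∫ t in (1 - ε)..1, aB d t)) κ / 2 with hv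
  have hv0 : 0 < v := by positivity
  have hv1 : 2 * v ≤ ∫ t in (-1)..(-1 + ε), aB d t := by rw [hv]; linarith [min_le_left (min (∫ t in (-1)..(-1 + ε), aB d t) (∫ t in (1 - ε)..1, aB d t)) κ, min_le_left (∫ t in (-1)..(-1 + ε), aB d t) (∫ t in (1 - ε)..1, aB d t)]
  have hv2 : 2 * v ≤ ∫ t in (1 - ε)..1, aB d t := by rw [hv]; linarith [min_le_left (min (∫ t in (-1)..(-1 + ε), aB d t) (∫ t in (1 - ε)..1, aB d t)) κ, min_le_right (∫ t in (-1)..(-1 + ε), aB d t) (∫ t in (1 - ε)..1, aB d t)]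
  have hv3 : v < κ := by rw [hv]; linarith [min_le_right (min (∫ t in (-1)..(-1 + ε), aB d t) (∫ t in (1 - ε)..1, aB d t)) κ]
  obtain ⟨α, hα, δ0, hδ0, hcut⟩ := cut_lb hd hv0 hv3
  clear_value v
  set η' := min 1 (η / (24 * κ)) with hη'
  have hη0 : 0 < η' := by positivity
  have hη1 : η' ≤ 1 := min_le_left _ _
  have hη2 : η' * (6 * κ) ≤ η / 4 := by
    refine (mul_le_mul_of_nonneg_right (min_le_right _ _) (by positivity)).trans (le_of_eq ?_); field_simp; norm_num
  clear_value η'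
  set L1 := 1 / β * (ω / α * (2 * κ)) with hL1
  have hL10 : 0 < L1 := by positivity
  set θ := η' / (2 * L1) with hθ
  have hθ0 : 0 < θ := by positivity
  set L2 := 1 / β * (4 + (3 + 2 * ω / α) * 2 + ω * (1 / θ + 1) * (2 / α) * (6 * d + 8)) with hL2
  have hL20 : 0 < L2 := by positivity
  obtain ⟨δ, hδ, d1, d2, d3, d4, d5⟩ : ∃ δ > 0, δ ≤ δ0 ∧ δ ≤ κ / 2 ∧ δ ≤ v / 2 ∧ δ ≤ η / 8 ∧ δ ≤ η' / (2 * L2) := by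
    refine ⟨min (min δ0 (κ / 2)) (min (v / 2) (min (η / 8) (η' / (2 * L2)))), by positivity, ?_, ?_, ?_, ?_, ?_⟩ <;> simp
  refine ⟨δ, hδ, fun g hAD hm hM hD i => ?_⟩
  have hcut' := hcut g hAD (hM.trans d1) (hD.trans (by linarith)) i
  obtain ⟨hg, hs, h0, h1⟩ := hAD
  set p : ℝ := 1 + 1 / (d : ℝ) with hp
  have hp1 : 1 ≤ p := le_add_of_nonneg_right (by positivity)
  obtain ⟨pc, ps, pi⟩ := pw_able hg.continuous hs (p := p) (by linarith)
  obtain ⟨Ac, As⟩ := sl_cont i hg.continuous hs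
  obtain ⟨ac, as⟩ := sl_cont i pc ps
  have gi : Integrable g := hg.continuous.integrable_of_hasCompactSupport hs
  set a : ℝ → ℝ := fun s => ∫ x, g (ins i s x) ^ p with ha
  set A : ℝ → ℝ := fun s => ∫ x, g (ins i s x) with hA
  have ai : Integrable a := ac.integrable_of_hasCompactSupport as
  have Ai : Integrable A := Ac.integrable_of_hasCompactSupport As
  have eM : ∫ x, g x ^ p = ∫ s, a s := ins_int i pi
  have em : ∫ x, g x = ∫ s, A s := ins_int i gi
  have ha0 : ∀ s, 0 ≤ a s := fun s => integral_nonneg fun x => Real.rpow_nonneg (h0 _) _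
  have haA : ∀ s, a s ≤ A s := fun u =>
    integral_mono ((pc.comp (by have := ins_cont i; fun_prop)).integrable_of_hasCompactSupport (sl_cs i ps u))
      ((hg.continuous.comp (by have := ins_cont i; fun_prop)).integrable_of_hasCompactSupport (sl_cs i hs u))
      fun x => Real.rpow_le_self_of_le_one (h0 _) (h1 _) hp1
  rw [em] at hm
  set M := ∫ x, g x ^ p with hMd
  obtain ⟨m1, m2⟩ := abs_le.1 hm
  obtain ⟨m3, m4⟩ := abs_le.1 hM
  set c := κ / (κ + 2 * δ) with hc
  have hc0 : 0 < c := by positivity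
  have ck : c * (κ + 2 * δ) = κ := by rw [hc]; field_simp
  have hc1 : c ≤ 1 := by rw [hc, div_le_one (by positivity)]; linarith
  have hch : 1 / 2 ≤ c := by rw [hc, div_le_div_iff₀ (by norm_num) (by positivity)]; linarith
  have cd0 : 0 < c * δ := by positivity
  have cd1 : c * δ ≤ δ := mul_le_of_le_one_left hδ.le hc1
  have cM1 : c * M ≤ c * (κ + δ) := mul_le_mul_of_nonneg_left (by linarith) hc0.le
  have cM2 : c * (κ - δ) ≤ c * M := mul_le_mul_of_nonneg_left (by linarith) hc0.le
  have hcM : c * M < κ := by linarith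
  have hcM' : κ - c * M ≤ 3 * δ := by linarith
  obtain ⟨T, T1, Tc, Td, TF, qi, TI⟩ := sl_main hd (sb_all hd) i hg hs h0 hc0 hc1 ha hcM
  set Q : ℝ → ℝ := fun s => a s * (√(A s / aB d (T s)) - 1) ^ 2 with hQ
  have hQ0 : ∀ s, 0 ≤ Q s := fun s => mul_nonneg (ha0 s) (sq_nonneg _)
  have TI' : c * ((d + 1) * M + ∫ s, Q s) ≤ (d + 1) * κ + δ := TI.trans hD
  have hQi : ∫ s, Q s ≤ (6 * d + 8) * δ := by
    have : 0 ≤ ∫ s, Q s := integral_nonneg hQ0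
    have h5 : (d + 1 : ℝ) * (κ - c * M) ≤ (d + 1) * (3 * δ) := mul_le_mul_of_nonneg_left hcM' (by positivity)
    have h6 : 1 / 2 * (∫ s, Q s) ≤ c * ∫ s, Q s := mul_le_mul_of_nonneg_right hch this
    rw [mul_add] at TI'
    linarith
  have hJ : ∀ s, |T s| ≤ 1 - ε → α ≤ A s := fun s hs => by
    obtain ⟨t1, t2⟩ := abs_le.1 hs
    have k1 : 2 * v ≤ ∫ u in (-1)..(T s), aB d u := hv1.trans (intervalIntegral.integral_mono_interval le_rfl (by linarith) (by linarith)
      (.of_forall fun t => aB_nn d t) (bi _ _))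
    have k2 : 2 * v ≤ ∫ u in (T s)..1, aB d u := hv2.trans (intervalIntegral.integral_mono_interval (by linarith) (by linarith) le_rfl
      (.of_forall fun t => aB_nn d t) (bi _ _))
    have k3 := intervalIntegral.integral_add_adjacent_intervals (bi (-1) (T s)) (bi (T s) 1)
    rw [← om_succ, ← hκ] at k3
    have k4 := TF s
    have k5 : 0 ≤ ∫ u in Iic s, a u := integral_nonneg ha0
    have k6 : ∫ u in Iic s, a u ≤ M := by rw [eM]; exact setIntegral_le_integral ai (.of_forall ha0)
    have k7 : c * (∫ u in Iic s, a u) ≤ ∫ u in Iic s, a u := mul_le_of_le_one_left k5 hc1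
    have k8 : c * (M - ∫ u in Iic s, a u) ≤ M - ∫ u in Iic s, a u := mul_le_of_le_one_left (by linarith) hc1
    rw [mul_sub] at k8
    exact hcut' s (by linarith) (by linarith)
  set E : ℝ → ℝ := fun s => 1 / β * ((1 - c) * a s + (3 + 2 * ω / α) * (A s - a s) + ω * θ / α * A s + ω * (1 / θ + 1) * (2 / α) * Q s) with hE
  have i1 : Integrable (fun s => (1 - c) * a s) := ai.const_mul _
  have i2 : Integrable (fun s => (3 + 2 * ω / α) * (A s - a s)) := (Ai.sub ai).const_mul _
  have i3 : Integrable (fun s => ω * θ / α * A s) := Ai.const_mul _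
  have i4 : Integrable (fun s => ω * (1 / θ + 1) * (2 / α) * Q s) := qi.const_mul _
  have Ei : Integrable E := (((i1.fun_add i2).fun_add i3).fun_add i4).const_mul _
  have E0 : ∀ s, 0 ≤ E s := fun s => by
    have z1 := ha0 s
    have z2 : 0 ≤ A s - a s := by linarith [haA s]
    have z3 : 0 ≤ A s := by linarith [haA s]
    have z4 : 0 ≤ 1 - c := by linarith
    have z5 := hQ0 s
    rw [hE]; positivity
  have EI : ∫ s, E s ≤ η' := by
    rw [hE, integral_const_mul, integral_add ((i1.fun_add i2).fun_add i3) i4, integral_add (i1.fun_add i2) i3, integral_add i1 i2,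
      integral_const_mul, integral_const_mul, integral_const_mul, integral_const_mul, integral_sub Ai ai, ← eM]
    have u1 : (1 - c) * M ≤ 4 * δ := by
      have := mul_le_mul_of_nonneg_left (by linarith : M ≤ 2 * κ) (by linarith : 0 ≤ 1 - c)
      linarith
    have u2 : (3 + 2 * ω / α) * ((∫ s, A s) - M) ≤ (3 + 2 * ω / α) * (2 * δ) := mul_le_mul_of_nonneg_left (by linarith) (by positivity)
    have u3 : ω * θ / α * (∫ s, A s) ≤ ω * θ / α * (2 * κ) := mul_le_mul_of_nonneg_left (by linarith) (by positivity)
    have u4 : ω * (1 / θ + 1) * (2 / α) * (∫ s, Q s) ≤ ω * (1 / θ + 1) * (2 / α) * ((6 * d + 8) * δ) := mul_le_mul_of_nonneg_left hQi (by positivity)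
    refine (mul_le_mul_of_nonneg_left (add_le_add (add_le_add (add_le_add u1 u2) u3) u4) (by positivity)).trans ?_
    have w1 : L1 * θ = η' / 2 := by rw [hθ]; field_simp
    have w2 : L2 * δ ≤ η' / 2 := by
      refine (mul_le_mul_of_nonneg_left d5 hL20.le).trans (le_of_eq (by field_simp))
    refine le_trans (le_of_eq ?_) (by linarith : L1 * θ + L2 * δ ≤ η')
    rw [hL1, hL2]; ring
  clear_value E
  have Tc' : Continuous (fun s => c * a s / aB d (T s)) := (ac.const_mul c).div (bc.comp Tc) fun s => (aB_pos d (T1 s)).ne'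
  have Tm : Monotone T := monotone_of_hasDerivAt_nonneg Td fun s => div_nonneg (mul_nonneg hc0.le (ha0 s)) (aB_nn d _)
  have hJJ : ∀ s0 s, |T s0| ≤ 1 - ε → |T s| ≤ 1 - ε → s0 ≤ s → |(s - T s) - (s0 - T s0)| ≤ η' := fun s0 s j0 j1 hss => by
    have f1 := intervalIntegral.integral_eq_sub_of_hasDerivAt (fun u _ => (hasDerivAt_id u).sub (Td u)) ((continuous_const.sub Tc').intervalIntegrable s0 s)
    have f2 := intervalIntegral.norm_integral_le_of_norm_le hss (f := fun u => 1 - c * a u / aB d (T u)) (g := E) (μ := volume) (.of_forall fun u hu => ?_) Ei.intervalIntegrable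
    · rw [f1, intervalIntegral.integral_of_le hss] at f2
      exact f2.trans ((setIntegral_le_integral Ei (.of_forall E0)).trans EI)
    · have : |T u| ≤ 1 - ε := abs_le.2 ⟨(abs_le.1 j0).1.trans (Tm hu.1.le), (Tm hu.2).trans (abs_le.1 j1).2⟩
      rw [hE]
      exact jac_bd hβ0 (hβle _ this) (aB_le d _) (ha0 u) (haA u) hα (hJ u this) hc1 hθ0
  obtain ⟨b, hb⟩ : ∃ b : ℝ, ∀ s, |T s| ≤ 1 - ε → |s - T s - b| ≤ η' := by
    by_cases hne : ∃ s0, |T s0| ≤ 1 - ε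
    · obtain ⟨s0, hs0⟩ := hne
      refine ⟨s0 - T s0, fun s hs => ?_⟩
      rcases le_total s0 s with h | h
      · exact hJJ _ _ hs0 hs h
      · rw [abs_sub_comm]; exact hJJ _ _ hs hs0 h
    · exact ⟨0, fun s hs => absurd ⟨s, hs⟩ hne⟩
  refine ⟨b, ?_⟩
  have pt : ∀ s, min ((s - b) ^ 2) 4 ≤ T s ^ 2 + 3 * η' + 8 * T s ^ (2 * k) := fun s => by
    have t2 : 0 ≤ T s ^ (2 * k) := (even_two_mul k).pow_nonneg _
    rcases le_or_gt (|T s|) (1 - ε) with h | h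
    · refine (min_le_left _ _).trans ?_
      have := pt_aux (T1 s).le (hb s h) hη1
      rw [(by ring : T s + (s - T s - b) = s - b)] at this
      linarith
    · refine (min_le_right _ _).trans ?_
      have := hpow _ h.le
      linarith [sq_nonneg (T s)]
  have gm : Integrable (fun x => g x ^ p * min ((x i - b) ^ 2) 4) := by
    refine Continuous.integrable_of_hasCompactSupport ?_ ps.mul_right
    exact pc.mul (by fun_prop)
  have j1 : Integrable (fun s => a s * T s ^ 2) := Continuous.integrable_of_hasCompactSupport (by fun_prop) as.mul_right
  have j2 : Integrable (fun s => 3 * η' * a s) := ai.const_mul _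
  have j3 : Integrable (fun s => a s * T s ^ (2 * k)) := Continuous.integrable_of_hasCompactSupport (by fun_prop) as.mul_right
  have s1 : ∫ x, g x ^ p * min ((x i - b) ^ 2) 4 ≤ (∫ s, a s * T s ^ 2) + 3 * η' * M + 8 * ∫ s, a s * T s ^ (2 * k) := by
    rw [ins_int i gm, eM, ← integral_const_mul, ← integral_const_mul, ← integral_add j1 j2, ← integral_add (j1.fun_add j2) (j3.const_mul 8)]
    refine integral_mono (ins_able i gm) ((j1.fun_add j2).fun_add (j3.const_mul 8)) fun s => ?_
    simp only [ins_same, integral_mul_const]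
    have := mul_le_mul_of_nonneg_left (pt s) (ha0 s)
    refine this.trans (le_of_eq ?_); ring
  have s2 := tr_chg ac as T1 Tc Td (h := fun t => t ^ 2) (by fun_prop) fun t => sq_nonneg t
  have s3 := tr_chg ac as T1 Tc Td (h := fun t => t ^ (2 * k)) (by fun_prop) fun t => (even_two_mul k).pow_nonneg t
  have s4 : ∫ x in ball (0 : EE (d + 1)) 1, x i ^ 2 = ∫ t in (-1)..1, t ^ 2 * aB d t := by
    rw [sl_ball i (h := fun t => t ^ 2) (by fun_prop), intervalIntegral.integral_of_le (by norm_num), integral_Ioc_eq_integral_Ioo]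
  have s5 : ∫ t in (-1)..1, t ^ 2 * aB d t ≤ κ := by
    rw [hκ, om_succ]
    refine intervalIntegral.integral_mono_on (by norm_num) ((by fun_prop : Continuous fun t => t ^ 2 * aB d t).intervalIntegrable _ _) (bi _ _) fun t ht => ?_
    exact mul_le_of_le_one_left (aB_nn d t) ((sq_le_one_iff_abs_le_one t).2 (abs_le.2 ht))
  have s6 : ∫ t in (-1)..1, t ^ (2 * k) * aB d t ≤ 2 * ω / (2 * k + 1) := by
    have : ∫ t in (-1)..1, t ^ (2 * k) * ω = 2 * ω / (2 * k + 1) := by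
      rw [intervalIntegral.integral_mul_const, integral_pow, (by exact ⟨k, by ring⟩ : Odd (2 * k + 1)).neg_one_pow]; push_cast; ring
    rw [← this]
    refine intervalIntegral.integral_mono_on (by norm_num) ((by fun_prop : Continuous fun t => t ^ (2 * k) * aB d t).intervalIntegrable _ _) ((by fun_prop : Continuous fun t : ℝ => t ^ (2 * k) * ω).intervalIntegrable _ _) fun t ht => ?_
    exact mul_le_mul_of_nonneg_left (aB_le d t) ((even_two_mul k).pow_nonneg t)
  rw [s4]
  have x1 : 0 ≤ ∫ s, a s * T s ^ 2 := integral_nonneg fun s => mul_nonneg (ha0 s) (sq_nonneg _)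
  have x2 : 0 ≤ ∫ s, a s * T s ^ (2 * k) := integral_nonneg fun s => mul_nonneg (ha0 s) ((even_two_mul k).pow_nonneg _)
  have s7 : (∫ s, a s * T s ^ 2) ≤ (∫ t in (-1)..1, t ^ 2 * aB d t) + 2 * δ := by
    have w1 : c * (∫ s, a s * T s ^ 2) ≤ c * ((∫ t in (-1)..1, t ^ 2 * aB d t) + 2 * δ) := by
      have := mul_le_mul_of_nonneg_right s5 (by linarith : 0 ≤ 1 - c)
      linarith
    exact le_of_mul_le_mul_left w1 hc0
  have s8 : (∫ s, a s * T s ^ (2 * k)) ≤ 2 * (2 * ω / (2 * k + 1)) := by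
    have := mul_le_mul_of_nonneg_right hch x2
    linarith
  have s9 : 3 * η' * M ≤ η / 4 := by
    have := mul_le_mul_of_nonneg_left (by linarith : M ≤ 2 * κ) (by positivity : 0 ≤ 3 * η')
    linarith
  have s10 : 8 * (2 * (2 * ω / (2 * k + 1))) = 32 * ω / (2 * k + 1) := by ring
  linarith

lemma chB_able (n : ℕ) : Integrable (chB n) := by
  have : Integrable ((ball (0 : EE n) 1).indicator fun _ => (1 : ℝ)) := (integrable_indicator_iff measurableSet_ball).2 (integrableOn_const (by finiteness))
  exact this

lemma pn_succ {d : ℕ} (hd : 1 ≤ d) : pn (d + 1) = 1 + 1 / (d : ℝ) := by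
  have : (d : ℝ) ≠ 0 := by positivity
  rw [pn]; push_cast; rw [add_sub_cancel_right]; field_simp

lemma bath {n : ℕ} (hn : 1 ≤ n) {φ : ℝ → ℝ} (h1 : ∀ r, 0 ≤ r → r < 1 → 0 ≤ φ r) (h2 : ∀ r, 1 ≤ r → φ r ≤ 0)
    (h3 : ∀ τ, 0 < τ → τ < 1 → ∃ m > 0, ∀ r, 0 ≤ r → (r ≤ 1 - τ → m ≤ φ r) ∧ (1 + τ ≤ r → φ r ≤ -m)) {η : ℝ} (hη : 0 < η) :
    ∃ δ > 0, ∀ G : EE n → ℝ, Integrable G → (∀ x, 0 ≤ G x) → (∀ x, G x ≤ 1) → Integrable (fun x => (chB n x - G x) * φ ‖x‖) →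
      ∫ x, (chB n x - G x) * φ ‖x‖ ≤ δ → ∫ x, |G x - chB n x| ≤ η := by
  have hk := om_pos n
  obtain ⟨τ, t0, t1, t2⟩ : ∃ τ : ℝ, 0 < τ ∧ τ < 1 ∧ om n * (1 + τ) ^ n - om n * (1 - τ) ^ n ≤ η / 2 := by
    have hc : ContinuousAt (fun t : ℝ => om n * (1 + t) ^ n - om n * (1 - t) ^ n) 0 := by fun_prop
    obtain ⟨e, he, h⟩ := Metric.eventually_nhds_iff.1 (hc.eventually_lt (continuousAt_const (y := η / 2)) (by simp; positivity))
    refine ⟨min (e / 2) (1 / 2), by positivity, (min_le_right _ _).trans_lt (by norm_num), (h ?_).le⟩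
    rw [Real.dist_eq, sub_zero, abs_of_pos (by positivity)]; exact (min_le_left _ _).trans_lt (by linarith)
  obtain ⟨m, hm, h4⟩ := h3 τ t0 t1
  refine ⟨m * (η / 2), by positivity, fun G Gi G0 G1 fi hf => ?_⟩
  have vb : ∀ r : ℝ, 0 < r → Integrable ((ball (0 : EE n) r).indicator fun _ => (1 : ℝ)) ∧ ∫ x, (ball (0 : EE n) r).indicator (fun _ => (1 : ℝ)) x = om n * r ^ n := fun r hr => by
    refine ⟨(integrable_indicator_iff measurableSet_ball).2 (integrableOn_const (by finiteness)), ?_⟩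
    rw [integral_indicator measurableSet_ball, setIntegral_const, smul_eq_mul, mul_one, measureReal_def, Measure.addHaar_ball_of_pos _ _ hr, ENNReal.toReal_mul, ENNReal.toReal_ofReal (by positivity), om, measureReal_def]
    simp [mul_comm]
  obtain ⟨a1, a2⟩ := vb (1 + τ) (by linarith)
  obtain ⟨b1, b2⟩ := vb (1 - τ) (by linarith)
  have key : ∫ x, |G x - chB n x| ≤ ∫ x, ((ball (0 : EE n) (1 + τ)).indicator (fun _ => (1 : ℝ)) x - (ball (0 : EE n) (1 - τ)).indicator (fun _ => (1 : ℝ)) x + 1 / m * ((chB n x - G x) * φ ‖x‖)) := by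
    refine integral_mono (Gi.sub (chB_able n)).abs ((a1.sub b1).add (fi.const_mul _)) fun x => ?_
    have g0 := G0 x
    have g1 := G1 x
    have hx := norm_nonneg x
    have hmi : ∀ u v : ℝ, 0 ≤ u → m ≤ v → u ≤ 1 / m * (u * v) := fun u v hu hv => by
      rw [one_div_mul_eq_div, le_div_iff₀ hm]; exact mul_le_mul_of_nonneg_left hv hu
    classical simp only [chB, indicator_apply, mem_ball_zero_iff]
    rcases lt_or_ge ‖x‖ 1 with h | h
    · rw [if_pos h, if_pos (by linarith), abs_sub_comm, abs_of_nonneg (by linarith)]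
      rcases lt_or_ge ‖x‖ (1 - τ) with h5 | h5
      · rw [if_pos h5]; linarith [hmi (1 - G x) (φ ‖x‖) (by linarith) ((h4 _ hx).1 h5.le)]
      · rw [if_neg (by linarith)]
        have : 0 ≤ 1 / m * ((1 - G x) * φ ‖x‖) := mul_nonneg (by positivity) (mul_nonneg (by linarith) (h1 _ hx h))
        linarith
    · rw [if_neg h.not_gt, if_neg (by linarith : ¬‖x‖ < 1 - τ), sub_zero, abs_of_nonneg g0, sub_zero, zero_sub]
      rcases lt_or_ge ‖x‖ (1 + τ) with h5 | h5
      · rw [if_pos h5]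
        have : 0 ≤ 1 / m * (-G x * φ ‖x‖) := mul_nonneg (by positivity) (mul_nonneg_of_nonpos_of_nonpos (by linarith) (h2 _ h))
        linarith
      · rw [if_neg (by linarith)]; have := hmi (G x) (-φ ‖x‖) g0 (by linarith [(h4 _ hx).2 h5])
        rw [zero_add]; refine this.trans (le_of_eq (by ring))
  refine key.trans ?_
  rw [integral_add (isub a1 b1) (fi.const_mul _), integral_sub a1 b1, a2, b2, integral_const_mul]
  have : 1 / m * (∫ x, (chB n x - G x) * φ ‖x‖) ≤ η / 2 := by
    rw [one_div_mul_eq_div, div_le_iff₀ hm]; linarith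
  linarith

lemma close {n : ℕ} (hn : 3 ≤ n) {η : ℝ} (hη : 0 < η) : ∃ δ > 0, ∀ g : EE n → ℝ, AD g → |(∫ x, g x) - om n| ≤ δ →
    |(∫ x, g x ^ pn n) - om n| ≤ δ → ∫ x, ‖fderiv ℝ g x‖ ≤ n * om n + δ → ∃ b : EE n, ∫ x, |g x - chB n (x - b)| ≤ η := by
  obtain ⟨d, rfl⟩ : ∃ d, n = d + 1 := ⟨n - 1, by omega⟩
  have hd : 1 ≤ d := by omega
  have hk := om_pos (d + 1)
  obtain ⟨δ1, hδ1, hb⟩ := bath (n := d + 1) (by omega) (φ := fun r => 1 - min (r ^ 2) 4) (η := η / 2) (fun r h0 h1 => by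
      have := min_le_left (r ^ 2) 4; nlinarith) (fun r h1 => by
      have : 1 ≤ min (r ^ 2) 4 := le_min (by nlinarith) (by norm_num)
      linarith) (fun τ t0 t1 => ⟨τ, t0, fun r hr => ⟨fun h => by
        have := min_le_left (r ^ 2) 4; nlinarith, fun h => by
        have : 1 + τ ≤ min (r ^ 2) 4 := le_min (by nlinarith) (by linarith)
        linarith⟩⟩) (by positivity)
  obtain ⟨δ2, hδ2, ho⟩ := one_dir hd (η := δ1 / (2 * (d + 1))) (by positivity)
  refine ⟨min δ2 (min (δ1 / 2) (η / 4)), by positivity, fun g hAD hm hM hD => ?_⟩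
  set δ := min δ2 (min (δ1 / 2) (η / 4)) with hδ
  have e1 : δ ≤ δ2 := min_le_left _ _
  have e2 : δ ≤ δ1 / 2 := (min_le_right _ _).trans (min_le_left _ _)
  have e3 : δ ≤ η / 4 := (min_le_right _ _).trans (min_le_right _ _)
  clear_value δ
  rw [pn_succ hd] at hM
  push_cast at hD
  have ho' := ho g hAD (hm.trans e1) (hM.trans e1) (hD.trans (by linarith))
  choose b hb1 using ho'
  obtain ⟨hg, hs, h0, h1⟩ := hAD
  set p : ℝ := 1 + 1 / (d : ℝ) with hp
  have hp1 : 1 ≤ p := le_add_of_nonneg_right (by positivity)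
  obtain ⟨pc, ps, pi⟩ := pw_able hg.continuous hs (p := p) (by linarith)
  have gi : Integrable g := hg.continuous.integrable_of_hasCompactSupport hs
  set v : EE (d + 1) := WithLp.toLp 2 b with hv
  have hvi : ∀ i, v i = b i := fun i => rfl
  refine ⟨v, ?_⟩
  have Ci := (chB_able (d + 1)).comp_sub_right v
  have ci : ∀ i, Integrable (fun x => g x ^ p * min ((x i - b i) ^ 2) 4) := fun i => (pc.mul (by fun_prop)).integrable_of_hasCompactSupport ps.mul_right
  have ki : Integrable (fun x => g x ^ p * min (‖x - v‖ ^ 2) 4) := (pc.mul (by fun_prop)).integrable_of_hasCompactSupport ps.mul_right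
  have t1 : ∫ x, g x ^ p * min (‖x - v‖ ^ 2) 4 ≤ (∫ x in ball (0 : EE (d + 1)) 1, ‖x‖ ^ 2) + δ1 / 2 := by
    calc _ ≤ ∫ x, ∑ i, g x ^ p * min ((x i - b i) ^ 2) 4 := by
          refine integral_mono ki (integrable_finsetSum _ fun i _ => ci i) fun x => ?_
          simp only [← Finset.mul_sum]
          refine mul_le_mul_of_nonneg_left ?_ (Real.rpow_nonneg (h0 x) _)
          by_cases hh : ∃ i, 4 ≤ (x i - b i) ^ 2
          · obtain ⟨i, hi⟩ := hh
            refine (min_le_right _ _).trans ?_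
            have := Finset.single_le_sum (f := fun i => min ((x i - b i) ^ 2) 4) (fun j _ => le_min (sq_nonneg _) (by norm_num)) (Finset.mem_univ i)
            rwa [min_eq_right hi] at this
          · push Not at hh
            refine (min_le_left _ _).trans (le_of_eq ?_)
            rw [EuclideanSpace.real_norm_sq_eq]
            exact Finset.sum_congr rfl fun i _ => by rw [min_eq_left (hh i).le]; rfl
      _ = ∑ i, ∫ x, g x ^ p * min ((x i - b i) ^ 2) 4 := integral_finsetSum _ fun i _ => ci i
      _ ≤ ∑ i : Fin (d + 1), ((∫ x in ball (0 : EE (d + 1)) 1, x i ^ 2) + δ1 / (2 * (d + 1))) := Finset.sum_le_sum fun i _ => hb1 i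
      _ = _ := by
          rw [Finset.sum_add_distrib, ← integral_finsetSum _ fun i _ =>
            ((by fun_prop : Continuous fun x : EE (d + 1) => x i ^ 2).continuousOn.integrableOn_compact (isCompact_closedBall 0 1)).mono_set ball_subset_closedBall]
          simp only [← EuclideanSpace.real_norm_sq_eq]
          congr 1; simp; field_simp
  have kb : ∀ u : EE (d + 1), chB (d + 1) u * min (‖u‖ ^ 2) 4 = (ball (0 : EE (d + 1)) 1).indicator (fun u => ‖u‖ ^ 2) u := fun u => by
    classical simp only [chB, indicator_apply, mem_ball_zero_iff]
    split_ifs with h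
    · rw [one_mul, min_eq_left]; nlinarith [norm_nonneg u]
    · simp
  have li : Integrable (fun u : EE (d + 1) => chB (d + 1) u * min (‖u‖ ^ 2) 4) := (chB_able _).mul_bdd (c := 4) (by fun_prop) (.of_forall fun u => by
    rw [Real.norm_of_nonneg (le_min (by positivity) (by norm_num))]; exact min_le_right _ _)
  have pi' := pi.comp_add_right v
  have ki' : Integrable (fun x => g (x + v) ^ p * min (‖x‖ ^ 2) 4) := by simpa using ki.comp_add_right v
  have ex : ∀ x, (chB (d + 1) x - g (x + v) ^ p) * (1 - min (‖x‖ ^ 2) 4) = (chB (d + 1) x - g (x + v) ^ p) - (chB (d + 1) x * min (‖x‖ ^ 2) 4 - g (x + v) ^ p * min (‖x‖ ^ 2) 4) := fun x => by ring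
  have t2 := hb (fun x => g (x + v) ^ p) pi' (fun x => Real.rpow_nonneg (h0 _) _) (fun x => Real.rpow_le_one (h0 _) (h1 _) (by linarith)) (by
    simp only [ex]; exact ((chB_able _).sub pi').sub (li.sub ki')) (by
    simp only [ex]
    rw [integral_sub (isub (chB_able _) pi') (isub li ki'), integral_sub (chB_able _) pi', integral_sub li ki', integral_add_right_eq_self (fun x => g x ^ p) v]
    have a1 := integral_add_right_eq_self (μ := volume) (fun x => g x ^ p * min (‖x - v‖ ^ 2) 4) v
    simp only [add_sub_cancel_right] at a1
    rw [a1]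
    simp only [kb]
    rw [integral_indicator measurableSet_ball]
    have a2 : ∫ x, chB (d + 1) x = om (d + 1) := by
      simp only [chB]; rw [integral_indicator measurableSet_ball, setIntegral_const, smul_eq_mul, mul_one, om]
    rw [a2]; linarith [(abs_le.1 hM).1])
  have t3 : ∫ x, |g x ^ p - chB (d + 1) (x - v)| ≤ η / 2 := by
    have := integral_add_right_eq_self (μ := volume) (fun x => |g x ^ p - chB (d + 1) (x - v)|) v
    simp only [add_sub_cancel_right] at this
    rwa [← this]
  calc ∫ x, |g x - chB (d + 1) (x - v)| ≤ ∫ x, ((g x - g x ^ p) + |g x ^ p - chB (d + 1) (x - v)|) := by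
        refine integral_mono (gi.sub Ci).abs ((gi.sub pi).add (pi.sub Ci).abs) fun x => ?_
        have := Real.rpow_le_self_of_le_one (h0 x) (h1 x) hp1
        have h2 := abs_add_le (g x - g x ^ p) (g x ^ p - chB (d + 1) (x - v))
        rw [abs_of_nonneg (by linarith : 0 ≤ g x - g x ^ p)] at h2
        simpa using h2
    _ ≤ η := by
        rw [integral_add (isub gi pi) (isub pi Ci).abs, integral_sub gi pi]
        linarith [(abs_le.1 hM).1, (abs_le.1 hm).2]

lemma conc_step {d : ℕ} {a b x : ℝ} (ha : 0 < a) (hb : 0 ≤ b) (h : x * a ^ ((d : ℝ) / (d + 1)) ≤ a - b) :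
    b ^ (1 / ((d : ℝ) + 1)) ≤ a ^ (1 / ((d : ℝ) + 1)) - x / (d + 1) := by
  have hd : (0 : ℝ) < (d : ℝ) + 1 := by positivity
  set u := a ^ (1 / ((d : ℝ) + 1)) with hu
  set v := b ^ (1 / ((d : ℝ) + 1)) with hv
  have u0 : 0 < u := Real.rpow_pos_of_pos ha _
  have v0 : 0 ≤ v := Real.rpow_nonneg hb _
  have e : ∀ t : ℝ, 0 ≤ t → (t ^ (1 / ((d : ℝ) + 1))) ^ (d + 1) = t := fun t ht => by
    rw [← Real.rpow_natCast, ← Real.rpow_mul ht]; push_cast; rw [one_div_mul_cancel hd.ne', Real.rpow_one]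
  have e2 : a ^ ((d : ℝ) / (d + 1)) = u ^ d := by
    rw [hu, ← Real.rpow_natCast, ← Real.rpow_mul ha.le]; congr 1; field_simp
  have ea : u ^ (d + 1) = a := e a ha.le
  have eb : v ^ (d + 1) = b := e b hb
  rw [e2] at h
  have B := one_add_mul_le_pow (a := v / u - 1) (by linarith [div_nonneg v0 u0.le]) (d + 1)
  rw [add_sub_cancel, div_pow, le_div_iff₀ (by positivity), eb] at B
  have B2 : u ^ d * (u + (d + 1) * (v - u)) ≤ u ^ d * (u - x) := by
    have : (1 + ((d + 1 : ℕ) : ℝ) * (v / u - 1)) * u ^ (d + 1) = u ^ d * (u + (d + 1) * (v - u)) := by push_cast; rw [pow_succ]; field_simp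
    rw [← this]; refine B.trans ?_; rw [mul_sub, ← pow_succ, ea]; linarith
  have := le_of_mul_le_mul_left B2 (by positivity)
  have h3 : x / ((d : ℝ) + 1) ≤ u - v := by rw [div_le_iff₀ hd]; linarith
  linarith

lemma chain {m : ℕ → ℝ} (hm : ∀ j, 0 ≤ m j) {d N : ℕ} {x : ℝ} (hx : 0 < x)
    (h0 : m 0 ^ (1 / ((d : ℝ) + 1)) < N * (x / (d + 1))) : ∃ j < N, m j - m (j + 1) ≤ x * m j ^ ((d : ℝ) / (d + 1)) := by
  by_contra! hh
  have hd : (0 : ℝ) < (d : ℝ) + 1 := by positivity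
  have : ∀ j : ℕ, j ≤ N → m j ^ (1 / ((d : ℝ) + 1)) ≤ m 0 ^ (1 / ((d : ℝ) + 1)) - j * (x / (d + 1)) := fun j hj => by
    induction j with
    | zero => simp
    | succ j ih =>
      have hp : 0 < m j := by
        rcases (hm j).lt_or_eq with h | h
        · exact h
        · have h1 := hh j (by omega)
          have h2 := mul_nonneg hx.le (Real.rpow_nonneg (hm j) ((d : ℝ) / (d + 1)))
          linarith [hm (j + 1)]
      have := conc_step hp (hm (j + 1)) (hh j (by omega)).le
      have ih' := ih (by omega)
      push_cast; linarith
  have h1 := this N le_rfl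
  have h2 := Real.rpow_nonneg (hm N) (1 / ((d : ℝ) + 1))
  linarith

lemma trunc {d : ℕ} (hd : 1 ≤ d) {L : ℝ} (hL : 0 < L) : ∃ θ > 0, ∀ er > 0, ∃ τ > 0, ∀ g : EE (d + 1) → ℝ, AD g →
    ∫ x, (g x - g x ^ (1 + 1 / (d : ℝ))) ≤ τ → ∀ l : EE (d + 1) → ℝ, ContDiff ℝ 1 l → (∀ x, ‖fderiv ℝ l x‖ ≤ 1) → ∀ s0,
    ∫ x, g x * (Ici s0).indicator 1 (l x) ≤ θ → ∃ q : EE (d + 1) → ℝ, AD (fun x => g x * q x) ∧ Continuous q ∧ (∀ x, 0 ≤ q x) ∧ (∀ x, q x ≤ 1) ∧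
      (∀ x, l x ≤ s0 → q x = 1) ∧ (∀ x, s0 + L ≤ l x → q x = 0) ∧
      (∫ x, ‖fderiv ℝ (fun x => g x * q x) x‖) + 8 * (d + 1) * ∫ x, g x * (1 - q x) ≤ (∫ x, ‖fderiv ℝ g x‖) + er := by
  obtain ⟨C, hC, hcut⟩ := cut
  have hK := Kd_pos d
  set K := Kd d with hKd
  set n : ℝ := (d : ℝ) + 1 with hn
  have n0 : 0 < n := by positivity
  set κ1 := K / (16 * C) with hκ1
  have k1 : 0 < κ1 := by positivity
  have k1' : 2 * C * κ1 = K / 8 := by rw [hκ1]; field_simp; ring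
  set θr := min (K / (64 * n)) (κ1 * L / (2 * n)) with hθr
  have r0 : 0 < θr := by positivity
  have rn : (θr ^ n) ^ (1 / n) = θr := by rw [← Real.rpow_mul r0.le, mul_one_div_cancel n0.ne', Real.rpow_one]
  refine ⟨θr ^ n, Real.rpow_pos_of_pos r0 _, fun er her => ?_⟩
  obtain ⟨κ, κ0, hκ⟩ : ∃ κ > 0, K / 8 * κ ^ (d / n) + 8 * n * κ ≤ er := by
    have hc : ContinuousAt (fun t : ℝ => K / 8 * t ^ (d / n) + 8 * n * t) 0 := by
      refine ContinuousAt.add (continuousAt_const.mul (Real.continuousAt_rpow_const _ _ (Or.inr (by positivity)))) (by fun_prop)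
    obtain ⟨e, he, h⟩ := Metric.eventually_nhds_iff.1 (hc.eventually_lt (continuousAt_const (y := er)) (by
      have : (d : ℝ) / n ≠ 0 := by positivity
      simp only [Real.zero_rpow this]; simpa using her))
    refine ⟨e / 2, by positivity, (h ?_).le⟩
    rw [Real.dist_eq, sub_zero, abs_of_pos (by positivity)]; linarith
  obtain ⟨N, hN⟩ := exists_nat_gt (2 * κ1 * L / κ ^ (1 / n))
  have κn : 0 < κ ^ (1 / n) := Real.rpow_pos_of_pos κ0 _
  have N0 : (0 : ℝ) < N := lt_of_le_of_lt (by positivity) hN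
  set h := L / N with hh
  have h0 : 0 < h := by positivity
  have hhκ : κ1 * h ≤ κ ^ (1 / n) / 2 := by
    rw [div_lt_iff₀ κn] at hN
    rw [hh, mul_div_assoc', div_le_div_iff₀ N0 two_pos]; linarith
  refine ⟨κ / 4, by positivity, fun g hg hgp l hl hl1 s0 hs0 => ?_⟩
  have gi : Integrable g := hg.1.continuous.integrable_of_hasCompactSupport hg.2.1
  have gI : ∀ A : Set ℝ, MeasurableSet A → Integrable (fun x => g x * A.indicator 1 (l x)) := fun A hA =>
    gi.mul_bdd (c := 1) ((measurable_one.indicator hA).comp hl.continuous.measurable).aestronglyMeasurable (.of_forall fun x => by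
      classical rw [indicator_apply]; split_ifs <;> simp)
  have ib : ∀ (A : Set ℝ) (t : ℝ), 0 ≤ A.indicator (1 : ℝ → ℝ) t := fun A t => indicator_nonneg (fun _ _ => zero_le_one) _
  set m : ℕ → ℝ := fun j => ∫ x, g x * (Ici (s0 + j * h)).indicator 1 (l x) with hmdef
  have m0 : ∀ j, 0 ≤ m j := fun j => integral_nonneg fun x => mul_nonneg (hg.2.2.1 x) (ib _ _)
  have mm : ∀ j, m j ≤ θr ^ n := fun j => by
    refine le_trans (integral_mono (gI _ measurableSet_Ici) (gI _ measurableSet_Ici) fun x => ?_) hs0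
    exact mul_le_mul_of_nonneg_left (indicator_le_indicator_of_subset (Ici_subset_Ici.2 (by nlinarith [Nat.cast_nonneg (α := ℝ) j])) (fun _ => zero_le_one) _) (hg.2.2.1 x)
  obtain ⟨j, hj, hjm⟩ := chain m0 (d := d) (N := N) (x := κ1 * h) (by positivity) (by
    refine lt_of_le_of_lt (Real.rpow_le_rpow (m0 0) (mm 0) (by positivity)) ?_
    rw [← hn, rn]
    have e : (N : ℝ) * (κ1 * h / n) = κ1 * L / n := by rw [hh]; field_simp
    rw [e]; refine (min_le_right _ _).trans_lt ?_
    gcongr; linarith)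
  rw [← hn] at hjm
  obtain ⟨q, q1, q2, q3, q4, q5, q6, q7⟩ := hcut d hd g hg l hl hl1 (s0 + j * h) (h / 2) (by positivity)
  have hjN : (j : ℝ) * h + h ≤ L := by
    have : ((j + 1 : ℕ) : ℝ) ≤ N := by exact_mod_cast hj
    calc (j : ℝ) * h + h = ((j + 1 : ℕ) : ℝ) * h := by push_cast; ring
      _ ≤ N * h := by gcongr
      _ = L := by rw [hh]; field_simp
  have j0 : 0 ≤ (j : ℝ) * h := by positivity
  refine ⟨q, q1, q2, q3, q4, fun x hx => q5 x (by linarith), fun x hx => q6 x (by linarith), ?_⟩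
  have st : ∫ x, g x * (Icc (s0 + j * h) (s0 + j * h + h / 2)).indicator 1 (l x) ≤ m j - m (j + 1) := by
    rw [hmdef]; beta_reduce; rw [← integral_sub (gI _ measurableSet_Ici) (gI _ measurableSet_Ici)]
    refine integral_mono (gI _ measurableSet_Icc) (isub (gI _ measurableSet_Ici) (gI _ measurableSet_Ici)) fun x => ?_
    beta_reduce; rw [← mul_sub]; refine mul_le_mul_of_nonneg_left ?_ (hg.2.2.1 x)
    have e : s0 + ((j + 1 : ℕ) : ℝ) * h = s0 + j * h + h := by push_cast; ring
    rw [e]; clear_value m h; generalize s0 + (j : ℝ) * h = a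
    classical simp only [indicator_apply, mem_Icc, mem_Ici, Pi.one_apply]
    clear * - h0; grind
  have qi : Integrable (fun x => g x * (1 - q x)) := (hg.1.continuous.mul (by fun_prop)).integrable_of_hasCompactSupport hg.2.1.mul_right
  have mu : ∫ x, g x * (1 - q x) ≤ m j := by
    refine integral_mono qi (gI _ measurableSet_Ici) fun x => mul_le_mul_of_nonneg_left ?_ (hg.2.2.1 x)
    classical rw [indicator_apply]
    split_ifs with hx
    · simp [q3 x]
    · rw [q5 x (not_le.1 hx).le]; simp
  have c1 : C / (h / 2) * ∫ x, g x * (Icc (s0 + j * h) (s0 + j * h + h / 2)).indicator 1 (l x) ≤ K / 8 * m j ^ (d / n) := by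
    calc _ ≤ C / (h / 2) * (κ1 * h * m j ^ (d / n)) := by gcongr; exact st.trans hjm
      _ = 2 * C * κ1 * m j ^ (d / n) := by field_simp
      _ = _ := by rw [k1']
  have mn := mul_le_mul_of_nonneg_left mu (by positivity : 0 ≤ 8 * n)
  have mpos : 0 ≤ (∫ x, (g x * (1 - q x)) ^ (1 + 1 / (d : ℝ))) := integral_nonneg fun x => Real.rpow_nonneg (mul_nonneg (hg.2.2.1 x) (by linarith [q4 x])) _
  rw [← hn] at q7
  rcases le_or_gt (m j) κ with hc | hc
  · have a1 : m j ^ (d / n) ≤ κ ^ (d / n) := Real.rpow_le_rpow (m0 j) hc (by positivity)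
    have a2 := mul_le_mul_of_nonneg_left a1 (by positivity : 0 ≤ K / 8)
    have a3 := mul_le_mul_of_nonneg_left hc (by positivity : 0 ≤ 8 * n)
    have a4 := mul_nonneg hK.le (Real.rpow_nonneg mpos (d / n))
    linarith
  · have mp : 0 < m j := κ0.trans hc
    have e0 : m j ^ (1 / n) * m j ^ (d / n) = m j := by
      rw [← Real.rpow_add mp, ← add_div, add_comm (1 : ℝ), ← hn, div_self n0.ne', Real.rpow_one]
    have b0 : 0 ≤ m j ^ (d / n) := Real.rpow_nonneg mp.le _
    have a1 : κ1 * h * m j ^ (d / n) ≤ m j / 2 := by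
      have h1 : κ ^ (1 / n) ≤ m j ^ (1 / n) := Real.rpow_le_rpow κ0.le hc.le (by positivity)
      calc κ1 * h * m j ^ (d / n) ≤ m j ^ (1 / n) / 2 * m j ^ (d / n) := by gcongr; linarith
        _ = m j / 2 := by rw [div_mul_eq_mul_div, e0]
    have p0 : (0 : ℝ) < 1 + 1 / (d : ℝ) := by positivity
    have a2 : m (j + 1) - κ / 4 ≤ ∫ x, (g x * (1 - q x)) ^ (1 + 1 / (d : ℝ)) := by
      have i1 := gI (Ici (s0 + (j + 1 : ℕ) * h)) measurableSet_Ici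
      have i2 := isub gi (pw_able hg.1.continuous hg.2.1 p0).2.2
      have : m (j + 1) - ∫ x, (g x - g x ^ (1 + 1 / (d : ℝ))) ≤ ∫ x, (g x * (1 - q x)) ^ (1 + 1 / (d : ℝ)) := by
        rw [hmdef]; beta_reduce; rw [← integral_sub i1 i2]
        refine integral_mono (isub i1 i2) (pw_able (hg.1.continuous.mul (by fun_prop)) hg.2.1.mul_right p0).2.2 fun x => ?_
        have g3 := Real.rpow_le_self_of_le_one (hg.2.2.1 x) (hg.2.2.2 x) (le_add_of_nonneg_right (by positivity) : 1 ≤ 1 + 1 / (d : ℝ))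
        have g4 : 0 ≤ (g x * (1 - q x)) ^ (1 + 1 / (d : ℝ)) := Real.rpow_nonneg (mul_nonneg (hg.2.2.1 x) (by linarith [q4 x])) _
        push_cast
        classical rw [indicator_apply]
        split_ifs with hx
        · rw [q6 x (by simp only [mem_Ici] at hx; linarith)]; simp
        · simp only [mul_zero]; linarith
      linarith
    have a3 : m j / 4 ≤ ∫ x, (g x * (1 - q x)) ^ (1 + 1 / (d : ℝ)) := by linarith
    have a4 : 1 / 4 * m j ^ (d / n) ≤ (∫ x, (g x * (1 - q x)) ^ (1 + 1 / (d : ℝ))) ^ (d / n) := by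
      refine le_trans ?_ (Real.rpow_le_rpow (by positivity) a3 (by positivity))
      rw [div_eq_inv_mul (m j) 4, Real.mul_rpow (by norm_num) mp.le]
      refine mul_le_mul_of_nonneg_right ?_ b0
      have := Real.rpow_le_rpow_of_exponent_ge (x := (4 : ℝ)⁻¹) (by norm_num) (by norm_num) (by rw [div_le_one n0]; linarith : (d : ℝ) / n ≤ 1)
      rw [Real.rpow_one] at this; linarith
    have a5 : 8 * n * m j ≤ K / 8 * m j ^ (d / n) := by
      have h1 : m j ^ (1 / n) ≤ K / (64 * n) := by
        refine le_trans (Real.rpow_le_rpow mp.le (mm j) (by positivity)) ?_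
        rw [rn]; exact min_le_left _ _
      calc 8 * n * m j = 8 * n * (m j ^ (1 / n) * m j ^ (d / n)) := by rw [e0]
        _ ≤ 8 * n * (K / (64 * n) * m j ^ (d / n)) := by gcongr
        _ = _ := by field_simp; norm_num
    have a6 := mul_le_mul_of_nonneg_left a4 hK.le
    linarith

lemma ball_ind (n : ℕ) {r : ℝ} (hr : 0 < r) : Integrable ((ball (0 : EE n) r).indicator fun _ => (1 : ℝ)) ∧ ∫ x, (ball (0 : EE n) r).indicator (fun _ => (1 : ℝ)) x = om n * r ^ n := by
  refine ⟨(integrable_indicator_iff measurableSet_ball).2 (integrableOn_const (by finiteness)), ?_⟩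
  rw [integral_indicator measurableSet_ball, setIntegral_const, smul_eq_mul, mul_one, measureReal_def, Measure.addHaar_ball_of_pos _ _ hr, ENNReal.toReal_mul, ENNReal.toReal_ofReal (by positivity), om, measureReal_def]
  simp [mul_comm]

lemma chB_tr {n : ℕ} {ρ : ℝ} (h0 : 0 < ρ) (h1 : ρ < 1) {z : EE n} (hz : ‖z‖ ≤ ρ) : ∫ x, |chB n x - chB n (x - z)| ≤ om n * (1 + ρ) ^ n - om n * (1 - ρ) ^ n := by
  obtain ⟨a1, a2⟩ := ball_ind n (by linarith : 0 < 1 + ρ)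
  obtain ⟨b1, b2⟩ := ball_ind n (by linarith : 0 < 1 - ρ)
  rw [← a2, ← b2, ← integral_sub a1 b1]
  refine integral_mono (isub (chB_able n) ((chB_able n).comp_sub_right z)).abs (isub a1 b1) fun x => ?_
  have u1 := norm_sub_norm_le x z
  have u2 := norm_sub_le x z
  classical simp only [chB, indicator_apply, mem_ball_zero_iff]
  generalize ‖x - z‖ = s at *
  generalize ‖x‖ = t at *
  clear a1 a2 b1 b2
  split_ifs <;> first | (exfalso; linarith) | norm_num

lemma dir_deriv {n : ℕ} (hn : 1 ≤ n) {G : EE n → ℝ} (hG : Continuous G) (hs : HasCompactSupport G) (h0 : ∀ x, 0 ≤ G x) {y : EE n}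
    (hy : ∀ᶠ z in nhds y, ∫ x, G x * ‖x - y‖ ≤ ∫ x, G x * ‖x - z‖) : ∫ x, G x • (‖x - y‖⁻¹ • (x - y)) = 0 := by
  have : NeZero n := ⟨by omega⟩
  have vb : ∀ x, ‖G x • (‖x - y‖⁻¹ • (x - y))‖ ≤ G x := fun x => by
    rw [norm_smul, Real.norm_of_nonneg (h0 x)]
    refine mul_le_of_le_one_right (h0 x) ?_
    rw [norm_smul, norm_inv, norm_norm]; exact inv_mul_le_one
  have gi : Integrable G := hG.integrable_of_hasCompactSupport hs
  have vi : Integrable (fun x => G x • (‖x - y‖⁻¹ • (x - y))) := by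
    refine gi.mono' ?_ (.of_forall vb)
    exact (hG.measurable.smul ((by fun_prop : Measurable fun x => ‖x - y‖⁻¹ • (x - y)))).aestronglyMeasurable
  refine ext_inner_left ℝ fun v => ?_
  rw [inner_zero_right, ← integral_inner vi]
  have hd := hasDerivAt_integral_of_dominated_loc_of_lip (μ := volume) (F := fun (t : ℝ) x => G x * ‖x - (y + t • v)‖) (x₀ := 0) (s := univ)
    (bound := fun x => G x * ‖v‖) (F' := fun x => -inner ℝ v (G x • (‖x - y‖⁻¹ • (x - y)))) Filter.univ_mem
    (.of_forall fun t => (by fun_prop : Continuous fun x => G x * ‖x - (y + t • v)‖).aestronglyMeasurable)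
    ((by fun_prop : Continuous fun x => G x * ‖x - (y + (0 : ℝ) • v)‖).integrable_of_hasCompactSupport hs.mul_right)
    (vi.const_inner v).neg.aestronglyMeasurable
    (.of_forall fun x => LipschitzOnWith.of_dist_le_mul fun a _ b _ => by
      rw [Real.dist_eq, Real.dist_eq, ← mul_sub, abs_mul, abs_of_nonneg (h0 x), Real.coe_nnabs, abs_of_nonneg (mul_nonneg (h0 x) (norm_nonneg v)), mul_assoc]
      refine mul_le_mul_of_nonneg_left ((abs_norm_sub_norm_le _ _).trans (le_of_eq ?_)) (h0 x)
      rw [show x - (y + a • v) - (x - (y + b • v)) = (b - a) • v by rw [sub_smul]; abel, norm_smul, Real.norm_eq_abs, abs_sub_comm, mul_comm])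
    (gi.mul_const _)
    (by
      have : ∀ᵐ x : EE n, x ≠ y := by simp [ae_iff]
      filter_upwards [this] with x hx
      have ne : 0 < ‖x - y‖ := norm_pos_iff.2 (sub_ne_zero.2 hx)
      have d1 : HasDerivAt (fun t : ℝ => x - (y + t • v)) (-v) 0 := by
        simpa using (((hasDerivAt_id (0 : ℝ)).smul_const v).const_add y).const_sub x
      have d2 := (d1.norm_sq.sqrt (by simpa using ne.ne')).const_mul (G x)
      simp only [Real.sqrt_sq (norm_nonneg _)] at d2
      refine d2.congr_deriv ?_
      simp only [zero_smul, add_zero, inner_neg_right, inner_smul_right, real_inner_comm v]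
      rw [mul_neg, neg_div, mul_neg, mul_div_mul_left _ _ two_ne_zero, div_eq_inv_mul])
  have hm : IsLocalMin (fun t : ℝ => ∫ x, G x * ‖x - (y + t • v)‖) 0 := by
    have hc : Filter.Tendsto (fun t : ℝ => y + t • v) (nhds 0) (nhds y) := by
      have : Continuous fun t : ℝ => y + t • v := by fun_prop
      simpa using this.tendsto 0
    have := hc.eventually hy
    simpa [IsLocalMin, IsMinFilter] using this
  have := hm.hasDerivAt_eq_zero hd.2
  rw [integral_neg] at this
  exact neg_eq_zero.1 this

lemma center {n : ℕ} (hn : 1 ≤ n) {ρ : ℝ} (h0 : 0 < ρ) (h1 : ρ ≤ 1) : ∃ η > 0, ∀ G : EE n → ℝ, Continuous G → HasCompactSupport G → (∀ x, 0 ≤ G x) →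
    ∫ x, |G x - chB n x| ≤ η → ∃ y, ‖y‖ ≤ ρ ∧ ∫ x, G x • (‖x - y‖⁻¹ • (x - y)) = 0 := by
  have hk := om_pos n
  refine ⟨om n * (ρ / 2) ^ n / 4, by positivity, fun G hG hs hG0 hη => ?_⟩
  have gi : Integrable G := hG.integrable_of_hasCompactSupport hs
  have fi : ∀ y, Integrable (fun x => G x * ‖x - y‖) := fun y => (by fun_prop : Continuous fun x => G x * ‖x - y‖).integrable_of_hasCompactSupport hs.mul_right
  have fc : Continuous fun y => ∫ x, G x * ‖x - y‖ := by
    refine (LipschitzWith.of_dist_le_mul (K := Real.nnabs (∫ x, G x)) fun a b => ?_).continuous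
    rw [Real.dist_eq, ← integral_sub (fi a) (fi b), Real.coe_nnabs, abs_of_nonneg (a := ∫ x, G x) (integral_nonneg fun x => hG0 x), ← integral_mul_const]
    refine (abs_integral_le_integral_abs).trans (integral_mono (isub (fi a) (fi b)).abs (gi.mul_const _) fun x => ?_)
    beta_reduce
    rw [← mul_sub, abs_mul, abs_of_nonneg (hG0 x)]
    refine mul_le_mul_of_nonneg_left ((abs_norm_sub_norm_le _ _).trans (le_of_eq ?_)) (hG0 x)
    rw [dist_comm, dist_eq_norm]; congr 1; abel
  obtain ⟨y, hy, hmin⟩ := (isCompact_closedBall (0 : EE n) ρ).exists_isMinOn ⟨0, by simp [h0.le]⟩ fc.continuousOn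
  rw [mem_closedBall_zero_iff] at hy
  refine ⟨y, hy, dir_deriv hn hG hs hG0 ?_⟩
  have hlt : ‖y‖ < ρ := by
    refine lt_of_le_of_ne hy fun hyρ => ?_
    have h00 := hmin (show (0 : EE n) ∈ closedBall 0 ρ by simp [h0.le])
    simp only [mem_setOf_eq, sub_zero] at h00
    have i0 : Integrable fun x => G x * ‖x‖ := by simpa using fi 0
    have bd : ∀ x : EE n, |‖x - y‖ - ‖x‖| ≤ ρ := fun x => by
      have := abs_norm_sub_norm_le (x - y) x
      rw [sub_sub_cancel_left, norm_neg, hyρ] at this; exact this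
    have bd' : ∀ x : EE n, |‖x + y‖ - ‖x‖| ≤ ρ := fun x => by
      have := abs_norm_sub_norm_le (x + y) x
      rw [add_sub_cancel_left, hyρ] at this; exact this
    have ci : Integrable fun x => chB n x * (‖x - y‖ - ‖x‖) := (chB_able n).mul_bdd (c := ρ) (by fun_prop) (.of_forall bd)
    have ci' : Integrable fun x => chB n x * (‖x + y‖ - ‖x‖) := (chB_able n).mul_bdd (c := ρ) (by fun_prop) (.of_forall bd')
    have gd := isub (fi y) i0
    have t1 : ∫ x, chB n x * (‖x - y‖ - ‖x‖) ≤ ρ * (om n * (ρ / 2) ^ n / 4) := by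
      have : (∫ x, chB n x * (‖x - y‖ - ‖x‖)) - (∫ x, (G x * ‖x - y‖ - G x * ‖x‖)) ≤ ρ * ∫ x, |G x - chB n x| := by
        rw [← integral_sub ci gd, ← integral_const_mul]
        refine integral_mono (isub ci gd) ((isub gi (chB_able n)).abs.const_mul _) fun x => ?_
        calc chB n x * (‖x - y‖ - ‖x‖) - (G x * ‖x - y‖ - G x * ‖x‖) = (chB n x - G x) * (‖x - y‖ - ‖x‖) := by ring
          _ ≤ |chB n x - G x| * |‖x - y‖ - ‖x‖| := by rw [← abs_mul]; exact le_abs_self _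
          _ ≤ |chB n x - G x| * ρ := mul_le_mul_of_nonneg_left (bd x) (abs_nonneg _)
          _ = _ := by rw [abs_sub_comm, mul_comm]
      rw [integral_sub (fi y) i0] at this
      have h5 := mul_le_mul_of_nonneg_left hη h0.le
      linarith
    have t2 : ∫ x, chB n x * (‖x - y‖ - ‖x‖) = ∫ x, chB n x * (‖x + y‖ - ‖x‖) := by
      rw [← integral_neg_eq_self]
      refine integral_congr_ae (.of_forall fun x => ?_)
      have : chB n (-x) = chB n x := by classical simp [chB, indicator_apply]
      beta_reduce; rw [this, norm_neg, ← neg_add', norm_neg]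
    obtain ⟨b1, b2⟩ := ball_ind n (by linarith : 0 < ρ / 2)
    have t3 : ρ * (om n * (ρ / 2) ^ n) ≤ (∫ x, chB n x * (‖x - y‖ - ‖x‖)) + ∫ x, chB n x * (‖x + y‖ - ‖x‖) := by
      rw [← integral_add ci ci', ← b2, ← integral_const_mul]
      refine integral_mono (b1.const_mul _) (ci.fun_add ci') fun x => ?_
      have e1 : 2 * ‖x‖ ≤ ‖x - y‖ + ‖x + y‖ := by
        have := norm_add_le (x - y) (x + y)
        rw [sub_add_add_cancel, ← two_smul ℝ, norm_smul] at this; simpa using this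
      have e2 : 2 * ρ ≤ ‖x - y‖ + ‖x + y‖ := by
        have := norm_sub_le (x + y) (x - y)
        rw [add_sub_sub_cancel, ← two_smul ℝ, norm_smul, hyρ] at this; norm_num at this; linarith
      classical simp only [chB, indicator_apply, mem_ball_zero_iff]
      generalize ‖x - y‖ = s at *
      generalize ‖x + y‖ = t at *
      split_ifs with k1 k2 k2 <;> first | linarith | (exfalso; linarith)
    rw [← t2] at t3
    have : 0 < ρ * (om n * (ρ / 2) ^ n) := by positivity
    linarith
  filter_upwards [isOpen_ball.mem_nhds (mem_ball_zero_iff.2 hlt)] with z hz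
  exact hmin (ball_subset_closedBall hz)

-- radial kernels, singular at 0 but integrable
def Rk (n : ℕ) (k : ℝ → ℝ) : Prop := Measurable k ∧ (∀ r, 0 ≤ r → 0 ≤ k r) ∧ (∀ r, 0 ≤ r → r ≤ 1 → r ^ (n - 1) * k r ≤ 1) ∧ ∀ r, 1 ≤ r → k r ≤ 1

lemma Rk.loc {n : ℕ} (hn : 1 ≤ n) {k : ℝ → ℝ} (hk : Rk n k) : Integrable fun x : EE n => chB n x * k ‖x‖ := by
  obtain ⟨k1, k2, k3, k4⟩ := hk
  refine pol_able hn ((chB_meas n).mul (k1.comp measurable_norm)) (R := 1) (C := 1) (fun x hx => ?_) fun x => ?_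
  · classical simp [chB, indicator_apply, hx.le]
  · rw [abs_of_nonneg (mul_nonneg (chB_bd x).1 (k2 _ (norm_nonneg x)))]
    classical simp only [chB, indicator_apply, mem_ball_zero_iff]
    split_ifs with h
    · rw [one_mul]; exact k3 _ (norm_nonneg x) h.le
    · simp

lemma Rk.sing {n : ℕ} (hn : 1 ≤ n) {k : ℝ → ℝ} (hk : Rk n k) {f : EE n → ℝ} (hf : Integrable f) {M : ℝ} (hM : ∀ x, |f x| ≤ M) (y : EE n) :
    Integrable (fun x => f x * k ‖x - y‖) ∧ ∫ x, |f x * k ‖x - y‖| ≤ M * (∫ x : EE n, chB n x * k ‖x‖) + ∫ x, |f x| := by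
  have il := hk.loc hn
  obtain ⟨k1, k2, k3, k4⟩ := hk
  have i1 : Integrable (fun x : EE n => M * (chB n (x - y) * k ‖x - y‖)) := (il.comp_sub_right y).const_mul M
  have bd : ∀ x, |f x * k ‖x - y‖| ≤ M * (chB n (x - y) * k ‖x - y‖) + |f x| := fun x => by
    have h0 := k2 _ (norm_nonneg (x - y))
    rw [abs_mul, abs_of_nonneg h0]
    rcases lt_or_ge ‖x - y‖ 1 with h | h
    · have : chB n (x - y) = 1 := by classical simp [chB, indicator_apply, h]
      rw [this, one_mul]; linarith [mul_le_mul_of_nonneg_right (hM x) h0, abs_nonneg (f x)]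
    · have : chB n (x - y) = 0 := by classical simp [chB, indicator_apply, h]
      rw [this, zero_mul, mul_zero, zero_add]; exact mul_le_of_le_one_right (abs_nonneg _) (k4 _ h)
  have ii : Integrable (fun x => f x * k ‖x - y‖) := (i1.fun_add hf.abs).mono'
    (hf.aestronglyMeasurable.mul (k1.comp (by fun_prop)).aestronglyMeasurable) (.of_forall bd)
  refine ⟨ii, (integral_mono ii.abs (i1.fun_add hf.abs) bd).trans (le_of_eq ?_)⟩
  rw [integral_add i1 hf.abs, integral_const_mul, integral_sub_right_eq_self (fun x => chB n x * k ‖x‖) y]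

lemma Rk_inv {n : ℕ} (hn : 2 ≤ n) : Rk n fun r => r⁻¹ := by
  refine ⟨measurable_inv, fun r hr => inv_nonneg.2 hr, fun r h0 h1 => ?_, fun r hr => inv_le_one_of_one_le₀ hr⟩
  obtain ⟨k, rfl⟩ : ∃ k, n = k + 2 := ⟨n - 2, by omega⟩
  rcases h0.eq_or_lt with h | h
  · simp [← h]
  · rw [show k + 2 - 1 = k + 1 by omega, pow_succ, mul_assoc, mul_inv_cancel₀ h.ne', mul_one]; exact pow_le_one₀ h0 h1

lemma lev {n : ℕ} (b : EE n) : ContDiff ℝ 1 (fun x : EE n => √(1 + ‖x - b‖ ^ 2)) ∧ ∀ x, ‖fderiv ℝ (fun x : EE n => √(1 + ‖x - b‖ ^ 2)) x‖ ≤ 1 := by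
  have key : ∀ s t : ℝ, √(1 + s ^ 2) ≤ √(1 + t ^ 2) + |s - t| := fun s t => by
    have h1 : |t| ≤ √(1 + t ^ 2) := Real.abs_le_sqrt (by linarith)
    have h2 := Real.sq_sqrt (by positivity : 0 ≤ 1 + t ^ 2)
    have h3 : t * (s - t) ≤ √(1 + t ^ 2) * |s - t| := (le_abs_self _).trans (by rw [abs_mul]; gcongr)
    refine (Real.sqrt_le_left (by positivity)).2 ?_
    rw [add_sq, h2, sq_abs]; linarith
  constructor
  · exact ((contDiff_const.add ((contDiff_id.sub contDiff_const).norm_sq ℝ)).sqrt fun x => by positivity)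
  · intro x
    refine (norm_fderiv_le_of_lipschitz ℝ (C := 1) (LipschitzWith.of_le_add fun u v => ?_)).trans (by simp)
    refine (key ‖u - b‖ ‖v - b‖).trans (add_le_add_right ((abs_norm_sub_norm_le _ _).trans (le_of_eq ?_)) _)
    rw [dist_eq_norm]; congr 1; abel

set_option maxHeartbeats 800000 in
lemma FJ {n : ℕ} (hn : 3 ≤ n) : ∃ c > 0, ∃ δ > 0, ∀ er > 0, ∃ τ > 0, ∀ g : EE n → ℝ, AD g → |(∫ x, g x) - om n| ≤ τ →
    |(∫ x, g x ^ pn n) - om n| ≤ τ → ∫ x, ‖fderiv ℝ g x‖ ≤ n * om n + δ →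
    ∃ y : EE n, (1 + c) * (n * om n) ≤ (∫ x, ‖fderiv ℝ g x‖) + c * ((n - 1) * ∫ x, g x * ‖x - y‖⁻¹) + er := by
  obtain ⟨c, hc, ηJ, hηJ, J⟩ := jlem hn
  have hk := om_pos n
  have hn1 : 1 ≤ n := by omega
  have n0 : (0 : ℝ) < n := by positivity
  obtain ⟨ρ, ρ0, ρ1, ρ2, ρ3⟩ : ∃ ρ : ℝ, 0 < ρ ∧ ρ < 1 ∧ (1 + 3 * ρ) ^ (n - 1) ≤ 2 ∧ om n * (1 + ρ) ^ n - om n * (1 - ρ) ^ n ≤ ηJ / 2 := by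
    have c1 : ContinuousAt (fun t : ℝ => om n * (1 + t) ^ n - om n * (1 - t) ^ n) 0 := by fun_prop
    have c2 : ContinuousAt (fun t : ℝ => (1 + 3 * t) ^ (n - 1)) 0 := by fun_prop
    obtain ⟨e, he, h⟩ := Metric.eventually_nhds_iff.1 ((c1.eventually_lt (continuousAt_const (y := ηJ / 2)) (by simp; positivity)).and
      (c2.eventually_lt (continuousAt_const (y := 2)) (by simp)))
    have := @h (min (e / 2) (1 / 2)) (by
      rw [Real.dist_eq, sub_zero, abs_of_pos (by positivity)]; exact (min_le_left _ _).trans_lt (by linarith))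
    exact ⟨min (e / 2) (1 / 2), by positivity, (min_le_right _ _).trans_lt (by norm_num), this.2.le, this.1.le⟩
  obtain ⟨d, rfl⟩ : ∃ d, n = d + 1 := ⟨n - 1, by omega⟩
  have hd : 1 ≤ d := by omega
  set s0 := √(1 + (1 + ρ) ^ 2) with hs0
  set s1 := √(1 + (1 + 2 * ρ) ^ 2) with hs1
  have hL : 0 < s1 - s0 := sub_pos.2 (Real.sqrt_lt_sqrt (by positivity) (by nlinarith))
  obtain ⟨θ, hθ, T⟩ := trunc hd hL
  obtain ⟨ηc, hηc, Ce⟩ := center (n := d + 1) hn1 ρ0 ρ1.le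
  set η := min θ (min (ηc / 4) (ηJ / 4)) with hη
  have η0 : 0 < η := by positivity
  have η1 : η ≤ θ := min_le_left _ _
  have η2 : η ≤ ηc / 4 := (min_le_right _ _).trans (min_le_left _ _)
  have η3 : η ≤ ηJ / 4 := (min_le_right _ _).trans (min_le_right _ _)
  clear_value η
  obtain ⟨δ, hδ, hcl⟩ := close hn η0
  refine ⟨c, hc, δ, hδ, fun er her => ?_⟩
  obtain ⟨τ, hτ, T⟩ := T (er / 2) (by positivity)
  set τ' := min δ (min (τ / 2) (er / (8 * (d + 1 : ℕ)))) with hτ'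
  have e1 : τ' ≤ δ := min_le_left _ _
  have e2 : τ' ≤ τ / 2 := (min_le_right _ _).trans (min_le_left _ _)
  have e3 : 4 * ((d + 1 : ℕ) : ℝ) * τ' ≤ er / 2 := by
    have : τ' ≤ er / (8 * (d + 1 : ℕ)) := (min_le_right _ _).trans (min_le_right _ _)
    rw [le_div_iff₀ (by positivity)] at this; linarith
  refine ⟨τ', by positivity, fun g hg hm hM hD => ?_⟩
  clear_value τ'
  obtain ⟨b, hb⟩ := hcl g hg (hm.trans e1) (hM.trans e1) hD
  obtain ⟨l1, l2⟩ := lev b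
  set p := pn (d + 1) with hp
  have hp' : p = 1 + 1 / (d : ℝ) := pn_succ hd
  obtain ⟨p1, p2⟩ := pn_bd hn
  rw [← hp] at p1 p2
  have gi : Integrable g := hg.1.continuous.integrable_of_hasCompactSupport hg.2.1
  have pi := (pw_able hg.1.continuous hg.2.1 (p := p) (by linarith)).2.2
  have Ci := (chB_able (d + 1)).comp_sub_right b
  have Di := (isub gi Ci).abs
  have lm : Measurable (fun x : EE (d + 1) => √(1 + ‖x - b‖ ^ 2)) := l1.continuous.measurable
  have gI : Integrable (fun x => g x * (Ici s0).indicator 1 (√(1 + ‖x - b‖ ^ 2))) :=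
    gi.mul_bdd (c := 1) ((measurable_one.indicator measurableSet_Ici).comp lm).aestronglyMeasurable (.of_forall fun x => by
      classical rw [indicator_apply]; split_ifs <;> simp)
  have out : ∫ x, g x * (Ici s0).indicator 1 (√(1 + ‖x - b‖ ^ 2)) ≤ η := by
    refine (integral_mono gI Di fun x => ?_).trans hb
    classical simp only [indicator_apply, mem_Ici]
    split_ifs with h
    · have h2 : 1 + ρ ≤ ‖x - b‖ := by
        by_contra hh
        exact absurd h (not_le.2 (Real.sqrt_lt_sqrt (by positivity) (by nlinarith [norm_nonneg (x - b)])))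
      have : chB (d + 1) (x - b) = 0 := by classical simp [chB, indicator_apply]; linarith
      rw [this, sub_zero]; simp [le_abs_self]
    · rw [mul_zero]; exact abs_nonneg _
  obtain ⟨q, q1, q2, q3, q4, q5, q6, q7⟩ := T g hg (by
    rw [← hp', integral_sub gi pi]; linarith [(abs_le.1 hm).2, (abs_le.1 hM).1]) _ l1 l2 s0 (out.trans η1)
  rw [add_sub_cancel] at q6
  have ui : Integrable (fun x => g x * (1 - q x)) := (hg.1.continuous.mul (by fun_prop)).integrable_of_hasCompactSupport hg.2.1.mul_right
  have u0 : ∀ x, 0 ≤ g x * (1 - q x) := fun x => mul_nonneg (hg.2.2.1 x) (by linarith [q4 x])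
  set μ := ∫ x, g x * (1 - q x) with hμ
  have hμη : μ ≤ η := by
    refine (integral_mono ui gI fun x => mul_le_mul_of_nonneg_left ?_ (hg.2.2.1 x)).trans out
    classical rw [indicator_apply]
    split_ifs with h
    · simp [q3 x]
    · rw [q5 x (not_le.1 h).le]; simp
  set G := fun x => g x * q x with hG
  have Gi : Integrable G := q1.1.continuous.integrable_of_hasCompactSupport q1.2.1
  obtain ⟨Gpc, Gps, Gpi⟩ := pw_able q1.1.continuous q1.2.1 (p := p) (by linarith)
  have Gb : ∫ x, |G x - chB (d + 1) (x - b)| ≤ 2 * η := by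
    calc _ ≤ ∫ x, (g x * (1 - q x) + |g x - chB (d + 1) (x - b)|) := by
          refine integral_mono (isub Gi Ci).abs (ui.fun_add Di) fun x => ?_
          have := abs_add_le (-(g x * (1 - q x))) (g x - chB (d + 1) (x - b))
          rw [abs_neg, abs_of_nonneg (u0 x)] at this
          refine le_trans (le_of_eq ?_) this
          congr 1; rw [hG]; ring
      _ ≤ _ := by rw [integral_add ui Di]; linarith
  obtain ⟨y, hy, hy0⟩ := Ce (fun x => G (x + b) ^ p) (Gpc.comp (by fun_prop)) (Gps.comp_homeomorph (Homeomorph.addRight b)) (fun x => Real.rpow_nonneg (q1.2.2.1 _) _) (by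
    calc _ ≤ ∫ x, 2 * |G (x + b) - chB (d + 1) x| := by
          exact integral_mono (isub (Gpi.comp_add_right b) (chB_able _)).abs ((isub (Gi.comp_add_right b) (chB_able _)).abs.const_mul 2) fun x =>
            pow_chB hn x (q1.2.2.1 _) (q1.2.2.2 _)
      _ = 2 * ∫ x, |G x - chB (d + 1) (x - b)| := by
          rw [integral_const_mul, ← integral_add_right_eq_self (fun x => |G x - chB (d + 1) (x - b)|) b]; simp only [add_sub_cancel_right]
      _ ≤ ηc := by linarith)
  set z := b + y with hz
  have hG2 : ContDiff ℝ 1 fun x => G (x + z) := q1.1.comp (contDiff_id.add contDiff_const)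
  have J' := J (1 + 3 * ρ) (by linarith) ρ2 (fun x => G (x + z)) hG2 (fun x => q1.2.2.1 _) (fun x => q1.2.2.2 _) (fun x hx => by
      have : 1 + 2 * ρ ≤ ‖x + z - b‖ := by
        have := norm_sub_le (x + y) y
        rw [add_sub_cancel_right] at this
        rw [show x + z - b = x + y by rw [hz]; abel]; linarith
      rw [hG]; beta_reduce; rw [q6 _ (Real.sqrt_le_sqrt (by nlinarith)), mul_zero]) (by
      rw [← hy0, ← integral_add_right_eq_self (fun x => G (x + b) ^ p • (‖x - y‖⁻¹ • (x - y))) y]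
      refine integral_congr_ae (.of_forall fun x => ?_)
      beta_reduce; rw [add_sub_cancel_right, show x + y + b = x + z by rw [hz]; abel]) (by
      have ct := chB_tr ρ0 ρ1 hy
      have i1 := Gi.comp_add_right z
      have i2 := (chB_able (d + 1)).comp_add_right y
      have i3 := chB_able (d + 1)
      calc ∫ x, |G (x + z) - chB (d + 1) x| ≤ ∫ x, (|G (x + z) - chB (d + 1) (x + y)| + |chB (d + 1) (x + y) - chB (d + 1) x|) :=
            integral_mono (isub i1 i3).abs ((isub i1 i2).abs.fun_add (isub i2 i3).abs) fun x => abs_sub_le _ _ _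
        _ = (∫ x, |G x - chB (d + 1) (x - b)|) + ∫ x, |chB (d + 1) x - chB (d + 1) (x - y)| := by
            rw [integral_add (isub i1 i2).abs (isub i2 i3).abs, ← integral_add_right_eq_self (fun x => |G x - chB (d + 1) (x - b)|) z,
              ← integral_add_right_eq_self (fun x => |chB (d + 1) x - chB (d + 1) (x - y)|) y]
            simp only [add_sub_cancel_right, hz, add_assoc, show ∀ x : EE (d + 1), x + (b + y) - b = x + y from fun x => by abel]
        _ ≤ ηJ := by linarith) (2 * μ + τ') (by
      rw [integral_add_right_eq_self (fun x => G x ^ p) z]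
      have h1 : (∫ x, g x ^ p) - (∫ x, G x ^ p) ≤ 2 * μ := by
        rw [← integral_sub pi Gpi, hμ, ← integral_const_mul]
        refine integral_mono (isub pi Gpi) (ui.const_mul 2) fun x => ?_
        have a1 := pow_cmp p1.le p2 (q3 x) (q4 x)
        have a2 := pow_cmp p1.le p2 (hg.2.2.1 x) (hg.2.2.2 x)
        rw [hG]; beta_reduce; rw [Real.mul_rpow (hg.2.2.1 x) (q3 x)]
        have := mul_le_mul a2.1 a1.2 (by linarith [Real.rpow_le_one (q3 x) (q4 x) (by linarith : 0 ≤ p)]) (hg.2.2.1 x)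
        linarith
      have h2 : ∫ x, G x ^ p ≤ ∫ x, g x ^ p := integral_mono Gpi pi fun x =>
        Real.rpow_le_rpow (q1.2.2.1 x) (mul_le_of_le_one_right (hg.2.2.1 x) (q4 x)) (by linarith)
      have μ0 : 0 ≤ μ := integral_nonneg u0
      rw [abs_le] at hM ⊢
      constructor <;> linarith [hM.1, hM.2])
  refine ⟨z, ?_⟩
  have f1 : ∫ x, ‖fderiv ℝ (fun x => G (x + z)) x‖ = ∫ x, ‖fderiv ℝ G x‖ := by
    simp only [fderiv_comp_add_right]
    exact integral_add_right_eq_self (fun x => ‖fderiv ℝ G x‖) z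
  have f2 : ∫ x, G (x + z) * ‖x‖⁻¹ ≤ ∫ x, g x * ‖x - z‖⁻¹ := by
    rw [← integral_add_right_eq_self (fun x => g x * ‖x - z‖⁻¹) z]
    simp only [add_sub_cancel_right]
    have R := Rk_inv (n := d + 1) (by omega)
    have r1 := (R.sing hn1 (Gi.comp_add_right z) (M := 1) (fun x => by rw [abs_of_nonneg (q1.2.2.1 _)]; exact q1.2.2.2 _) 0).1
    have r2 := (R.sing hn1 (gi.comp_add_right z) (M := 1) (fun x => by rw [abs_of_nonneg (hg.2.2.1 _)]; exact hg.2.2.2 _) 0).1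
    simp only [sub_zero] at r1 r2
    exact integral_mono r1 r2 fun x => mul_le_mul_of_nonneg_right (mul_le_of_le_one_right (hg.2.2.1 _) (q4 _)) (inv_nonneg.2 (norm_nonneg _))
  rw [f1] at J'
  have f3 := mul_le_mul_of_nonneg_left (mul_le_mul_of_nonneg_left f2 (by push_cast; linarith [Nat.cast_nonneg (α := ℝ) d] : (0 : ℝ) ≤ ((d + 1 : ℕ) : ℝ) - 1)) hc.le
  have e8 : (8 : ℝ) * (d + 1) * μ = 4 * ((d + 1 : ℕ) : ℝ) * (2 * μ) := by push_cast; ring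
  rw [e8] at q7
  have e9 : 4 * ((d + 1 : ℕ) : ℝ) * (2 * μ + τ') = 4 * ((d + 1 : ℕ) : ℝ) * (2 * μ) + 4 * ((d + 1 : ℕ) : ℝ) * τ' := by ring
  rw [e9] at J'
  linarith

noncomputable def ch {n : ℕ} (E : Set (EE n)) : EE n → ℝ := E.indicator fun _ => 1

lemma ch_bd {n : ℕ} (E : Set (EE n)) (x) : 0 ≤ ch E x ∧ ch E x ≤ 1 := by
  classical simp only [ch, indicator_apply]; split_ifs <;> norm_num

lemma ch_int {n : ℕ} {E : Set (EE n)} (hE : MeasurableSet E) (hf : volume E ≠ ⊤) : Integrable (ch E) :=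
  (integrable_indicator_iff hE).2 (integrableOn_const hf)

lemma ch_set {n : ℕ} {E : Set (EE n)} (hE : MeasurableSet E) (f : EE n → ℝ) : ∫ x in E, f x = ∫ x, ch E x * f x := by
  rw [← integral_indicator hE]; congr 1; ext x; classical simp only [ch, indicator_apply]; split_ifs <;> simp

lemma ch_sub {n : ℕ} (E : Set (EE n)) {F : Set (EE n)} (hE : MeasurableSet E) (hF : MeasurableSet F) :
    ∫ x, |ch E x - ch F x| = volume.real (symmDiff E F) := by
  rw [← integral_indicator_one (hE.symmDiff hF)]; congr 1; ext x
  classical simp only [ch, indicator_apply, mem_symmDiff, Pi.one_apply]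
  by_cases h1 : x ∈ E <;> by_cases h2 : x ∈ F <;> simp [h1, h2]

lemma vdiv_cc {n : ℕ} {φ : EE n → EE n} (h : ContDiff ℝ 1 φ) (hs : HasCompactSupport φ) :
    Continuous (vdiv φ) ∧ HasCompactSupport (vdiv φ) :=
  ⟨by have := h.continuous_fderiv one_ne_zero; unfold vdiv; fun_prop,
    cs_of (hs.fderiv ℝ) fun x hx => by simp [vdiv, hx]⟩

lemma sum_co {n : ℕ} (x : EE n) : ∑ i, x i • EuclideanSpace.single i (1:ℝ) = x := by
  ext j; simp [Pi.single_apply]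

lemma ibp_div {n : ℕ} {u : EE n → ℝ} {φ : EE n → EE n} (hu : ContDiff ℝ 1 u) (h : ContDiff ℝ 1 φ)
    (hs : HasCompactSupport φ) : ∫ x, u x * vdiv φ x = -∫ x, fderiv ℝ u x (φ x) := by
  have hu' := hu.continuous_fderiv one_ne_zero
  have hφ' := h.continuous_fderiv one_ne_zero
  have uc := hu.continuous
  have pc := h.continuous
  have e1 (x) (i : Fin n) : fderiv ℝ φ x (EuclideanSpace.single i 1) i = fderiv ℝ (fun y => φ y i) x (EuclideanSpace.single i 1) := by
    have := ((EuclideanSpace.proj i : EE n →L[ℝ] ℝ).hasFDerivAt.comp x (h.differentiable one_ne_zero x).hasFDerivAt).fderiv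
    rw [show (fun y => φ y i) = (EuclideanSpace.proj i : EE n →L[ℝ] ℝ) ∘ φ from rfl, this]; rfl
  have i1 (i : Fin n) : Integrable fun x => u x * fderiv ℝ φ x (EuclideanSpace.single i 1) i :=
    Continuous.integrable_of_hasCompactSupport (by fun_prop) (cs_of (hs.fderiv ℝ) fun x hx => by simp [hx])
  have i2 (i : Fin n) : Integrable fun x => fderiv ℝ u x (EuclideanSpace.single i 1) * φ x i :=
    Continuous.integrable_of_hasCompactSupport (by fun_prop) (cs_of hs fun x hx => by simp [hx])
  have e2 (x) : fderiv ℝ u x (φ x) = ∑ i, fderiv ℝ u x (EuclideanSpace.single i 1) * φ x i := by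
    conv_lhs => rw [← sum_co (φ x), map_sum]
    simp [mul_comm]
  simp only [vdiv, Finset.mul_sum, e2]
  rw [integral_finsetSum _ fun i _ => i1 i, integral_finsetSum _ fun i _ => i2 i, ← Finset.sum_neg_distrib]
  refine Finset.sum_congr rfl fun i _ => ?_
  simp only [e1] at i1 ⊢
  exact integral_mul_fderiv_eq_neg_fderiv_mul_of_integrable (i2 i) (i1 i)
    (Continuous.integrable_of_hasCompactSupport (by fun_prop) (cs_of hs fun x hx => by simp [hx]))
    (fun x _ => hu.differentiable one_ne_zero x) (fun x _ => ((EuclideanSpace.proj i : EE n →L[ℝ] ℝ).contDiff.comp h).differentiable one_ne_zero x)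

lemma ch_tr {n : ℕ} {E : Set (EE n)} (hE : MeasurableSet E) (hf : volume E ≠ ⊤) {τ : ℝ} (hτ : 0 < τ) :
    ∃ ε > 0, ∀ t : EE n, ‖t‖ < ε → ∫ x, |ch E (x - t) - ch E x| ≤ τ := by
  have h1 : Continuous (Function.uncurry fun (t x : EE n) => x - t) := by fun_prop
  let f : EE n → C(EE n, EE n) := fun t => ⟨fun x => x - t, by fun_prop⟩
  have hc : Continuous f := ContinuousMap.continuous_of_continuous_uncurry _ h1
  have hp (t) : MeasurePreserving (f t) := measurePreserving_sub_right volume t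
  have := tendsto_measure_symmDiff_preimage_nhds_zero (hc.tendsto 0) (.of_forall hp) (hp 0) hE.nullMeasurableSet hf
  obtain ⟨ε, hε, h⟩ := Metric.eventually_nhds_iff.1 ((ENNReal.tendsto_nhds_zero.1 this) (ENNReal.ofReal τ) (by simpa))
  refine ⟨ε, hε, fun t ht => ?_⟩
  have h2 := h (y := t) (by simpa using ht)
  have h3 : f 0 ⁻¹' E = E := by ext x; simp [f]
  rw [h3] at h2
  have : ∀ x, ch E (x - t) = ch (f t ⁻¹' E) x := fun x => rfl
  simp only [this]
  rw [ch_sub _ ((f t).continuous.measurable hE) hE]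
  exact ENNReal.toReal_le_of_le_ofReal hτ.le h2

set_option maxHeartbeats 1000000 in
lemma mol {n : ℕ} {E : Set (EE n)} (hE : MeasurableSet E) (hf : volume E ≠ ⊤) (hb : BddAbove (perimVals E)) {τ : ℝ} (hτ : 0 < τ) :
    ∃ g : EE n → ℝ, ContDiff ℝ 2 g ∧ (∀ x, 0 ≤ g x ∧ g x ≤ 1) ∧ Integrable g ∧ ∫ x, |g x - ch E x| ≤ τ ∧
      ∀ φ : EE n → EE n, ContDiff ℝ 1 φ → HasCompactSupport φ → (∀ x, ‖φ x‖ ≤ 1) → ∫ x, g x * vdiv φ x ≤ perimeter E := by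
  obtain ⟨ε, hε, htr⟩ := ch_tr hE hf hτ
  let b : ContDiffBump (0 : EE n) := ⟨ε / 2, ε, by linarith, by linarith⟩
  set w := b.normed volume
  have w0 : ∀ x, 0 ≤ w x := b.nonneg_normed
  have w1 : ∫ x, w x = 1 := b.integral_normed
  have wi : Integrable w := b.integrable_normed
  have wz : ∀ x, ε ≤ ‖x‖ → w x = 0 := fun x hx => by
    have : x ∉ Function.support w := by rw [b.support_normed_eq]; simp [b, hx]
    simpa using this
  have ci := ch_int hE hf
  have cb := ch_bd E
  have cm : Measurable (ch E) := measurable_const.indicator hE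
  let L := ContinuousLinearMap.lsmul ℝ ℝ (E := ℝ)
  have pi : Integrable (fun p : EE n × EE n => w p.2 * ch E (p.1 - p.2)) (volume.prod volume) := wi.convolution_integrand L ci
  have g2 : ContDiff ℝ 2 (convolution w (ch E) L volume) :=
    b.hasCompactSupport_normed.contDiff_convolution_left L (n := 2) b.contDiff_normed ci.locallyIntegrable
  have gi : Integrable (convolution w (ch E) L volume) := wi.integrable_convolution L ci
  rw [show convolution w (ch E) L volume = fun x => ∫ t, w t * ch E (x - t) from rfl] at g2 gi
  have it (x) : Integrable fun t => w t * ch E (x - t) :=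
    wi.mono' (wi.1.mul (cm.comp (by fun_prop)).aestronglyMeasurable) (.of_forall fun t => by
      rw [Real.norm_eq_abs, abs_of_nonneg (mul_nonneg (w0 t) (cb _).1)]; nlinarith [w0 t, (cb (x - t)).2])
  refine ⟨_, g2, fun x => ⟨integral_nonneg fun t => mul_nonneg (w0 t) (cb _).1, ?_⟩, gi, ?_, fun φ h hs h1 => ?_⟩
  · rw [← w1]; exact integral_mono (it x) wi fun t => by beta_reduce; nlinarith [w0 t, (cb (x - t)).2]
  · have p2 : Integrable (fun p : EE n × EE n => w p.2 * |ch E (p.1 - p.2) - ch E p.1|) (volume.prod volume) := by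
      refine (isub pi (ci.mul_prod wi)).norm.congr (.of_forall fun p => ?_)
      beta_reduce
      rw [show w p.2 * ch E (p.1 - p.2) - ch E p.1 * w p.2 = w p.2 * (ch E (p.1 - p.2) - ch E p.1) by ring, norm_mul,
        Real.norm_eq_abs, Real.norm_eq_abs, abs_of_nonneg (w0 _)]
    calc _ ≤ ∫ x, ∫ t, w t * |ch E (x - t) - ch E x| := by
          refine integral_mono (isub gi ci).abs p2.integral_prod_left fun x => ?_
          have : (∫ t, w t * ch E (x - t)) - ch E x = ∫ t, w t * (ch E (x - t) - ch E x) := by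
            simp only [mul_sub]
            rw [integral_sub (it x) (wi.mul_const _), integral_mul_const, w1, one_mul]
          beta_reduce
          rw [this]
          refine abs_integral_le_integral_abs.trans (le_of_eq (integral_congr_ae (.of_forall fun t => ?_)))
          beta_reduce
          rw [abs_mul, abs_of_nonneg (w0 t)]
      _ = ∫ t, ∫ x, w t * |ch E (x - t) - ch E x| := integral_integral_swap p2
      _ ≤ ∫ t, w t * τ := by
          refine integral_mono p2.integral_prod_right (wi.mul_const _) fun t => ?_
          beta_reduce
          rw [integral_const_mul]
          rcases le_or_gt ε ‖t‖ with h | h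
          · simp [wz t h]
          · exact mul_le_mul_of_nonneg_left (htr t h) (w0 t)
      _ = τ := by rw [integral_mul_const, w1, one_mul]
  · obtain ⟨vc, vs⟩ := vdiv_cc h hs
    obtain ⟨C, hC⟩ := vs.exists_bound_of_continuous vc
    have p2 : Integrable (fun p : EE n × EE n => w p.2 * ch E (p.1 - p.2) * vdiv φ p.1) (volume.prod volume) :=
      pi.mul_bdd (c := C) (vc.comp continuous_fst).aestronglyMeasurable (.of_forall fun p => hC _)
    calc _ = ∫ x, ∫ t, w t * ch E (x - t) * vdiv φ x := by simp only [integral_mul_const]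
      _ = ∫ t, ∫ x, w t * ch E (x - t) * vdiv φ x := integral_integral_swap p2
      _ ≤ ∫ t, w t * perimeter E := by
          refine integral_mono p2.integral_prod_right (wi.mul_const _) fun t => ?_
          simp only [mul_assoc]
          rw [integral_const_mul]
          refine mul_le_mul_of_nonneg_left (le_csSup hb ⟨fun x => φ (x + t), h.comp (contDiff_id.add contDiff_const), hs.comp_homeomorph (Homeomorph.addRight t), fun x => h1 _, ?_⟩) (w0 t)
          rw [ch_set hE, ← integral_add_right_eq_self (fun x => ch E (x - t) * vdiv φ x) t]
          simp [vdiv, fderiv_comp_add_right]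
      _ = _ := by rw [integral_mul_const, w1, one_mul]

set_option maxHeartbeats 1000000 in
lemma approx {n : ℕ} {E : Set (EE n)} (hE : MeasurableSet E) (hf : volume E ≠ ⊤) (hb : BddAbove (perimVals E)) {τ : ℝ} (hτ : 0 < τ) :
    ∃ g : EE n → ℝ, AD g ∧ ∫ x, |g x - ch E x| ≤ τ ∧ ∫ x, ‖fderiv ℝ g x‖ ≤ perimeter E + τ := by
  obtain ⟨g, g2, gb, gi, gE, gp⟩ := mol hE hf hb (half_pos hτ)
  obtain ⟨C, hC, hr⟩ := ramp
  obtain ⟨lc, ld⟩ := lev (0 : EE n)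
  simp only [sub_zero] at lc ld
  have npos (N : ℕ) : (0:ℝ) < N + 1 := by positivity
  choose q qc q0 q1 qa qb qd using fun N : ℕ => hr n _ lc ld (N + 1) (N + 1) (npos N)
  have t1 : Filter.Tendsto (fun N => ∫ x, g x * (1 - q N x)) Filter.atTop (nhds 0) := by
    rw [← integral_zero (EE n) ℝ (μ := volume)]
    refine tendsto_integral_of_dominated_convergence g (fun N => (g2.continuous.mul (continuous_const.sub (qc N).continuous)).aestronglyMeasurable) gi
      (fun N => .of_forall fun x => ?_) (.of_forall fun x => ?_)
    · rw [Real.norm_eq_abs, abs_of_nonneg (mul_nonneg (gb x).1 (by linarith [q1 N x]))]; nlinarith [(gb x).1, q0 N x]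
    · obtain ⟨M, hM⟩ := exists_nat_ge √(1 + ‖x‖ ^ 2)
      refine tendsto_const_nhds.congr' ((Filter.eventually_ge_atTop M).mono fun N hN => ?_)
      have h5 : (M:ℝ) ≤ N := by exact_mod_cast hN
      beta_reduce
      rw [qa N x (by linarith)]; simp
  have t2 : Filter.Tendsto (fun N : ℕ => C / ((N:ℝ) + 1) * ∫ x, g x) Filter.atTop (nhds 0) := by
    simpa using (tendsto_const_div_atTop_nhds_zero_nat C |>.comp (Filter.tendsto_add_atTop_nat 1)).mul_const (∫ x, g x)
  obtain ⟨N, hN1, hN2⟩ := ((t1.eventually (ge_mem_nhds (half_pos hτ))).and (t2.eventually (ge_mem_nhds (half_pos hτ)))).exists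
  replace qc := qc N; replace q0 := q0 N; replace q1 := q1 N; replace qb := qb N; replace qd := qd N
  set q := q N
  set M : ℝ := N + 1
  have M0 : 0 < M := npos N
  have qs : HasCompactSupport q := HasCompactSupport.of_support_subset_isCompact (isCompact_closedBall 0 (M + M)) fun x hx => by
    by_contra h
    refine hx (qb x (Real.le_sqrt_of_sq_le ?_))
    have : M + M < ‖x‖ := by simpa using h
    nlinarith
  have qi : Integrable q := qc.continuous.integrable_of_hasCompactSupport qs
  have gq : AD fun x => g x * q x := ⟨(g2.of_le (by norm_num)).mul qc, cs_of qs fun x hx => by simp [hx],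
    fun x => mul_nonneg (gb x).1 (q0 x), fun x => mul_le_one₀ (gb x).2 (q0 x) (q1 x)⟩
  have hgc := g2.continuous
  have qcc := qc.continuous
  refine ⟨_, gq, ?_, ?_⟩
  · have i1 : Integrable fun x => g x * (1 - q x) := (isub gi (hgc.mul qcc |>.integrable_of_hasCompactSupport gq.2.1)).congr (.of_forall fun x => by simp; ring)
    have i2 := (isub gi (ch_int hE hf)).abs
    calc _ ≤ ∫ x, (|g x - ch E x| + g x * (1 - q x)) := by
          refine integral_mono (isub (hgc.mul qcc |>.integrable_of_hasCompactSupport gq.2.1) (ch_int hE hf)).abs (i2.add i1) fun x => ?_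
          beta_reduce
          rw [show g x * q x - ch E x = (g x - ch E x) - g x * (1 - q x) by ring]
          exact (abs_sub _ _).trans (by rw [abs_of_nonneg (mul_nonneg (gb x).1 (by linarith [q1 x]))])
      _ ≤ _ := by rw [integral_add i2 i1]; linarith
  refine le_of_forall_pos_le_add fun e he => ?_
  obtain ⟨δ, hδ, hδ2⟩ : ∃ δ > 0, δ * ∫ x, q x ≤ e / 2 + τ / 2 - τ / 2 := by
    have h0 : 0 ≤ ∫ x, q x := integral_nonneg q0
    refine ⟨e / 2 / ((∫ x, q x) + 1), by positivity, ?_⟩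
    rw [div_mul_eq_mul_div, div_le_iff₀ (by positivity)]; nlinarith
  let G : EE n → EE n := fun x => (InnerProductSpace.toDual ℝ (EE n)).symm (fderiv ℝ g x)
  have Gc : ContDiff ℝ 1 G := (InnerProductSpace.toDual ℝ (EE n)).symm.contDiff.comp (g2.fderiv_right (m := 1) (by norm_num))
  have Gn (x) : ‖G x‖ = ‖fderiv ℝ g x‖ := LinearIsometryEquiv.norm_map _ _
  have Gi (x) : fderiv ℝ g x (G x) = ‖G x‖ ^ 2 := by
    rw [← real_inner_self_eq_norm_sq]; exact (InnerProductSpace.toDual_symm_apply (x := G x) (y := fderiv ℝ g x)).symm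
  let s : EE n → ℝ := fun x => √(‖G x‖ ^ 2 + δ ^ 2)
  have sp (x) : 0 < ‖G x‖ ^ 2 + δ ^ 2 := by positivity
  have s0 (x) : 0 < s x := Real.sqrt_pos.2 (sp x)
  have ss (x) : s x ^ 2 = ‖G x‖ ^ 2 + δ ^ 2 := Real.sq_sqrt (sp x).le
  have sc : ContDiff ℝ 1 s := ((Gc.norm_sq ℝ).add contDiff_const).sqrt fun x => (sp x).ne'
  have sG (x) : ‖G x‖ ≤ s x := Real.le_sqrt_of_sq_le (by nlinarith)
  have hc : ContDiff ℝ 1 fun x => -(q x * (s x)⁻¹) • G x := (qc.mul (sc.inv fun x => (s0 x).ne')).neg.smul Gc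
  have hp := gp _ hc (cs_of qs fun x hx => by simp [hx]) fun x => by
    rw [norm_smul, norm_neg, Real.norm_eq_abs, abs_of_nonneg (mul_nonneg (q0 x) (inv_pos.2 (s0 x)).le), mul_assoc]
    exact mul_le_one₀ (q1 x) (by have := s0 x; positivity) (by rw [inv_mul_le_iff₀ (s0 x)]; simpa using sG x)
  rw [ibp_div (g2.of_le (by norm_num)) hc (cs_of qs fun x hx => by simp [hx]), ← integral_neg] at hp
  have e1 (x) : -(fderiv ℝ g x (-(q x * (s x)⁻¹) • G x)) = q x * ((s x)⁻¹ * ‖G x‖ ^ 2) := by rw [map_smul, Gi, smul_eq_mul]; ring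
  simp only [e1] at hp
  have i1 : Integrable fun x => q x * ((s x)⁻¹ * ‖G x‖ ^ 2) := by
    have := sc.continuous.inv₀ fun x => (s0 x).ne'
    exact Continuous.integrable_of_hasCompactSupport (qcc.mul (this.mul (Gc.continuous.norm.pow 2))) (cs_of qs fun x hx => by simp [hx])
  calc _ ≤ ∫ x, (q x * ((s x)⁻¹ * ‖G x‖ ^ 2) + δ * q x + C / M * g x) := by
        refine integral_mono ((gq.1.continuous_fderiv one_ne_zero).integrable_of_hasCompactSupport (gq.2.1.fderiv ℝ)).norm
          ((i1.fun_add (qi.const_mul δ)).fun_add (gi.const_mul _)) fun x => ?_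
        beta_reduce
        rw [fderiv_fun_mul (g2.differentiable (by norm_num) x) (qc.differentiable one_ne_zero x)]
        refine (norm_add_le _ _).trans ?_
        rw [norm_smul, norm_smul, Real.norm_eq_abs, Real.norm_eq_abs, abs_of_nonneg (gb x).1, abs_of_nonneg (q0 x), ← Gn]
        have h1 : ‖fderiv ℝ q x‖ ≤ C / M := (qd x).trans (by
          have : (Icc M (M + M)).indicator (1 : ℝ → ℝ) √(1 + ‖x‖ ^ 2) ≤ 1 := indicator_le_self' (by simp) _
          have := div_pos hC M0; nlinarith)
        have h2 : ‖G x‖ ≤ (s x)⁻¹ * ‖G x‖ ^ 2 + δ := by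
          rw [← mul_le_mul_iff_right₀ (s0 x), mul_add, mul_inv_cancel_left₀ (s0 x).ne']
          have : δ ≤ s x := Real.le_sqrt_of_sq_le (by nlinarith [norm_nonneg (G x)])
          nlinarith [ss x, sG x, norm_nonneg (G x)]
        nlinarith [mul_le_mul_of_nonneg_left h1 (gb x).1, mul_le_mul_of_nonneg_left h2 (q0 x)]
    _ ≤ _ := by
      rw [integral_add (i1.fun_add (qi.const_mul δ)) (gi.const_mul _), integral_add i1 (qi.const_mul δ), integral_const_mul, integral_const_mul]
      linarith

lemma Rk_pow {n j : ℕ} (hn : 2 ≤ n) (hj : j + 1 ≤ n) : Rk n fun r => (r⁻¹) ^ j := by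
  refine ⟨by fun_prop, fun r _ => by positivity, fun r h0 h1 => ?_, fun r h => pow_le_one₀ (by positivity) (inv_le_one_of_one_le₀ h)⟩
  rcases h0.eq_or_lt with rfl | h0
  · simp [show n - 1 ≠ 0 by omega]
  rw [show n - 1 = (n - 1 - j) + j by omega, pow_add, mul_assoc, ← mul_pow, mul_inv_cancel₀ h0.ne']
  simpa using pow_le_one₀ h0.le h1

lemma small {n : ℕ} (hn : 3 ≤ n) {er : ℝ} (he : 0 < er) : ∃ τ > 0, ∀ f : EE n → ℝ, Integrable f → (∀ x, |f x| ≤ 1) →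
    ∫ x, |f x| ≤ τ → ∀ y, ∫ x, |f x * ‖x - y‖⁻¹| ≤ er := by
  set C := ∫ x, chB n x * (‖x‖⁻¹) ^ 2
  have hC : 0 ≤ C := integral_nonneg fun x => mul_nonneg (chB_bd x).1 (by positivity)
  set K := 1 + 2 * C / er with hK
  have K0 : 0 < K := by positivity
  refine ⟨er / (2 * (K + K⁻¹)), by positivity, fun f hf hb ht y => ?_⟩
  obtain ⟨i1, h1⟩ := (Rk_pow (j := 2) (by omega) hn).sing (by omega) hf hb y
  calc _ ≤ ∫ x, (K * |f x| + K⁻¹ * |f x * (‖x - y‖⁻¹) ^ 2|) := by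
        refine integral_mono ((Rk_inv (by omega)).sing (by omega) hf hb y).1.abs ((hf.abs.const_mul _).fun_add (i1.abs.const_mul _)) fun x => ?_
        beta_reduce
        rw [abs_mul, abs_mul, abs_of_nonneg (a := ‖x - y‖⁻¹) (by positivity), abs_of_nonneg (a := ‖x - y‖⁻¹ ^ 2) (by positivity),
          mul_left_comm, mul_comm K, ← mul_add]
        refine mul_le_mul_of_nonneg_left ?_ (abs_nonneg _)
        rw [← mul_le_mul_iff_right₀ K0, mul_add, mul_inv_cancel_left₀ K0.ne']
        nlinarith [sq_nonneg (K - ‖x - y‖⁻¹), sq_nonneg (K + ‖x - y‖⁻¹)]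
    _ ≤ (K + K⁻¹) * (∫ x, |f x|) + K⁻¹ * C := by
        rw [integral_add (hf.abs.const_mul _) (i1.abs.const_mul _), integral_const_mul, integral_const_mul]
        have := mul_le_mul_of_nonneg_left h1 (inv_pos.2 K0).le
        linarith
    _ ≤ er / 2 + er / 2 := by
        refine add_le_add ?_ ?_
        · have := mul_le_mul_of_nonneg_left ht (show 0 ≤ K + K⁻¹ by positivity)
          refine this.trans (le_of_eq (by field_simp))
        · rw [inv_mul_le_iff₀ K0, hK]
          have : (1 + 2 * C / er) * (er / 2) = er / 2 + C := by field_simp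
          linarith
    _ = er := by ring

lemma om_ch {n : ℕ} {E : Set (EE n)} (hE : MeasurableSet E) (hv : volume E = volume (ball (0 : EE n) 1)) : ∫ x, ch E x = om n := by
  rw [om, Measure.real, ← hv]; exact integral_indicator_one (μ := volume) hE

set_option maxHeartbeats 1000000 in
lemma SJ {n : ℕ} (hn : 3 ≤ n) : ∃ c > 0, ∃ δ > 0, ∀ E : Set (EE n), MeasurableSet E → BddAbove (perimVals E) →
    volume E = volume (ball (0 : EE n) 1) → perimeter E ≤ n * om n + δ → ∀ er > 0, ∃ y,
    (1 + c) * (n * om n) ≤ perimeter E + c * ((n - 1) * ∫ x, ch E x * ‖x - y‖⁻¹) + er := by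
  obtain ⟨c, hc, δ, hδ, H⟩ := FJ hn
  refine ⟨c, hc, δ / 2, half_pos hδ, fun E hE hb hv hP er he => ?_⟩
  have n1 : (0:ℝ) < n - 1 := by have : (3:ℝ) ≤ n := by exact_mod_cast hn
                                linarith
  obtain ⟨t1, ht1, H⟩ := H (er / 3) (by positivity)
  obtain ⟨t2, ht2, H2⟩ := small hn (er := er / 3 / (c * (n - 1))) (by positivity)
  have hf : volume E ≠ ⊤ := by rw [hv]; finiteness
  have ci := ch_int hE hf
  obtain ⟨g, hg, hg1, hg2⟩ := approx hE hf hb (τ := min (min (t1 / 2) t2) (min (δ / 2) (er / 3))) (by positivity)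
  simp only [min_def] at hg1 hg2
  have gi : Integrable g := hg.1.continuous.integrable_of_hasCompactSupport hg.2.1
  obtain ⟨p1, p2⟩ := pn_bd hn
  obtain ⟨-, -, gpi⟩ := pw_able hg.1.continuous hg.2.1 (p := pn n) (by linarith)
  obtain ⟨b1, b2, b3, b4, b5⟩ : (∫ x, |g x - ch E x| ≤ t1 / 2) ∧ (∫ x, |g x - ch E x| ≤ t2) ∧ (∫ x, ‖fderiv ℝ g x‖ ≤ perimeter E + δ / 2) ∧
      (∫ x, ‖fderiv ℝ g x‖ ≤ perimeter E + er / 3) ∧ 0 < n - 1 := by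
    refine ⟨?_, ?_, ?_, ?_, by omega⟩ <;> (split_ifs at hg1 hg2 <;> linarith)
  have hgb (x) : |g x - ch E x| ≤ 1 := by
    have := ch_bd E x; have := hg.2.2.1 x; have := hg.2.2.2 x; rw [abs_le]; constructor <;> linarith
  obtain ⟨y, hy⟩ := H g hg (by
      rw [← om_ch hE hv, ← integral_sub gi ci]; exact abs_integral_le_integral_abs.trans (by linarith)) (by
      rw [← om_ch hE hv, ← integral_sub gpi ci]
      refine abs_integral_le_integral_abs.trans (le_trans (integral_mono (isub gpi ci).abs ((isub gi ci).abs.const_mul 2) fun x => ?_) ((integral_const_mul _ _).trans_le (by linarith)))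
      obtain ⟨h1, h2⟩ := pow_cmp p1.le p2 (hg.2.2.1 x) (hg.2.2.2 x)
      have h3 := Real.rpow_nonneg (hg.2.2.1 x) (pn n)
      have h4 := hg.2.2.1 x
      have h5 := hg.2.2.2 x
      classical simp only [ch, indicator_apply]
      split_ifs
      · rw [abs_sub_comm, abs_sub_comm (g x), abs_of_nonneg (by linarith), abs_of_nonneg (by linarith)]; exact h2
      · simp only [sub_zero]; rw [abs_of_nonneg h3, abs_of_nonneg h4]; linarith) (by linarith)
  refine ⟨y, hy.trans ?_⟩
  obtain ⟨i1, -⟩ := (Rk_inv (by omega)).sing (by omega) (isub gi ci) hgb y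
  obtain ⟨i2, -⟩ := (Rk_inv (by omega)).sing (by omega) ci (M := 1) (fun x => abs_le.2 ⟨by linarith [ch_bd E x], (ch_bd E x).2⟩) y
  have h1 := (le_abs_self _).trans (abs_integral_le_integral_abs.trans (H2 _ (isub gi ci) hgb b2 y))
  have e1 : ∫ x, g x * ‖x - y‖⁻¹ = (∫ x, (g x - ch E x) * ‖x - y‖⁻¹) + ∫ x, ch E x * ‖x - y‖⁻¹ := by
    rw [← integral_add i1 i2]; congr 1; ext x; ring
  have h2 := mul_le_mul_of_nonneg_left h1 (mul_pos hc n1).le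
  rw [mul_div_cancel₀ _ (mul_pos hc n1).ne'] at h2
  rw [e1]
  nlinarith

lemma euler {n : ℕ} {u : EE n → ℝ} (hu : ContDiff ℝ 1 u) (hs : HasCompactSupport u) : ∫ x, -(fderiv ℝ u x x) = n * ∫ x, u x := by
  have hc : ContDiff ℝ 1 fun x => u x • x := hu.smul contDiff_id
  have h := ibp_div (u := fun _ => 1) contDiff_const hc (cs_of hs fun x hx => by simp [hx])
  have e1 (x) : vdiv (fun x => u x • x) x = n * u x + fderiv ℝ u x x := by
    have : fderiv ℝ (fun x => u x • x) x = u x • ContinuousLinearMap.id ℝ (EE n) + (fderiv ℝ u x).smulRight x :=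
      ((hu.differentiable one_ne_zero x).hasFDerivAt.smul (hasFDerivAt_id x)).fderiv
    simp only [vdiv, this]
    conv_rhs => rw [← sum_co x, map_sum, sum_co x]
    simp [Finset.sum_add_distrib, mul_comm]
  have i1 : Integrable u := hu.continuous.integrable_of_hasCompactSupport hs
  have i2 : Integrable fun x => fderiv ℝ u x x := by
    have := hu.continuous_fderiv one_ne_zero
    exact Continuous.integrable_of_hasCompactSupport (by fun_prop) (cs_of (hs.fderiv ℝ) fun x hx => by simp [hx])
  simp only [e1, one_mul] at h
  rw [integral_add (i1.const_mul _) i2, integral_const_mul] at h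
  simp at h
  rw [integral_neg]; linarith

lemma ballP {n : ℕ} {v : ℝ} (hv : v ∈ perimVals (ball (0 : EE n) 1)) : v ≤ n * om n := by
  obtain ⟨φ, h, hs, h1, rfl⟩ := hv
  obtain ⟨vc, vs⟩ := vdiv_cc h hs
  obtain ⟨M, hM⟩ := vs.exists_bound_of_continuous vc
  have hM0 : 0 ≤ M := (norm_nonneg _).trans (hM 0)
  obtain ⟨C, hC, hst⟩ := st_bd
  have key : ∀ ε > 0, ∫ x in ball (0 : EE n) 1, vdiv φ x ≤ n * (om n * (1 + ε) ^ n) + M * (om n * (1 + ε) ^ n - om n) := by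
    intro ε hε
    let S := Real.smoothTransition
    let u : EE n → ℝ := fun x => 1 - S ((‖x‖ ^ 2 - 1) / ε)
    have uc : ContDiff ℝ 1 u := contDiff_const.sub (Real.smoothTransition.contDiff.comp (((contDiff_norm_sq ℝ).sub contDiff_const).div_const _))
    have ub (x) : 0 ≤ u x ∧ u x ≤ 1 := ⟨by simp only [u, S]; linarith [Real.smoothTransition.le_one ((‖x‖ ^ 2 - 1) / ε)], by simp only [u, S]; linarith [Real.smoothTransition.nonneg ((‖x‖ ^ 2 - 1) / ε)]⟩
    have u0 (x : EE n) (hx : 1 + ε ≤ ‖x‖) : u x = 0 := by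
      simp only [u, S]; rw [Real.smoothTransition.one_of_one_le, sub_self]; rw [le_div_iff₀ hε]; nlinarith
    have u1 (x : EE n) (hx : ‖x‖ < 1) : u x = 1 := by
      simp only [u, S]; rw [Real.smoothTransition.zero_of_nonpos, sub_zero]; exact div_nonpos_of_nonpos_of_nonneg (by nlinarith [norm_nonneg x]) hε.le
    have us : HasCompactSupport u := HasCompactSupport.of_support_subset_isCompact (isCompact_closedBall 0 (1 + ε)) fun x hx => by
      by_contra h; exact hx (u0 x (by simpa using (not_le.1 fun h' => h (by simpa using h')).le))
    have ui : Integrable u := uc.continuous.integrable_of_hasCompactSupport us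
    have hU : ∫ x, u x ≤ om n * (1 + ε) ^ n := by
      obtain ⟨bi, be⟩ := ball_ind n (r := 1 + ε) (by positivity)
      rw [← be]
      refine integral_mono ui bi fun x => ?_
      classical simp only [indicator_apply, mem_ball_zero_iff]
      split_ifs with h
      · exact (ub x).2
      · exact (u0 x (not_lt.1 h)).le
    have d1 (x) : ‖fderiv ℝ u x‖ ≤ -(fderiv ℝ u x x) := by
      have hd : fderiv ℝ u x = (-(deriv S ((‖x‖ ^ 2 - 1) / ε) * (2 / ε))) • innerSL ℝ x := by
        have a1 : HasFDerivAt (fun x : EE n => (‖x‖ ^ 2 - 1) / ε) ((2 / ε) • innerSL ℝ x) x := by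
          simp only [div_eq_mul_inv]
          exact (((hasStrictFDerivAt_norm_sq x).hasFDerivAt.sub_const 1).mul_const ε⁻¹).congr_fderiv (by ext z; simp; ring)
        have a2 := ((Real.smoothTransition.contDiff (n := 1)).differentiable one_ne_zero ((‖x‖ ^ 2 - 1) / ε)).hasDerivAt.comp_hasFDerivAt x a1
        refine (a2.const_sub 1).fderiv.trans ?_
        rw [smul_smul, neg_smul]
      have hp : 0 ≤ deriv S ((‖x‖ ^ 2 - 1) / ε) := Real.smoothTransition.monotone.deriv_nonneg
      rw [hd, norm_smul, norm_neg, Real.norm_eq_abs, abs_of_nonneg (by positivity), innerSL_apply_norm]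
      simp only [ContinuousLinearMap.smul_apply, innerSL_apply_apply, real_inner_self_eq_norm_sq, smul_eq_mul]
      rcases lt_or_ge ‖x‖ 1 with hx | hx
      · have := hst ((‖x‖ ^ 2 - 1) / ε)
        rw [indicator_of_notMem (by rw [mem_Icc, not_and_or]; left; rw [not_le]; exact div_neg_of_neg_of_pos (by nlinarith [norm_nonneg x]) hε), mul_zero] at this
        rw [abs_nonpos_iff.1 this]; simp
      · have : 0 ≤ deriv S ((‖x‖ ^ 2 - 1) / ε) * (2 / ε) := by positivity
        nlinarith [mul_nonneg this (norm_nonneg x)]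
    have uf := uc.continuous_fderiv one_ne_zero
    have pc := h.continuous
    have e1 : ∫ x, u x * vdiv φ x ≤ n * ∫ x, u x := by
      rw [ibp_div uc h hs, ← integral_neg, ← euler uc us]
      refine integral_mono (Continuous.integrable_of_hasCompactSupport (by fun_prop) (cs_of hs fun x hx => by simp [hx]))
        (Continuous.integrable_of_hasCompactSupport (by fun_prop) (cs_of (us.fderiv ℝ) fun x hx => by simp [hx])) fun x => ?_
      refine (neg_le_abs _).trans (((fderiv ℝ u x).le_opNorm (φ x)).trans (le_trans ?_ (d1 x)))
      nlinarith [norm_nonneg (fderiv ℝ u x), h1 x]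
    have ci := ch_int (n := n) (E := ball 0 1) measurableSet_ball (by finiteness)
    have i1 : Integrable fun x => u x * vdiv φ x := ui.mul_bdd (c := M) vc.aestronglyMeasurable (.of_forall hM)
    have i2 : Integrable fun x => ch (ball 0 1) x * vdiv φ x := ci.mul_bdd (c := M) vc.aestronglyMeasurable (.of_forall hM)
    have e2 : (∫ x, ch (ball 0 1) x * vdiv φ x) - ∫ x, u x * vdiv φ x ≤ M * ((∫ x, u x) - om n) := by
      rw [← om_ch measurableSet_ball rfl, ← integral_sub i2 i1, ← integral_sub ui ci, ← integral_const_mul]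
      refine integral_mono (isub i2 i1) ((isub ui ci).const_mul M) fun x => ?_
      have hh : ch (ball 0 1) x ≤ u x := by
        classical simp only [ch, indicator_apply, mem_ball_zero_iff]
        split_ifs with h
        · exact (u1 x h).ge
        · exact (ub x).1
      have := abs_le.1 ((Real.norm_eq_abs _).symm.trans_le (hM x))
      beta_reduce; nlinarith
    rw [ch_set measurableSet_ball]
    have a : (n:ℝ) * ∫ x, u x ≤ n * (om n * (1 + ε) ^ n) := by gcongr
    have b : M * ((∫ x, u x) - om n) ≤ M * (om n * (1 + ε) ^ n - om n) := by gcongr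
    linarith
  have ht : Filter.Tendsto (fun ε : ℝ => n * (om n * (1 + ε) ^ n) + M * (om n * (1 + ε) ^ n - om n)) (nhdsWithin 0 (Ioi 0)) (nhds (n * om n)) := by
    have : Continuous fun ε : ℝ => n * (om n * (1 + ε) ^ n) + M * (om n * (1 + ε) ^ n - om n) := by fun_prop
    simpa using (this.tendsto 0).mono_left nhdsWithin_le_nhds
  exact ge_of_tendsto ht (Filter.eventually_of_mem self_mem_nhdsWithin fun ε hε => key ε hε)

lemma ballinv {n : ℕ} (hn : 3 ≤ n) : (n - 1) * ∫ x, chB n x * ‖x‖⁻¹ = n * om n := by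
  have := sg_prob (n := n) (by omega)
  have hi := (Rk_inv (n := n) (by omega)).loc (by omega)
  rw [pol_eq (n := n) (by omega) hi (R := 1) fun x hx => by classical simp [chB, hx.le]]
  have : ∀ᵐ θ ∂sg n, ∫ r in Ioc (0:ℝ) 1, r ^ (n - 1) * (chB n (r • θ) * ‖r • θ‖⁻¹) = ((n:ℝ) - 1)⁻¹ := by
    filter_upwards [sg_norm n] with θ hθ
    have h1 := int_pow (n := n - 1) (by omega) (zero_le_one (α := ℝ))
    rw [integral_Ioc_eq_integral_Ioo] at h1 ⊢
    rw [one_pow, Nat.cast_sub (by omega), Nat.cast_one] at h1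
    rw [← eq_inv_of_mul_eq_one_right h1]
    refine setIntegral_congr_fun measurableSet_Ioo fun r hr => ?_
    have hr0 : r ≠ 0 := hr.1.ne'
    have e : ‖r • θ‖ = r := by rw [norm_smul, hθ, mul_one, Real.norm_eq_abs, abs_of_pos hr.1]
    classical simp only [chB, indicator_apply, mem_ball_zero_iff, e, hr.2, if_true, one_mul]
    obtain ⟨k, rfl⟩ : ∃ k, n = k + 2 := ⟨n - 2, by omega⟩
    rw [show k + 2 - 1 - 1 = k by omega, show k + 2 - 1 = k + 1 by omega, pow_succ]; field_simp
  rw [integral_congr_ae this]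
  have : ((n:ℝ) - 1) ≠ 0 := by have : (3:ℝ) ≤ n := by exact_mod_cast hn
                               linarith
  simp; field_simp

lemma gauss_rep {n : ℕ} (hn : 3 ≤ n) : ∃ w : ℝ × EE n → ENNReal, Measurable w ∧ ∀ x y : EE n, x ≠ y →
    ENNReal.ofReal ((‖x - y‖⁻¹) ^ (n - 2)) = ∫⁻ p, w p * (ENNReal.ofReal (Real.exp (-(2 * p.1 ^ 2 * ‖x - p.2‖ ^ 2))) *
      ENNReal.ofReal (Real.exp (-(2 * p.1 ^ 2 * ‖y - p.2‖ ^ 2)))) ∂((volume.restrict (Ioi (0:ℝ))).prod volume) := by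
  let G : ℝ → ENNReal := fun s => ∫⁻ z : EE n, ENNReal.ofReal (Real.exp (-(4 * s ^ 2 * ‖z‖ ^ 2)))
  have Gm : Measurable G := by
    refine Measurable.lintegral_prod_right' (f := fun p : ℝ × EE n => ENNReal.ofReal (Real.exp (-(4 * p.1 ^ 2 * ‖p.2‖ ^ 2)))) ?_
    fun_prop
  have Gf (s : ℝ) (hs : 0 < s) : G s ≠ ⊤ := by
    have : Integrable fun z : EE n => Real.exp (-(4 * s ^ 2 * ‖z‖ ^ 2)) := by
      have := GaussianFourier.integrable_cexp_neg_mul_sq_norm_add (V := EE n) (b := ((4 * s ^ 2 : ℝ) : ℂ)) (by rw [Complex.ofReal_re]; positivity) 0 0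
      refine this.norm.congr (.of_forall fun z => ?_)
      simp [Complex.norm_exp, ← Complex.ofReal_pow]
    exact ((hasFiniteIntegral_iff_ofReal (.of_forall fun z => (Real.exp_pos _).le)).1 this.2).ne
  have G0 (s : ℝ) : G s ≠ 0 := by
    have : 0 < G s := by
      rw [lintegral_pos_iff_support (by fun_prop), Function.support_eq_univ fun z => by simp [Real.exp_pos]]
      exact isOpen_univ.measure_pos _ univ_nonempty
    exact this.ne'
  set c := (1 / 2 : ℝ) * Real.Gamma (((n:ℝ) - 3 + 1) / 2)
  have hn' : (3:ℝ) ≤ n := by exact_mod_cast hn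
  have hc : 0 < c := mul_pos (by norm_num) (Real.Gamma_pos_of_pos (by linarith))
  refine ⟨fun p => ENNReal.ofReal (c⁻¹ * p.1 ^ ((n:ℝ) - 3)) * (G p.1)⁻¹, by fun_prop, fun x y hxy => ?_⟩
  set ρ := ‖x - y‖
  have hρ : 0 < ρ := norm_pos_iff.2 (sub_ne_zero.2 hxy)
  have hpar (s : ℝ) (z : EE n) : Real.exp (-(2 * s ^ 2 * ‖x - z‖ ^ 2)) * Real.exp (-(2 * s ^ 2 * ‖y - z‖ ^ 2)) =
      Real.exp (-ρ ^ 2 * s ^ (2:ℝ)) * Real.exp (-(4 * s ^ 2 * ‖z - (1 / 2 : ℝ) • (x + y)‖ ^ 2)) := by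
    rw [← Real.exp_add, ← Real.exp_add]; congr 1
    have := parallelogram_law_with_norm ℝ (x - z) (y - z)
    rw [show x - z + (y - z) = (-2 : ℝ) • (z - (1 / 2 : ℝ) • (x + y)) by module, show x - z - (y - z) = x - y by abel, norm_smul] at this
    norm_num at this ⊢
    rw [show ‖x - y‖ = ρ from rfl] at this
    nlinarith
  rw [lintegral_prod _ (by fun_prop)]
  have h1 : ∀ s ∈ Ioi (0:ℝ), (∫⁻ z, ENNReal.ofReal (c⁻¹ * s ^ ((n:ℝ) - 3)) * (G s)⁻¹ * (ENNReal.ofReal (Real.exp (-(2 * s ^ 2 * ‖x - z‖ ^ 2))) *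
      ENNReal.ofReal (Real.exp (-(2 * s ^ 2 * ‖y - z‖ ^ 2))))) = ENNReal.ofReal (c⁻¹ * (s ^ ((n:ℝ) - 3) * Real.exp (-ρ ^ 2 * s ^ (2:ℝ)))) := by
    intro s hs
    have hs0 : 0 ≤ s := (mem_Ioi.1 hs).le
    simp only [← ENNReal.ofReal_mul (Real.exp_pos _).le, hpar]
    simp only [ENNReal.ofReal_mul (Real.exp_pos _).le]
    rw [lintegral_const_mul _ (by fun_prop), lintegral_const_mul _ (by fun_prop),
      lintegral_sub_right_eq_self (fun z => ENNReal.ofReal (Real.exp (-(4 * s ^ 2 * ‖z‖ ^ 2)))),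
      ← mul_assoc c⁻¹, ENNReal.ofReal_mul (p := c⁻¹ * s ^ ((n:ℝ) - 3)) (by positivity)]
    change _ * (G s)⁻¹ * (_ * G s) = _
    rw [mul_assoc, mul_comm _ (G s), ← mul_assoc (G s)⁻¹, ENNReal.inv_mul_cancel (G0 s) (Gf s hs), one_mul]
  rw [setLIntegral_congr_fun measurableSet_Ioi h1]
  have h2 := integral_rpow_mul_exp_neg_mul_rpow (p := 2) (q := (n:ℝ) - 3) (b := ρ ^ 2) (by norm_num) (by linarith) (by positivity)
  have e2 : (ρ ^ 2) ^ (-((n:ℝ) - 3 + 1) / 2) = (ρ⁻¹) ^ (n - 2) := by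
    rw [← Real.rpow_natCast, ← Real.rpow_natCast, ← Real.rpow_mul hρ.le, Real.inv_rpow hρ.le, ← Real.rpow_neg hρ.le, Nat.cast_sub (by omega)]
    congr 1; push_cast; ring
  rw [e2, mul_assoc] at h2
  have h3 : Integrable (fun s : ℝ => s ^ ((n:ℝ) - 3) * Real.exp (-ρ ^ 2 * s ^ (2:ℝ))) (volume.restrict (Ioi 0)) := by
    refine not_imp_comm.1 integral_undef ?_
    rw [h2]; positivity
  rw [← ofReal_integral_eq_lintegral_ofReal (h3.const_mul _) ((ae_restrict_iff' measurableSet_Ioi).2 (.of_forall fun s hs => by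
    have : (0:ℝ) ≤ s := (mem_Ioi.1 hs).le
    simp only [Pi.zero_apply]; positivity)), integral_const_mul, h2]
  congr 1
  rw [mul_comm (ρ⁻¹ ^ (n - 2)), inv_mul_cancel_left₀ hc.ne']

lemma pos_lint {n : ℕ} (hn : 3 ≤ n) (A B : Set (EE n)) :
    2 * (∫⁻ x in A, ∫⁻ y in B, ENNReal.ofReal ((‖x - y‖⁻¹) ^ (n - 2))) ≤
    (∫⁻ x in A, ∫⁻ y in A, ENNReal.ofReal ((‖x - y‖⁻¹) ^ (n - 2))) + ∫⁻ x in B, ∫⁻ y in B, ENNReal.ofReal ((‖x - y‖⁻¹) ^ (n - 2)) := by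
  obtain ⟨w, wm, hw⟩ := gauss_rep hn
  set ν := (volume.restrict (Ioi (0:ℝ))).prod (volume : Measure (EE n))
  let K : EE n → ℝ × EE n → ENNReal := fun x p => ENNReal.ofReal (Real.exp (-(2 * p.1 ^ 2 * ‖x - p.2‖ ^ 2)))
  have hK : Measurable (Function.uncurry K) := by unfold K Function.uncurry; fun_prop
  have Nt : Nontrivial (EE n) := by
    have : Nonempty (Fin n) := ⟨⟨0, by omega⟩⟩
    infer_instance
  let a : Set (EE n) → ℝ × EE n → ENNReal := fun A p => ∫⁻ x in A, K x p
  have am (A) : Measurable (a A) := (hK.comp measurable_swap).lintegral_prod_right'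
  have key (A B : Set (EE n)) : ∫⁻ x in A, ∫⁻ y in B, ENNReal.ofReal ((‖x - y‖⁻¹) ^ (n - 2)) = ∫⁻ p, w p * (a A p * a B p) ∂ν := by
    calc _ = ∫⁻ x in A, ∫⁻ y in B, ∫⁻ p, w p * (K x p * K y p) ∂ν := by
          refine lintegral_congr fun x => lintegral_congr_ae (ae_restrict_of_ae ?_)
          filter_upwards [compl_mem_ae_iff.2 (measure_singleton x)] with y hy
          exact hw x y (Ne.symm hy)
      _ = ∫⁻ x in A, ∫⁻ p, w p * (K x p * a B p) ∂ν := by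
          refine lintegral_congr fun x => ?_
          rw [lintegral_lintegral_swap (by fun_prop)]
          refine lintegral_congr fun p => ?_
          rw [lintegral_const_mul _ (by fun_prop), lintegral_const_mul _ (by fun_prop)]
      _ = _ := by
          rw [lintegral_lintegral_swap (by fun_prop)]
          refine lintegral_congr fun p => ?_
          rw [lintegral_const_mul _ (by fun_prop), lintegral_mul_const _ (by fun_prop)]
  rw [key, key, key, ← lintegral_const_mul _ (by fun_prop), ← lintegral_add_left (by fun_prop)]
  refine lintegral_mono fun p => ?_
  have : 2 * (a A p * a B p) ≤ a A p * a A p + a B p * a B p := by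
    rcases le_total (a A p) (a B p) with h | h <;> obtain ⟨d, h⟩ := le_iff_exists_add.1 h <;> rw [h]
    · exact le_iff_exists_add.2 ⟨d * d, by ring⟩
    · exact le_iff_exists_add.2 ⟨d * d, by ring⟩
  calc _ = w p * (2 * (a A p * a B p)) := by ring
    _ ≤ _ := by rw [← mul_add]; gcongr

noncomputable def UU {n : ℕ} (B : Set (EE n)) (x : EE n) : ℝ := ∫ y, ch B y * (‖y - x‖⁻¹) ^ (n - 2)

lemma ch_abs {n : ℕ} (E : Set (EE n)) (x) : |ch E x| ≤ 1 := abs_le.2 ⟨by linarith [ch_bd E x], (ch_bd E x).2⟩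

lemma UU_bd {n : ℕ} (hn : 3 ≤ n) : ∃ M, ∀ B : Set (EE n), MeasurableSet B → volume B ≠ ⊤ → Measurable (UU B) ∧
    (∀ x, Integrable fun y => ch B y * (‖y - x‖⁻¹) ^ (n - 2)) ∧ (∀ x, 0 ≤ UU B x ∧ UU B x ≤ M + ∫ x, ch B x) := by
  refine ⟨∫ x, chB n x * (‖x‖⁻¹) ^ (n - 2), fun B hB hf => ?_⟩
  have hs := (Rk_pow (n := n) (j := n - 2) (by omega) (by omega)).sing (by omega) (ch_int hB hf) (ch_abs B)
  refine ⟨?_, fun x => (hs x).1, fun x => ⟨integral_nonneg fun y => mul_nonneg (ch_bd B y).1 (by positivity), (le_abs_self _).trans (abs_integral_le_integral_abs.trans ?_)⟩⟩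
  · have cm : Measurable (ch B) := measurable_const.indicator hB
    have : StronglyMeasurable (UU B) := StronglyMeasurable.integral_prod_right' (ν := volume) (f := fun p : EE n × EE n => ch B p.2 * (‖p.2 - p.1‖⁻¹) ^ (n - 2))
      (Measurable.stronglyMeasurable (by fun_prop))
    exact this.measurable
  · refine (hs x).2.trans (le_of_eq ?_)
    rw [one_mul]; congr 2; ext y; exact abs_of_nonneg (ch_bd B y).1

lemma ch_UU {n : ℕ} (hn : 3 ≤ n) {A B : Set (EE n)} (hA : MeasurableSet A) (hB : MeasurableSet B) (fA : volume A ≠ ⊤) (fB : volume B ≠ ⊤) :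
    Integrable (fun x => ch A x * UU B x) ∧
    ∫⁻ x in A, ∫⁻ y in B, ENNReal.ofReal ((‖x - y‖⁻¹) ^ (n - 2)) = ENNReal.ofReal (∫ x, ch A x * UU B x) := by
  obtain ⟨M, hM⟩ := UU_bd hn
  obtain ⟨um, ui, ub⟩ := hM B hB fB
  have i1 : Integrable (fun x => ch A x * UU B x) := (ch_int hA fA).mul_bdd um.aestronglyMeasurable
    (.of_forall fun x => by rw [Real.norm_eq_abs, abs_of_nonneg (ub x).1]; exact (ub x).2)
  have hind {A : Set (EE n)} (hA : MeasurableSet A) {f : EE n → ℝ} (h : Integrable fun x => ch A x * f x) : IntegrableOn f A := by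
    rw [← integrable_indicator_iff hA]
    refine h.congr (.of_forall fun x => ?_)
    classical simp only [ch, indicator_apply]; split_ifs <;> simp
  refine ⟨i1, ?_⟩
  have h1 (x) : ∫⁻ y in B, ENNReal.ofReal ((‖x - y‖⁻¹) ^ (n - 2)) = ENNReal.ofReal (UU B x) := by
    rw [UU, ← ch_set hB, ofReal_integral_eq_lintegral_ofReal (hind hB (ui x)) (.of_forall fun y => by simp only [Pi.zero_apply]; positivity)]
    simp only [norm_sub_rev]
  simp only [h1]
  rw [← ch_set hA, ofReal_integral_eq_lintegral_ofReal (hind hA i1) (.of_forall fun y => (ub y).1)]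

lemma posI {n : ℕ} (hn : 3 ≤ n) {A B : Set (EE n)} (hA : MeasurableSet A) (hB : MeasurableSet B) (fA : volume A ≠ ⊤) (fB : volume B ≠ ⊤) :
    2 * (∫ x, ch A x * UU B x) ≤ (∫ x, ch A x * UU A x) + ∫ x, ch B x * UU B x := by
  have h := pos_lint hn A B
  obtain ⟨M, hM⟩ := UU_bd hn
  have p {A B : Set (EE n)} (hA : MeasurableSet A) (fA : volume A ≠ ⊤) : 0 ≤ ∫ x, ch B x * UU A x :=
    integral_nonneg fun x => mul_nonneg (ch_bd B x).1 ((hM A hA fA).2.2 x).1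
  have e2 (a) : 2 * ENNReal.ofReal a = ENNReal.ofReal (2 * a) := by rw [ENNReal.ofReal_mul (by norm_num)]; simp
  rw [(ch_UU hn hA hB fA fB).2, (ch_UU hn hA hA fA fA).2, (ch_UU hn hB hB fB fB).2, ← ENNReal.ofReal_add (p hA fA) (p hB fB),
    e2, ENNReal.ofReal_le_ofReal_iff (add_nonneg (p hA fA) (p hB fB))] at h
  exact h

lemma ker {n : ℕ} (hn : 3 ≤ n) {r : ℝ} (hr : 0 ≤ r) : r ^ (2 - (n:ℝ)) = (r⁻¹) ^ (n - 2) := by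
  rw [← Real.rpow_natCast, Real.inv_rpow hr, ← Real.rpow_neg hr, Nat.cast_sub (by omega)]
  congr 1; push_cast; ring

lemma NL_UU {n : ℕ} (hn : 3 ≤ n) {F : Set (EE n)} (hF : MeasurableSet F) : NL F = ∫ x, ch F x * UU F x := by
  rw [NL, ch_set hF]
  congr 1; ext x
  rw [ch_set hF, UU]
  simp only [ker hn (norm_nonneg _), norm_sub_rev x]

lemma UU_rot {n : ℕ} {x x' : EE n} (h : ‖x‖ = ‖x'‖) : UU (ball 0 1) x = UU (ball (0 : EE n) 1) x' := by
  obtain ⟨f, hf⟩ : ∃ f : EE n ≃ₗᵢ[ℝ] EE n, f x = x' := ⟨Submodule.reflection (ℝ ∙ (x - x'))ᗮ, Submodule.reflection_sub h⟩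
  rw [UU, UU, ← f.measurePreserving.integral_comp f.toHomeomorph.measurableEmbedding (fun y => ch (ball 0 1) y * (‖y - x'‖⁻¹) ^ (n - 2)), ← hf]
  congr 1; ext y
  classical simp only [ch, indicator_apply, mem_ball_zero_iff, ← map_sub, f.norm_map]

lemma inv_lip {a b : ℝ} (ha : 0 ≤ a) (hb : 0 ≤ b) {N : ℕ} (hN : 1 ≤ N) :
    |(a⁻¹) ^ N - (b⁻¹) ^ N| ≤ N * |a - b| * ((a⁻¹) ^ (N + 1) + (b⁻¹) ^ (N + 1)) := by
  set m := max a⁻¹ b⁻¹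
  have m0 : 0 ≤ m := le_max_of_le_left (by positivity)
  have h1 : |a⁻¹ - b⁻¹| ≤ |a - b| * m ^ 2 := by
    have sq {b : ℝ} (hb : 0 ≤ b) : b⁻¹ = b * b⁻¹ ^ 2 := by
      rcases eq_or_ne b 0 with rfl | h
      · simp
      · field_simp
    rcases ha.eq_or_lt with rfl | ha
    · simp only [inv_zero, zero_sub, abs_neg]
      rw [abs_of_nonneg hb, abs_of_nonneg (by positivity), sq hb]
      gcongr; exact le_max_right _ _
    rcases hb.eq_or_lt with rfl | hb
    · simp only [inv_zero, sub_zero]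
      rw [abs_of_nonneg ha.le, abs_of_nonneg (by positivity), sq ha.le]
      gcongr; exact le_max_left _ _
    rw [inv_sub_inv ha.ne' hb.ne', abs_div, abs_of_pos (mul_pos ha hb), abs_sub_comm, div_eq_mul_inv, mul_inv, pow_two]
    gcongr
    · exact le_max_left _ _
    · exact le_max_right _ _
  have h2 := abs_pow_sub_pow_le a⁻¹ b⁻¹ N
  rw [abs_of_nonneg (a := a⁻¹) (by positivity), abs_of_nonneg (a := b⁻¹) (by positivity)] at h2
  calc _ ≤ |a - b| * m ^ 2 * N * m ^ (N - 1) := h2.trans (by gcongr)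
    _ = N * |a - b| * m ^ (N + 1) := by rw [show N + 1 = 2 + (N - 1) by omega, pow_add]; ring
    _ ≤ _ := by
      refine mul_le_mul_of_nonneg_left ?_ (by positivity)
      rcases max_cases a⁻¹ b⁻¹ with ⟨h, -⟩ | ⟨h, -⟩ <;> simp only [m, h]
      · have : 0 ≤ b⁻¹ ^ (N + 1) := by positivity
        linarith
      · have : 0 ≤ a⁻¹ ^ (N + 1) := by positivity
        linarith

lemma UU_lip {n : ℕ} (hn : 3 ≤ n) : ∃ L, 0 ≤ L ∧ ∀ x x' : EE n, |UU (ball 0 1) x - UU (ball (0 : EE n) 1) x'| ≤ L * ‖x - x'‖ := by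
  have ci := chB_able n
  have cb (x : EE n) : |chB n x| ≤ 1 := ch_abs _ x
  have h1 := (Rk_pow (n := n) (j := n - 2) (by omega) (by omega)).sing (by omega) ci cb
  have h2 := (Rk_pow (n := n) (j := n - 2 + 1) (by omega) (by omega)).sing (by omega) ci cb
  set D := 1 * (∫ x, chB n x * (fun r : ℝ => r⁻¹ ^ (n - 2 + 1)) ‖x‖) + ∫ x, |chB n x| with hD
  have D0 : 0 ≤ D := (integral_nonneg fun x => abs_nonneg _).trans (h2 0).2
  refine ⟨(n - 2 : ℕ) * (2 * D), by positivity, fun x x' => ?_⟩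
  have e : UU (ball 0 1) x - UU (ball (0 : EE n) 1) x' = ∫ y, (chB n y * (‖y - x‖⁻¹) ^ (n - 2) - chB n y * (‖y - x'‖⁻¹) ^ (n - 2)) :=
    (integral_sub (h1 x).1 (h1 x').1).symm
  rw [e]
  calc _ ≤ ∫ y, (n - 2 : ℕ) * ‖x - x'‖ * (|chB n y * (‖y - x‖⁻¹) ^ (n - 2 + 1)| + |chB n y * (‖y - x'‖⁻¹) ^ (n - 2 + 1)|) := by
        refine abs_integral_le_integral_abs.trans (integral_mono (isub (h1 x).1 (h1 x').1).abs (((h2 x).1.abs.fun_add (h2 x').1.abs).const_mul _) fun y => ?_)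
        beta_reduce
        rw [← mul_sub, abs_mul, abs_mul, abs_mul, ← mul_add, mul_left_comm]
        refine mul_le_mul_of_nonneg_left ?_ (abs_nonneg _)
        have := inv_lip (norm_nonneg (y - x)) (norm_nonneg (y - x')) (N := n - 2) (by omega)
        rw [abs_of_nonneg (a := ‖y - x‖⁻¹ ^ (n - 2 + 1)) (by positivity), abs_of_nonneg (a := ‖y - x'‖⁻¹ ^ (n - 2 + 1)) (by positivity)]
        refine this.trans ?_
        have := abs_norm_sub_norm_le (y - x) (y - x')
        rw [show y - x - (y - x') = -(x - x') by abel, norm_neg] at this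
        gcongr
    _ ≤ _ := by
        rw [integral_const_mul, integral_add (h2 x).1.abs (h2 x').1.abs, mul_right_comm]
        have a := (h2 x).2
        have b := (h2 x').2
        refine mul_le_mul_of_nonneg_right (mul_le_mul_of_nonneg_left ?_ (by positivity)) (norm_nonneg (x - x'))
        linarith

noncomputable def ph (r : ℝ) : ℝ := if r ≤ 0 then 1 else r⁻¹ - 1

lemma UU_ph {n : ℕ} (hn : 3 ≤ n) : ∃ C > 0, ∃ v, ∀ x : EE n, |UU (ball 0 1) x - v| ≤ C * |ph ‖x‖| := by
  obtain ⟨L, hL, hl⟩ := UU_lip hn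
  obtain ⟨M, hM⟩ := UU_bd hn
  obtain ⟨-, -, ub⟩ := hM (ball 0 1) measurableSet_ball (by finiteness)
  set Q := M + ∫ x, ch (ball (0 : EE n) 1) x
  have Q0 : 0 ≤ Q := (ub 0).1.trans (ub 0).2
  let e : EE n := EuclideanSpace.single ⟨0, by omega⟩ 1
  have he : ‖e‖ = 1 := by simp [e]
  refine ⟨2 * L + 2 * Q + 1, by positivity, UU (ball 0 1) e, fun x => ?_⟩
  have hb : |UU (ball 0 1) x - UU (ball 0 1) e| ≤ Q := abs_le.2 ⟨by linarith [ub x, ub e], by linarith [ub x, ub e]⟩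
  rcases (norm_nonneg x).eq_or_lt with h | h
  · rw [← h, ph, if_pos le_rfl, abs_one]; linarith
  have h1 : |UU (ball 0 1) x - UU (ball 0 1) e| ≤ L * |‖x‖ - 1| := by
    rw [UU_rot (x := e) (x' := ‖x‖⁻¹ • x) (by rw [he, norm_smul, norm_inv, norm_norm, inv_mul_cancel₀ h.ne'])]
    refine (hl _ _).trans (le_of_eq ?_)
    rw [show x - ‖x‖⁻¹ • x = ((‖x‖ - 1) * ‖x‖⁻¹) • x by rw [sub_mul, mul_inv_cancel₀ h.ne']; module, norm_smul, norm_mul, norm_inv, norm_norm,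
      mul_assoc, inv_mul_cancel₀ h.ne', mul_one, Real.norm_eq_abs]
  rw [ph, if_neg (not_le.2 h)]
  have e1 : |‖x‖ - 1| = ‖x‖ * |‖x‖⁻¹ - 1| := by
    rw [show ‖x‖ * |‖x‖⁻¹ - 1| = |‖x‖| * |‖x‖⁻¹ - 1| by rw [abs_norm], ← abs_mul, mul_sub, mul_inv_cancel₀ h.ne', mul_one, abs_sub_comm]
  rcases le_total ‖x‖ 2 with h2 | h2
  · rw [e1] at h1
    have : L * (‖x‖ * |‖x‖⁻¹ - 1|) ≤ L * (2 * |‖x‖⁻¹ - 1|) := by gcongr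
    nlinarith [abs_nonneg (‖x‖⁻¹ - 1)]
  · have : ‖x‖⁻¹ ≤ 1 / 2 := by rw [inv_le_comm₀ h (by norm_num)]; simpa
    rw [abs_of_nonpos (a := ‖x‖⁻¹ - 1) (by linarith)]
    nlinarith

lemma NL_tr {n : ℕ} (hn : 3 ≤ n) {E : Set (EE n)} (hE : MeasurableSet E) (y : EE n) : NL ((fun x => x + y) ⁻¹' E) = NL E := by
  have h1 (x) : UU ((fun x => x + y) ⁻¹' E) x = UU E (x + y) := by
    rw [UU, UU, ← integral_add_right_eq_self (fun z => ch E z * (‖z - (x + y)‖⁻¹) ^ (n - 2)) y]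
    simp only [add_sub_add_right_eq_sub]; rfl
  rw [NL_UU hn (measurable_add_const y hE), NL_UU hn hE, ← integral_add_right_eq_self (fun x => ch E x * UU E x) y]
  simp only [h1]; rfl

lemma ph_sgn {n : ℕ} (E : Set (EE n)) (x : EE n) : |chB n x - ch E x| * |ph ‖x‖| = (chB n x - ch E x) * ph ‖x‖ := by
  rw [← abs_mul, abs_of_nonneg]
  have := ch_bd E x
  classical simp only [chB, ph, indicator_apply, mem_ball_zero_iff]
  split_ifs with h1 h2 h2
  · nlinarith
  · have := (one_le_inv₀ (not_le.1 h2)).2 h1.le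
    nlinarith
  · linarith
  · have := (inv_le_one₀ (not_le.1 h2)).2 (not_lt.1 h1)
    nlinarith

set_option maxHeartbeats 1000000 in
lemma NLd {n : ℕ} (hn : 3 ≤ n) : ∃ C > 0, ∀ E : Set (EE n), MeasurableSet E → volume E = volume (ball (0 : EE n) 1) → ∀ y,
    Integrable (fun x => (chB n x - ch E (x + y)) * ph ‖x‖) ∧ 0 ≤ ∫ x, (chB n x - ch E (x + y)) * ph ‖x‖ ∧
    ∫ x, (chB n x - ch E (x + y)) * ph ‖x‖ = (∫ x, chB n x * ‖x‖⁻¹) - ∫ x, ch E x * ‖x - y‖⁻¹ ∧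
    NL (ball (0 : EE n) 1) ≤ NL E + C * ∫ x, (chB n x - ch E (x + y)) * ph ‖x‖ := by
  obtain ⟨C, hC, v, hv⟩ := UU_ph hn
  refine ⟨2 * C, by positivity, fun E₀ hE₀ hvol₀ y => ?_⟩
  have Nt : Nontrivial (EE n) := by
    have : Nonempty (Fin n) := ⟨⟨0, by omega⟩⟩
    infer_instance
  set E := (fun x => x + y) ⁻¹' E₀ with hEd
  have hE : MeasurableSet E := measurable_add_const y hE₀
  have hvol : volume E = volume (ball (0 : EE n) 1) := (measure_preimage_add_right volume y E₀).trans hvol₀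
  have fE : volume E ≠ ⊤ := by rw [hvol]; finiteness
  have fB : volume (ball (0 : EE n) 1) ≠ ⊤ := by finiteness
  rw [← NL_tr hn hE₀ y, ← integral_add_right_eq_self (fun x => ch E₀ x * ‖x - y‖⁻¹) y]
  simp only [add_sub_cancel_right, ← hEd, show ∀ x, ch E₀ (x + y) = ch E x from fun x => rfl]
  have ci := chB_able n
  have ei := ch_int hE fE
  have eci : ∫ x, (chB n x - ch E x) = 0 := by
    rw [integral_sub ci ei, om_ch hE hvol, sub_eq_zero]; exact om_ch measurableSet_ball rfl
  have j (A : Set (EE n)) (hA : Integrable (ch A)) : Integrable fun x => ch A x * ‖x‖⁻¹ := by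
    simpa using ((Rk_inv (n := n) (by omega)).sing (by omega) hA (ch_abs A) 0).1
  have i1 : Integrable fun x => chB n x * ‖x‖⁻¹ := j (ball 0 1) ci
  have i2 := j E ei
  have ae : (fun x => (chB n x * ‖x‖⁻¹ - ch E x * ‖x‖⁻¹) - (chB n x - ch E x)) =ᵐ[volume] fun x => (chB n x - ch E x) * ph ‖x‖ := by
    filter_upwards [compl_mem_ae_iff.2 (measure_singleton (0 : EE n))] with x hx
    rw [ph, if_neg (by simpa using hx)]; ring
  have hi := (isub (isub i1 i2) (isub ci ei)).congr ae
  refine ⟨hi, integral_nonneg fun x => by rw [Pi.zero_apply, ← ph_sgn]; positivity, ?_, ?_⟩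
  · rw [← integral_congr_ae ae, integral_sub (isub i1 i2) (isub ci ei), eci, sub_zero, integral_sub i1 i2]
  · have p := posI hn hE measurableSet_ball fE fB
    have e1 : Integrable fun x => ch (ball (0 : EE n) 1) x * UU (ball (0 : EE n) 1) x := (ch_UU hn measurableSet_ball measurableSet_ball fB fB).1
    have e2 := (ch_UU hn hE measurableSet_ball fE fB).1
    rw [NL_UU hn measurableSet_ball, NL_UU hn hE]
    have e3 : (∫ x, ch (ball (0 : EE n) 1) x * UU (ball (0 : EE n) 1) x) - (∫ x, ch E x * UU (ball (0 : EE n) 1) x) = ∫ x, (chB n x - ch E x) * (UU (ball (0 : EE n) 1) x - v) := by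
      rw [← integral_sub e1 e2, ← sub_zero (∫ x, _), ← zero_mul v, ← eci, ← integral_mul_const, ← integral_sub (isub e1 e2) ((isub ci ei).mul_const v)]
      congr 1; ext x; change _ = (ch (ball (0 : EE n) 1) x - _) * _; change _ - (ch (ball (0 : EE n) 1) x - _) * _ = _; ring
    have e4 : ∫ x, (chB n x - ch E x) * (UU (ball (0 : EE n) 1) x - v) ≤ C * ∫ x, (chB n x - ch E x) * ph ‖x‖ := by
      rw [← integral_const_mul]
      refine integral_mono ?_ (hi.const_mul C) fun x => ?_
      · refine (isub (isub e1 e2) ((isub ci ei).mul_const v)).congr (.of_forall fun x => ?_)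
        change _ = (ch (ball (0 : EE n) 1) x - _) * _; change _ - (ch (ball (0 : EE n) 1) x - _) * _ = _; ring
      · beta_reduce
        rw [← ph_sgn, mul_left_comm]
        exact (le_abs_self _).trans (by rw [abs_mul]; exact mul_le_mul_of_nonneg_left (hv x) (abs_nonneg _))
    linarith

set_option maxHeartbeats 1000000 in
lemma cpt {n : ℕ} {E : Set (EE n)} (hE : MeasurableSet E) (hv : volume E = volume (ball (0 : EE n) 1))
    (h : ∀ η > 0, ∃ y, ∫ x, |ch E (x + y) - chB n x| ≤ η) : ∃ y, volume (symmDiff E (ball y 1)) = 0 := by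
  have fE : volume E ≠ ⊤ := by rw [hv]; finiteness
  have om0 := om_pos n
  let f : EE n → ℝ := fun y => ∫ x, |ch E (x + y) - chB n x|
  have ei := ch_int hE fE
  have ci := chB_able n
  have eiy (y) : Integrable fun x => ch E (x + y) := ei.comp_add_right y
  have fs (y) : f y = ∫ x, |ch E x - ch (ball y 1) x| := by
    rw [← integral_add_right_eq_self (fun x => |ch E x - ch (ball y 1) x|) y]
    simp only [f]
    congr 1; ext x; congr 2
    classical simp [chB, ch, indicator_apply]
  have fc : Continuous f := by
    rw [Metric.continuous_iff]
    intro y ε hε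
    obtain ⟨d, hd, h⟩ := ch_tr hE fE (half_pos hε)
    refine ⟨d, hd, fun y' hy => ?_⟩
    rw [Real.dist_eq]
    have h2 := h (y - y') (by rwa [← dist_eq_norm, dist_comm])
    rw [← integral_add_right_eq_self (fun x => |ch E (x - (y - y')) - ch E x|) y] at h2
    refine lt_of_le_of_lt ?_ (half_lt_self hε)
    refine le_trans ?_ h2
    rw [← integral_sub (isub (eiy y') ci).abs (isub (eiy y) ci).abs]
    refine abs_integral_le_integral_abs.trans (integral_mono (isub (isub (eiy y') ci).abs (isub (eiy y) ci).abs).abs ?_ fun x => ?_)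
    · simp only [show ∀ x, x + y - (y - y') = x + y' from fun x => by abel]; exact (isub (eiy y') (eiy y)).abs
    · beta_reduce
      rw [show x + y - (y - y') = x + y' by abel]
      exact (abs_abs_sub_abs_le _ _).trans (le_of_eq (by congr 1; ring))
  obtain ⟨y0, h0⟩ := h (om n / 4) (by positivity)
  obtain ⟨z, -, hz⟩ := (isCompact_closedBall y0 2).exists_isMinOn ⟨y0, by simp⟩ fc.continuousOn
  refine ⟨z, ?_⟩
  have hle : f z ≤ 0 := by
    refine le_of_forall_pos_le_add fun η hη => ?_
    obtain ⟨y, hy⟩ := h (min η (om n / 4)) (by positivity)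
    rw [zero_add]
    refine (hz ?_).trans (hy.trans (min_le_left _ _))
    by_contra hd
    have hd : 2 < dist y y0 := by simpa using hd
    have h1 : f y ≤ om n / 4 := hy.trans (min_le_right _ _)
    have h2 : f y0 ≤ om n / 4 := h0
    rw [fs] at h1 h2
    have bi (y) : Integrable (ch (ball y 1) : EE n → ℝ) := ch_int measurableSet_ball (by finiteness)
    have bo (y) : ∫ x, ch (ball y 1) x = om n := om_ch measurableSet_ball (Measure.addHaar_ball_center _ _ _)
    have h3 : (∫ x, ch (ball y 1) x) + (∫ x, ch (ball y0 1) x) ≤ (∫ x, |ch E x - ch (ball y 1) x|) + (∫ x, |ch E x - ch (ball y0 1) x|) + ∫ x, ch E x := by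
      rw [← integral_add (bi y) (bi y0), ← integral_add (isub ei (bi y)).abs (isub ei (bi y0)).abs,
        ← integral_add ((isub ei (bi y)).abs.fun_add (isub ei (bi y0)).abs) ei]
      refine integral_mono ((bi y).add (bi y0)) (((isub ei (bi y)).abs.fun_add (isub ei (bi y0)).abs).fun_add ei) fun x => ?_
      have : ¬(x ∈ ball y 1 ∧ x ∈ ball y0 1) := fun ⟨a, b⟩ => by
        have := dist_triangle_left y y0 x
        rw [mem_ball] at a b; linarith
      by_cases a : x ∈ ball y 1 <;> by_cases b : x ∈ ball y0 1 <;> by_cases c : x ∈ E <;>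
        simp only [ch, indicator_of_mem, indicator_of_notMem, a, b, c, not_false_eq_true] <;> first | (exact (this ⟨a, b⟩).elim) | norm_num
    rw [bo, bo, om_ch hE hv] at h3
    linarith
  rw [fs, ch_sub _ hE measurableSet_ball] at hle
  have := le_antisymm hle measureReal_nonneg
  rwa [measureReal_eq_zero_iff] at this

set_option maxHeartbeats 1000000 in
lemma unit {n : ℕ} (hn : 3 ≤ n) : ∃ ε0 > 0, ∀ ε, 0 < ε → ε < ε0 → ∀ E : Set (EE n), MeasurableSet E → BddAbove (perimVals E) →
    volume E = volume (ball (0 : EE n) 1) → n * om n + ε * NL (ball (0 : EE n) 1) ≤ perimeter E + ε * NL E ∧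
    (perimeter E + ε * NL E ≤ n * om n + ε * NL (ball (0 : EE n) 1) → ∃ y, volume (symmDiff E (ball y 1)) = 0) := by
  obtain ⟨c, hc, δ, hδ, hS⟩ := SJ hn
  obtain ⟨C, hC, hN⟩ := NLd hn
  have n1 : (0:ℝ) < n - 1 := by have : (3:ℝ) ≤ n := by exact_mod_cast hn
                                linarith
  have np (E : Set (EE n)) : 0 ≤ NL E := integral_nonneg fun x => integral_nonneg fun y => Real.rpow_nonneg (norm_nonneg _) _
  have nB := np (ball 0 1)
  set k := c * (n - 1) / 2 with hk
  have k0 : 0 < k := by positivity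
  refine ⟨min (δ / (NL (ball (0 : EE n) 1) + 1)) (k / C), by positivity, fun ε e0 e1 E hE hb hv => ?_⟩
  obtain ⟨e1, e2⟩ := lt_min_iff.1 e1
  rw [lt_div_iff₀ (by positivity)] at e1 e2
  have nE := mul_nonneg e0.le (np E)
  rcases lt_or_ge (n * om n + δ) (perimeter E) with hP | hP
  · exact ⟨by nlinarith, fun h => by nlinarith⟩
  have key : ∀ er > 0, ∃ y, Integrable (fun x => (chB n x - ch E (x + y)) * ph ‖x‖) ∧ 0 ≤ k * (∫ x, (chB n x - ch E (x + y)) * ph ‖x‖) ∧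
      n * om n + ε * NL (ball (0 : EE n) 1) + k * (∫ x, (chB n x - ch E (x + y)) * ph ‖x‖) ≤ perimeter E + ε * NL E + er := by
    intro er he
    obtain ⟨y, hy⟩ := hS E hE hb hv hP er he
    obtain ⟨i, h0, h1, h2⟩ := hN E hE hv y
    refine ⟨y, i, by positivity, ?_⟩
    have := ballinv hn
    set H := ∫ x, (chB n x - ch E (x + y)) * ph ‖x‖
    have a : n * om n + 2 * (k * H) ≤ perimeter E + er := by rw [h1, hk]; linear_combination hy + c * this
    have b := mul_le_mul_of_nonneg_left h2 e0.le
    have d := mul_le_mul_of_nonneg_right e2.le h0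
    linarith
  refine ⟨le_of_forall_pos_le_add fun er he => ?_, fun hle => cpt hE hv fun η hη => ?_⟩
  · obtain ⟨y, -, h1, h2⟩ := key er he
    linarith
  · obtain ⟨d, hd, hB⟩ := bath (n := n) (φ := ph) (by omega) (fun r h0 h1 => by
        unfold ph; split_ifs with h
        · norm_num
        · linarith [(one_le_inv₀ (not_le.1 h)).2 h1.le]) (fun r h1 => by
        rw [ph, if_neg (by linarith)]; linarith [(inv_le_one₀ (by linarith)).2 h1]) (fun τ t0 t1 => by
        refine ⟨min τ (1 - (1 + τ)⁻¹), lt_min t0 (by linarith [inv_lt_one_of_one_lt₀ (show 1 < 1 + τ by linarith)]), fun r hr => ⟨fun h => ?_, fun h => ?_⟩⟩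
        · refine (min_le_left _ _).trans ?_
          unfold ph; split_ifs with h0
          · linarith
          · have h0 := not_le.1 h0
            have : r * r⁻¹ = 1 := mul_inv_cancel₀ h0.ne'
            have : 0 < r⁻¹ := inv_pos.2 h0
            nlinarith
        · rw [ph, if_neg (by linarith)]
          have : r⁻¹ ≤ (1 + τ)⁻¹ := by gcongr
          linarith [min_le_right τ (1 - (1 + τ)⁻¹)]) hη
    obtain ⟨y, i, h1, h2⟩ := key (k * d) (by positivity)
    refine ⟨y, hB _ ((ch_int hE (by rw [hv]; finiteness)).comp_add_right y) (fun x => (ch_bd E _).1) (fun x => (ch_bd E _).2) i ?_⟩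
    exact le_of_mul_le_mul_left (by linarith) k0

set_option maxHeartbeats 1000000 in
lemma perim_sc {n : ℕ} (hn : 1 ≤ n) {F : Set (EE n)} (hF : MeasurableSet F) {r : ℝ} (hr : 0 < r) {v : ℝ} (hv : v ∈ perimVals F) :
    (r⁻¹) ^ (n - 1) * v ∈ perimVals ((fun x : EE n => r • x) ⁻¹' F) := by
  obtain ⟨φ, h1, h2, h3, rfl⟩ := hv
  refine ⟨fun x => φ (r • x), h1.comp (contDiff_id.const_smul r), ?_, fun x => h3 _, ?_⟩
  · exact h2.comp_homeomorph (Homeomorph.smulOfNeZero r hr.ne')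
  · have e (x : EE n) : vdiv (fun x => φ (r • x)) x = r * vdiv φ (r • x) := by
      simp only [vdiv, Finset.mul_sum]
      refine Finset.sum_congr rfl fun i _ => ?_
      have hd : HasFDerivAt (fun x => φ (r • x)) ((fderiv ℝ φ (r • x)).comp (r • ContinuousLinearMap.id ℝ (EE n))) x :=
        ((h1.differentiable (by simp)).differentiableAt.hasFDerivAt (x := r • x)).comp x ((hasFDerivAt_id x).const_smul r)
      rw [hd.fderiv]; simp
    have m : Measurable fun x : EE n => r • x := by fun_prop
    rw [ch_set hF, ch_set (hF.preimage m)]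
    simp only [e]
    have := Measure.integral_comp_smul volume (fun x => ch F x * vdiv φ x) r
    rw [finrank_euclideanSpace_fin, abs_of_pos (by positivity), smul_eq_mul] at this
    calc _ = r * ((r ^ n)⁻¹ * ∫ x, ch F x * vdiv φ x) := by
          obtain ⟨k, rfl⟩ := Nat.exists_eq_add_of_le' hn
          simp only [Nat.add_sub_cancel, inv_pow]; field_simp; ring
      _ = _ := by
          rw [← this, ← integral_const_mul]; congr 1; ext x
          rw [show ch ((fun x => r • x) ⁻¹' F) x = ch F (r • x) from rfl]; ring

set_option maxHeartbeats 1000000 in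
lemma NL_sc {n : ℕ} (hn : 3 ≤ n) {F : Set (EE n)} (hF : MeasurableSet F) {r : ℝ} (hr : 0 < r) :
    NL F = r ^ (n - 1) * (r ^ 3 * NL ((fun x : EE n => r • x) ⁻¹' F)) := by
  have m : Measurable fun x : EE n => r • x := by fun_prop
  have cv (f : EE n → ℝ) : ∫ x in F, f x = r ^ n * ∫ x in (fun x : EE n => r • x) ⁻¹' F, f (r • x) := by
    rw [ch_set hF, ch_set (hF.preimage m)]
    have := Measure.integral_comp_smul volume (fun x => ch F x * f x) r
    rw [finrank_euclideanSpace_fin, abs_of_pos (by positivity), smul_eq_mul] at this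
    rw [show (∫ x, ch ((fun x => r • x) ⁻¹' F) x * f (r • x)) = ∫ x, ch F (r • x) * f (r • x) from rfl, this]
    field_simp
  unfold NL
  rw [cv]
  simp only [cv, ← smul_sub, norm_smul, Real.norm_of_nonneg hr.le, Real.mul_rpow hr.le (norm_nonneg _), integral_const_mul]
  have : r ^ (2 - (n : ℝ)) * r ^ n = r ^ 2 := by
    rw [← Real.rpow_natCast r n, ← Real.rpow_add hr, sub_add_cancel]; norm_num
  obtain ⟨k, rfl⟩ := Nat.exists_eq_add_of_le' (show 1 ≤ n by omega)
  rw [Nat.add_sub_cancel]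
  linear_combination (r ^ (k + 1) * ∫ x in (fun x : EE (k + 1) => r • x) ⁻¹' F, ∫ y in (fun x : EE (k + 1) => r • x) ⁻¹' F, ‖x - y‖ ^ (2 - ((k + 1 : ℕ) : ℝ))) * this

lemma zero_per {n : ℕ} (F : Set (EE n)) : (perimVals F).Nonempty :=
  ⟨_, fun _ => 0, contDiff_const, HasCompactSupport.zero, by simp, rfl⟩

lemma pre_ball {n : ℕ} {r : ℝ} (hr : 0 < r) (y : EE n) : (fun x : EE n => r • x) ⁻¹' ball (r • y) r = ball y 1 := by
  ext x
  simp only [mem_preimage, mem_ball, dist_smul₀, Real.norm_of_nonneg hr.le]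
  exact mul_lt_iff_lt_one_right hr

lemma vol_sc {n : ℕ} {r : ℝ} (hr : 0 < r) (F : Set (EE n)) : volume ((fun x : EE n => r • x) ⁻¹' F) = ENNReal.ofReal ((r ^ n)⁻¹) * volume F := by
  rw [Measure.addHaar_preimage_smul _ hr.ne', finrank_euclideanSpace_fin, abs_of_pos (by positivity)]

/-- Isoperimetric problem with Coulombic repulsion: for all sufficiently small masses `m`,
the ball of volume `m` uniquely (up to translation, i.e. up to a null symmetric
difference with a translated ball) minimizes `P(F) + NL(F)` among sets of finite
perimeter of volume `m`. -/
theorem statement0 (n : ℕ) (hn : 3 ≤ n) :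
    ∃ mn : ℝ, 0 < mn ∧ ∀ m : ℝ, 0 < m → m < mn →
      ∀ r : ℝ, 0 < r →
        volume (ball (0 : EuclideanSpace ℝ (Fin n)) r) = ENNReal.ofReal m →
        (∀ F : Set (EuclideanSpace ℝ (Fin n)), HasFinitePerimeter F →
            volume F = ENNReal.ofReal m →
            perimeter (ball (0 : EuclideanSpace ℝ (Fin n)) r) +
                NL (ball (0 : EuclideanSpace ℝ (Fin n)) r) ≤ perimeter F + NL F) ∧
        ∀ F : Set (EuclideanSpace ℝ (Fin n)), HasFinitePerimeter F →
            volume F = ENNReal.ofReal m →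
            perimeter F + NL F =
              perimeter (ball (0 : EuclideanSpace ℝ (Fin n)) r) +
                NL (ball (0 : EuclideanSpace ℝ (Fin n)) r) →
            ∃ c : EuclideanSpace ℝ (Fin n), volume (symmDiff F (ball c r)) = 0 := by
  obtain ⟨ε0, e0, hU⟩ := unit hn
  have om0 := om_pos n
  have n1 : 1 ≤ n := by omega
  have hm : 0 < min 1 ε0 := by positivity
  refine ⟨om n * (min 1 ε0) ^ n, by positivity, fun m m0 m1 r hr hv => ?_⟩
  have pb : (fun x : EE n => r • x) ⁻¹' ball 0 r = ball 0 1 := by simpa using pre_ball hr (0 : EE n)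
  have hrm : m = r ^ n * om n := by
    have h := om_ch (n := n) measurableSet_ball rfl
    rw [← pb, ← mul_one (∫ x, _), ← integral_mul_const, ← ch_set (f := fun _ => 1) (by rw [pb]; exact measurableSet_ball)] at h
    rw [setIntegral_const, smul_eq_mul, mul_one, measureReal_def, vol_sc hr, hv, ENNReal.toReal_mul, ENNReal.toReal_ofReal (by positivity), ENNReal.toReal_ofReal m0.le] at h
    rw [← h]; field_simp
  have r1 : r < min 1 ε0 := by
    by_contra h
    have := pow_le_pow_left₀ hm.le (not_lt.1 h) n
    nlinarith
  obtain ⟨ra, rb⟩ := lt_min_iff.1 r1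
  have r3 : r ^ 3 < ε0 := (pow_le_of_le_one hr.le ra.le (by norm_num)).trans_lt rb
  have rp : 0 < r ^ (n - 1) := by positivity
  have cc : (r⁻¹) ^ (n - 1) * r ^ (n - 1) = 1 := by rw [inv_pow]; field_simp
  have hB : perimeter (ball (0 : EE n) r) ≤ r ^ (n - 1) * (n * om n) := by
    refine csSup_le (zero_per _) fun v hv => ?_
    have := perim_sc n1 measurableSet_ball hr hv
    rw [pb] at this
    have := mul_le_mul_of_nonneg_left (ballP this) rp.le
    linear_combination this - v * cc
  have hNB := NL_sc hn (measurableSet_ball (x := (0 : EE n)) (ε := r)) hr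
  rw [pb] at hNB
  have main (F : Set (EE n)) (hF : HasFinitePerimeter F) (hFv : volume F = ENNReal.ofReal m) :
      r ^ (n - 1) * (perimeter ((fun x : EE n => r • x) ⁻¹' F) + r ^ 3 * NL ((fun x : EE n => r • x) ⁻¹' F)) ≤ perimeter F + NL F ∧
      BddAbove (perimVals ((fun x : EE n => r • x) ⁻¹' F)) ∧ MeasurableSet ((fun x : EE n => r • x) ⁻¹' F) ∧
      volume ((fun x : EE n => r • x) ⁻¹' F) = volume (ball (0 : EE n) 1) := by
    have mE : MeasurableSet ((fun x : EE n => r • x) ⁻¹' F) := hF.1.preimage (by fun_prop)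
    have up : ∀ v ∈ perimVals ((fun x : EE n => r • x) ⁻¹' F), v ≤ (r⁻¹) ^ (n - 1) * perimeter F := fun v hv => by
      have := perim_sc n1 mE (inv_pos.2 hr) hv
      rw [inv_inv, ← preimage_comp, show (fun x : EE n => r • x) ∘ (fun x => r⁻¹ • x) = id by ext1 x; simp [smul_smul, hr.ne'], preimage_id] at this
      have := mul_le_mul_of_nonneg_left (le_csSup hF.2 this) (show 0 ≤ (r⁻¹) ^ (n - 1) by positivity)
      change _ ≤ (r⁻¹) ^ (n - 1) * perimeter F at this
      linear_combination this - v * cc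
    refine ⟨?_, ⟨_, up⟩, mE, ?_⟩
    · have := mul_le_mul_of_nonneg_left (csSup_le (zero_per _) up) rp.le
      change r ^ (n - 1) * perimeter _ ≤ _ at this
      rw [NL_sc hn hF.1 hr]
      linear_combination this + perimeter F * cc
    · rw [vol_sc hr, hFv, ← hv, ← vol_sc hr, pb]
  refine ⟨fun F hF hFv => ?_, fun F hF hFv he => ?_⟩
  · obtain ⟨h1, h2, h3, h4⟩ := main F hF hFv
    have := mul_le_mul_of_nonneg_left (hU (r ^ 3) (by positivity) r3 _ h3 h2 h4).1 rp.le
    rw [hNB]; linarith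
  · obtain ⟨h1, h2, h3, h4⟩ := main F hF hFv
    obtain ⟨y, hy⟩ := (hU (r ^ 3) (by positivity) r3 _ h3 h2 h4).2 (by
      refine le_of_mul_le_mul_left ?_ rp
      rw [he, hNB] at h1; linarith)
    refine ⟨r • y, ?_⟩
    rw [← pre_ball hr y, show symmDiff ((fun x : EE n => r • x) ⁻¹' F) ((fun x : EE n => r • x) ⁻¹' ball (r • y) r) = (fun x : EE n => r • x) ⁻¹' symmDiff F (ball (r • y) r) from rfl, vol_sc hr] at hy
    refine (mul_eq_zero.1 hy).resolve_left ?_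
    rw [ENNReal.ofReal_eq_zero, not_le]; positivity
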